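/- For every ε' > 0 and B > 0 there exists c_1 > 0 such that for all y ≥ 3: Σ_{k ≤ y, κ(k) ≤ y^{1/2 - ε'}} | Ψ(k) |^2 ≪ y (log y)^{-B}, where Ψ(k) = Σ_{q > (log y)^{c_1}} (μ(q)/φ(q)) ∏_{p | q} (n_{k,p} − 1), the sum being over squarefree integers q > (log y)^{c_1} all of whose prime factors are congruent to 1 modulo 4, and the implied constant depends only on ε' and B. -/

import Mathlib

open Finset
open scoped Classical

/-- The square-full part `κ(n)`: if `n = ℓ^2 * m` with `m` squarefree, then `κ(n) = ℓ^2`. -/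
noncomputable def kappa (n : ℕ) : ℕ := ∏ p ∈ n.primeFactors, p ^ (2 * (n.factorization p / 2))

/-- `nSol k r p` is the number of solutions `n ∈ ℤ/pℤ` of `n^r + k ≡ 0 (mod p)`. -/
def nSol (k : ℤ) (r p : ℕ) : ℕ :=
  (Finset.filter (fun n : ℕ => ((n : ℤ) ^ r + k) % (p : ℤ) = 0) (Finset.range p)).card

/-! Generic Dirichlet series: integral bounds. -/

noncomputable def LL (f : ℕ → ℂ) (s : ℝ) : ℂ := LSeries f ((1 + s : ℝ) : ℂ)

lemma II_bounds (S : ℝ → ℂ) (hm : Measurable S) (D θ : ℝ) (hD : 0 ≤ D) (hθ : 0 < θ) 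
    (hS : ∀ t : ℝ, 1 ≤ t → ‖S t‖ ≤ D * t ^ (1 - θ / 2)) (s s' : ℝ) (hs : 0 ≤ s) (hs' : 0 ≤ s') :
    ‖∫ t in Set.Ioi (1 : ℝ), S t * (t : ℂ) ^ (-(((1 + s : ℝ) : ℂ) + 1))‖ ≤ 2 * D / θ ∧
    ‖(∫ t in Set.Ioi (1 : ℝ), S t * (t : ℂ) ^ (-(((1 + s : ℝ) : ℂ) + 1))) - 
      ∫ t in Set.Ioi (1 : ℝ), S t * (t : ℂ) ^ (-(((1 + s' : ℝ) : ℂ) + 1))‖ 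
      ≤ |s - s'| * (16 * D / θ ^ 2) := by
  have hcp : ∀ (s t : ℝ), 1 < t → 
      (t : ℂ) ^ (-(((1 + s : ℝ) : ℂ) + 1)) = ((t ^ (-2 - s) : ℝ) : ℂ) := by
    intro s t ht
    rw [Complex.ofReal_cpow (by linarith)]
    congr 1
    push_cast; ring
  have hb1 : ∀ s : ℝ, 0 ≤ s → ∀ t : ℝ, 1 < t → 
      ‖S t * (t : ℂ) ^ (-(((1 + s : ℝ) : ℂ) + 1))‖ ≤ D * t ^ (-1 - θ / 2) := by
    intro s hs t ht
    rw [hcp s t ht, norm_mul, Complex.norm_real, Real.norm_of_nonneg (by positivity)]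
    calc ‖S t‖ * t ^ (-2 - s) ≤ (D * t ^ (1 - θ / 2)) * t ^ (-2 : ℝ) := by
          apply mul_le_mul (hS t ht.le) _ (by positivity) (by positivity)
          exact Real.rpow_le_rpow_of_exponent_le ht.le (by linarith)
      _ = D * t ^ (-1 - θ / 2) := by
          rw [mul_assoc, ← Real.rpow_add (by linarith)]; ring_nf
  have hintg : ∀ a : ℝ, 0 < a → MeasureTheory.IntegrableOn (fun t : ℝ => t ^ (-1 - a)) (Set.Ioi 1) :=
    fun a ha => integrableOn_Ioi_rpow_of_lt (by linarith) one_pos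
  have hval : ∀ a : ℝ, 0 < a → ∫ t in Set.Ioi (1:ℝ), t ^ (-1 - a) = 1 / a := by
    intro a ha
    rw [integral_Ioi_rpow_of_lt (by linarith) one_pos]
    simp
    rw [neg_div, ← div_neg]; ring_nf
  have hmeas : ∀ s : ℝ, Measurable fun t : ℝ => S t * (t : ℂ) ^ (-(((1 + s : ℝ) : ℂ) + 1)) := by
    intro s
    exact hm.mul (Complex.measurable_ofReal.pow_const _)
  have hI : ∀ s : ℝ, 0 ≤ s → MeasureTheory.IntegrableOn 
      (fun t : ℝ => S t * (t : ℂ) ^ (-(((1 + s : ℝ) : ℂ) + 1))) (Set.Ioi 1) := by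
    intro s hs
    refine MeasureTheory.Integrable.mono' ((hintg (θ/2) (by linarith)).const_mul D) (hmeas s).aestronglyMeasurable ?_
    filter_upwards [MeasureTheory.ae_restrict_mem measurableSet_Ioi] with t ht
    exact hb1 s hs t ht
  constructor
  · refine (MeasureTheory.norm_integral_le_of_norm_le (((hintg (θ/2) (by linarith)).const_mul D)) ?_).trans ?_
    · filter_upwards [MeasureTheory.ae_restrict_mem measurableSet_Ioi] with t ht
      exact hb1 s hs t ht
    · rw [MeasureTheory.integral_const_mul, hval _ (by linarith)]
      apply le_of_eq; field_simp
  · rw [← MeasureTheory.integral_sub (hI s hs) (hI s' hs')]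
    refine (MeasureTheory.norm_integral_le_of_norm_le 
      ((hintg (θ/4) (by linarith)).const_mul (|s - s'| * D * (4 / θ))) ?_).trans ?_
    · filter_upwards [MeasureTheory.ae_restrict_mem measurableSet_Ioi] with t ht
      have ht : 1 < t := ht
      rw [← mul_sub, hcp s t ht, hcp s' t ht, ← Complex.ofReal_sub, norm_mul, Complex.norm_real, Real.norm_eq_abs]
      have hlog : 0 < Real.log t := Real.log_pos ht
      have h1 : |t ^ (-2 - s) - t ^ (-2 - s')| ≤ |s - s'| * Real.log t * t ^ (-2 : ℝ) := by
        have key : ∀ a b : ℝ, 0 ≤ a → a ≤ b → 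
            |t ^ (-2 - a) - t ^ (-2 - b)| ≤ (b - a) * Real.log t * t ^ (-2 : ℝ) := by
          intro a b ha hab
          have e1 : t ^ (-2 - b) = t ^ (-2 - a) * Real.exp (-((b - a) * Real.log t)) := by
            rw [Real.rpow_def_of_pos (by linarith), Real.rpow_def_of_pos (by linarith), ← Real.exp_add]
            congr 1; ring
          have e2 : t ^ (-2 - a) ≤ t ^ (-2 : ℝ) := Real.rpow_le_rpow_of_exponent_le ht.le (by linarith)
          have e3 := Real.add_one_le_exp (-((b - a) * Real.log t))
          have e4 : Real.exp (-((b - a) * Real.log t)) ≤ 1 := Real.exp_le_one_iff.mpr (by nlinarith)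
          have e5 : 0 < t ^ (-2 - a) := by positivity
          have e6 : 0 ≤ (b - a) * Real.log t := by nlinarith
          rw [e1, abs_of_nonneg (by nlinarith)]
          nlinarith
        rcases le_total s s' with h | h
        · rw [abs_of_nonpos (sub_nonpos.mpr h), neg_sub]; exact key s s' hs h
        · rw [abs_of_nonneg (sub_nonneg.mpr h), abs_sub_comm]; exact key s' s hs' h
      have h2 : Real.log t ≤ (4 / θ) * t ^ (θ / 4) := by
        have := Real.log_le_rpow_div (x := t) (by linarith) (ε := θ / 4) (by linarith)
        calc _ ≤ _ := this
          _ = _ := by field_simp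
      calc ‖S t‖ * |t ^ (-2 - s) - t ^ (-2 - s')| 
          ≤ (D * t ^ (1 - θ / 2)) * (|s - s'| * ((4 / θ) * t ^ (θ / 4)) * t ^ (-2 : ℝ)) := by
            apply mul_le_mul (hS t ht.le) (h1.trans _) (by positivity) (by positivity)
            gcongr
        _ = |s - s'| * D * (4 / θ) * (t ^ (1 - θ / 2) * t ^ (θ / 4) * t ^ (-2 : ℝ)) := by ring
        _ = |s - s'| * D * (4 / θ) * t ^ (-1 - θ / 4) := by
            rw [← Real.rpow_add (by linarith), ← Real.rpow_add (by linarith)]; ring_nf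
    · rw [MeasureTheory.integral_const_mul, hval _ (by linarith)]
      apply le_of_eq; field_simp; ring

structure BaseF (f : ℕ → ℂ) : Prop where
  zero : f 0 = 0
  one : f 1 = 1
  mult : ∀ m n : ℕ, m.Coprime n → f (m * n) = f m * f n
  van : ∀ n : ℕ, ¬ n.Coprime 6 → f n = 0
  pow : ∀ p j : ℕ, p.Prime → ‖f (p ^ j)‖ ≤ 2 ^ j
  cnt : ∀ N : ℕ, ∑ n ∈ Icc 1 N, ‖f n‖ ≤ 9 * N

structure GoodF (f : ℕ → ℂ) (K : ℝ) : Prop extends BaseF f where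
  hK : 3 ≤ K
  canc : ∀ N : ℕ, ‖∑ n ∈ Icc 1 N, f n‖ ≤ K * Real.sqrt N

lemma summ_of_cnt (f : ℕ → ℂ) (h : ∀ N : ℕ, ∑ n ∈ Icc 1 N, ‖f n‖ ≤ 9 * N) (s : ℝ) (hs : 0 < s) : 
    LSeriesSummable f ((1 + s : ℝ) : ℂ) := by
  apply LSeriesSummable_of_sum_norm_bigO (r := 1) _ zero_le_one (by simpa using hs)
  refine Asymptotics.IsBigO.of_bound 9 (Filter.Eventually.of_forall fun n => ?_)
  rw [Real.norm_of_nonneg (Finset.sum_nonneg fun _ _ => norm_nonneg _), Real.rpow_one]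
  simpa using h n

lemma sum_cnt (f : ℕ → ℂ) (h : ∀ N : ℕ, ∑ n ∈ Icc 1 N, ‖f n‖ ≤ 9 * N) (N : ℕ) :
    ‖∑ n ∈ Icc 1 N, f n‖ ≤ 9 * N := (norm_sum_le _ _).trans (h N)

lemma LL_eq (f : ℕ → ℂ) (h : ∀ N : ℕ, ∑ n ∈ Icc 1 N, ‖f n‖ ≤ 9 * N) (s : ℝ) (hs : 0 < s) : 
    LL f s = ((1 + s : ℝ) : ℂ) * 
      ∫ t in Set.Ioi (1 : ℝ), (∑ k ∈ Icc 1 ⌊t⌋₊, f k) * (t : ℂ) ^ (-(((1 + s : ℝ) : ℂ) + 1)) := by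
  apply LSeries_eq_mul_integral (r := 1) _ zero_le_one (by simpa using hs) (summ_of_cnt f h s hs)
  refine Asymptotics.IsBigO.of_bound 9 (Filter.Eventually.of_forall fun n => ?_)
  simpa using sum_cnt f h n

lemma LL_bounds (f : ℕ → ℂ) (K : ℝ) (hK : 3 ≤ K) (h : ∀ N : ℕ, ∑ n ∈ Icc 1 N, ‖f n‖ ≤ 9 * N) 
    (hc : ∀ N : ℕ, ‖∑ n ∈ Icc 1 N, f n‖ ≤ K * Real.sqrt N)
    (s s' : ℝ) (hs : 0 < s) (hs' : 0 < s') (h1 : s ≤ 1) (h1' : s' ≤ 1) :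
    ‖LL f s‖ ≤ 120 * Real.log K ∧ ‖LL f s - LL f s'‖ ≤ 1000 * |s - s'| * Real.log K ^ 2 := by
  set S : ℝ → ℂ := fun t => ∑ k ∈ Icc 1 ⌊t⌋₊, f k with hSdef
  have hm : Measurable S := (measurable_from_top (f := fun n : ℕ => ∑ k ∈ Icc 1 n, f k)).comp Nat.measurable_floor
  have hlog : 1 ≤ Real.log K := by
    rw [Real.le_log_iff_exp_le (by linarith)]
    linarith [Real.exp_one_lt_d9]
  set θ := 1 / Real.log K with hθ
  have hθ0 : 0 < θ := by positivity
  have hθ1 : θ ≤ 1 := by rw [hθ, div_le_one (by linarith)]; exact hlog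
  have hKθ : K ^ θ ≤ 3 := by
    rw [Real.rpow_def_of_pos (by linarith), hθ, mul_one_div_cancel (by linarith)]
    linarith [Real.exp_one_lt_d9]
  have hS : ∀ t : ℝ, 1 ≤ t → ‖S t‖ ≤ 27 * t ^ (1 - θ / 2) := by
    intro t ht
    have hft : ((⌊t⌋₊ : ℕ) : ℝ) ≤ t := Nat.floor_le (by linarith)
    have a1 : ‖S t‖ ≤ 9 * t := (sum_cnt f h _).trans (by linarith)
    have a2 : ‖S t‖ ≤ K * t ^ (1/2 : ℝ) := by
      refine (hc _).trans ?_
      rw [← Real.sqrt_eq_rpow]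
      gcongr
    calc ‖S t‖ = ‖S t‖ ^ (1 - θ) * ‖S t‖ ^ θ := by
          rw [← Real.rpow_add_of_nonneg (norm_nonneg _) (by linarith) hθ0.le]; simp
      _ ≤ (9 * t) ^ (1 - θ) * (K * t ^ (1/2 : ℝ)) ^ θ := by
          apply mul_le_mul
          · exact Real.rpow_le_rpow (norm_nonneg _) a1 (by linarith)
          · exact Real.rpow_le_rpow (norm_nonneg _) a2 (by linarith)
          · positivity
          · positivity
      _ = 9 ^ (1 - θ) * K ^ θ * t ^ (1 - θ / 2) := by
          rw [Real.mul_rpow (by norm_num) (by linarith), Real.mul_rpow (by linarith) (by positivity), 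
            ← Real.rpow_mul (by linarith)]
          have : t ^ (1 - θ / 2) = t ^ (1 - θ) * t ^ (1/2 * θ) := by
            rw [← Real.rpow_add (by linarith)]; ring_nf
          rw [this]; ring
      _ ≤ 9 * 3 * t ^ (1 - θ / 2) := by
          have : (9:ℝ) ^ (1 - θ) ≤ 9 := by
            calc (9:ℝ) ^ (1 - θ) ≤ 9 ^ (1:ℝ) := Real.rpow_le_rpow_of_exponent_le (by norm_num) (by linarith)
              _ = 9 := Real.rpow_one _
          gcongr
      _ = _ := by norm_num
  obtain ⟨b1, b2⟩ := II_bounds S hm 27 θ (by norm_num) hθ0 hS s s' hs.le hs'.le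
  obtain ⟨b1', -⟩ := II_bounds S hm 27 θ (by norm_num) hθ0 hS s' s hs'.le hs.le
  rw [LL_eq f h s hs, LL_eq f h s' hs']
  set I := ∫ t in Set.Ioi (1 : ℝ), (∑ k ∈ Icc 1 ⌊t⌋₊, f k) * (t : ℂ) ^ (-(((1 + s : ℝ) : ℂ) + 1))
  set I' := ∫ t in Set.Ioi (1 : ℝ), (∑ k ∈ Icc 1 ⌊t⌋₊, f k) * (t : ℂ) ^ (-(((1 + s' : ℝ) : ℂ) + 1))
  have b1 : ‖I‖ ≤ 2 * 27 / θ := b1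
  have b1' : ‖I'‖ ≤ 2 * 27 / θ := b1'
  have b2 : ‖I - I'‖ ≤ |s - s'| * (16 * 27 / θ ^ 2) := b2
  have e1 : 2 * 27 / θ = 54 * Real.log K := by rw [hθ]; field_simp; norm_num
  have e2 : 16 * 27 / θ ^ 2 = 432 * Real.log K ^ 2 := by rw [hθ]; field_simp; norm_num
  rw [e1] at b1 b1'
  rw [e2] at b2
  have n1 : ‖((1 + s : ℝ) : ℂ)‖ ≤ 2 := by
    rw [Complex.norm_real, Real.norm_of_nonneg (by linarith)]; linarith
  constructor
  · rw [norm_mul]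
    calc _ ≤ 2 * (54 * Real.log K) := by gcongr
      _ ≤ _ := by linarith
  · have : ((1 + s : ℝ) : ℂ) * I - ((1 + s' : ℝ) : ℂ) * I' 
        = ((1 + s : ℝ) : ℂ) * (I - I') + ((s - s' : ℝ) : ℂ) * I' := by push_cast; ring
    rw [this]
    calc _ ≤ _ := norm_add_le _ _
      _ ≤ 2 * (|s - s'| * (432 * Real.log K ^ 2)) + |s - s'| * (54 * Real.log K) := by
          rw [norm_mul, norm_mul, Complex.norm_real (s - s'), Real.norm_eq_abs]
          gcongr
      _ ≤ _ := by
          have : Real.log K ≤ Real.log K ^ 2 := by nlinarith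
          nlinarith [abs_nonneg (s - s')]

noncomputable def PP (f : ℕ → ℂ) (s : ℝ) : ℝ := ∑' p : Nat.Primes, (f p).re * (p : ℝ) ^ (-(1 + s))

noncomputable def Vs (c : ℕ → ℂ) (x : ℝ) : ℂ := ∑' j : ℕ, c (j + 2) * ((x ^ (j + 2) : ℝ) : ℂ)

noncomputable def Hs (c : ℕ → ℂ) (x : ℝ) : ℂ := Complex.log (1 + (c 1 * (x : ℂ) + Vs c x)) - c 1 * (x : ℂ)

lemma geo_aux : ∑' j : ℕ, ((j : ℝ) + 2) * (2 / 5 : ℝ) ^ j = 40 / 9 ∧ 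
    Summable (fun j : ℕ => ((j : ℝ) + 2) * (2 / 5 : ℝ) ^ j) := by
  have h1 := hasSum_coe_mul_geometric_of_norm_lt_one (r := (2/5 : ℝ)) (by norm_num)
  have h2 := (hasSum_geometric_of_lt_one (r := (2/5 : ℝ)) (by norm_num) (by norm_num)).mul_left 2
  have h3 := h1.add h2
  have h4 : HasSum (fun j : ℕ => ((j : ℝ) + 2) * (2 / 5 : ℝ) ^ j) (40/9) := by
    have e1 : (fun j : ℕ => ((j : ℝ) + 2) * (2 / 5 : ℝ) ^ j) = fun b : ℕ => (b:ℝ) * (2 / 5 : ℝ) ^ b + 2 * (2 / 5 : ℝ) ^ b := by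
      ext j; ring
    have e2 : (40 / 9 : ℝ) = 2 / 5 / (1 - 2 / 5) ^ 2 + 2 * (1 - 2 / 5)⁻¹ := by norm_num
    rw [e1, e2]; exact h3
  exact ⟨h4.tsum_eq, h4.summable⟩

lemma Vs_term (c : ℕ → ℂ) (hc : ∀ j, ‖c j‖ ≤ 2 ^ j) (P x : ℝ) (hP : 5 ≤ P) (hx : 0 ≤ x) (hxP : x ≤ 1 / P) (j : ℕ) :
    ‖c (j + 2) * ((x ^ (j + 2) : ℝ) : ℂ)‖ ≤ (4 / P ^ 2) * (2 / 5) ^ j := by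
  rw [norm_mul, Complex.norm_real, Real.norm_of_nonneg (by positivity)]
  have h5 : (1 / P) ≤ 1 / 5 := one_div_le_one_div_of_le (by norm_num) hP
  have hx5 : x ≤ 1 / 5 := hxP.trans h5
  calc ‖c (j + 2)‖ * x ^ (j + 2) ≤ 2 ^ (j + 2) * ((1/5) ^ j * (1 / P) ^ 2) := by
        rw [pow_add x]
        gcongr
        exact hc _
    _ = (4 / P ^ 2) * (2 / 5) ^ j := by
        rw [pow_add, div_pow, div_pow, div_pow]; field_simp; ring

lemma Vs_summ (c : ℕ → ℂ) (hc : ∀ j, ‖c j‖ ≤ 2 ^ j) (P x : ℝ) (hP : 5 ≤ P) (hx : 0 ≤ x) (hxP : x ≤ 1 / P) :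
    Summable (fun j : ℕ => c (j + 2) * ((x ^ (j + 2) : ℝ) : ℂ)) := by
  refine Summable.of_norm_bounded ((summable_geometric_of_lt_one (r := (2/5 : ℝ)) (by norm_num) (by norm_num)).mul_left (4/P^2)) ?_
  exact Vs_term c hc P x hP hx hxP

lemma Vs_bound (c : ℕ → ℂ) (hc : ∀ j, ‖c j‖ ≤ 2 ^ j) (P x : ℝ) (hP : 5 ≤ P) (hx : 0 ≤ x) (hxP : x ≤ 1 / P) :
    ‖Vs c x‖ ≤ 20 / (3 * P ^ 2) := by
  have h1 := (hasSum_geometric_of_lt_one (r := (2/5 : ℝ)) (by norm_num) (by norm_num)).mul_left (4/P^2)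
  have := tsum_of_norm_bounded h1 (Vs_term c hc P x hP hx hxP)
  refine this.trans (le_of_eq ?_)
  field_simp; norm_num

lemma pow_diff (x x' b : ℝ) (hx : 0 ≤ x) (hx' : 0 ≤ x') (hb : x ≤ b) (hb' : x' ≤ b) (n : ℕ) : 
    |x ^ (n + 1) - x' ^ (n + 1)| ≤ (n + 1) * b ^ n * |x - x'| := by
  induction n with
  | zero => simp
  | succ n ih =>
    have : x ^ (n + 2) - x' ^ (n + 2) = x * (x ^ (n+1) - x' ^ (n+1)) + x' ^ (n + 1) * (x - x') := by ring
    rw [this]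
    refine (abs_add_le _ _).trans ?_
    rw [abs_mul, abs_mul, abs_of_nonneg hx, abs_of_nonneg (pow_nonneg hx' _)]
    have hb0 : 0 ≤ b := hx.trans hb
    calc _ ≤ b * ((n + 1) * b ^ n * |x - x'|) + b ^ (n+1) * |x - x'| := by gcongr
      _ = _ := by push_cast; ring

lemma Vs_lip (c : ℕ → ℂ) (hc : ∀ j, ‖c j‖ ≤ 2 ^ j) (P x x' : ℝ) (hP : 5 ≤ P) (hx : 0 ≤ x) (hxP : x ≤ 1 / P) 
    (hx' : 0 ≤ x') (hxP' : x' ≤ 1 / P) :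
    ‖Vs c x - Vs c x'‖ ≤ 20 / P * |x - x'| := by
  unfold Vs
  rw [← Summable.tsum_sub (Vs_summ c hc P x hP hx hxP) (Vs_summ c hc P x' hP hx' hxP')]
  have hs := (geo_aux.2.hasSum).mul_left (4 / P * |x - x'|)
  rw [geo_aux.1] at hs
  refine (tsum_of_norm_bounded hs ?_).trans ?_
  · intro j
    rw [← mul_sub, ← Complex.ofReal_sub, norm_mul, Complex.norm_real, Real.norm_eq_abs]
    have := pow_diff x x' (1 / P) hx hx' hxP hxP' (j + 1)
    have h5 : (1 / P) ≤ 1 / 5 := one_div_le_one_div_of_le (by norm_num) hP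
    calc _ ≤ 2 ^ (j + 2) * (((j + 1 : ℕ) + 1) * ((1 / 5) ^ j * (1 / P)) * |x - x'|) := by
          apply mul_le_mul (hc _) (this.trans _) (abs_nonneg _) (by positivity)
          rw [pow_succ (1 / P)]
          gcongr
      _ = _ := by rw [pow_add]; push_cast; simp only [div_pow]; field_simp; ring
  · have : 0 ≤ |x - x'| := abs_nonneg _
    have hP0 : 0 < P := by linarith
    rw [mul_right_comm]
    gcongr
    rw [div_mul_eq_mul_div]
    gcongr
    norm_num

lemma U_bound (c : ℕ → ℂ) (hc : ∀ j, ‖c j‖ ≤ 2 ^ j) (P x : ℝ) (hP : 5 ≤ P) (hx : 0 ≤ x) (hxP : x ≤ 1 / P) :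
    ‖c 1 * (x : ℂ) + Vs c x‖ ≤ 10 / (3 * P) := by
  refine (norm_add_le _ _).trans ?_
  have h1 := Vs_bound c hc P x hP hx hxP
  have h2 : ‖c 1 * (x : ℂ)‖ ≤ 2 * (1 / P) := by
    rw [norm_mul, Complex.norm_real, Real.norm_of_nonneg hx]
    gcongr
    simpa using hc 1
  have h3 : 20 / (3 * P ^ 2) ≤ 4 / (3 * P) := by
    rw [div_le_div_iff₀ (by positivity) (by positivity)]
    nlinarith
  calc _ ≤ 2 * (1 / P) + 4 / (3 * P) := by linarith
    _ = _ := by field_simp; norm_num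

lemma U_23 (c : ℕ → ℂ) (hc : ∀ j, ‖c j‖ ≤ 2 ^ j) (P x : ℝ) (hP : 5 ≤ P) (hx : 0 ≤ x) (hxP : x ≤ 1 / P) :
    ‖c 1 * (x : ℂ) + Vs c x‖ ≤ 2 / 3 := by
  refine (U_bound c hc P x hP hx hxP).trans ?_
  rw [div_le_div_iff₀ (by positivity) (by positivity)]; nlinarith

lemma Hs_bound (c : ℕ → ℂ) (hc : ∀ j, ‖c j‖ ≤ 2 ^ j) (P x : ℝ) (hP : 5 ≤ P) (hx : 0 ≤ x) (hxP : x ≤ 1 / P) :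
    ‖Hs c x‖ ≤ 32 / P ^ 2 := by
  have h1 := Vs_bound c hc P x hP hx hxP
  have h2 := U_bound c hc P x hP hx hxP
  have h3 := U_23 c hc P x hP hx hxP
  set U := c 1 * (x : ℂ) + Vs c x with hU
  have : Hs c x = (Complex.log (1 + U) - U) + Vs c x := by rw [Hs, hU]; ring
  rw [this]
  have h4 := Complex.norm_log_one_add_sub_self_le (z := U) (by linarith)
  have h5 : (1 - ‖U‖)⁻¹ ≤ 3 := by
    rw [inv_le_comm₀ (by linarith) (by norm_num)]; linarith
  calc _ ≤ _ := norm_add_le _ _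
    _ ≤ (10 / (3 * P)) ^ 2 * 3 / 2 + 20 / (3 * P ^ 2) := by
      refine add_le_add (h4.trans ?_) h1
      have : 0 ≤ 1 - ‖U‖ := by linarith
      gcongr
    _ ≤ 32 / P ^ 2 := by
      rw [div_pow, mul_pow]
      have : 10 ^ 2 / (3 ^ 2 * P ^ 2) * 3 / 2 + 20 / (3 * P ^ 2) = (70 / 3) / P ^ 2 := by field_simp; norm_num
      rw [this]; gcongr; norm_num

lemma Hs_lip (c : ℕ → ℂ) (hc : ∀ j, ‖c j‖ ≤ 2 ^ j) (P x x' : ℝ) (hP : 5 ≤ P) (hx : 0 ≤ x) (hxP : x ≤ 1 / P) 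
    (hx' : 0 ≤ x') (hxP' : x' ≤ 1 / P) :
    ‖Hs c x - Hs c x'‖ ≤ 80 / P * |x - x'| := by
  have h2 := U_bound c hc P x hP hx hxP
  have h2' := U_bound c hc P x' hP hx' hxP'
  have hv := Vs_lip c hc P x x' hP hx hxP hx' hxP'
  have hP0 : 0 < P := by linarith
  set U := c 1 * (x : ℂ) + Vs c x with hU
  set U' := c 1 * (x' : ℂ) + Vs c x' with hU'
  have e : Hs c x - Hs c x' = ((Complex.log (1 + U) - U) - (Complex.log (1 + U') - U')) + (Vs c x - Vs c x') := by 
    rw [Hs, Hs, hU, hU']; ring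
  have hr : 10 / (3 * P) ≤ 2 / 3 := by rw [div_le_div_iff₀ (by positivity) (by positivity)]; nlinarith
  have hd : ‖(Complex.log (1 + U) - U) - (Complex.log (1 + U') - U')‖ ≤ (10 / P) * ‖U - U'‖ := by
    have hconv : Convex ℝ (Metric.closedBall (0:ℂ) (10 / (3 * P))) := convex_closedBall _ _
    refine hconv.norm_image_sub_le_of_norm_hasDerivWithin_le (f := fun u => Complex.log (1 + u) - u) 
      (f' := fun u => 1 / (1 + u) - 1) ?_ ?_ (by simpa using h2') (by simpa using h2)
    · intro u hu
      have hu : ‖u‖ ≤ 10 / (3 * P) := by simpa using hu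
      have hs : (1 + u) ∈ Complex.slitPlane := Complex.mem_slitPlane_of_norm_lt_one (by linarith)
      have := (((hasDerivAt_id u).const_add 1).clog hs).sub (hasDerivAt_id u)
      exact this.hasDerivWithinAt
    · intro u hu
      have hu : ‖u‖ ≤ 10 / (3 * P) := by simpa using hu
      have h1u : 1 / 3 ≤ ‖1 + u‖ := by
        have := norm_sub_norm_le (1:ℂ) (-u)
        simp at this; linarith
      have hne : (1 + u) ≠ 0 := by
        intro h; rw [h] at h1u; simp at h1u; linarith
      have : 1 / (1 + u) - 1 = - u / (1 + u) := by field_simp; ring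
      rw [this, norm_div, norm_neg, div_le_iff₀ (by linarith)]
      have : (10 / P) * (1/3) ≤ 10 / P * ‖1 + u‖ := by gcongr
      have e3 : 10 / (3 * P) = 10 / P * (1/3) := by field_simp
      linarith
  have hUU : ‖U - U'‖ ≤ 6 * |x - x'| := by
    have : U - U' = c 1 * ((x - x' : ℝ) : ℂ) + (Vs c x - Vs c x') := by rw [hU, hU']; push_cast; ring
    rw [this]
    refine (norm_add_le _ _).trans ?_
    rw [norm_mul, Complex.norm_real, Real.norm_eq_abs]
    have h1 : ‖c 1‖ ≤ 2 := by simpa using hc 1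
    have h20 : 20 / P ≤ 4 := by rw [div_le_iff₀ (by linarith)]; linarith
    nlinarith [abs_nonneg (x - x')]
  rw [e]
  calc _ ≤ _ := norm_add_le _ _
    _ ≤ (10 / P) * (6 * |x - x'|) + 20 / P * |x - x'| := by
      refine add_le_add (hd.trans ?_) hv
      gcongr
    _ = _ := by ring

noncomputable def cP : ℝ := 200 * ∑' p : Nat.Primes, (p : ℝ) ^ (-(3/2) : ℝ)

lemma cP_summ : Summable fun p : Nat.Primes => 200 * (p : ℝ) ^ (-(3/2) : ℝ) := 
  (Nat.Primes.summable_rpow.mpr (by norm_num)).mul_left _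

lemma cP_nonneg : 0 ≤ cP := by
  unfold cP
  have : 0 ≤ ∑' p : Nat.Primes, (p : ℝ) ^ (-(3/2) : ℝ) := tsum_nonneg fun p => by positivity
  linarith

lemma BaseF.p1 {f : ℕ → ℂ} (hf : BaseF f) (p : ℕ) (hp : p.Prime) : ‖f p‖ ≤ 2 := by
  simpa using hf.pow p 1 hp

lemma BaseF.PP_summ {f : ℕ → ℂ} (hf : BaseF f) (s : ℝ) (hs : 0 < s) : 
    Summable fun p : Nat.Primes => (f p).re * (p : ℝ) ^ (-(1 + s)) := by
  refine Summable.of_norm_bounded (((Nat.Primes.summable_rpow (r := -(1 + s))).mpr (by linarith)).mul_left 2) ?_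
  intro p
  rw [norm_mul, Real.norm_of_nonneg (by positivity : (0:ℝ) ≤ (p : ℝ) ^ (-(1 + s)))]
  gcongr
  rw [Real.norm_eq_abs]
  exact (Complex.abs_re_le_norm _).trans (hf.p1 p p.2)

lemma prime_x_lip (p : ℕ) (hp : 2 ≤ p) (s s' : ℝ) (hs : 0 ≤ s) (hs' : 0 ≤ s') : 
    |(p:ℝ) ^ (-(1 + s)) - (p:ℝ) ^ (-(1 + s'))| ≤ |s - s'| * (Real.log p / p) := by
  have hp1 : (1:ℝ) < p := by exact_mod_cast hp
  have hlog : 0 < Real.log p := Real.log_pos hp1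
  have key : ∀ a b : ℝ, 0 ≤ a → a ≤ b → 
      |(p:ℝ) ^ (-(1 + a)) - (p:ℝ) ^ (-(1 + b))| ≤ (b - a) * (Real.log p / p) := by
    intro a b ha hab
    have e1 : (p:ℝ) ^ (-(1 + b)) = (p:ℝ) ^ (-(1 + a)) * Real.exp (-((b - a) * Real.log p)) := by
      rw [Real.rpow_def_of_pos (by linarith), Real.rpow_def_of_pos (by linarith), ← Real.exp_add]
      congr 1; ring
    have e2 : (p:ℝ) ^ (-(1 + a)) ≤ 1 / p := by
      rw [one_div, ← Real.rpow_neg_one]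
      exact Real.rpow_le_rpow_of_exponent_le hp1.le (by linarith)
    have e3 := Real.add_one_le_exp (-((b - a) * Real.log p))
    have e4 : Real.exp (-((b - a) * Real.log p)) ≤ 1 := Real.exp_le_one_iff.mpr (by nlinarith)
    have e5 : 0 < (p:ℝ) ^ (-(1 + a)) := by positivity
    have e6 : 0 ≤ (b - a) * Real.log p := by nlinarith
    rw [e1, abs_of_nonneg (by nlinarith), div_eq_mul_one_div (Real.log p)]
    nlinarith
  rcases le_total s s' with h | h
  · rw [abs_of_nonpos (sub_nonpos.mpr h), neg_sub]; exact key s s' hs h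
  · rw [abs_of_nonneg (sub_nonneg.mpr h), abs_sub_comm]; exact key s' s hs' h

lemma log_div_sq_le (p : ℝ) (hp : 1 ≤ p) : Real.log p / p / p ≤ 2 * p ^ (-(3/2) : ℝ) := by
  have h := Real.log_le_rpow_div (x := p) (by linarith) (ε := 1/2) (by norm_num)
  have hp0 : 0 < p := by linarith
  have e : p ^ (-(3/2) : ℝ) = p ^ (1/2 : ℝ) / p / p := by
    rw [← Real.rpow_sub_one hp0.ne', ← Real.rpow_sub_one hp0.ne']; norm_num
  rw [e]
  have : p ^ (1/2 : ℝ) / (1/2) = 2 * p ^ (1/2 : ℝ) := by ring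
  rw [this] at h
  calc Real.log p / p / p ≤ (2 * p ^ (1/2 : ℝ)) / p / p := by gcongr
    _ = _ := by ring

lemma inv_sq_le (p : ℝ) (hp : 1 ≤ p) : 1 / p ^ 2 ≤ p ^ (-(3/2) : ℝ) := by
  have hp0 : 0 < p := by linarith
  have : 1 / p ^ 2 = p ^ (-2 : ℝ) := by rw [Real.rpow_neg hp0.le]; norm_cast; simp
  rw [this]
  exact Real.rpow_le_rpow_of_exponent_le hp (by norm_num)

lemma prime_x (p : ℕ) (hp : 2 ≤ p) (s : ℝ) (hs : 0 ≤ s) : 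
    0 ≤ (p:ℝ) ^ (-(1 + s)) ∧ (p:ℝ) ^ (-(1 + s)) ≤ 1 / p := by
  refine ⟨by positivity, ?_⟩
  rw [one_div, ← Real.rpow_neg_one]
  exact Real.rpow_le_rpow_of_exponent_le (by exact_mod_cast (by omega : 1 ≤ p)) (by linarith)

/-- local log deviation -/
noncomputable def Hp (f : ℕ → ℂ) (s : ℝ) (p : ℕ) : ℂ := Hs (fun j => f (p ^ j)) ((p:ℝ) ^ (-(1 + s)))

lemma BaseF.small {f : ℕ → ℂ} (hf : BaseF f) (p : ℕ) (hp : p.Prime) (h5 : p < 5) (j : ℕ) (hj : 0 < j) : f (p ^ j) = 0 := by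
  apply hf.van
  rw [Nat.coprime_pow_left_iff hj]
  have := hp.two_le
  interval_cases p <;> first | decide | (exfalso; revert hp; decide)

lemma BaseF.Hp_small {f : ℕ → ℂ} (hf : BaseF f) (s : ℝ) (p : ℕ) (hp : p.Prime) (h5 : p < 5) : Hp f s p = 0 := by
  have h1 : f p = 0 := by simpa using hf.small p hp h5 1 one_pos
  have h2 : ∀ j, f (p ^ (j + 2)) = 0 := fun j => hf.small p hp h5 _ (by omega)
  simp [Hp, Hs, Vs, h1, h2]

lemma BaseF.Hp_bound {f : ℕ → ℂ} (hf : BaseF f) (s : ℝ) (hs : 0 ≤ s) (p : Nat.Primes) : 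
    ‖Hp f s p‖ ≤ 200 * (p : ℝ) ^ (-(3/2) : ℝ) := by
  by_cases h5 : (p : ℕ) < 5
  · rw [hf.Hp_small s p p.2 h5]; simp; positivity
  · push Not at h5
    have hx := prime_x p p.2.two_le s hs
    have h5' : (5:ℝ) ≤ (p:ℕ) := by exact_mod_cast h5
    refine (Hs_bound _ (fun j => hf.pow p j p.2) (p:ℕ) _ h5' hx.1 hx.2).trans ?_
    have := inv_sq_le (p:ℕ) (by linarith)
    calc (32:ℝ) / ((p:ℕ):ℝ)^2 = 32 * (1 / ((p:ℕ):ℝ)^2) := by ring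
      _ ≤ 200 * (1 / ((p:ℕ):ℝ)^2) := by gcongr; norm_num
      _ ≤ _ := by gcongr

lemma BaseF.Hp_lip {f : ℕ → ℂ} (hf : BaseF f) (s s' : ℝ) (hs : 0 ≤ s) (hs' : 0 ≤ s') (p : Nat.Primes) : 
    ‖Hp f s p - Hp f s' p‖ ≤ |s - s'| * (200 * (p : ℝ) ^ (-(3/2) : ℝ)) := by
  by_cases h5 : (p : ℕ) < 5
  · rw [hf.Hp_small s p p.2 h5, hf.Hp_small s' p p.2 h5]; simp; positivity
  · push Not at h5
    have hx := prime_x p p.2.two_le s hs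
    have hx' := prime_x p p.2.two_le s' hs'
    have h5' : (5:ℝ) ≤ (p:ℕ) := by exact_mod_cast h5
    refine (Hs_lip _ (fun j => hf.pow p j p.2) (p:ℕ) _ _ h5' hx.1 hx.2 hx'.1 hx'.2).trans ?_
    have h1 := prime_x_lip p p.2.two_le s s' hs hs'
    have h2 := log_div_sq_le (p:ℕ) (by linarith)
    calc _ ≤ 80 / ((p:ℕ):ℝ) * (|s - s'| * (Real.log (p:ℕ) / (p:ℕ))) := by gcongr
      _ = |s - s'| * (80 * (Real.log (p:ℕ) / (p:ℕ) / (p:ℕ))) := by ring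
      _ ≤ |s - s'| * (80 * (2 * ((p:ℕ):ℝ) ^ (-(3/2) : ℝ))) := by gcongr
      _ ≤ _ := by 
        have : (0:ℝ) ≤ ((p:ℕ):ℝ) ^ (-(3/2) : ℝ) := by positivity
        gcongr ?_ * ?_
        linarith

lemma BaseF.hasProd {f : ℕ → ℂ} (hf : BaseF f) (s : ℝ) (hs : 0 < s) : 
    HasProd (fun p : Nat.Primes => 1 + ((f p) * (((p:ℝ) ^ (-(1 + s)) : ℝ) : ℂ) + Vs (fun j => f ((p:ℕ) ^ j)) ((p:ℝ) ^ (-(1 + s))))) (LL f s) := by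
  have hsum := summ_of_cnt f hf.cnt s hs
  set F : ℕ → ℂ := fun n => f n * (((n:ℝ) ^ (-(1 + s)) : ℝ) : ℂ) with hF
  have hFt : F = LSeries.term f ((1 + s : ℝ) : ℂ) := by
    ext n
    rcases eq_or_ne n 0 with rfl | hn
    · simp [hF, hf.zero]
    · rw [LSeries.term_of_ne_zero hn, hF]
      simp only
      rw [Complex.ofReal_cpow (by positivity), div_eq_mul_inv, ← Complex.cpow_neg]
      push_cast; rfl
  have hsF : Summable F := by rw [hFt]; exact hsum
  have h := EulerProduct.eulerProduct_hasProd (f := F) ?_ ?_ hsF.norm ?_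
  · have e : ∑' n, F n = LL f s := by rw [hFt]; rfl
    rw [e] at h
    convert h using 2 with p
    have hsp : Summable fun e : ℕ => F ((p:ℕ) ^ e) := 
      hsF.comp_injective (Nat.pow_right_injective p.2.two_le)
    rw [hsp.tsum_eq_zero_add, ((summable_nat_add_iff 1).mpr hsp).tsum_eq_zero_add]
    congr 1
    · simp [hF, hf.one]
    · congr 1
      · simp [hF]
      · unfold Vs
        apply tsum_congr
        intro j
        simp only [hF]
        congr 2
        push_cast
        rw [← Real.rpow_natCast, ← Real.rpow_mul (by positivity), ← Real.rpow_natCast, ← Real.rpow_mul (by positivity)]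
        push_cast; ring_nf
  · simp [hF, hf.one]
  · intro m n hmn
    simp only [hF]
    rw [hf.mult m n hmn]
    push_cast
    rw [Real.mul_rpow (by positivity) (by positivity)]
    push_cast; ring
  · simp [hF, hf.zero]

lemma BaseF.log_eq {f : ℕ → ℂ} (hf : BaseF f) (s : ℝ) (hs : 0 < s) : 
    LL f s ≠ 0 ∧ Real.log ‖LL f s‖ = PP f s + ∑' p : Nat.Primes, (Hp f s p).re := by
  have hp := (hf.hasProd s hs).norm
  have hsH : Summable fun p : Nat.Primes => (Hp f s p).re := 
    Summable.of_norm_bounded cP_summ (fun p => (Complex.abs_re_le_norm _).trans (hf.Hp_bound s hs.le p))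
  have hsum := (hf.PP_summ s hs).hasSum.add hsH.hasSum
  have hexp := hsum.rexp
  have : ∀ p : Nat.Primes, ‖1 + ((f p) * (((p:ℝ) ^ (-(1 + s)) : ℝ) : ℂ) + Vs (fun j => f ((p:ℕ) ^ j)) ((p:ℝ) ^ (-(1 + s))))‖ = 
      Real.exp ((f p).re * (p : ℝ) ^ (-(1 + s)) + (Hp f s p).re) := by
    intro p
    set U := ((f p) * (((p:ℝ) ^ (-(1 + s)) : ℝ) : ℂ) + Vs (fun j => f ((p:ℕ) ^ j)) ((p:ℝ) ^ (-(1 + s)))) with hU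
    have hHp : Hp f s p = Complex.log (1 + U) - (f p) * (((p:ℝ) ^ (-(1 + s)) : ℝ) : ℂ) := by
      simp only [Hp, Hs, pow_one]; rfl
    have hne : 1 + U ≠ 0 := by
      by_cases h5 : (p : ℕ) < 5
      · have h1 : f p = 0 := by simpa using hf.small p p.2 h5 1 one_pos
        have h2 : ∀ j, f ((p:ℕ) ^ (j + 2)) = 0 := fun j => hf.small p p.2 h5 _ (by omega)
        simp [hU, Vs, h1, h2]
      · push Not at h5
        have hx := prime_x p p.2.two_le s hs.le
        have h5' : (5:ℝ) ≤ (p:ℕ) := by exact_mod_cast h5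
        have := U_23 _ (fun j => hf.pow p j p.2) (p:ℕ) _ h5' hx.1 hx.2
        simp only [pow_one] at this
        intro h0
        have hU1 : U = -1 := by linear_combination h0
        have : ‖U‖ ≤ 2/3 := this
        rw [hU1] at this; norm_num at this
    rw [hHp, Complex.sub_re, Complex.re_mul_ofReal, Complex.log_re]
    rw [add_sub_cancel, Real.exp_log (norm_pos_iff.mpr hne)]
  simp_rw [this] at hp
  have huniq := hp.unique hexp
  have hpos : 0 < ‖LL f s‖ := by rw [huniq]; exact Real.exp_pos _
  refine ⟨norm_pos_iff.mp hpos, ?_⟩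
  rw [huniq, Real.log_exp]; rfl

lemma BaseF.log_bound {f : ℕ → ℂ} (hf : BaseF f) (s : ℝ) (hs : 0 < s) : 
    |Real.log ‖LL f s‖ - PP f s| ≤ cP := by
  rw [(hf.log_eq s hs).2, add_sub_cancel_left, ← Real.norm_eq_abs]
  refine tsum_of_norm_bounded (g := fun p : Nat.Primes => 200 * (p : ℝ) ^ (-(3/2) : ℝ)) ?_ ?_
  · unfold cP; rw [← tsum_mul_left]; exact cP_summ.hasSum
  · exact fun p => (Complex.abs_re_le_norm _).trans (hf.Hp_bound s hs.le p)

lemma BaseF.log_lip {f : ℕ → ℂ} (hf : BaseF f) (s s' : ℝ) (hs : 0 < s) (hs' : 0 < s') : 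
    |(Real.log ‖LL f s‖ - PP f s) - (Real.log ‖LL f s'‖ - PP f s')| ≤ |s - s'| * cP := by
  rw [(hf.log_eq s hs).2, (hf.log_eq s' hs').2, add_sub_cancel_left, add_sub_cancel_left, ← Real.norm_eq_abs]
  have hsH : ∀ s : ℝ, 0 < s → Summable fun p : Nat.Primes => (Hp f s p).re := fun s hs =>
    Summable.of_norm_bounded cP_summ (fun p => (Complex.abs_re_le_norm _).trans (hf.Hp_bound s hs.le p))
  rw [← Summable.tsum_sub (hsH s hs) (hsH s' hs')]
  refine tsum_of_norm_bounded (g := fun p : Nat.Primes => |s - s'| * (200 * (p : ℝ) ^ (-(3/2) : ℝ))) ?_ ?_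
  · unfold cP; rw [← tsum_mul_left]; exact cP_summ.hasSum.mul_left _
  · intro p
    rw [← Complex.sub_re]
    exact (Complex.abs_re_le_norm _).trans (hf.Hp_lip s s' hs.le hs'.le p)

/-! Lattice point sums. -/

noncomputable def Dk (N : ℕ) : Finset (ℤ × ℤ) := 
  ((Icc (-(Nat.sqrt N : ℤ)) (Nat.sqrt N)) ×ˢ (Icc (-(Nat.sqrt N : ℤ)) (Nat.sqrt N))).filter 
    (fun v => v.1 ^ 2 + v.2 ^ 2 ≤ (N : ℤ))

lemma sqrt_int_le (a : ℤ) (N : ℕ) (h : a ^ 2 ≤ (N:ℤ)) : -(Nat.sqrt N : ℤ) ≤ a ∧ a ≤ (Nat.sqrt N : ℤ) := by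
  have : a.natAbs ≤ Nat.sqrt N := by
    rw [Nat.le_sqrt']
    have : ((a.natAbs ^ 2 : ℕ) : ℤ) ≤ N := by push_cast; rw [sq_abs]; exact h
    exact_mod_cast this
  omega

lemma mem_Dk (N : ℕ) (v : ℤ × ℤ) : v ∈ Dk N ↔ v.1 ^ 2 + v.2 ^ 2 ≤ (N : ℤ) := by
  unfold Dk
  simp only [mem_filter, mem_product, mem_Icc]
  constructor
  · exact fun h => h.2
  · intro h
    exact ⟨⟨sqrt_int_le _ _ (by nlinarith [sq_nonneg v.2]), sqrt_int_le _ _ (by nlinarith [sq_nonneg v.1])⟩, h⟩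

lemma Dk_swap (N : ℕ) (g : ℤ → ℤ → ℂ) : ∑ v ∈ Dk N, g v.1 v.2 = ∑ v ∈ Dk N, g v.2 v.1 := by
  refine Finset.sum_bij (fun v _ => (v.2, v.1)) ?_ ?_ ?_ ?_
  · intro v hv; rw [mem_Dk] at *; simpa [add_comm] using hv
  · rintro ⟨a, b⟩ _ ⟨c, d⟩ _ h; simp at h; simp [h]
  · rintro ⟨a, b⟩ hv; exact ⟨(b, a), by rw [mem_Dk] at *; simpa [add_comm] using hv, rfl⟩
  · intro v _; rfl

lemma tele (h : ℤ → ℂ) (c : ℕ) : ∑ a ∈ Icc (-(c:ℤ)) c, (h (a + 1) - h a) = h (c + 1) - h (-c) := by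
  induction c with
  | zero => simp
  | succ c ih =>
    have : Icc (-((c + 1 : ℕ):ℤ)) ((c + 1 : ℕ) : ℤ) = insert (-((c:ℤ) + 1)) (insert ((c:ℤ) + 1) (Icc (-(c:ℤ)) c)) := by
      ext x; simp only [mem_Icc, mem_insert]; push_cast; omega
    rw [this, sum_insert, sum_insert, ih]
    · push_cast
      rw [show -((c:ℤ) + 1) + 1 = -c by ring]
      ring
    · simp
    · simp only [mem_insert, mem_Icc]; omega

lemma Dk_row (N : ℕ) (g : ℤ → ℤ → ℂ) (hg : ∀ a b, ‖g a b‖ ≤ 1) : 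
    ‖∑ v ∈ Dk N, (g (v.1 + 1) v.2 - g v.1 v.2)‖ ≤ 2 * (2 * Nat.sqrt N + 1) := by
  unfold Dk
  rw [sum_filter, sum_product_right]
  have : ∀ b ∈ Icc (-(Nat.sqrt N : ℤ)) (Nat.sqrt N), 
      ‖∑ a ∈ Icc (-(Nat.sqrt N : ℤ)) (Nat.sqrt N), (if (a, b).1 ^ 2 + (a, b).2 ^ 2 ≤ (N:ℤ) then 
        (g ((a, b).1 + 1) (a, b).2 - g (a, b).1 (a, b).2) else 0)‖ ≤ 2 := by
    intro b hb
    simp only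
    rw [← sum_filter]
    rw [mem_Icc] at hb
    have hb2 : b ^ 2 ≤ (N : ℤ) := by
      have : ((Nat.sqrt N : ℕ) : ℤ) ^ 2 ≤ N := by exact_mod_cast Nat.sqrt_le' N
      nlinarith
    obtain ⟨m, hm⟩ : ∃ m : ℕ, (m : ℤ) = N - b ^ 2 := ⟨(N - b ^ 2).toNat, by omega⟩
    have hf : (Icc (-(Nat.sqrt N : ℤ)) (Nat.sqrt N)).filter (fun a => a ^ 2 + b ^ 2 ≤ (N:ℤ)) 
        = Icc (-(Nat.sqrt m : ℤ)) (Nat.sqrt m) := by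
      ext a
      simp only [mem_filter, mem_Icc]
      constructor
      · rintro ⟨-, h⟩
        exact sqrt_int_le a m (by omega)
      · intro h
        have : ((Nat.sqrt m : ℕ) : ℤ) ^ 2 ≤ m := by exact_mod_cast Nat.sqrt_le' m
        have h2 : a ^ 2 ≤ (m : ℤ) := by nlinarith
        exact ⟨sqrt_int_le a N (by nlinarith [sq_nonneg b]), by omega⟩
    rw [hf, tele (fun a => g a b)]
    calc _ ≤ _ := norm_sub_le _ _
      _ ≤ 1 + 1 := add_le_add (hg _ _) (hg _ _)
      _ = 2 := by norm_num
  refine (norm_sum_le_of_le _ this).trans ?_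
  simp only [sum_const, Int.card_Icc, nsmul_eq_mul]
  rw [mul_comm]
  gcongr
  have : ((Nat.sqrt N : ℤ) + 1 - -(Nat.sqrt N : ℤ)).toNat = 2 * Nat.sqrt N + 1 := by omega
  rw [this]; push_cast; rfl

lemma Dk_shift (N : ℕ) (g : ℤ → ℤ → ℂ) (hg : ∀ a b, ‖g a b‖ ≤ 1) (r t : ℕ) : 
    ‖∑ v ∈ Dk N, g (v.1 + r) (v.2 + t) - ∑ v ∈ Dk N, g v.1 v.2‖ ≤ (r + t) * (2 * (2 * Nat.sqrt N + 1)) := by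
  have h1 : ∀ (g : ℤ → ℤ → ℂ), (∀ a b, ‖g a b‖ ≤ 1) → ∀ r : ℕ, 
      ‖∑ v ∈ Dk N, g (v.1 + r) v.2 - ∑ v ∈ Dk N, g v.1 v.2‖ ≤ r * (2 * (2 * Nat.sqrt N + 1)) := by
    intro g hg r
    induction r with
    | zero => simp
    | succ r ih =>
      have h := Dk_row N (fun a b => g (a + r) b) (fun a b => hg _ _)
      rw [sum_sub_distrib] at h
      have e : ∑ v ∈ Dk N, g (v.1 + ((r + 1 : ℕ):ℤ)) v.2 = ∑ v ∈ Dk N, g (v.1 + 1 + r) v.2 := by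
        apply sum_congr rfl; intro v _; congr 1; push_cast; ring
      rw [e]
      have := norm_add_le_of_le h ih
      rw [sub_add_sub_cancel] at this
      refine this.trans (le_of_eq ?_)
      push_cast; ring
  have a1 := h1 (fun a b => g a (b + t)) (fun a b => hg _ _) r
  have a2 := h1 (fun b a => g a b) (fun a b => hg _ _) t
  rw [Dk_swap N (fun a b => g b (a + t)), Dk_swap N (fun a b => g b a)] at a2
  have := norm_add_le_of_le a1 a2
  rw [sub_add_sub_cancel] at this
  refine this.trans (le_of_eq ?_)
  ring

lemma per_sum (M : ℕ) (hM : 0 < M) (h : ℤ → ℂ) (hp : ∀ a, h (a + M) = h a) (a : ℤ) : 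
    ∑ r ∈ range M, h (a + r) = ∑ r ∈ range M, h r := by
  have key : ∀ b : ℤ, ∑ r ∈ range M, h (b + 1 + r) = ∑ r ∈ range M, h (b + r) := by
    intro b
    have h1 := sum_range_succ (fun r : ℕ => h (b + r)) M
    have h2 := sum_range_succ' (fun r : ℕ => h (b + r)) M
    rw [h1] at h2
    simp only [hp, Nat.cast_zero, add_zero] at h2
    have h3 := add_right_cancel h2
    rw [h3]
    apply sum_congr rfl; intro r _; congr 1; push_cast; ring
  induction a using Int.induction_on with
  | zero => simp
  | succ i ih => rw [key, ih]
  | pred i ih => rw [← ih, ← key]; simp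

lemma lattice_canc (N M : ℕ) (hN : 0 < N) (hM : 0 < M) (g : ℤ → ℤ → ℂ) (hg : ∀ a b, ‖g a b‖ ≤ 1) 
    (hp1 : ∀ a b, g (a + M) b = g a b) (hp2 : ∀ a b, g a (b + M) = g a b) 
    (h0 : ∑ r ∈ range M, ∑ t ∈ range M, g r t = 0) : 
    ‖∑ v ∈ Dk N, g v.1 v.2‖ ≤ 12 * M * Real.sqrt N := by
  have hz : ∑ r ∈ range M, ∑ t ∈ range M, ∑ v ∈ Dk N, g (v.1 + r) (v.2 + t) = 0 := by
    have : ∑ r ∈ range M, ∑ t ∈ range M, ∑ v ∈ Dk N, g (v.1 + r) (v.2 + t) = 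
        ∑ v ∈ Dk N, ∑ r ∈ range M, ∑ t ∈ range M, g (v.1 + r) (v.2 + t) := by
      rw [sum_comm (s := Dk N)]
      apply sum_congr rfl; intro r _; rw [sum_comm]
    rw [this]
    apply sum_eq_zero
    intro v _
    calc _ = ∑ r ∈ range M, ∑ t ∈ range M, g (v.1 + r) t := by
          apply sum_congr rfl; intro r _
          exact per_sum M hM (fun b => g (v.1 + r) b) (fun b => hp2 _ b) v.2
      _ = ∑ t ∈ range M, ∑ r ∈ range M, g (v.1 + r) t := sum_comm
      _ = ∑ t ∈ range M, ∑ r ∈ range M, g r t := by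
          apply sum_congr rfl; intro t _
          exact per_sum M hM (fun a => g a t) (fun a => hp1 a _) v.1
      _ = 0 := by rw [sum_comm]; exact h0
  set S := ∑ v ∈ Dk N, g v.1 v.2 with hS
  have h2 : ∑ r ∈ range M, ∑ t ∈ range M, (∑ v ∈ Dk N, g (v.1 + r) (v.2 + t) - S) = - ((M:ℂ) * M * S) := by
    simp only [sum_sub_distrib, hz, sum_const, card_range, nsmul_eq_mul]
    ring
  have h3 : ‖∑ r ∈ range M, ∑ t ∈ range M, (∑ v ∈ Dk N, g (v.1 + r) (v.2 + t) - S)‖ ≤ 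
      ∑ r ∈ range M, ∑ t ∈ range M, (2 * M * (2 * (2 * Nat.sqrt N + 1)) : ℝ) := by
    refine norm_sum_le_of_le _ fun r hr => norm_sum_le_of_le _ fun t ht => (Dk_shift N g hg r t).trans ?_
    rw [mem_range] at hr ht
    have : (r:ℝ) + t ≤ 2 * M := by
      have : r + t ≤ 2 * M := by omega
      exact_mod_cast this
    gcongr
  rw [h2, norm_neg] at h3
  simp only [sum_const, card_range, nsmul_eq_mul, norm_mul, Complex.norm_natCast] at h3
  have hM' : (0:ℝ) < M := by exact_mod_cast hM
  have h4 : ‖S‖ ≤ 2 * M * (2 * (2 * Nat.sqrt N + 1)) := by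
    have := mul_pos hM' hM'
    by_contra hcon
    push Not at hcon
    nlinarith
  have h5 : (Nat.sqrt N : ℝ) ≤ Real.sqrt N := Real.nat_sqrt_le_real_sqrt
  have h6 : 1 ≤ Real.sqrt N := by rw [Real.one_le_sqrt]; exact_mod_cast hN
  refine h4.trans ?_
  nlinarith

lemma Dk_card (N : ℕ) (hN : 0 < N) : ((Dk N).card : ℝ) ≤ 9 * N := by
  have h1 : (Dk N).card ≤ (2 * Nat.sqrt N + 1) * (2 * Nat.sqrt N + 1) := by
    unfold Dk
    refine (card_filter_le _ _).trans ?_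
    rw [card_product]
    simp only [Int.card_Icc]
    have : ((Nat.sqrt N : ℤ) + 1 - -(Nat.sqrt N : ℤ)).toNat = 2 * Nat.sqrt N + 1 := by omega
    rw [this]
  have h2 := Nat.sqrt_le' N
  have h3 : 1 ≤ Nat.sqrt N := by rw [Nat.le_sqrt']; omega
  have : (Dk N).card ≤ 9 * N := by nlinarith
  exact_mod_cast this

/-- One dimensional periodic cancellation. -/
lemma per_canc (M : ℕ) (hM : 0 < M) (h : ℕ → ℂ) (hb : ∀ a, ‖h a‖ ≤ 1) (hp : ∀ a, h (a + M) = h a) 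
    (h0 : ∑ r ∈ range M, h r = 0) (N : ℕ) : ‖∑ n ∈ range N, h n‖ ≤ M := by
  induction N using Nat.strong_induction_on with
  | _ N ih =>
    by_cases hN : N < M
    · calc _ ≤ ∑ n ∈ range N, (1:ℝ) := norm_sum_le_of_le _ fun n _ => hb n
        _ = N := by simp
        _ ≤ M := by exact_mod_cast hN.le
    · push Not at hN
      obtain ⟨m, rfl⟩ := Nat.exists_eq_add_of_le hN
      rw [sum_range_add, h0, zero_add]
      simp_rw [add_comm M, hp]
      exact ih m (by omega)

/-! Gaussian characters. -/

abbrev GI := GaussianInt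

def Prim (α : GI) : Prop := α.im % 2 = 0 ∧ (α.re + α.im) % 4 = 1

def nm (α : GI) : ℕ := (Zsqrtd.norm α).natAbs

lemma nm_cast (α : GI) : (nm α : ℤ) = α.re ^ 2 + α.im ^ 2 := by
  unfold nm
  rw [Int.natCast_natAbs, abs_of_nonneg (GaussianInt.norm_nonneg α), Zsqrtd.norm_def]
  ring

lemma nm_mul (α β : GI) : nm (α * β) = nm α * nm β := by
  unfold nm; rw [Zsqrtd.norm_mul, Int.natAbs_mul]

lemma nm_one : nm 1 = 1 := by unfold nm; simp

lemma nm_star (α : GI) : nm (star α) = nm α := by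
  have : (nm (star α) : ℤ) = nm α := by rw [nm_cast, nm_cast]; simp
  exact_mod_cast this

lemma mul_star_nm (α : GI) : α * star α = ((nm α : ℕ) : GI) := by
  rw [Zsqrtd.ext_iff]
  have := nm_cast α
  constructor
  · simp [Zsqrtd.re_mul]; rw [this]; ring
  · simp [Zsqrtd.im_mul]; ring

lemma nm_natCast (n : ℕ) : nm (n : GI) = n ^ 2 := by
  have : (nm (n : GI) : ℤ) = ((n ^ 2 : ℕ) : ℤ) := by rw [nm_cast]; simp
  exact_mod_cast this

lemma nm_dvd {α β : GI} (h : α ∣ β) : nm α ∣ nm β := by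
  obtain ⟨c, rfl⟩ := h
  rw [nm_mul]; exact Dvd.intro _ rfl

lemma nm_eq_one_unit (α : GI) : nm α = 1 ↔ IsUnit α := Zsqrtd.norm_eq_one_iff

lemma nm_zero_iff (α : GI) : nm α = 0 ↔ α = 0 := by
  unfold nm; rw [Int.natAbs_eq_zero]
  exact GaussianInt.norm_eq_zero

lemma Prim_one : Prim 1 := ⟨by simp, by simp⟩

lemma Prim_mul {α β : GI} (ha : Prim α) (hb : Prim β) : Prim (α * β) := by
  obtain ⟨a1, a2⟩ := ha
  obtain ⟨b1, b2⟩ := hb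
  obtain ⟨x, hx⟩ : ∃ x, α.im = 2 * x := ⟨α.im / 2, by omega⟩
  obtain ⟨y, hy⟩ : ∃ y, β.im = 2 * y := ⟨β.im / 2, by omega⟩
  obtain ⟨u, hu⟩ : ∃ u, α.re = 4 * u + 1 - 2 * x := ⟨(α.re + α.im) / 4, by omega⟩
  obtain ⟨v, hv⟩ : ∃ v, β.re = 4 * v + 1 - 2 * y := ⟨(β.re + β.im) / 4, by omega⟩
  constructor
  · rw [Zsqrtd.im_mul, hx, hy]
    have : α.re * (2 * y) + 2 * x * β.re = 2 * (α.re * y + x * β.re) := by ring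
    omega
  · rw [Zsqrtd.im_mul, Zsqrtd.re_mul, hx, hy, hu, hv]
    have : (4 * u + 1 - 2 * x) * (4 * v + 1 - 2 * y) + -1 * (2 * x) * (2 * y) + ((4 * u + 1 - 2 * x) * (2 * y) + 2 * x * (4 * v + 1 - 2 * y)) = 4 * (4 * u * v + u + v - 2 * x * y) + 1 := by ring
    omega

lemma Prim_star {α : GI} (ha : Prim α) : Prim (star α) := by
  obtain ⟨a1, a2⟩ := ha
  constructor
  · simp; omega
  · simp; omega

lemma Prim_nm {α : GI} (ha : Prim α) : nm α % 4 = 1 := by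
  obtain ⟨a1, a2⟩ := ha
  have h := nm_cast α
  obtain ⟨x, hx⟩ : ∃ x, α.im = 2 * x := ⟨α.im / 2, by omega⟩
  obtain ⟨u, hu⟩ : ∃ u, α.re = 4 * u + 1 - 2 * x := ⟨(α.re + α.im) / 4, by omega⟩
  rw [hx, hu] at h
  have : (4 * u + 1 - 2 * x) ^ 2 + (2 * x) ^ 2 = 4 * (4 * u ^ 2 + 2 * u - 4 * u * x + x ^ 2 - x + x ^ 2) + 1 := by ring
  omega

lemma Prim_nat {n : ℕ} (h : n % 4 = 1) : Prim (n : GI) := by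
  constructor
  · simp
  · simp; omega

/-- cancellation -/
lemma Prim_of_mul {α β : GI} (ha : Prim α) (hab : Prim (α * β)) : Prim β := by
  have h1 : Prim (star α * (α * β)) := Prim_mul (Prim_star ha) hab
  have e : star α * (α * β) = ((nm α : ℕ) : GI) * β := by rw [← mul_star_nm]; ring
  rw [e] at h1
  obtain ⟨h1, h2⟩ := h1
  have hn := Prim_nm ha
  obtain ⟨w, hw⟩ : ∃ w : ℤ, (nm α : ℤ) = 4 * w + 1 := ⟨(nm α : ℤ) / 4, by omega⟩
  simp only [Zsqrtd.re_mul, Zsqrtd.im_mul, Zsqrtd.re_natCast, Zsqrtd.im_natCast] at h1 h2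
  rw [hw] at h1 h2
  have e1 : (4 * w + 1) * β.im + 0 * β.re = 4 * (w * β.im) + β.im := by ring
  have e2 : (4 * w + 1) * β.re + -1 * 0 * β.im + ((4 * w + 1) * β.im + 0 * β.re) = 4 * (w * β.re + w * β.im) + (β.re + β.im) := by ring
  rw [e1] at h1
  rw [e2] at h2
  exact ⟨by omega, by omega⟩

lemma unit_cases (u : GI) (h : IsUnit u) : u = 1 ∨ u = -1 ∨ u = ⟨0, 1⟩ ∨ u = ⟨0, -1⟩ := by
  have h1 := (nm_eq_one_unit u).mpr h
  have h2 := nm_cast u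
  rw [h1] at h2
  obtain ⟨a, b⟩ := u
  simp only [Nat.cast_one] at h2
  have ha : -1 ≤ a ∧ a ≤ 1 := by constructor <;> nlinarith [sq_nonneg b]
  have hb : -1 ≤ b ∧ b ≤ 1 := by constructor <;> nlinarith [sq_nonneg a]
  obtain ⟨ha1, ha2⟩ := ha
  obtain ⟨hb1, hb2⟩ := hb
  clear h h1
  interval_cases a <;> interval_cases b <;>
    first
      | (exfalso; norm_num at h2; done)
      | (simp [Zsqrtd.ext_iff]; done)

lemma Prim_unit {u : GI} (h : IsUnit u) (hp : Prim u) : u = 1 := by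
  rcases unit_cases u h with rfl | rfl | rfl | rfl
  · rfl
  all_goals (exfalso; revert hp; unfold Prim; decide)

lemma Prim_assoc {α β : GI} (ha : Prim α) (hb : Prim β) (h : Associated α β) : α = β := by
  obtain ⟨u, rfl⟩ := h
  have := Prim_unit u.isUnit (Prim_of_mul ha hb)
  rw [this, mul_one]

lemma Prim_exists {α : GI} (h : nm α % 2 = 1) : ∃ β, Prim β ∧ Associated α β := by
  have hc := nm_cast α
  obtain ⟨a, b⟩ := α
  simp only at hc
  have hI : IsUnit (⟨0, 1⟩ : GI) := (nm_eq_one_unit _).mp (by decide)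
  have hI' : IsUnit (⟨0, -1⟩ : GI) := (nm_eq_one_unit _).mp (by decide)
  have hpar : (a + b) % 2 = 1 := by
    have e : a ^ 2 + b ^ 2 = (a + b) + (a * (a - 1) + b * (b - 1)) := by ring
    have e1 : (a * (a - 1)) % 2 = 0 := by 
      rcases Int.even_or_odd a with h | h
      · exact Int.even_iff.mp (h.mul_right _)
      · exact Int.even_iff.mp ((h.sub_odd odd_one).mul_left _)
    have e2 : (b * (b - 1)) % 2 = 0 := by 
      rcases Int.even_or_odd b with h | h
      · exact Int.even_iff.mp (h.mul_right _)
      · exact Int.even_iff.mp ((h.sub_odd odd_one).mul_left _)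
    omega
  have hm : (a + b) % 4 = 1 ∨ (a + b) % 4 = 3 := by omega
  rcases Int.emod_two_eq_zero_or_one b with hb | hb
  · rcases hm with h1 | h1
    · exact ⟨⟨a, b⟩, ⟨hb, h1⟩, Associated.refl _⟩
    · refine ⟨-⟨a, b⟩, ⟨by simp; omega, by simp; omega⟩, ?_⟩
      exact (Associated.refl _).neg_right
  · have : (b - a) % 4 = 1 ∨ (b - a) % 4 = 3 := by omega
    rcases this with h1 | h1
    · refine ⟨⟨a, b⟩ * ⟨0, -1⟩, ⟨by simp [Zsqrtd.im_mul]; omega, by simp [Zsqrtd.im_mul, Zsqrtd.re_mul]; omega⟩, ?_⟩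
      exact (associated_mul_unit_right _ _ hI')
    · refine ⟨⟨a, b⟩ * ⟨0, 1⟩, ⟨by simp [Zsqrtd.im_mul]; omega, by simp [Zsqrtd.im_mul, Zsqrtd.re_mul]; omega⟩, ?_⟩
      exact (associated_mul_unit_right _ _ hI)

noncomputable def Sp (n : ℕ) : Finset GI := 
  ((Dk n).image (fun v => (⟨v.1, v.2⟩ : GI))).filter (fun α => nm α = n)

lemma mem_Sp (n : ℕ) (α : GI) : α ∈ Sp n ↔ nm α = n := by
  unfold Sp
  rw [mem_filter, mem_image]
  constructor
  · exact fun h => h.2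
  · intro h
    refine ⟨⟨(α.re, α.im), ?_, rfl⟩, h⟩
    rw [mem_Dk]
    have := nm_cast α
    rw [h] at this; simp [this]

noncomputable def PS (n : ℕ) : Finset GI := (Sp n).filter Prim

lemma mem_PS (n : ℕ) (α : GI) : α ∈ PS n ↔ nm α = n ∧ Prim α := by
  unfold PS; rw [mem_filter, mem_Sp]

lemma PS_pow_card (p : ℕ) (hp : p.Prime) (j : ℕ) : (PS (p ^ j)).card ≤ 2 ^ j := by
  induction j using Nat.strong_induction_on with
  | _ j ih =>
  rcases Nat.eq_zero_or_pos j with rfl | hj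
  · refine card_le_one_iff_subset_singleton.mpr ⟨1, ?_⟩
    intro α hα
    rw [mem_PS] at hα
    simp only [mem_singleton]
    exact Prim_unit ((nm_eq_one_unit α).mp (by simpa using hα.1)) hα.2
  by_cases hem : (PS (p ^ j)) = ∅
  · rw [hem]; simp
  obtain ⟨α0, hα0⟩ := Finset.nonempty_iff_ne_empty.mpr hem
  have hodd : ∀ α : GI, α ∣ (p : GI) → nm α % 2 = 1 := by
    intro α hα
    have h1 := nm_dvd hα
    rw [nm_natCast] at h1
    rw [mem_PS] at hα0
    have h2 := Prim_nm hα0.2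
    rw [hα0.1] at h2
    have h3 : nm α ∣ p ^ (2 * j) := by
      refine h1.trans (pow_dvd_pow _ (by omega))
    have : Odd (p ^ j) := Nat.odd_iff.mpr (by omega)
    have : Odd (p ^ (2 * j)) := by rw [mul_comm, pow_mul]; exact this.pow
    exact Nat.odd_iff.mp (this.of_dvd_nat h3)
  have hpu : ¬ IsUnit (p : GI) := by
    rw [← nm_eq_one_unit, nm_natCast]
    have := hp.two_le
    nlinarith
  obtain ⟨π, hπ, hπd⟩ := WfDvdMonoid.exists_irreducible_factor hpu (by exact_mod_cast hp.ne_zero)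
  have hπp : Prime π := hπ.prime
  obtain ⟨τ1, ht1, hτ1⟩ := Prim_exists (hodd π hπd)
  have hnm1 : nm τ1 = nm π := by
    obtain ⟨u, rfl⟩ := hτ1
    rw [nm_mul, (nm_eq_one_unit _).mpr u.isUnit, mul_one]
  have hnd := nm_dvd hπd
  rw [nm_natCast] at hnd
  obtain ⟨e, he2, he⟩ := (Nat.dvd_prime_pow hp).mp hnd
  have he1 : 1 ≤ e := by
    by_contra hcon
    have : e = 0 := by omega
    rw [this, pow_zero] at he
    exact hπ.not_isUnit ((nm_eq_one_unit π).mp he)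
  have key : ∀ α ∈ PS (p ^ j), e ≤ j ∧ α ∈ ((PS (p ^ (j - e))).image (fun β => τ1 * β)) ∪ ((PS (p ^ (j - e))).image (fun β => star τ1 * β)) := by
    intro α hα
    rw [mem_PS] at hα
    have hu : ¬ IsUnit α := by
      rw [← nm_eq_one_unit, hα.1]
      exact (Nat.one_lt_pow hj.ne' hp.one_lt).ne'
    have h0 : α ≠ 0 := by
      intro h; rw [h] at hα; have := (hα.2).2; simp at this
    obtain ⟨ρ, hρ, hρd⟩ := WfDvdMonoid.exists_irreducible_factor hu h0
    have hρp : Prime ρ := hρ.prime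
    have h1 : ρ ∣ (p : GI) := by
      have : ρ ∣ ((p ^ j : ℕ) : GI) := by
        rw [← hα.1, ← mul_star_nm]; exact hρd.mul_right _
      rw [Nat.cast_pow] at this
      exact hρp.dvd_of_dvd_pow this
    have h2 : ρ ∣ τ1 * star τ1 := by
      rw [mul_star_nm, hnm1, he, Nat.cast_pow]
      exact h1.trans (dvd_pow_self _ (by omega))
    have aux : ∀ τ : GI, Prime τ → Prim τ → nm τ = p ^ e → ρ ∣ τ → e ≤ j ∧ α ∈ ((PS (p ^ (j - e))).image (fun β => τ * β)) := by
      intro τ hτ hPτ hnτ hd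
      have hτα : τ ∣ α := ((hρp.associated_of_dvd hτ hd).symm.dvd).trans hρd
      obtain ⟨β, rfl⟩ := hτα
      have hb := hα.1
      rw [nm_mul, hnτ] at hb
      have hej : e ≤ j := by
        have : p ^ e ∣ p ^ j := Dvd.intro _ hb
        exact (Nat.pow_dvd_pow_iff_le_right hp.one_lt).mp this
      refine ⟨hej, mem_image.mpr ⟨β, ?_, rfl⟩⟩
      rw [mem_PS]
      refine ⟨?_, Prim_of_mul hPτ hα.2⟩
      have : p ^ j = p ^ e * p ^ (j - e) := by rw [← pow_add]; congr 1; omega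
      rw [this] at hb
      exact Nat.eq_of_mul_eq_mul_left (pow_pos hp.pos _) hb
    have hτp : Prime τ1 := hτ1.prime hπp
    have hτsp : Prime (star τ1) := (MulEquiv.prime_iff (starRingAut (R := GI))).mpr hτp
    rcases hρp.dvd_or_dvd h2 with h | h
    · have := aux τ1 hτp ht1 (hnm1.trans he) h
      exact ⟨this.1, mem_union_left _ this.2⟩
    · have := aux (star τ1) hτsp (Prim_star ht1) (by rw [nm_star]; exact hnm1.trans he) h
      exact ⟨this.1, mem_union_right _ this.2⟩
  have hej := (key α0 hα0).1
  calc (PS (p ^ j)).card ≤ _ := card_le_card (fun α hα => (key α hα).2)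
    _ ≤ _ := card_union_le _ _
    _ ≤ 2 ^ (j - e) + 2 ^ (j - e) := add_le_add (card_image_le.trans (ih _ (by omega))) (card_image_le.trans (ih _ (by omega)))
    _ = 2 ^ (j - e + 1) := by ring
    _ ≤ 2 ^ j := Nat.pow_le_pow_right (by norm_num) (by omega)

lemma PS_mul (m n : ℕ) (hm : 0 < m) (hn : 0 < n) (hmn : m.Coprime n) (F : GI → ℂ) : 
    ∑ γ ∈ PS (m * n), F γ = ∑ v ∈ PS m ×ˢ PS n, F (v.1 * v.2) := by
  symm
  refine Finset.sum_bij (fun v _ => v.1 * v.2) ?_ ?_ ?_ ?_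
  · rintro ⟨α, β⟩ h
    rw [mem_product, mem_PS, mem_PS] at h
    rw [mem_PS]
    simp only at h ⊢
    exact ⟨by rw [nm_mul, h.1.1, h.2.1], Prim_mul h.1.2 h.2.2⟩
  · rintro ⟨α, β⟩ h ⟨α', β'⟩ h' heq
    rw [mem_product, mem_PS, mem_PS] at h h'
    simp only at h h' heq
    have hne : α' ≠ 0 := by
      intro h0; rw [h0] at h'; have := (h'.1.2).2; simp at this
    have hdv : α ∣ α' := by
      have hcop : IsCoprime α β' := by
        have : IsCoprime ((m : ℤ)) (n : ℤ) := Nat.isCoprime_iff_coprime.mpr hmn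
        obtain ⟨x, y, hxy⟩ := this
        refine ⟨(x : GI) * star α, (y : GI) * star β', ?_⟩
        rw [mul_assoc, mul_assoc, mul_comm (star α), mul_comm (star β'), mul_star_nm, mul_star_nm, h.1.1, h'.2.1]
        have := congrArg (fun z : ℤ => (z : GI)) hxy
        push_cast at this
        exact this
      exact hcop.dvd_of_dvd_mul_right (heq ▸ Dvd.intro _ rfl)
    have hα : α = α' := by
      obtain ⟨u, hu⟩ := hdv
      have : nm α' = nm α * nm u := by rw [hu, nm_mul]
      rw [h.1.1, h'.1.1] at this
      have hu1 : nm u = 1 := by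
        have : m * 1 = m * nm u := by omega
        exact (Nat.eq_of_mul_eq_mul_left hm this).symm
      have huu := (nm_eq_one_unit u).mp hu1
      apply Prim_assoc h.1.2 h'.1.2
      rw [hu]; exact associated_mul_unit_right _ _ huu
    subst hα
    have := mul_left_cancel₀ hne heq
    rw [this]
  · intro γ hγ
    rw [mem_PS] at hγ
    have hd : γ ∣ (m : GI) * (n : GI) := by
      have := mul_star_nm γ
      rw [hγ.1, Nat.cast_mul] at this
      rw [← this]; exact Dvd.intro _ rfl
    obtain ⟨a, b, ha, hb, rfl⟩ := exists_dvd_and_dvd_of_dvd_mul hd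
    have hab := hγ.1
    rw [nm_mul] at hab
    have h1 := nm_dvd ha
    have h2 := nm_dvd hb
    rw [nm_natCast] at h1 h2
    have c1 : (nm a).Coprime n := Nat.Coprime.coprime_dvd_left h1 (hmn.pow_left 2)
    have c2 : (nm b).Coprime m := Nat.Coprime.coprime_dvd_left h2 (hmn.symm.pow_left 2)
    have d1 : nm a ∣ m := c1.dvd_of_dvd_mul_right (hab ▸ Dvd.intro _ rfl)
    have d1' : m ∣ nm a := c2.symm.dvd_of_dvd_mul_right (hab ▸ Dvd.intro _ rfl)
    have ea : nm a = m := Nat.dvd_antisymm d1 d1'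
    have eb : nm b = n := by
      rw [ea] at hab
      exact Nat.eq_of_mul_eq_mul_left hm hab
    have hodd : nm a % 2 = 1 := by
      have := Prim_nm hγ.2
      rw [nm_mul] at this
      have ho : Odd (nm a * nm b) := Nat.odd_iff.mpr (by omega)
      exact Nat.odd_iff.mp (Nat.odd_mul.mp ho).1
    obtain ⟨a', ha', u, hu⟩ := Prim_exists hodd
    have hprod : a * b = a' * ((↑u⁻¹ : GI) * b) := by
      rw [← hu]
      calc a * b = a * ((u : GI) * (↑u⁻¹ : GI)) * b := by simp
        _ = _ := by ring
    refine ⟨(a', (↑u⁻¹ : GI) * b), ?_, hprod.symm⟩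
    rw [mem_product, mem_PS, mem_PS]
    refine ⟨⟨?_, ha'⟩, ⟨?_, ?_⟩⟩
    · rw [← hu, nm_mul, (nm_eq_one_unit _).mpr u.isUnit, mul_one, ea]
    · rw [nm_mul, (nm_eq_one_unit _).mpr u⁻¹.isUnit, one_mul, eb]
    · apply Prim_of_mul ha'
      rw [← hprod]; exact hγ.2
  · intro v _; rfl

structure GChar (ξ : GI → ℂ) (M : ℕ) : Prop where
  hM : 0 < M
  h6 : 6 ∣ M
  per : ∀ α β : GI, ξ (α + (M : GI) * β) = ξ α
  one : ξ 1 = 1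
  mul : ∀ α β, Prim α → Prim β → ξ (α * β) = ξ α * ξ β
  supp : ∀ α, ξ α ≠ 0 → Prim α ∧ (nm α).Coprime M
  unit : ∀ α, Prim α → (nm α).Coprime M → ‖ξ α‖ = 1

/-- coefficients of the associated Dirichlet series -/
noncomputable def cf (ξ : GI → ℂ) (n : ℕ) : ℂ := ∑ α ∈ PS n, ξ α

lemma GChar.bd {ξ : GI → ℂ} {M : ℕ} (h : GChar ξ M) (α : GI) : ‖ξ α‖ ≤ 1 := by
  by_cases h0 : ξ α = 0
  · rw [h0]; simp
  · obtain ⟨h1, h2⟩ := h.supp α h0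
    exact (h.unit α h1 h2).le

lemma GChar.mul' {ξ : GI → ℂ} {M : ℕ} (h : GChar ξ M) (α β : GI) (ha : Prim α) : ξ (α * β) = ξ α * ξ β := by
  by_cases hb : Prim β
  · exact h.mul α β ha hb
  · have h1 : ξ β = 0 := by
      by_contra h0; exact hb (h.supp β h0).1
    have h2 : ξ (α * β) = 0 := by
      by_contra h0; exact hb (Prim_of_mul ha (h.supp _ h0).1)
    rw [h1, h2, mul_zero]

lemma sum_Dk (F : GI → ℂ) (hF : ∀ α, ¬ Prim α → F α = 0) (N : ℕ) : 
    ∑ n ∈ Icc 1 N, ∑ α ∈ PS n, F α = ∑ v ∈ Dk N, F ⟨v.1, v.2⟩ := by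
  rw [← sum_biUnion]
  · symm
    rw [← sum_image (s := Dk N) (g := fun v => (⟨v.1, v.2⟩ : GI)) (f := F)]
    · symm
      apply sum_subset
      · intro α hα
        rw [mem_biUnion] at hα
        obtain ⟨n, hn, hα⟩ := hα
        rw [mem_PS] at hα
        rw [mem_image]
        refine ⟨(α.re, α.im), ?_, rfl⟩
        rw [mem_Dk]
        have := nm_cast α
        simp only
        rw [← this, hα.1]
        exact_mod_cast (mem_Icc.mp hn).2
      · intro α hα hα'
        apply hF
        intro hP
        apply hα'
        rw [mem_image] at hα
        obtain ⟨v, hv, rfl⟩ := hα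
        rw [mem_Dk] at hv
        rw [mem_biUnion]
        refine ⟨nm ⟨v.1, v.2⟩, ?_, ?_⟩
        · rw [mem_Icc]
          constructor
          · have := Prim_nm hP; omega
          · have := nm_cast ⟨v.1, v.2⟩
            simp only at this
            rw [← this] at hv; exact_mod_cast hv
        · rw [mem_PS]; exact ⟨rfl, hP⟩
    · rintro ⟨a, b⟩ _ ⟨c, d⟩ _ h
      simpa [Zsqrtd.ext_iff] using h
  · intro m _ n _ hmn
    rw [Function.onFun, Finset.disjoint_left]
    intro α h1 h2
    rw [mem_PS] at h1 h2
    exact hmn (h1.1.symm.trans h2.1)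

lemma PS_one : PS 1 = {1} := by
  ext α
  rw [mem_PS, mem_singleton]
  constructor
  · rintro ⟨h1, h2⟩; exact Prim_unit ((nm_eq_one_unit α).mp h1) h2
  · rintro rfl; exact ⟨nm_one, Prim_one⟩

lemma PS_zero : PS 0 = ∅ := by
  ext α
  rw [mem_PS]
  simp only [notMem_empty, iff_false, not_and]
  intro h hP
  have := Prim_nm hP
  omega

lemma cnt_aux (N : ℕ) : ∑ n ∈ Icc 1 N, ((PS n).card : ℝ) ≤ 9 * N := by
  rcases Nat.eq_zero_or_pos N with rfl | hN
  · simp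
  have h := sum_Dk (fun α => if Prim α then 1 else 0) (fun α h => if_neg h) N
  have e : ∀ n, ∑ α ∈ PS n, (if Prim α then (1:ℂ) else 0) = ((PS n).card : ℂ) := by
    intro n
    rw [sum_congr rfl (g := fun _ => (1:ℂ))]
    · simp
    · intro α hα; rw [if_pos ((mem_PS n α).mp hα).2]
  simp_rw [e] at h
  have h2 : ‖∑ n ∈ Icc 1 N, ((PS n).card : ℂ)‖ ≤ (Dk N).card := by
    rw [h]
    refine (norm_sum_le_of_le (f := fun v : ℤ × ℤ => if Prim ⟨v.1, v.2⟩ then (1:ℂ) else 0) (n := fun _ => 1) _ fun v _ => ?_).trans (by simp)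
    split_ifs <;> simp
  have h3 : ∑ n ∈ Icc 1 N, ((PS n).card : ℂ) = ((∑ n ∈ Icc 1 N, (PS n).card : ℕ) : ℂ) := by push_cast; rfl
  rw [h3, Complex.norm_natCast] at h2
  have := h2.trans (Dk_card N hN)
  push_cast at this; exact this

lemma GChar.base {ξ : GI → ℂ} {M : ℕ} (h : GChar ξ M) : BaseF (cf ξ) where
  zero := by simp [cf, PS_zero]
  one := by simp [cf, PS_one, h.one]
  mult := by
    intro m n hmn
    rcases Nat.eq_zero_or_pos m with rfl | hm
    · simp [cf, PS_zero]
    rcases Nat.eq_zero_or_pos n with rfl | hn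
    · simp [cf, PS_zero]
    unfold cf
    rw [PS_mul m n hm hn hmn, sum_product, sum_mul_sum]
    refine sum_congr rfl fun α hα => sum_congr rfl fun β hβ => ?_
    exact h.mul α β ((mem_PS _ _).mp hα).2 ((mem_PS _ _).mp hβ).2
  van := by
    intro n hn
    apply sum_eq_zero
    intro α hα
    by_contra h0
    apply hn
    have := (h.supp α h0).2
    rw [((mem_PS _ _).mp hα).1] at this
    exact this.coprime_dvd_right h.h6
  pow := by
    intro p j hp
    calc ‖cf ξ (p ^ j)‖ ≤ ∑ α ∈ PS (p ^ j), (1:ℝ) := norm_sum_le_of_le _ fun α _ => h.bd α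
      _ = (PS (p ^ j)).card := by simp
      _ ≤ 2 ^ j := by exact_mod_cast PS_pow_card p hp j
  cnt := by
    intro N
    refine (sum_le_sum fun n _ => ?_).trans (cnt_aux N)
    calc ‖cf ξ n‖ ≤ ∑ α ∈ PS n, (1:ℝ) := norm_sum_le_of_le _ fun α _ => h.bd α
      _ = (PS n).card := by simp

lemma GChar.per1 {ξ : GI → ℂ} {M : ℕ} (h : GChar ξ M) (a b c d : ℤ) (h1 : (a : ZMod M) = c) (h2 : (b : ZMod M) = d) : 
    ξ ⟨a, b⟩ = ξ ⟨c, d⟩ := by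
  rw [ZMod.intCast_eq_intCast_iff_dvd_sub] at h1 h2
  obtain ⟨x, hx⟩ := h1
  obtain ⟨y, hy⟩ := h2
  rw [← h.per ⟨a, b⟩ ⟨x, y⟩]
  congr 1
  rw [Zsqrtd.ext_iff]
  simp [Zsqrtd.re_mul, Zsqrtd.im_mul]
  constructor <;> linarith

lemma GChar.box {ξ : GI → ℂ} {M : ℕ} (h : GChar ξ M) (α : GI) (ha : Prim α) (hc : (nm α).Coprime M) (h1 : ξ α ≠ 1) : 
    ∑ r ∈ range M, ∑ t ∈ range M, ξ ⟨r, t⟩ = 0 := by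
  haveI : NeZero M := ⟨h.hM.ne'⟩
  set G : ZMod M × ZMod M → ℂ := fun x => ξ ⟨(x.1.val : ℤ), (x.2.val : ℤ)⟩ with hG
  have hGv : ∀ a b : ℤ, G ((a : ZMod M), (b : ZMod M)) = ξ ⟨a, b⟩ := by
    intro a b
    simp only [hG]
    apply h.per1 <;> simp
  have e1 : ∑ r ∈ range M, ∑ t ∈ range M, ξ ⟨r, t⟩ = ∑ x : ZMod M × ZMod M, G x := by
    rw [← sum_product']
    refine sum_nbij' (fun v => ((v.1 : ZMod M), (v.2 : ZMod M))) (fun x => (x.1.val, x.2.val)) ?_ ?_ ?_ ?_ ?_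
    · simp
    · rintro ⟨x, y⟩ _; simp [ZMod.val_lt]
    · rintro ⟨a, b⟩ hv; simp at hv; simp [ZMod.val_cast_of_lt hv.1, ZMod.val_cast_of_lt hv.2]
    · rintro ⟨x, y⟩ _; simp
    · rintro ⟨a, b⟩ _; have := hGv a b; push_cast at this; simp [this]
  set T : ZMod M × ZMod M → ZMod M × ZMod M := fun x => 
    ((α.re : ZMod M) * x.1 - α.im * x.2, (α.re : ZMod M) * x.2 + α.im * x.1) with hT
  have hinj : Function.Injective T := by
    have hu : IsUnit ((nm α : ℕ) : ZMod M) := (ZMod.isUnit_iff_coprime _ _).mpr hc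
    have hn : ((nm α : ℕ) : ZMod M) = (α.re : ZMod M) ^ 2 + (α.im : ZMod M) ^ 2 := by
      have := congrArg (fun z : ℤ => (z : ZMod M)) (nm_cast α)
      push_cast at this; exact this
    rintro ⟨x, y⟩ ⟨x', y'⟩ hxy
    simp only [hT, Prod.mk.injEq] at hxy
    obtain ⟨q1, q2⟩ := hxy
    have r1 : ((nm α : ℕ) : ZMod M) * x = ((nm α : ℕ) : ZMod M) * x' := by
      rw [hn]; linear_combination (α.re : ZMod M) * q1 + (α.im : ZMod M) * q2
    have r2 : ((nm α : ℕ) : ZMod M) * y = ((nm α : ℕ) : ZMod M) * y' := by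
      rw [hn]; linear_combination (α.re : ZMod M) * q2 - (α.im : ZMod M) * q1
    rw [hu.mul_left_cancel r1, hu.mul_left_cancel r2]
  have hbij : Function.Bijective T := Finite.injective_iff_bijective.mp hinj
  have hTG : ∀ x, G (T x) = ξ α * G x := by
    rintro ⟨x, y⟩
    have e : T (x, y) = (((α.re * x.val - α.im * y.val : ℤ) : ZMod M), ((α.re * y.val + α.im * x.val : ℤ) : ZMod M)) := by
      simp [hT]
    rw [e, hGv]
    simp only [hG]
    rw [← h.mul' _ _ ha]
    congr 1
    rw [Zsqrtd.ext_iff]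
    simp [Zsqrtd.re_mul, Zsqrtd.im_mul]
    ring
  have e2 : ∑ x, G (T x) = ∑ x, G x := hbij.sum_comp G
  simp_rw [hTG, ← mul_sum] at e2
  rw [e1]
  have : (ξ α - 1) * ∑ x, G x = 0 := by rw [sub_mul, e2]; ring
  rcases mul_eq_zero.mp this with h0 | h0
  · exact absurd (sub_eq_zero.mp h0) h1
  · exact h0

def NonTriv (ξ : GI → ℂ) (M : ℕ) : Prop := ∃ α, Prim α ∧ (nm α).Coprime M ∧ ξ α ≠ 1

lemma GChar.good {ξ : GI → ℂ} {M : ℕ} (h : GChar ξ M) (hn : NonTriv ξ M) : GoodF (cf ξ) (12 * M) where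
  toBaseF := h.base
  hK := by
    have : (1:ℝ) ≤ M := by exact_mod_cast h.hM
    linarith
  canc := by
    intro N
    rcases Nat.eq_zero_or_pos N with rfl | hN
    · simp
    unfold cf
    rw [sum_Dk ξ (fun α hα => by by_contra h0; exact hα (h.supp α h0).1)]
    obtain ⟨α, ha, hc, h1⟩ := hn
    refine lattice_canc N M hN h.hM (fun a b => ξ ⟨a, b⟩) (fun a b => h.bd _) ?_ ?_ (h.box α ha hc h1)
    · intro a b; apply h.per1 <;> simp
    · intro a b; apply h.per1 <;> simp

lemma GChar.mulchar {ξ η : GI → ℂ} {M M' : ℕ} (h : GChar ξ M) (h' : GChar η M') : 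
    GChar (fun α => ξ α * η α) (M * M') where
  hM := Nat.mul_pos h.hM h'.hM
  h6 := h.h6.mul_right _
  per := by
    intro α β
    have e1 : α + ((M * M' : ℕ) : GI) * β = α + (M : GI) * (M' * β) := by push_cast; ring
    have e2 : α + ((M * M' : ℕ) : GI) * β = α + (M' : GI) * (M * β) := by push_cast; ring
    nth_rewrite 1 [e1]
    rw [e2, h.per, h'.per]
  one := by simp [h.one, h'.one]
  mul := by intro α β ha hb; rw [h.mul α β ha hb, h'.mul α β ha hb]; ring
  supp := by
    intro α h0
    have h1 := h.supp α (left_ne_zero_of_mul h0)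
    have h2 := h'.supp α (right_ne_zero_of_mul h0)
    exact ⟨h1.1, Nat.Coprime.mul_right h1.2 h2.2⟩
  unit := by
    intro α ha hc
    rw [norm_mul, h.unit α ha hc.coprime_mul_right_right, h'.unit α ha hc.coprime_mul_left_right, one_mul]

lemma GChar.conj {ξ : GI → ℂ} {M : ℕ} (h : GChar ξ M) : GChar (fun α => (starRingEnd ℂ) (ξ α)) M where
  hM := h.hM
  h6 := h.h6
  per := by intro α β; rw [h.per]
  one := by simp [h.one]
  mul := by intro α β ha hb; rw [h.mul α β ha hb, map_mul]
  supp := by intro α h0; exact h.supp α (by simpa using h0)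
  unit := by intro α ha hc; rw [RCLike.norm_conj]; exact h.unit α ha hc

def II : GI := ⟨0, 1⟩

lemma II_sq : II * II = -1 := by decide

def isV (u : GI) : Prop := u = 0 ∨ u = 1 ∨ u = -1 ∨ u = II ∨ u = -II

lemma isV_pow {u : GI} (h : isV u) : u ^ 5 = u := by
  rcases h with rfl | rfl | rfl | rfl | rfl <;> decide

lemma isV_mul {u v : GI} (h : isV u) (h' : isV v) : isV (u * v) := by
  have h2 := II_sq
  rcases h with rfl | rfl | rfl | rfl | rfl <;> rcases h' with rfl | rfl | rfl | rfl | rfl <;>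
    simp [isV, h2]

lemma isV_of_pow_four {u : GI} (h : u ^ 4 = 1) : isV u := by
  have hu : IsUnit u := IsUnit.of_pow_eq_one h (by norm_num)
  rcases unit_cases u hu with h | h | h | h
  · right; left; exact h
  · right; right; left; exact h
  · right; right; right; left; exact h
  · right; right; right; right; rw [h]; decide

lemma isV_nm_sub {u v : GI} (h : isV u) (h' : isV v) (hne : u ≠ v) : nm (u - v) ∣ 4 := by
  rcases h with rfl | rfl | rfl | rfl | rfl <;> rcases h' with rfl | rfl | rfl | rfl | rfl <;>
    first | exact absurd rfl hne | decide

/-- a ring hom to a field of odd characteristic is injective on `V` -/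
lemma isV_inj {R : Type*} [Field R] (h2 : (2:R) ≠ 0) (θ : GI →+* R) {u v : GI} (hu : isV u) (hv : isV v) (h : θ u = θ v) : u = v := by
  by_contra hne
  obtain ⟨c, hc⟩ := isV_nm_sub hu hv hne
  have h1 : θ ((u - v) * star (u - v)) = 0 := by rw [map_mul, map_sub, h]; simp
  rw [mul_star_nm, map_natCast] at h1
  have : ((4:ℕ) : R) = 0 := by rw [hc]; push_cast; rw [h1]; simp
  apply h2
  have h4 : (2:R) * 2 = 0 := by push_cast at this; rw [← this]; norm_num
  exact mul_self_eq_zero.mp h4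

lemma isV_of_theta {R : Type*} [Field R] (θ : GI →+* R) {x : R} (hx : x ^ 5 = x) : ∃ u, isV u ∧ θ u = x := by
  have hI : θ II * θ II = -1 := by rw [← map_mul, II_sq]; simp
  have : x * (x - 1) * (x + 1) * ((x - θ II) * (x + θ II)) = 0 := by
    have e : (x - θ II) * (x + θ II) = x ^ 2 + 1 := by linear_combination -hI
    rw [e]
    linear_combination hx
  rcases mul_eq_zero.mp this with h | h
  · rcases mul_eq_zero.mp h with h | h
    · rcases mul_eq_zero.mp h with h | h
      · exact ⟨0, Or.inl rfl, by simp [h]⟩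
      · exact ⟨1, Or.inr (Or.inl rfl), by simp; linear_combination -h⟩
    · exact ⟨-1, Or.inr (Or.inr (Or.inl rfl)), by simp; linear_combination -h⟩
  · rcases mul_eq_zero.mp h with h | h
    · exact ⟨II, by simp [isV], by linear_combination -h⟩
    · exact ⟨-II, by simp [isV], by simp; linear_combination -h⟩

section chi
variable {p : ℕ} [hp : Fact p.Prime] {χ : MulChar (ZMod p) GI}

lemma chi_pow (hχ : orderOf χ = 4) : χ ^ 4 = 1 := by rw [← hχ]; exact pow_orderOf_eq_one χ

lemma chi_pow_four (hχ : orderOf χ = 4) {x : ZMod p} (hx : x ≠ 0) : χ x ^ 4 = 1 := by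
  have := congrArg (fun f : MulChar (ZMod p) GI => f x) (chi_pow hχ)
  rw [MulChar.pow_apply' _ (by norm_num), MulChar.one_apply (Ne.isUnit hx)] at this
  exact this

lemma chi_V (hχ : orderOf χ = 4) (x : ZMod p) : isV (χ x) := by
  by_cases hx : x = 0
  · left; rw [hx]; exact MulChar.map_zero χ
  · exact isV_of_pow_four (chi_pow_four hχ hx)

lemma chi_gen (hχ : orderOf χ = 4) : ∃ g : (ZMod p)ˣ, (∀ x, x ∈ Subgroup.zpowers g) ∧ χ g ^ 2 = -1 := by
  obtain ⟨g, hg⟩ := IsCyclic.exists_generator (α := (ZMod p)ˣ)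
  refine ⟨g, hg, ?_⟩
  have h4 := chi_pow_four hχ (g.ne_zero)
  have hne : χ g ^ 2 ≠ 1 := by
    intro h
    have : χ ^ 2 = 1 := by
      rw [MulChar.eq_one_iff]
      intro a
      obtain ⟨n, rfl⟩ := Subgroup.mem_zpowers_iff.mp (hg a)
      rw [MulChar.pow_apply' _ (by norm_num)]
      have h1 : (Units.map (χ : ZMod p →* GI) (g ^ n)) ^ 2 = 1 := by
        rw [map_zpow, ← zpow_natCast, ← zpow_mul, mul_comm, zpow_mul]
        have : (Units.map (χ : ZMod p →* GI) g) ^ ((2:ℕ):ℤ) = 1 := by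
          rw [zpow_natCast, Units.ext_iff]; simpa using h
        rw [this, one_zpow]
      have := congrArg (fun u : GIˣ => (u : GI)) h1
      rw [Units.val_pow_eq_pow_val, Units.coe_map] at this
      exact this
    have := orderOf_dvd_of_pow_eq_one this
    rw [hχ] at this
    omega
  have : (χ g ^ 2 - 1) * (χ g ^ 2 + 1) = 0 := by linear_combination h4
  rcases mul_eq_zero.mp this with h | h
  · exact absurd (sub_eq_zero.mp h) hne
  · exact eq_neg_of_add_eq_zero_left h

lemma chi_star (hχ : orderOf χ = 4) : χ.ringHomComp (starRingEnd GI) = χ⁻¹ := by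
  symm
  rw [inv_eq_iff_mul_eq_one]
  apply MulChar.ext
  intro a
  rw [MulChar.mul_apply, MulChar.ringHomComp_apply, MulChar.one_apply_coe, starRingEnd_apply, mul_star_nm]
  have := chi_pow_four hχ a.ne_zero
  have h1 : nm (χ a) ^ 4 = 1 := by
    have := congrArg nm this
    rw [nm_one] at this
    rw [← this]
    simp [pow_succ, nm_mul]
  rw [(Nat.pow_eq_one.mp h1).resolve_right (by norm_num)]; simp

lemma jac_star (hχ : orderOf χ = 4) : star (jacobiSum χ χ) = jacobiSum χ⁻¹ χ⁻¹ := by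
  rw [← chi_star hχ, jacobiSum_ringHomComp]; rfl

lemma chi_sq_ne (hχ : orderOf χ = 4) : χ * χ ≠ 1 := by
  intro h
  rw [← pow_two] at h
  have := orderOf_dvd_of_pow_eq_one h
  rw [hχ] at this; omega

lemma chi_ne (hχ : orderOf χ = 4) : χ ≠ 1 := by
  intro h; rw [h] at hχ; simp at hχ

lemma jac_nm (hχ : orderOf χ = 4) : nm (jacobiSum χ χ) = p := by
  have hinj : Function.Injective (fun χ : MulChar (ZMod p) GI => χ.ringHomComp GaussianInt.toComplex) := by
    apply MulChar.injective_ringHomComp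
    exact GaussianInt.toComplex_injective
  have h1 : χ.ringHomComp GaussianInt.toComplex ≠ 1 := by
    intro h
    apply chi_ne hχ
    apply hinj
    simp only [h]; symm; exact MulChar.ringHomComp_one _
  have h2 : χ.ringHomComp GaussianInt.toComplex * χ.ringHomComp GaussianInt.toComplex ≠ 1 := by
    intro h
    apply chi_sq_ne hχ
    apply hinj
    simp only [MulChar.ringHomComp_mul]
    rw [h, MulChar.ringHomComp_one]
  have := jacobiSum_mul_jacobiSum_inv (F := ZMod p) (F' := ℂ) (by
    rw [ZMod.ringChar_zmod_n, ringChar.eq_zero]; exact hp.1.ne_zero.symm) h1 h1 h2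
  rw [MulChar.ringHomComp_inv, jacobiSum_ringHomComp, jacobiSum_ringHomComp, ← map_mul, ← jac_star hχ, mul_star_nm, ZMod.card, map_natCast] at this
  exact_mod_cast this

lemma II_prim : IsPrimitiveRoot II 4 := by
  refine IsPrimitiveRoot.mk_of_lt II (by norm_num) (by decide) ?_
  intro l h1 h2
  interval_cases l <;> decide

def OddG (α : GI) : Prop := α.re % 2 = 1 ∧ α.im % 2 = 0

lemma jac_odd (hχ : orderOf χ = 4) (h4 : p % 4 = 1) : OddG (jacobiSum χ χ) := by
  obtain ⟨z, -, hz⟩ := exists_jacobiSum_eq_neg_one_add (F := ZMod p) (n := 4) (by norm_num) (chi_pow hχ) (chi_pow hχ)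
    (by rw [ZMod.card]; omega) II_prim
  rw [hz]
  have : (II - 1) ^ 2 = ⟨0, -2⟩ := by decide
  rw [this]
  constructor
  · simp [Zsqrtd.re_mul]
  · simp [Zsqrtd.im_mul]
end chi

structure QR (k : ℤ) (m : ℕ) (ψ : GI → GI) : Prop where
  per : ∀ α β, ψ (α + (m : GI) * β) = ψ α
  mul : ∀ α β, OddG α → OddG β → ψ (α * β) = ψ α * ψ β
  neg : ∀ α, OddG α → ψ (-α) = ψ α
  V : ∀ α, OddG α → isV (ψ α)
  sq : ∀ α, OddG α → ψ α ^ 2 = ((jacobiSym k (nm α) : ℤ) : GI)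
  recip : ∀ (p : ℕ) [Fact p.Prime], p % 4 = 1 → ∀ χ : MulChar (ZMod p) GI, orderOf χ = 4 →
    ψ (jacobiSum χ χ) = χ (k : ZMod p)

lemma OddG_nm {α : GI} (h : OddG α) : nm α % 4 = 1 := by
  obtain ⟨h1, h2⟩ := h
  have h := nm_cast α
  obtain ⟨x, hx⟩ : ∃ x, α.im = 2 * x := ⟨α.im / 2, by omega⟩
  obtain ⟨u, hu⟩ : ∃ u, α.re = 2 * u + 1 := ⟨α.re / 2, by omega⟩
  have : (nm α : ℤ) = 4 * (u ^ 2 + u + x ^ 2) + 1 := by rw [h, hx, hu]; ring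
  omega

lemma OddG_of_Prim {α : GI} (h : Prim α) : OddG α := by
  obtain ⟨h1, h2⟩ := h
  exact ⟨by omega, h1⟩

lemma QR_mul {k k' : ℤ} {m m' M : ℕ} {ψ ψ' : GI → GI} (h : QR k m ψ) (h' : QR k' m' ψ') (hm : m ∣ M) (hm' : m' ∣ M) :
    QR (k * k') M (fun α => ψ α * ψ' α) where
  per := by
    intro α β
    have e : ψ (α + (M : GI) * β) = ψ α := by
      obtain ⟨c, rfl⟩ := hm
      rw [show ((m * c : ℕ) : GI) * β = (m : GI) * (c * β) by push_cast; ring, h.per]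
    have e' : ψ' (α + (M : GI) * β) = ψ' α := by
      obtain ⟨c, rfl⟩ := hm'
      rw [show ((m' * c : ℕ) : GI) * β = (m' : GI) * (c * β) by push_cast; ring, h'.per]
    rw [e, e']
  mul := by intro α β ha hb; rw [h.mul _ _ ha hb, h'.mul _ _ ha hb]; ring
  neg := by intro α ha; rw [h.neg _ ha, h'.neg _ ha]
  V := fun α ha => isV_mul (h.V α ha) (h'.V α ha)
  sq := by intro α ha; rw [mul_pow, h.sq α ha, h'.sq α ha, jacobiSym.mul_left]; push_cast; rfl
  recip := by intro p _ h4 χ hχ; rw [h.recip p h4 χ hχ, h'.recip p h4 χ hχ]; push_cast; rw [map_mul]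

lemma isV_jac (k : ℤ) (n : ℕ) : isV ((jacobiSym k n : ℤ) : GI) := by
  rcases jacobiSym.trichotomy k n with h | h | h <;> rw [h] <;> simp [isV]

lemma isV_pow2 {u : GI} (h : isV u) (n : ℕ) : isV (u ^ n) := by
  induction n with
  | zero => simp [isV]
  | succ n ih => rw [pow_succ]; exact isV_mul ih h

lemma QR_ofE {R : Type*} [Field R] (h2 : (2:R) ≠ 0) (θ : GI →+* R) (q : ℕ) (hq : (q : R) = 0) (k : ℤ) (E : GI → R)
    (hmul : ∀ α β, E (α * β) = E α * E β) (hper : ∀ α β, θ α = θ β → θ (star α) = θ (star β) → E α = E β)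
    (hneg : E (-1) = 1) (h5 : ∀ α, E α ^ 5 = E α) (hsq : ∀ α, OddG α → E α ^ 2 = ((jacobiSym k (nm α) : ℤ) : R))
    (hrec : ∀ (p : ℕ) [Fact p.Prime], p % 4 = 1 → ∀ χ : MulChar (ZMod p) GI, orderOf χ = 4 →
      E (jacobiSum χ χ) = θ (χ (k : ZMod p))) : ∃ ψ, QR k q ψ := by
  have hc : ∀ α, ∃ u, isV u ∧ θ u = E α := fun α => isV_of_theta θ (h5 α)
  choose ψ hV hψ using hc
  refine ⟨ψ, ?_, ?_, ?_, fun α _ => hV α, ?_, ?_⟩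
  · intro α β
    apply isV_inj h2 θ (hV _) (hV _)
    rw [hψ, hψ]
    apply hper
    · simp [hq]
    · simp [hq]
  · intro α β _ _
    apply isV_inj h2 θ (hV _) (isV_mul (hV _) (hV _))
    rw [hψ, map_mul, hψ, hψ, hmul]
  · intro α _
    apply isV_inj h2 θ (hV _) (hV _)
    rw [hψ, hψ, ← neg_one_mul, hmul, hneg, one_mul]
  · intro α ha
    apply isV_inj h2 θ (isV_pow2 (hV _) 2) (isV_jac _ _)
    rw [map_pow, hψ, hsq α ha, map_intCast]
  · intro p _ h4 χ hχ
    apply isV_inj h2 θ (hV _) (chi_V hχ _)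
    rw [hψ, hrec p h4 χ hχ]

section gauss
variable {p : ℕ} [hp : Fact p.Prime] {χ : MulChar (ZMod p) GI} {R : Type*} [Field R]

/-- data: g^4 -/
lemma gauss4 (hχ : orderOf χ = 4) (h4 : p % 4 = 1) (h2 : (2:R) ≠ 0) (θ : GI →+* R) (e : AddChar (ZMod p) R) (he : e.IsPrimitive) :
    gaussSum (χ.ringHomComp θ) e ^ 4 = θ (jacobiSum χ χ) ^ 2 * p ∧ χ.ringHomComp θ ≠ 1 := by
  obtain ⟨g, -, hg2⟩ := chi_gen hχ
  have hsqne : χ.ringHomComp θ * χ.ringHomComp θ ≠ 1 := by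
    intro h
    have := congrArg (fun f : MulChar (ZMod p) R => f g) h
    simp only [MulChar.mul_apply, MulChar.ringHomComp_apply, MulChar.one_apply_coe] at this
    rw [← map_mul, ← pow_two, hg2] at this
    apply h2
    simp at this
    linear_combination -this
  have hne : χ.ringHomComp θ ≠ 1 := by
    intro h; rw [h] at hsqne; simp at hsqne
  refine ⟨?_, hne⟩
  have h1 := jacobiSum_mul_nontrivial hsqne e
  rw [jacobiSum_ringHomComp] at h1
  have hq : (χ.ringHomComp θ * χ.ringHomComp θ).IsQuadratic := by
    intro a
    rw [MulChar.mul_apply, MulChar.ringHomComp_apply, ← map_mul]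
    have := chi_V hχ a
    rcases this with h | h | h | h | h <;> rw [h] <;> simp [II_sq]
  have h3 := gaussSum_sq hsqne hq he
  have hm1 : (χ.ringHomComp θ * χ.ringHomComp θ) (-1) = 1 := by
    rw [MulChar.mul_apply, ← map_mul]; simp
  rw [hm1, ZMod.card, one_mul] at h3
  calc _ = (gaussSum (χ.ringHomComp θ) e * gaussSum (χ.ringHomComp θ) e) ^ 2 := by ring
    _ = _ := by rw [← h1, mul_pow, h3]; ring

end gauss

section gauss
variable {p : ℕ} [hp : Fact p.Prime] {χ : MulChar (ZMod p) GI} {R : Type*} [Field R]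
variable {q : ℕ} [hq : Fact q.Prime] [CharP R q]

lemma theta_p (hχ : orderOf χ = 4) (θ : GI →+* R) : θ (jacobiSum χ χ) * θ (star (jacobiSum χ χ)) = (p : R) := by
  rw [← map_mul, mul_star_nm, jac_nm hχ, map_natCast]

lemma comp_pow4 (hχ : orderOf χ = 4) (θ : GI →+* R) : (χ.ringHomComp θ) ^ 4 = 1 := by
  rw [MulChar.ringHomComp_pow, chi_pow hχ, MulChar.ringHomComp_one]

lemma p_ne (hpq : p ≠ q) : (p : R) ≠ 0 := by
  intro h
  have := (CharP.cast_eq_zero_iff R q p).mp h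
  exact hpq ((Nat.prime_dvd_prime_iff_eq hq.1 hp.1).mp this).symm

lemma q_ne (hpq : p ≠ q) : (q : ZMod p) ≠ 0 := by
  intro h
  have := (CharP.cast_eq_zero_iff (ZMod p) p q).mp h
  exact hpq ((Nat.prime_dvd_prime_iff_eq hp.1 hq.1).mp this)

lemma rec1 (hχ : orderOf χ = 4) (h4 : p % 4 = 1) (h2 : (2:R) ≠ 0) (θ : GI →+* R) (e : AddChar (ZMod p) R) (he : e.IsPrimitive)
    (hpq : p ≠ q) (hq4 : q % 4 = 1) :
    (θ (jacobiSum χ χ) * θ (star (jacobiSum χ χ)) ^ 3) ^ (q / 4) = θ (χ ((q : ℤ) : ZMod p)) := by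
  obtain ⟨hg4, hne⟩ := gauss4 hχ h4 h2 θ e he
  set g := gaussSum (χ.ringHomComp θ) e with hg
  obtain ⟨m, hm⟩ : ∃ m, q = 4 * m + 1 := ⟨q / 4, by omega⟩
  have hm' : q / 4 = m := by omega
  rw [hm']
  have hp0 := p_ne (R := R) hpq
  have hg0 : g ≠ 0 := gaussSum_ne_zero_of_nontrivial (by rwa [ZMod.card]) hne he
  have h1 : g ^ q = gaussSum (χ.ringHomComp θ) (e.mulShift (q : ZMod p)) := by
    rw [hg, gaussSum_frob, AddChar.pow_mulShift]
    congr 1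
    rw [hm, pow_succ, pow_mul, comp_pow4 hχ, one_pow, one_mul]
  obtain ⟨u, hu⟩ : ∃ u : (ZMod p)ˣ, (u : ZMod p) = q := ⟨Units.mk0 _ (q_ne hpq), rfl⟩
  have h3 := gaussSum_mulShift (χ.ringHomComp θ) e u
  rw [hu, ← h1, ← hg, MulChar.ringHomComp_apply] at h3
  have h5 : θ (χ (q : ZMod p)) * (θ (jacobiSum χ χ) ^ 2 * p) ^ m = 1 := by
    rw [← hg4, ← pow_mul]
    apply mul_right_cancel₀ hg0
    rw [one_mul, mul_assoc, ← pow_succ, ← hm, h3]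
  have h6 : (p : R) ^ (4 * m) = 1 := by
    apply mul_right_cancel₀ hp0
    rw [← pow_succ, ← hm, one_mul, ← frobenius_def, map_natCast]
  have htp := theta_p hχ θ
  set x := θ (jacobiSum χ χ)
  set y := θ (star (jacobiSum χ χ))
  rw [Int.cast_natCast]
  calc (x * y ^ 3) ^ m = (θ (χ (q : ZMod p)) * (x ^ 2 * p) ^ m) * (x * y ^ 3) ^ m := by rw [h5, one_mul]
    _ = θ (χ (q : ZMod p)) * ((x ^ 2 * p) * (x * y ^ 3)) ^ m := by rw [mul_pow]; ring
    _ = θ (χ (q : ZMod p)) * p ^ (4 * m) := by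
        rw [pow_mul]; congr 2; rw [← htp]; ring
    _ = _ := by rw [h6, mul_one]

lemma rec3 (hχ : orderOf χ = 4) (h4 : p % 4 = 1) (h2 : (2:R) ≠ 0) (θ : GI →+* R) (e : AddChar (ZMod p) R) (he : e.IsPrimitive)
    (hpq : p ≠ q) (hq4 : q % 4 = 3) (hfr : θ (star (jacobiSum χ χ)) = θ (jacobiSum χ χ) ^ q) :
    θ (jacobiSum χ χ) ^ ((q ^ 2 - 1) / 4) = θ (χ ((-q : ℤ) : ZMod p)) := by
  obtain ⟨hg4, hne⟩ := gauss4 hχ h4 h2 θ e he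
  set g := gaussSum (χ.ringHomComp θ) e with hg
  obtain ⟨m, hm⟩ : ∃ m, q = 4 * m + 3 := ⟨q / 4, by omega⟩
  have hm' : (q ^ 2 - 1) / 4 = (m + 1) * (4 * m + 2) := by
    rw [hm]
    have : (4 * m + 3) ^ 2 - 1 = 4 * ((m + 1) * (4 * m + 2)) := by
      rw [Nat.sub_eq_iff_eq_add (Nat.one_le_pow _ _ (by omega))]; ring
    rw [this]; simp
  rw [hm']
  have hp0 := p_ne (R := R) hpq
  have hg0 : g ≠ 0 := gaussSum_ne_zero_of_nontrivial (by rwa [ZMod.card]) hne he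
  have h1 : g ^ q = gaussSum ((χ.ringHomComp θ) ^ 3) (e.mulShift (q : ZMod p)) := by
    rw [hg, gaussSum_frob, AddChar.pow_mulShift]
    congr 1
    rw [hm, pow_add, pow_mul, comp_pow4 hχ, one_pow, one_mul]
  obtain ⟨u, hu⟩ : ∃ u : (ZMod p)ˣ, (u : ZMod p) = q := ⟨Units.mk0 _ (q_ne hpq), rfl⟩
  have h3 := gaussSum_mulShift ((χ.ringHomComp θ) ^ 3) e u
  rw [hu, ← h1, MulChar.pow_apply' _ (by norm_num), MulChar.ringHomComp_apply] at h3
  have hord : orderOf (χ.ringHomComp θ) = 4 := by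
    refine orderOf_eq_prime_pow (p := 2) (n := 1) ?_ ?_
    · obtain ⟨g, -, hg2⟩ := chi_gen hχ
      intro h
      have := congrArg (fun f : MulChar (ZMod p) R => f g) h
      simp only [pow_one, MulChar.pow_apply' _ (two_ne_zero), MulChar.ringHomComp_apply, MulChar.one_apply_coe] at this
      rw [← map_pow, hg2] at this
      apply h2
      simp at this
      linear_combination -this
    · exact comp_pow4 hχ θ
  have h7 := gaussSum_mul_gaussSum_pow_orderOf_sub_one hne he
  rw [hord, ZMod.card, show 4 - 1 = 3 from rfl, ← h3, ← hg, MulChar.ringHomComp_apply] at h7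
  have hc4 : θ (χ (q : ZMod p)) ^ 4 = 1 := by
    rw [← map_pow, chi_pow_four hχ (q_ne hpq), map_one]
  have h8 : g ^ (q + 1) = θ (χ (-(q:ZMod p))) * p := by
    have : χ (-(q:ZMod p)) = χ (-1) * χ q := by rw [← map_mul]; simp
    rw [this, map_mul]
    linear_combination θ (χ (q : ZMod p)) * h7 - g ^ (q+1) * hc4
  have h9 : q + 1 = 4 * (m + 1) := by omega
  rw [h9, pow_mul, hg4] at h8
  have htp := theta_p hχ θ
  rw [hfr, ← pow_succ', h9] at htp
  apply mul_right_cancel₀ hp0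
  push_cast
  rw [← h8, ← htp]
  ring
end gauss

lemma frob_theta {R : Type*} [Field R] {q : ℕ} [hq : Fact q.Prime] [CharP R q] (θ : GI →+* R) :
    (q % 4 = 1 → ∀ α, θ α ^ q = θ α) ∧ (q % 4 = 3 → ∀ α, θ α ^ q = θ (star α)) := by
  have hI : θ II * θ II = -1 := by rw [← map_mul, II_sq]; simp
  have hI2 : θ II ^ 2 = -1 := by rw [pow_two, hI]
  constructor
  · intro h4 α
    have : (frobenius R q).comp θ = θ := by
      apply Zsqrtd.hom_ext
      show θ II ^ q = θ II
      obtain ⟨m, hm⟩ : ∃ m, q = 4 * m + 1 := ⟨q / 4, by omega⟩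
      rw [hm, pow_succ, pow_mul, show 4 = 2 * 2 from rfl, pow_mul, hI2]; simp
    exact congrArg (fun f : GI →+* R => f α) this
  · intro h4 α
    have : (frobenius R q).comp θ = θ.comp (starRingEnd GI) := by
      apply Zsqrtd.hom_ext
      show θ II ^ q = θ (star II)
      obtain ⟨m, hm⟩ : ∃ m, q = 4 * m + 3 := ⟨q / 4, by omega⟩
      rw [hm, pow_add, pow_mul, show 4 = 2 * 2 from rfl, pow_mul, hI2,
        show star II = -II by decide, pow_succ (θ II) 2, hI2]
      simp
    exact congrArg (fun f : GI →+* R => f α) this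

lemma leg_pow {R : Type*} [Field R] {q : ℕ} [hq : Fact q.Prime] [CharP R q] (n : ℕ) :
    (n : R) ^ (q / 2) = ((jacobiSym n q : ℤ) : R) := by
  rw [← jacobiSym.legendreSym.to_jacobiSym]
  have := congrArg (ZMod.castHom (dvd_refl q) R) (legendreSym.eq_pow q n)
  rw [map_pow, map_intCast] at this
  simpa using this.symm

theorem QR_odd (q : ℕ) (hq : q.Prime) (hq2 : q ≠ 2) : 
    ∃ ψ, QR (if q % 4 = 1 then (q:ℤ) else -q) q ψ := by
  haveI : Fact q.Prime := ⟨hq⟩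
  set R := AlgebraicClosure (ZMod q)
  haveI : CharP R q := inferInstance
  have hodd : q % 2 = 1 := (hq.eq_two_or_odd).resolve_left hq2
  have h2 : (2:R) ≠ 0 := by
    intro h
    have := (CharP.cast_eq_zero_iff R q 2).mp (by exact_mod_cast h)
    exact hq2 ((Nat.prime_dvd_prime_iff_eq hq Nat.prime_two).mp this)
  obtain ⟨ι, hι⟩ := IsAlgClosed.exists_pow_nat_eq (-1 : R) (n := 2) (by norm_num)
  let θ : GI →+* R := Zsqrtd.lift ⟨ι, by rw [← pow_two, hι]; simp⟩
  have hq0 : (q : R) = 0 := CharP.cast_eq_zero R q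
  have hprim : ∀ (p : ℕ) [Fact p.Prime], p ≠ q → ∃ e : AddChar (ZMod p) R, e.IsPrimitive := by
    intro p hp hpq
    haveI : NeZero (p : R) := ⟨p_ne hpq⟩
    obtain ⟨ζ, hζ⟩ := HasEnoughRootsOfUnity.exists_primitiveRoot R p
    exact ⟨_, AddChar.zmodChar_primitive_of_primitive_root p hζ⟩
  have hf := frob_theta (q := q) θ
  have hthN : ∀ α, θ α * θ (star α) = (nm α : R) := by
    intro α; rw [← map_mul, mul_star_nm, map_natCast]
  by_cases h4 : q % 4 = 1
  · rw [if_pos h4]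
    have hf := hf.1 h4
    obtain ⟨m, hm⟩ : ∃ m, q = 4 * m + 1 := ⟨q / 4, by omega⟩
    have hm' : q / 4 = m := by omega
    have hm2 : q / 2 = 2 * m := by omega
    have hm0 : m ≠ 0 := by rintro rfl; rw [hm] at hq; exact Nat.not_prime_one hq
    refine QR_ofE h2 θ q hq0 q (fun α => (θ α * θ (star α) ^ 3) ^ (q / 4)) ?_ ?_ ?_ ?_ ?_ ?_
    · intro α β; simp only [star_mul', map_mul]; rw [← mul_pow]; congr 1; ring
    · intro α β h h'; simp only [h, h']
    · simp only [star_neg, star_one, map_neg, map_one]; norm_num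
    · intro α
      simp only [hm']
      have h1 : (θ α * θ (star α) ^ 3) ^ q = θ α * θ (star α) ^ 3 := by
        rw [mul_pow, ← pow_mul, mul_comm 3 q, pow_mul, hf, hf]
      set t := θ α * θ (star α) ^ 3
      calc (t ^ m) ^ 5 = t ^ q * t ^ (m - 1) := by
            rw [← pow_mul, ← pow_add]; congr 1; omega
        _ = t ^ m := by rw [h1, ← pow_succ']; congr 1; omega
    · intro α ha
      simp only [hm']
      rw [jacobiSym.quadratic_reciprocity_one_mod_four' (Nat.odd_iff.mpr hodd) (OddG_nm ha), ← leg_pow, hm2]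
      rw [← hthN]
      by_cases h0 : θ (star α) = 0
      · simp [h0, hm0]
      · have : θ (star α) ^ (4 * m) = 1 := by
          apply mul_right_cancel₀ h0
          rw [← pow_succ, ← hm, hf, one_mul]
        calc _ = θ α ^ (2 * m) * θ (star α) ^ (2 * m) * θ (star α) ^ (4 * m) := by ring
          _ = _ := by rw [this]; ring
    · intro p hp hp4 χ hχ
      by_cases hpq : p = q
      · subst hpq
        have := theta_p hχ θ
        rw [hq0] at this
        have e : θ (jacobiSum χ χ) * θ (star (jacobiSum χ χ)) ^ 3 = 0 := by
          rw [pow_succ', ← mul_assoc, this, zero_mul]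
        simp only [e, hm', zero_pow hm0]
        rw [Int.cast_natCast, CharP.cast_eq_zero, MulChar.map_zero, map_zero]
      · obtain ⟨e, he⟩ := hprim p hpq
        exact rec1 hχ hp4 h2 θ e he hpq h4
  · rw [if_neg h4]
    have h43 : q % 4 = 3 := by omega
    have hf := hf.2 h43
    obtain ⟨m, hm⟩ : ∃ m, q = 4 * m + 3 := ⟨q / 4, by omega⟩
    have hm' : (q ^ 2 - 1) / 4 = (m + 1) * (4 * m + 2) := by
      rw [hm]
      have : (4 * m + 3) ^ 2 - 1 = 4 * ((m + 1) * (4 * m + 2)) := by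
        rw [Nat.sub_eq_iff_eq_add (Nat.one_le_pow _ _ (by omega))]; ring
      rw [this]; simp
    have hq1 : q + 1 = 4 * (m + 1) := by omega
    refine QR_ofE h2 θ q hq0 (-q) (fun α => θ α ^ ((q ^ 2 - 1) / 4)) ?_ ?_ ?_ ?_ ?_ ?_
    · intro α β; simp only [map_mul]; rw [← mul_pow]
    · intro α β h h'; simp only [h]
    · simp only [map_neg, map_one, hm']
      rw [show (m + 1) * (4 * m + 2) = 2 * ((m+1) * (2 * m + 1)) by ring, pow_mul]; simp
    · intro α
      simp only [hm']
      have h1 : θ α ^ (4 * ((m + 1) * (4 * m + 2)) + 1) = θ α := by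
        have : 4 * ((m + 1) * (4 * m + 2)) + 1 = q * q := by rw [hm]; ring
        rw [this, pow_mul, hf, hf, star_star]
      set t := θ α
      set n := (m + 1) * (4 * m + 2) with hn
      have hn0 : n ≠ 0 := by positivity
      calc (t ^ n) ^ 5 = t ^ (4 * n + 1) * t ^ (n - 1) := by
            rw [← pow_mul, ← pow_add]; congr 1; omega
        _ = t ^ n := by rw [h1, ← pow_succ', Nat.sub_add_cancel (by omega)]
    · intro α ha
      simp only [hm']
      have hodd' : Odd (nm α) := by rw [Nat.odd_iff]; have := OddG_nm ha; omega
      rw [jacobiSym.neg _ hodd', ZMod.χ₄_nat_one_mod_four (OddG_nm ha), one_mul,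
        jacobiSym.quadratic_reciprocity_one_mod_four' (Nat.odd_iff.mpr hodd) (OddG_nm ha), ← leg_pow, ← hthN, ← hf,
        ← pow_succ', hq1, ← pow_mul, ← pow_mul]
      congr 1
      have : q / 2 = 2 * m + 1 := by omega
      rw [this]; ring
    · intro p hp hp4 χ hχ
      have hpq : p ≠ q := by rintro rfl; omega
      obtain ⟨e, he⟩ := hprim p hpq
      exact rec3 hχ hp4 h2 θ e he hpq h43 (hf _).symm

lemma nm_per (α β : GI) : ∃ c : ℤ, (nm (α + (16:ℕ) * β) : ℤ) = nm α + 32 * c := by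
  rw [nm_cast, nm_cast]
  simp
  exact ⟨α.re * β.re + 8 * β.re ^ 2 + α.im * β.im + 8 * β.im ^ 2, by ring⟩

lemma nm_per4 (α β : GI) : ∃ a b : ℕ, nm (α + (16:ℕ) * β) / 4 + 8 * a = nm α / 4 + 8 * b := by
  obtain ⟨c, hc⟩ := nm_per α β
  refine ⟨(-c).toNat, c.toNat, ?_⟩
  omega

lemma nm_mul4 {α β : GI} (ha : OddG α) (hb : OddG β) : nm (α * β) / 4 = 4 * ((nm α / 4) * (nm β / 4)) + nm α / 4 + nm β / 4 := by
  have h1 := OddG_nm ha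
  have h2 := OddG_nm hb
  obtain ⟨x, hx⟩ : ∃ x, nm α = 4 * x + 1 := ⟨nm α / 4, by omega⟩
  obtain ⟨y, hy⟩ : ∃ x, nm β = 4 * x + 1 := ⟨nm β / 4, by omega⟩
  have e1 : nm α / 4 = x := by omega
  have e2 : nm β / 4 = y := by omega
  rw [nm_mul, e1, e2, hx, hy]
  have : (4 * x + 1) * (4 * y + 1) = 4 * (4 * (x * y) + x + y) + 1 := by ring
  omega

lemma nm_neg (α : GI) : nm (-α) = nm α := by
  have : (nm (-α) : ℤ) = nm α := by rw [nm_cast, nm_cast]; simp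
  exact_mod_cast this

section red
variable {p : ℕ} [hp : Fact p.Prime] {χ : MulChar (ZMod p) GI}

lemma red_exists (hχ : orderOf χ = 4) (h4 : p % 4 = 1) : ∃ φ : GI →+* ZMod p, ∀ t, φ (χ t) = t ^ (p / 4) := by
  obtain ⟨g, hg, hg2⟩ := chi_gen hχ
  obtain ⟨m, hm⟩ : ∃ m, p = 4 * m + 1 := ⟨p / 4, by omega⟩
  have hm' : p / 4 = m := by omega
  have hm0 : m ≠ 0 := by rintro rfl; rw [hm] at hp; exact Nat.not_prime_one hp.1
  rw [hm']
  have hord : orderOf g = p - 1 := by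
    rw [orderOf_eq_card_of_forall_mem_zpowers hg, Nat.card_eq_fintype_card, ZMod.card_units]
  set x : ZMod p := (g : ZMod p) ^ m with hx
  have hx2 : x ^ 2 ≠ 1 := by
    intro h
    rw [hx, ← pow_mul, ← Units.val_pow_eq_pow_val, Units.val_eq_one] at h
    have := orderOf_dvd_of_pow_eq_one h
    rw [hord] at this
    have := Nat.le_of_dvd (by omega) this
    omega
  have hx4 : x ^ 4 = 1 := by
    rw [hx, ← pow_mul, ← Units.val_pow_eq_pow_val, Units.val_eq_one]
    rw [show m * 4 = orderOf g by rw [hord]; omega]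
    exact pow_orderOf_eq_one g
  have hxx : x * x = -1 := by
    have : (x ^ 2 - 1) * (x * x + 1) = 0 := by linear_combination hx4
    rcases mul_eq_zero.mp this with h | h
    · exact absurd (sub_eq_zero.mp h) hx2
    · exact eq_neg_of_add_eq_zero_left h
  obtain ⟨φ, hφ⟩ : ∃ φ : GI →+* ZMod p, φ (χ g) = x := by
    have hV := chi_V hχ g
    have key : ∀ w : ZMod p, w * w = -1 → ∃ φ : GI →+* ZMod p, φ II = w := by
      intro w hw
      refine ⟨Zsqrtd.lift ⟨w, by rw [hw]; simp⟩, ?_⟩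
      simp [II]
    rcases hV with h | h | h | h | h
    · rw [h] at hg2; exact absurd hg2 (by decide)
    · rw [h] at hg2; exact absurd hg2 (by decide)
    · rw [h] at hg2; exact absurd hg2 (by decide)
    · obtain ⟨φ, hφ⟩ := key x hxx
      exact ⟨φ, by rw [h, hφ]⟩
    · obtain ⟨φ, hφ⟩ := key (-x) (by rw [neg_mul_neg, hxx])
      exact ⟨φ, by rw [h, map_neg, hφ, neg_neg]⟩
  refine ⟨φ, fun t => ?_⟩
  by_cases ht : t = 0
  · rw [ht, zero_pow hm0, MulChar.map_zero, map_zero]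
  · obtain ⟨n, hn⟩ := mem_powers_iff_mem_zpowers.mpr (hg (Units.mk0 t ht))
    have hn' : (g : ZMod p) ^ n = t := by
      have := congrArg (fun u : (ZMod p)ˣ => (u : ZMod p)) hn
      simpa using this
    rw [← hn', map_pow, map_pow, hφ, hx]; ring

lemma red_jac (hχ : orderOf χ = 4) (h4 : p % 4 = 1) (φ : GI →+* ZMod p) (hφ : ∀ t, φ (χ t) = t ^ (p / 4)) : φ (jacobiSum χ χ) = 0 := by
  unfold jacobiSum
  rw [map_sum]
  simp_rw [map_mul, hφ]
  have h1 : ∀ t : ZMod p, t ^ (p/4) * (1 - t) ^ (p/4) = ∑ j ∈ range (p/4+1), ((-1) ^ j * ((p/4).choose j)) * t ^ (p/4 + j) := by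
    intro t
    rw [show (1 - t) = (-t) + 1 by ring, add_pow, mul_sum]
    apply sum_congr rfl
    intro j _
    rw [neg_pow t j]; ring
  simp_rw [h1]
  rw [sum_comm]
  apply sum_eq_zero
  intro j hj
  rw [← mul_sum, FiniteField.sum_pow_lt_card_sub_one, mul_zero]
  rw [ZMod.card]
  have := mem_range.mp hj
  have := hp.1.two_le
  omega

lemma jac_abs (h4 : p % 4 = 1) (c : ℤ) (hc : c % 2 = 1) : jacobiSym c p = jacobiSym p c.natAbs := by
  have hpo : Odd p := by rw [Nat.odd_iff]; omega
  have h1 : jacobiSym c p = jacobiSym (c.natAbs : ℤ) p := by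
    rcases Int.natAbs_eq c with h | h
    · rw [← h]
    · rw [h, jacobiSym.neg _ hpo, ZMod.χ₄_nat_one_mod_four h4, one_mul]; simp
  rw [h1]
  have := jacobiSym.quadratic_reciprocity_one_mod_four' (a := c.natAbs) (b := p) (by rw [Nat.odd_iff]; omega) h4
  exact this

lemma chi8_neg (x : ZMod 8) : ZMod.χ₈ (-x) = ZMod.χ₈ x := by revert x; decide

lemma int_leg (c : ℤ) : (c : ZMod p) ^ (p / 2) = ((jacobiSym c p : ℤ) : ZMod p) := by
  rw [← jacobiSym.legendreSym.to_jacobiSym, legendreSym.eq_pow]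

lemma rec_two (hχ : orderOf χ = 4) (h4 : p % 4 = 1) :
    II ^ (3 * (nm (jacobiSum χ χ) / 4)) * ((ZMod.χ₈ (((jacobiSum χ χ).re + (jacobiSum χ χ).im : ℤ) : ZMod 8) : ℤ) : GI) = χ ((2:ℤ) : ZMod p) := by
  obtain ⟨φ, hφ⟩ := red_exists hχ h4
  have hJ := red_jac hχ h4 φ hφ
  have hodd := jac_odd hχ h4
  have hnm := jac_nm hχ
  have hnmc := nm_cast (jacobiSum χ χ)
  rw [hnm] at hnmc ⊢
  set J := jacobiSum χ χ with hJdef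
  set a := J.re
  set b := J.im
  obtain ⟨m, hm⟩ : ∃ m, p = 4 * m + 1 := ⟨p / 4, by omega⟩
  have hm' : p / 4 = m := by omega
  have hm2 : p / 2 = 2 * m := by omega
  rw [hm'] at hφ ⊢
  have hII : φ II * φ II = -1 := by rw [← map_mul, II_sq]; simp
  set w := φ II
  have hJ2 : (a : ZMod p) + b * w = 0 := by
    rw [← hJ]
    have : J = (a : GI) + b * II := by rw [Zsqrtd.ext_iff]; simp [II, a, b]
    rw [this]; simp [w]
  have hb : (b : ZMod p) = a * w := by linear_combination b * hII - w * hJ2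
  have hkey : ((a : ZMod p) + b) ^ 2 = 2 * a ^ 2 * w := by rw [hb]; linear_combination a ^ 2 * hII
  obtain ⟨ho1, ho2⟩ := hodd
  have hp1 := hp.1.one_lt
  have hpa : ¬ (p : ℤ) ∣ a := by
    intro h
    have hb' : (p : ℤ) ∣ b := by
      rw [← ZMod.intCast_zmod_eq_zero_iff_dvd] at h ⊢ 
      rw [hb, h, zero_mul]
    obtain ⟨x, hx⟩ := h
    obtain ⟨y, hy⟩ := hb'
    have : (p : ℤ) * (p * (x ^ 2 + y ^ 2)) = p * 1 := by
      have : (p:ℤ) = (p * x) ^ 2 + (p * y) ^ 2 := by rw [← hx, ← hy]; exact hnmc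
      linear_combination -this
    have := mul_left_cancel₀ (by exact_mod_cast hp.1.ne_zero) this
    have := Int.eq_one_of_dvd_one (by positivity) (Dvd.intro _ this)
    omega
  have hpa0 : (a : ZMod p) ≠ 0 := by
    intro h; exact hpa ((ZMod.intCast_zmod_eq_zero_iff_dvd _ _).mp h)
  have h20 : (2 : ZMod p) ≠ 0 := by
    intro h
    have := (CharP.cast_eq_zero_iff (ZMod p) p 2).mp (by exact_mod_cast h)
    have := Nat.le_of_dvd (by norm_num) this
    omega
  have hw0 : w ≠ 0 := by intro h; rw [h] at hII; simp at hII
  have hpab : ((a + b : ℤ) : ZMod p) ≠ 0 := by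
    push_cast
    intro h; rw [h] at hkey
    have : 2 * (a:ZMod p) ^ 2 * w ≠ 0 := by positivity
    exact this (by rw [← hkey]; simp)
  have hsq1 : ∀ c d : ℤ, ∀ n : ℕ, jacobiSym c n ≠ 0 → jacobiSym c n = jacobiSym (d ^ 2) n → jacobiSym c n = 1 := by
    intro c d n h0 h
    rw [h] at h0 ⊢
    rw [jacobiSym.pow_left] at h0 ⊢
    rcases jacobiSym.trichotomy d n with h | h | h <;> rw [h] at h0 ⊢
    · simp at h0
    · simp
    · simp
  have hne : ∀ c : ℤ, (c : ZMod p) ≠ 0 → jacobiSym c p ≠ 0 := by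
    intro c hc h
    rw [jacobiSym.eq_zero_iff] at h
    apply h.2
    rw [← Int.isCoprime_iff_gcd_eq_one]
    apply IsCoprime.symm
    rw [Int.isCoprime_iff_gcd_eq_one, Int.gcd_eq_natAbs, Int.natAbs_natCast]
    apply (Nat.Prime.coprime_iff_not_dvd hp.1).mpr
    intro h'
    apply hc
    rw [ZMod.intCast_zmod_eq_zero_iff_dvd]
    exact Int.natCast_dvd.mpr h'
  have hA : jacobiSym a p = 1 := by
    have h1 := hne a hpa0
    rw [jac_abs h4 a ho1] at h1 ⊢
    apply hsq1 _ b _ h1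
    apply jacobiSym.mod_left'
    apply Int.emod_eq_emod_iff_emod_sub_eq_zero.mpr
    apply Int.emod_eq_zero_of_dvd
    rw [Int.natAbs_dvd]
    exact ⟨a, by rw [hnmc]; ring⟩
  have hB : jacobiSym (a + b) p = ZMod.χ₈ ((a + b : ℤ) : ZMod 8) := by
    have h1 := hne (a + b) hpab
    rw [jac_abs h4 (a + b) (by omega)] at h1 ⊢
    set s := (a + b).natAbs with hs
    have hso : Odd s := by rw [Nat.odd_iff]; omega
    have h2 : jacobiSym 2 s = ZMod.χ₈ ((a + b : ℤ) : ZMod 8) := by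
      rw [jacobiSym.at_two hso]
      rcases Int.natAbs_eq (a + b) with h | h
      · rw [h, Int.cast_natCast]
      · rw [h, Int.cast_neg, Int.cast_natCast, chi8_neg]
    rw [← h2]
    have h20 : jacobiSym 2 s ≠ 0 := by
      intro h
      rw [jacobiSym.eq_zero_iff] at h
      apply h.2
      rw [Int.gcd_eq_natAbs]
      exact (Nat.coprime_two_left).mpr hso
    have h3 : jacobiSym (2 * p) s = 1 := by
      apply hsq1 _ (a - b)
      · rw [jacobiSym.mul_left]; exact mul_ne_zero h20 h1
      apply jacobiSym.mod_left'
      apply Int.emod_eq_emod_iff_emod_sub_eq_zero.mpr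
      apply Int.emod_eq_zero_of_dvd
      rw [Int.natAbs_dvd]
      exact ⟨a + b, by rw [hnmc]; ring⟩
    rw [jacobiSym.mul_left] at h3
    rcases jacobiSym.trichotomy 2 s with h | h | h
    · exact absurd h h20
    · rw [h] at h3 ⊢; linarith
    · rw [h] at h3 ⊢; linarith
  have hfin : (2 : ZMod p) ^ m * w ^ m = ((ZMod.χ₈ ((a + b : ℤ) : ZMod 8) : ℤ) : ZMod p) := by
    rw [← hB, ← int_leg, hm2, pow_mul]
    push_cast
    rw [hkey, mul_pow, mul_pow, ← pow_mul, ← hm2, int_leg, hA]; simp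
  have hV1 : isV (II ^ (3 * m) * ((ZMod.χ₈ ((a + b : ℤ) : ZMod 8) : ℤ) : GI)) := by
    apply isV_mul
    · apply isV_pow2; simp [isV]
    · rw [← hB]; exact isV_jac _ _
  apply isV_inj h20 φ hV1 (chi_V hχ _)
  rw [hφ, map_mul, map_pow, map_intCast, ← hfin]
  push_cast
  have : w ^ (3 * m) * w ^ m = 1 := by
    rw [← pow_add, show 3 * m + m = m * 4 by ring, mul_comm, pow_mul]
    rw [show w ^ 4 = (w * w) * (w * w) by ring, hII]; simp
  linear_combination 2 ^ m * this

end red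

theorem QR_neg_one : QR (-1) 16 (fun α => (-1) ^ (nm α / 4)) where
  per := by
    intro α β
    obtain ⟨a, b, h⟩ := nm_per4 α β
    have : ((-1 : GI)) ^ (nm (α + (16:ℕ) * β) / 4 + 8 * a) = (-1) ^ (nm α / 4 + 8 * b) := by rw [h]
    rw [pow_add, pow_add, pow_mul, pow_mul, show (-1 : GI) ^ 8 = 1 by decide] at this
    simpa using this
  mul := by
    intro α β ha hb
    rw [nm_mul4 ha hb, pow_add, pow_add, pow_mul, show (-1 : GI) ^ 4 = 1 by decide]; simp
  neg := by intro α _; rw [nm_neg]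
  V := by intro α _; apply isV_pow2; simp [isV]
  sq := by
    intro α ha
    have hodd' : Odd (nm α) := by rw [Nat.odd_iff]; have := OddG_nm ha; omega
    rw [jacobiSym.at_neg_one hodd', ZMod.χ₄_nat_one_mod_four (OddG_nm ha), ← pow_mul, mul_comm, pow_mul]; simp
  recip := by
    intro p hp h4 χ hχ
    obtain ⟨φ, hφ⟩ := red_exists hχ h4
    have h20 : (2 : ZMod p) ≠ 0 := by
      intro h
      have := (CharP.cast_eq_zero_iff (ZMod p) p 2).mp (by exact_mod_cast h)
      have := Nat.le_of_dvd (by norm_num) this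
      have := hp.1.two_le
      omega
    apply isV_inj h20 φ (isV_pow2 (by simp [isV]) _) (chi_V hχ _)
    rw [hφ, jac_nm hχ]; simp

theorem QR_two : QR 2 16 (fun α => II ^ (3 * (nm α / 4)) * ((ZMod.χ₈ ((α.re + α.im : ℤ) : ZMod 8) : ℤ) : GI)) where
  per := by
    intro α β
    obtain ⟨a, b, h⟩ := nm_per4 α β
    have hI4 : II ^ 24 = 1 := by decide
    have e1 : II ^ (3 * (nm (α + (16:ℕ) * β) / 4)) = II ^ (3 * (nm α / 4)) := by
      have : II ^ (3 * (nm (α + (16:ℕ) * β) / 4 + 8 * a)) = II ^ (3 * (nm α / 4 + 8 * b)) := by rw [h]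
      rw [mul_add, mul_add, pow_add, pow_add, ← mul_assoc, ← mul_assoc, pow_mul II (3 * 8), pow_mul II (3 * 8), hI4] at this
      simpa using this
    rw [e1]
    have e2 : (((α + (16:ℕ) * β).re + (α + (16:ℕ) * β).im : ℤ) : ZMod 8) = ((α.re + α.im : ℤ) : ZMod 8) := by
      simp
      have : (16 : ZMod 8) = 0 := by decide
      rw [this]; ring
    rw [e2]
  mul := by
    intro α β ha hb
    rw [nm_mul4 ha hb]
    have e2 : (((α * β).re + (α * β).im : ℤ) : ZMod 8) = ((α.re + α.im : ℤ) : ZMod 8) * ((β.re + β.im : ℤ) : ZMod 8) := by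
      obtain ⟨-, h1⟩ := ha
      obtain ⟨-, h2⟩ := hb
      obtain ⟨x, hx⟩ : ∃ x, α.im = 2 * x := ⟨α.im / 2, by omega⟩
      obtain ⟨y, hy⟩ : ∃ x, β.im = 2 * x := ⟨β.im / 2, by omega⟩
      simp [Zsqrtd.re_mul, Zsqrtd.im_mul, hx, hy]
      have : (8 : ZMod 8) = 0 := by decide
      linear_combination (-(x : ZMod 8) * y) * this
    rw [e2, map_mul]
    have hI4 : II ^ 12 = 1 := by decide
    rw [mul_add, mul_add, pow_add, pow_add, ← mul_assoc 3 4, pow_mul II (3 * 4), hI4]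
    push_cast
    simp
    ring
  neg := by
    intro α _
    rw [nm_neg]
    have : (((-α).re + (-α).im : ℤ) : ZMod 8) = -((α.re + α.im : ℤ) : ZMod 8) := by simp; ring
    rw [this, chi8_neg]
  V := by
    intro α _
    apply isV_mul
    · apply isV_pow2; simp [isV]
    · have : ∀ x : ZMod 8, ZMod.χ₈ x = 0 ∨ ZMod.χ₈ x = 1 ∨ ZMod.χ₈ x = -1 := by decide
      rcases this ((α.re + α.im : ℤ) : ZMod 8) with h | h | h <;> rw [h] <;> simp [isV]
  sq := by
    intro α ha
    have h1 := OddG_nm ha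
    obtain ⟨x, hx⟩ : ∃ x, nm α = 4 * x + 1 := ⟨nm α / 4, by omega⟩
    have e1 : nm α / 4 = x := by omega
    have hodd' : Odd (nm α) := by rw [Nat.odd_iff]; omega
    rw [jacobiSym.at_two hodd', mul_pow, e1]
    have h8 : (ZMod.χ₈ ((α.re + α.im : ℤ) : ZMod 8)) ^ 2 = 1 := by
      have hodd : (α.re + α.im) % 2 = 1 := by have := ha.1; have := ha.2; omega
      have key : ∀ z : ZMod 8, ZMod.χ₈ (2 * z + 1) ^ 2 = 1 := by decide
      obtain ⟨u, hu⟩ : ∃ u, α.re + α.im = 2 * u + 1 := ⟨(α.re + α.im) / 2, by omega⟩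
      rw [hu]; push_cast; exact key _
    have h8' : ((ZMod.χ₈ ((α.re + α.im : ℤ) : ZMod 8) : ℤ) : GI) ^ 2 = 1 := by exact_mod_cast h8
    rw [h8', mul_one, hx]
    have hI6 : II ^ 6 = -1 := by decide
    rw [← pow_mul, show 3 * x * 2 = 6 * x by ring, pow_mul, hI6]
    rcases Nat.even_or_odd x with ⟨c, hc⟩ | ⟨c, hc⟩
    · have : ((4 * x + 1 : ℕ) : ZMod 8) = 1 := by
        rw [hc]; push_cast
        have : (8 : ZMod 8) = 0 := by decide
        linear_combination (c : ZMod 8) * this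
      rw [this, hc, ← two_mul, pow_mul]; simp
    · have : ((4 * x + 1 : ℕ) : ZMod 8) = 5 := by
        rw [hc]; push_cast
        have : (8 : ZMod 8) = 0 := by decide
        linear_combination (c : ZMod 8) * this
      rw [this, hc, pow_succ, pow_mul]
      have : ZMod.χ₈ 5 = -1 := by decide
      rw [this]; simp
  recip := by
    intro p hp h4 χ hχ
    exact rec_two hχ h4

theorem QR_exists (k : ℕ) (hk : 0 < k) : ∃ ψ, QR k (16 * k) ψ := by
  induction k using Nat.recOnMul with
  | zero => omega
  | one =>
    refine ⟨fun α => 1, ?_, ?_, ?_, ?_, ?_, ?_⟩ <;> simp [isV]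
  | prime q hq =>
    by_cases h2 : q = 2
    · subst h2
      have := QR_mul QR_two QR_two (M := 32) (by norm_num) (by norm_num)
      refine ⟨_, ?_, QR_two.mul, QR_two.neg, QR_two.V, QR_two.sq, QR_two.recip⟩
      intro α β
      have := QR_two.per α (2 * β)
      rw [← this]
      congr 2 <;> push_cast <;> ring
    · obtain ⟨ψ, hψ⟩ := QR_odd q hq h2
      by_cases h4 : q % 4 = 1
      · rw [if_pos h4] at hψ
        refine ⟨_, ?_, hψ.mul, hψ.neg, hψ.V, hψ.sq, hψ.recip⟩
        intro α β
        have := hψ.per α (16 * β)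
        rw [← this]
        congr 2 <;> push_cast <;> ring
      · rw [if_neg h4] at hψ
        have := QR_mul QR_neg_one hψ (M := 16 * q) (Dvd.intro _ rfl) (Dvd.intro_left _ rfl)
        rw [neg_one_mul, neg_neg] at this
        exact ⟨_, this⟩
  | mul a b ha hb =>
    have ha0 : 0 < a := Nat.pos_of_mul_pos_right hk |> fun h => Nat.pos_of_ne_zero (by rintro rfl; simp at hk)
    have hb0 : 0 < b := Nat.pos_of_ne_zero (by rintro rfl; simp at hk)
    obtain ⟨ψ, h⟩ := ha ha0
    obtain ⟨ψ', h'⟩ := hb hb0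
    have := QR_mul h h' (M := 16 * (a * b)) ⟨b, by ring⟩ ⟨a, by ring⟩
    rw [← Nat.cast_mul] at this
    exact ⟨_, this⟩

theorem QR_neg_exists (k : ℕ) (hk : 0 < k) : ∃ ψ, QR (-k) (16 * k) ψ := by
  obtain ⟨ψ, h⟩ := QR_exists k hk
  have := QR_mul QR_neg_one h (M := 16 * k) (Dvd.intro _ rfl) (dvd_refl _)
  rw [neg_one_mul] at this
  exact ⟨_, this⟩

noncomputable def psiN (k : ℕ) : GI → GI := if h : 0 < k then (QR_neg_exists k h).choose else fun _ => 0

lemma psiN_spec (k : ℕ) (hk : 0 < k) : QR (-k) (16 * k) (psiN k) := by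
  unfold psiN; rw [dif_pos hk]; exact (QR_neg_exists k hk).choose_spec

noncomputable def xi (k : ℕ) (α : GI) : ℂ := if Prim α ∧ ¬ 3 ∣ nm α then GaussianInt.toComplex (psiN k α) else 0

lemma jac_neg_nm (k : ℤ) {α : GI} (ha : Prim α) : jacobiSym (-k) (nm α) = jacobiSym k (nm α) := by
  have h1 := Prim_nm ha
  rw [jacobiSym.neg _ (by rw [Nat.odd_iff]; omega), ZMod.χ₄_nat_one_mod_four h1, one_mul]

lemma xi_sq (k : ℕ) (hk : 0 < k) {α : GI} (ha : Prim α) (h3 : ¬ 3 ∣ nm α) : xi k α ^ 2 = ((jacobiSym k (nm α) : ℤ) : ℂ) := by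
  unfold xi
  rw [if_pos ⟨ha, h3⟩, ← map_pow, (psiN_spec k hk).sq α (OddG_of_Prim ha), jac_neg_nm _ ha, map_intCast]

lemma Prim_per (α β : GI) (c : ℕ) (hc : 4 ∣ c) : Prim (α + (c : GI) * β) ↔ Prim α := by
  obtain ⟨d, rfl⟩ := hc
  unfold Prim
  simp
  have h1 : ((4:ℤ) * d * β.im) = 4 * (d * β.im) := by ring
  have h2 : ((4:ℤ) * d * β.re) = 4 * (d * β.re) := by ring
  rw [h1, h2]
  constructor <;> rintro ⟨h3, h4⟩ <;> constructor <;> omega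

lemma nm_per_dvd (α β : GI) (c m : ℕ) (hc : m ∣ c) : m ∣ nm (α + (c : GI) * β) ↔ m ∣ nm α := by
  obtain ⟨d, rfl⟩ := hc
  rw [← Int.natCast_dvd_natCast, ← Int.natCast_dvd_natCast, nm_cast, nm_cast]
  simp
  have : (α.re + m * d * β.re) ^ 2 + (α.im + m * d * β.im) ^ 2 = (α.re ^ 2 + α.im ^ 2) + 
    m * (2 * d * α.re * β.re + m * d ^ 2 * β.re ^ 2 + 2 * d * α.im * β.im + m * d ^ 2 * β.im ^ 2) := by ring
  rw [this]
  exact (Int.dvd_iff_dvd_of_dvd_sub (by simp)) 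

lemma xi_GChar (k : ℕ) (hk : 0 < k) : GChar (xi k) (48 * k) where
  hM := by omega
  h6 := ⟨8 * k, by ring⟩
  per := by
    intro α β
    unfold xi
    simp only [Prim_per α β (48 * k) ⟨12 * k, by ring⟩, nm_per_dvd α β (48 * k) 3 ⟨16 * k, by ring⟩]
    rw [show ((48 * k : ℕ) : GI) * β = ((16 * k : ℕ) : GI) * (3 * β) by push_cast; ring, (psiN_spec k hk).per]
  one := by
    unfold xi
    rw [if_pos ⟨Prim_one, by rw [nm_one]; norm_num⟩]
    have h1 := (psiN_spec k hk).sq 1 (OddG_of_Prim Prim_one)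
    have h2 := (psiN_spec k hk).mul 1 1 (OddG_of_Prim Prim_one) (OddG_of_Prim Prim_one)
    rw [nm_one, jacobiSym.one_right] at h1
    rw [mul_one, ← pow_two, h1] at h2
    rw [h2]; simp
  mul := by
    intro α β ha hb
    unfold xi
    rw [(psiN_spec k hk).mul α β (OddG_of_Prim ha) (OddG_of_Prim hb), nm_mul, map_mul]
    simp only [Nat.prime_three.dvd_mul]
    have := Prim_mul ha hb
    by_cases h1 : 3 ∣ nm α <;> by_cases h2 : 3 ∣ nm β <;> simp [ha, hb, this, h1, h2]
  supp := by
    intro α h0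
    have hP : Prim α ∧ ¬ 3 ∣ nm α := by
      by_contra h; unfold xi at h0; rw [if_neg h] at h0; exact h0 rfl
    refine ⟨hP.1, ?_⟩
    have h1 := xi_sq k hk hP.1 hP.2
    have h2 : jacobiSym k (nm α) ≠ 0 := by
      intro h; rw [h] at h1; simp at h1; exact h0 h1
    have h3 : Nat.Coprime k (nm α) := by
      by_contra h
      apply h2
      rw [jacobiSym.eq_zero_iff]
      have := Prim_nm hP.1
      exact ⟨by omega, h⟩
    have h4 := Prim_nm hP.1
    have h5 : Nat.Coprime (nm α) 2 := by
      rw [Nat.coprime_two_right, Nat.odd_iff]; omega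
    have h6 : Nat.Coprime (nm α) 3 := ((Nat.Prime.coprime_iff_not_dvd Nat.prime_three).mpr hP.2).symm
    have : Nat.Coprime (nm α) (2 ^ 4 * 3) := Nat.Coprime.mul_right (h5.pow_right 4) h6
    exact Nat.Coprime.mul_right this h3.symm
  unit := by
    intro α ha hc
    have h3 : ¬ 3 ∣ nm α := by
      have : Nat.Coprime (nm α) 3 := hc.coprime_dvd_right ⟨16 * k, by ring⟩
      intro h
      have := Nat.eq_one_of_dvd_coprimes this h (dvd_refl 3)
      omega
    have h1 := xi_sq k hk ha h3
    have h2 : jacobiSym k (nm α) ^ 2 = 1 := by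
      apply jacobiSym.sq_one
      exact (hc.coprime_dvd_right (Dvd.intro_left _ rfl)).symm
    have h4 : ‖xi k α‖ ^ 4 = 1 := by
      have : xi k α ^ 4 = 1 := by
        rw [show xi k α ^ 4 = (xi k α ^ 2) ^ 2 by ring, h1]; exact_mod_cast h2
      rw [← norm_pow, this]; simp
    exact (pow_eq_one_iff_of_nonneg (norm_nonneg _) (by norm_num)).mp h4

noncomputable def fk (k : ℕ) : ℕ → ℂ := cf (xi k)

lemma PS_empty {p : ℕ} (h : p % 4 ≠ 1) : PS p = ∅ := by
  rw [Finset.eq_empty_iff_forall_notMem]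
  intro α ha
  rw [mem_PS] at ha
  have := Prim_nm ha.2
  rw [ha.1] at this
  exact h this

lemma xi_J (k : ℕ) (hk : 0 < k) (p : ℕ) [hp : Fact p.Prime] (h4 : p % 4 = 1) (χ : MulChar (ZMod p) GI) (hχ : orderOf χ = 4) :
    ∃ π, Prim π ∧ nm π = p ∧ Associated (jacobiSum χ χ) π ∧ xi k π = GaussianInt.toComplex (χ ((-k : ℤ) : ZMod p)) := by
  have hodd := jac_odd hχ h4
  have hq := psiN_spec k hk
  have hr := hq.recip p h4 χ hχ
  have hn := jac_nm hχ
  have hp3 : ¬ 3 ∣ p := by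
    intro h
    have := (Nat.prime_dvd_prime_iff_eq Nat.prime_three hp.1).mp h
    omega
  set J := jacobiSum χ χ
  have h12 : Prim J ∨ Prim (-J) := by
    obtain ⟨h1, h2⟩ := hodd
    unfold Prim
    simp
    omega
  rcases h12 with h | h
  · refine ⟨J, h, hn, Associated.refl _, ?_⟩
    unfold xi
    rw [if_pos ⟨h, by rwa [hn]⟩, hr]
  · refine ⟨-J, h, by rw [nm_neg, hn], (Associated.refl J).neg_right, ?_⟩
    unfold xi
    rw [if_pos ⟨h, by rwa [nm_neg, hn]⟩, hq.neg _ hodd, hr]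

lemma exists_chi (p : ℕ) [hp : Fact p.Prime] (h4 : p % 4 = 1) : ∃ χ : MulChar (ZMod p) GI, orderOf χ = 4 :=
  MulChar.exists_mulChar_orderOf (ZMod p) (by rw [ZMod.card]; omega) II_prim

lemma fk_prime (k : ℕ) (hk : 0 < k) (p : ℕ) [hp : Fact p.Prime] (h4 : p % 4 = 1) (χ : MulChar (ZMod p) GI) (hχ : orderOf χ = 4) :
    fk k p = GaussianInt.toComplex (χ ((-k : ℤ) : ZMod p)) + GaussianInt.toComplex (χ⁻¹ ((-k : ℤ) : ZMod p)) := by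
  have hχ' : orderOf χ⁻¹ = 4 := by rw [orderOf_inv, hχ]
  obtain ⟨π, hP, hn, hA, hx⟩ := xi_J k hk p h4 χ hχ
  obtain ⟨π', hP', hn', hA', hx'⟩ := xi_J k hk p h4 χ⁻¹ hχ'
  rw [← jac_star hχ] at hA'
  have hstar : star π = π' := by
    apply Prim_assoc (Prim_star hP) hP'
    refine Associated.trans ?_ hA'
    have := hA.map (starRingEnd GI)
    exact this.symm
  have hne : π ≠ π' := by
    rw [← hstar]
    intro h
    have him : π.im = 0 := by
      have := congrArg Zsqrtd.im h
      simp at this; omega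
    have := nm_cast π
    rw [hn, him] at this
    have h' : p = π.re.natAbs ^ 2 := by
      zify; rw [this, sq_abs]; ring
    exact Irreducible.not_isSquare hp.1 ⟨_, by rw [h', pow_two]⟩
  have hPS : PS p = {π, π'} := by
    ext σ
    rw [mem_PS, mem_insert, mem_singleton]
    constructor
    · rintro ⟨h1, h2⟩
      have hirr : ∀ τ : GI, nm τ = p → Irreducible τ := by
        intro τ hτ
        constructor
        · rw [← nm_eq_one_unit, hτ]; exact hp.1.one_lt.ne'
        · intro a b hab
          rw [hab, nm_mul] at hτ
          rw [← nm_eq_one_unit, ← nm_eq_one_unit]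
          rcases Nat.prime_mul_iff.mp (hτ ▸ hp.1) with h | h
          · right; exact h.2
          · left; exact h.2
      have hpr : Prime σ := (hirr σ h1).prime
      have hd : σ ∣ π * π' := by
        rw [← hstar, mul_star_nm, hn, ← h1, ← mul_star_nm]; exact Dvd.intro _ rfl
      rcases hpr.dvd_or_dvd hd with h | h
      · left; exact Prim_assoc h2 hP ((hirr σ h1).associated_of_dvd (hirr π hn) h)
      · right; exact Prim_assoc h2 hP' ((hirr σ h1).associated_of_dvd (hirr π' hn') h)
    · rintro (rfl | rfl)
      · exact ⟨hn, hP⟩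
      · exact ⟨hn', hP'⟩
  unfold fk cf
  rw [hPS, sum_pair hne, hx, hx']

lemma nSol_eq (k : ℤ) (r p : ℕ) [hp : NeZero p] : nSol k r p = (univ.filter (fun x : ZMod p => x ^ r = -(k : ZMod p))).card := by
  unfold nSol
  refine Finset.card_bij' (fun n _ => (n : ZMod p)) (fun x _ => x.val) ?_ ?_ ?_ ?_
  · intro n hn
    rw [mem_filter] at hn ⊢
    refine ⟨mem_univ _, ?_⟩
    have := hn.2
    rw [← Int.dvd_iff_emod_eq_zero, ← ZMod.intCast_zmod_eq_zero_iff_dvd _ p] at this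
    push_cast at this
    exact eq_neg_of_add_eq_zero_left this
  · intro x hx
    rw [mem_filter] at hx ⊢
    refine ⟨mem_range.mpr (ZMod.val_lt x), ?_⟩
    rw [← Int.dvd_iff_emod_eq_zero, ← ZMod.intCast_zmod_eq_zero_iff_dvd _ p]
    push_cast
    rw [ZMod.natCast_zmod_val, hx.2]; ring
  · intro n hn
    rw [mem_filter, mem_range] at hn
    exact ZMod.val_cast_of_lt hn.1
  · intro x _
    exact ZMod.natCast_zmod_val x

lemma card_pow4 {p : ℕ} [hp : Fact p.Prime] (h4 : p % 4 = 1) {χ : MulChar (ZMod p) GI} (hχ : orderOf χ = 4) (c : ZMod p) :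
    (univ.filter (fun x : ZMod p => x ^ 4 = c)).card = if c = 0 then 1 else if χ c = 1 then 4 else 0 := by
  split_ifs with h0 h1
  · subst h0
    rw [card_eq_one]
    refine ⟨0, ?_⟩
    ext x; simp
  · obtain ⟨g, hg, hg2⟩ := chi_gen hχ
    obtain ⟨n, hn⟩ := Subgroup.mem_zpowers_iff.mp (hg (Units.mk0 c h0))
    have hgu : (χ.toUnitHom g) ^ n = 1 := by
      rw [← map_zpow, hn]
      apply Units.ext
      rw [MulChar.coe_toUnitHom]; simpa using h1
    have hord : orderOf (χ.toUnitHom g) = 4 := by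
      have h2 : (χ.toUnitHom g) ^ 2 = -1 := by
        apply Units.ext; push_cast; rw [MulChar.coe_toUnitHom]; exact hg2
      refine orderOf_eq_of_pow_and_pow_div_prime (by norm_num) ?_ ?_
      · rw [show 4 = 2 * 2 from rfl, pow_mul, h2]; norm_num
      · intro q hq hq4
        have : q = 2 := by
          rw [show 4 = 2 ^ 2 from rfl] at hq4
          exact (Nat.prime_dvd_prime_iff_eq hq Nat.prime_two).mp (hq.dvd_of_dvd_pow hq4)
        subst this
        rw [show 4 / 2 = 2 from rfl, h2]
        decide
    have h4n := orderOf_dvd_iff_zpow_eq_one.mpr hgu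
    rw [hord] at h4n
    obtain ⟨m, hm⟩ := h4n
    set x0 : ZMod p := ((g ^ m : (ZMod p)ˣ) : ZMod p)
    have hx0 : x0 ^ 4 = c := by
      have : (g ^ m) ^ 4 = Units.mk0 c h0 := by
        rw [← hn, hm, mul_comm, zpow_mul]; norm_cast
      have h2 := congrArg (fun u : (ZMod p)ˣ => (u : ZMod p)) this
      rw [show x0 ^ 4 = (((g ^ m) ^ 4 : (ZMod p)ˣ) : ZMod p) from (Units.val_pow_eq_pow_val _ _).symm, this]; rfl
    have hx00 : x0 ≠ 0 := Units.ne_zero _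
    obtain ⟨w, hw⟩ : IsSquare (-1 : ZMod p) := ZMod.exists_sq_eq_neg_one_iff.mpr (by omega)
    have h2 : (2 : ZMod p) ≠ 0 := by
      intro h
      have : ((2:ℕ) : ZMod p) = 0 := by exact_mod_cast h
      rw [ZMod.natCast_eq_zero_iff] at this
      have := Nat.le_of_dvd (by norm_num) this
      have := hp.1.two_le
      omega
    have hw1 : w ≠ 1 := by rintro rfl; apply h2; linear_combination -hw
    have hw2 : w ≠ -1 := by rintro rfl; apply h2; linear_combination -hw
    have hw0 : w ≠ 0 := by rintro rfl; simp at hw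
    have : univ.filter (fun x : ZMod p => x ^ 4 = c) = {x0, -x0, w * x0, -(w * x0)} := by
      ext x
      simp only [mem_filter, mem_univ, true_and, mem_insert, mem_singleton]
      constructor
      · intro h
        have : (x - x0) * (x + x0) * ((x - w * x0) * (x + w * x0)) = 0 := by
          linear_combination h - hx0 + x0 ^ 2 * (x^2 - x0^2) * hw
        rcases mul_eq_zero.mp this with h | h <;> rcases mul_eq_zero.mp h with h | h
        · left; exact sub_eq_zero.mp h
        · right; left; exact eq_neg_of_add_eq_zero_left h
        · right; right; left; exact sub_eq_zero.mp h
        · right; right; right; exact eq_neg_of_add_eq_zero_left h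
      · rintro (rfl | rfl | rfl | rfl)
        · exact hx0
        · rw [← hx0]; ring
        · rw [← hx0]; linear_combination - x0 ^ 4 * (w ^ 2 - 1) * hw
        · rw [← hx0]; linear_combination - x0 ^ 4 * (w ^ 2 - 1) * hw
    rw [this]
    have e1 : x0 ≠ -x0 := by
      intro h; have : 2 * x0 = 0 := by linear_combination h
      rcases mul_eq_zero.mp this with h | h <;> contradiction
    have e2 : ∀ v : ZMod p, v ≠ 1 → v * x0 ≠ x0 := by
      intro v hv h; apply hv
      exact mul_right_cancel₀ hx00 (by rw [h, one_mul])
    have e3 : ∀ v : ZMod p, v ≠ -1 → v * x0 ≠ - x0 := by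
      intro v hv h; apply hv
      exact mul_right_cancel₀ hx00 (by rw [h]; ring)
    have e4 : w * x0 ≠ -(w * x0) := by
      intro h; have : 2 * (w * x0) = 0 := by linear_combination h
      rcases mul_eq_zero.mp this with h | h
      · contradiction
      · rcases mul_eq_zero.mp h with h | h <;> contradiction
    have e5 : x0 ≠ -(w * x0) := fun h => e3 w hw2 (by rw [← neg_eq_iff_eq_neg.mpr h]; )
    rw [card_insert_of_notMem, card_insert_of_notMem, card_insert_of_notMem, card_singleton]
    · rw [mem_singleton]; exact e4
    · rw [mem_insert, mem_singleton]; push Not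
      exact ⟨(e3 w hw2).symm, fun h => e2 w hw1 (neg_injective h).symm⟩
    · rw [mem_insert, mem_insert, mem_singleton]; push Not
      exact ⟨e1, (e2 w hw1).symm, e5⟩
  · rw [card_eq_zero, filter_eq_empty_iff]
    intro x _ hx
    apply h1
    rw [← hx, map_pow]
    apply chi_pow_four hχ
    rintro rfl
    apply h0; rw [← hx]; simp

/-- `A_k(p)` -/
noncomputable def Ak (k p : ℕ) : ℝ := if p % 4 = 1 then (nSol k 4 p : ℝ) - 1 else 0

lemma nSol_formula (k : ℕ) (hk : 0 < k) (p : ℕ) [hp : Fact p.Prime] (h4 : p % 4 = 1) :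
    (nSol k 4 p : ℝ) - 1 = (fk k p).re + (jacobiSym k p : ℤ) := by
  obtain ⟨χ, hχ⟩ := exists_chi p h4
  have hf := fk_prime k hk p h4 χ hχ
  obtain ⟨π, hP, hn, -, hx⟩ := xi_J k hk p h4 χ hχ
  have hp3 : ¬ 3 ∣ p := by
    intro h
    have := (Nat.prime_dvd_prime_iff_eq Nat.prime_three hp.1).mp h
    omega
  have hsq := xi_sq k hk hP (by rwa [hn])
  rw [hn, hx] at hsq
  have hinv : χ⁻¹ ((-k : ℤ) : ZMod p) = star (χ ((-k : ℤ) : ZMod p)) := by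
    rw [← chi_star hχ]; rfl
  rw [hinv] at hf
  rw [hf, nSol_eq, card_pow4 h4 hχ]
  have hV := chi_V hχ ((-k : ℤ) : ZMod p)
  have h0 : (-((k : ℤ) : ZMod p) = 0) ↔ χ ((-k : ℤ) : ZMod p) = 0 := by
    push_cast
    constructor
    · intro h; rw [h]; exact MulChar.map_zero χ
    · intro h
      by_contra h'
      have := chi_pow_four hχ h'
      rw [h] at this; simp at this
  rw [show -((k : ℤ) : ZMod p) = ((-k : ℤ) : ZMod p) by push_cast; rfl] at h0 ⊢
  rw [← map_pow] at hsq
  have hjac : (((jacobiSym k p : ℤ)) : GI) = χ ((-k : ℤ) : ZMod p) ^ 2 := by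
    apply GaussianInt.toComplex_injective
    rw [hsq, map_intCast]
  have hjac2 := congrArg Zsqrtd.re hjac
  rw [Zsqrtd.re_intCast] at hjac2
  rw [hjac2]
  simp only [h0]
  generalize χ ((-k : ℤ) : ZMod p) = u at *
  have t1 : (II ^ 2).re = -1 := by decide
  have t2 : ((-II) ^ 2).re = -1 := by decide
  have t3 : ((1 : GI) ^ 2).re = 1 := by decide
  have t4 : ((-1 : GI) ^ 2).re = 1 := by decide
  have t5 : ((0 : GI) ^ 2).re = 0 := by decide
  rcases hV with rfl | rfl | rfl | rfl | rfl
  · rw [t5]; simp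
  · rw [t3]; norm_num
  · rw [t4, if_neg (by decide), if_neg (by decide)]; norm_num
  · rw [t1, if_neg (by decide), if_neg (by decide)]; simp [II, GaussianInt.toComplex_def]
  · rw [t2, if_neg (by decide), if_neg (by decide)]; simp [II, GaussianInt.toComplex_def]

/-- least quadratic nonresidue: there is `a` with `a^2+1` nonresidue mod `q` -/
lemma exists_nonres (q : ℕ) [hq : Fact q.Prime] (h2 : q ≠ 2) : ∃ a : ℕ, legendreSym q ((a : ℤ) ^ 2 + 1) = -1 := by
  have hex : ∃ t : ℕ, legendreSym q (t : ℤ) = -1 := by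
    obtain ⟨x, hx⟩ := FiniteField.exists_nonsquare (F := ZMod q) (by rwa [ZMod.ringChar_zmod_n])
    refine ⟨x.val, ?_⟩
    rw [legendreSym.eq_neg_one_iff]
    rw [Int.cast_natCast, ZMod.natCast_zmod_val]; exact hx
  obtain ⟨ht, hmin⟩ : legendreSym q ((Nat.find hex : ℕ) : ℤ) = -1 ∧ ∀ m < Nat.find hex, ¬ legendreSym q (m : ℤ) = -1 :=
    ⟨Nat.find_spec hex, fun m hm => Nat.find_min hex hm⟩
  set t := Nat.find hex
  have ht0 : t ≠ 0 := by rintro h; rw [h] at ht; simp [legendreSym.at_zero] at ht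
  obtain ⟨m, hm⟩ := Nat.exists_eq_succ_of_ne_zero ht0
  have hm1 := hmin m (by omega)
  rw [legendreSym.eq_neg_one_iff, not_not] at hm1
  obtain ⟨x, hx⟩ := hm1
  refine ⟨x.val, ?_⟩
  rw [legendreSym.eq_neg_one_iff] at ht ⊢
  rw [hm] at ht
  push_cast at ht hx ⊢
  rw [ZMod.natCast_zmod_val, pow_two, ← hx]; exact ht

lemma crt_alpha (R Q : ℕ) (h : R.Coprime Q) (a b : ℕ) : ∃ A B : ℕ, A ≡ 1 [MOD R] ∧ B ≡ 0 [MOD R] ∧ A ≡ a [MOD Q] ∧ B ≡ b [MOD Q] := by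
  obtain ⟨A, h1, h2⟩ := Nat.chineseRemainder h 1 a
  obtain ⟨B, h3, h4⟩ := Nat.chineseRemainder h 0 b
  exact ⟨A, B, h1, h3, h2, h4⟩

/-- key nontriviality statement -/
lemma exists_jac_neg (k : ℕ) (hk : 0 < k) (hns : ¬ IsSquare k) : 
    ∃ α : GI, Prim α ∧ (nm α).Coprime (6 * k) ∧ jacobiSym k (nm α) = -1 := by
  obtain ⟨a, b, hab, hsf⟩ := Nat.sq_mul_squarefree k
  have ha1 : a ≠ 1 := by
    rintro rfl; apply hns; exact ⟨b, by rw [← hab]; ring⟩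
  obtain ⟨q, hq, hqa⟩ := Nat.exists_prime_and_dvd ha1
  have : Fact q.Prime := ⟨hq⟩
  obtain ⟨m, rfl⟩ := hqa
  have hqm : ¬ q ∣ m := by
    intro ⟨c, hc⟩
    have := hsf q ⟨c, by rw [hc]; ring⟩
    exact hq.one_lt.ne' (Nat.isUnit_iff.mp this)
  have hb0 : b ≠ 0 := by rintro rfl; simp at hab; omega
  have hm0 : m ≠ 0 := by rintro rfl; simp at hab; omega
  obtain ⟨E, R, hR, hER⟩ := Nat.exists_eq_pow_mul_and_not_dvd (n := 48 * k) (by omega) q hq.ne_one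
  have hcop : ∀ N : ℕ, N ≡ 1 [MOD R] → N.Coprime q → N.Coprime (6 * k) := by
    intro N h1 h2
    have : N.Coprime (48 * k) := by
      rw [hER]
      refine Nat.Coprime.mul_right (h2.pow_right _) ?_
      have := h1.gcd_eq
      rw [Nat.coprime_comm, Nat.Coprime, Nat.gcd_comm, this]; simp
    exact this.coprime_dvd_right ⟨8, by ring⟩
  -- the Jacobi symbol reduces
  have hjac : ∀ N : ℕ, N.Coprime (6 * k) → jacobiSym k N = jacobiSym q N * jacobiSym m N := by
    intro N hN
    have hb : Int.gcd (b : ℤ) (N : ℤ) = 1 := by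
      rw [Int.gcd_natCast_natCast]
      refine (hN.coprime_dvd_right ?_).symm
      rw [← hab]; exact ⟨6 * b * (q * m), by ring⟩
    rw [← hab]; push_cast
    rw [jacobiSym.mul_left, jacobiSym.sq_one' hb, one_mul, jacobiSym.mul_left]
  have hm48 : ∀ d : ℕ, d ∣ 48 * k → ¬ q ∣ d → d ∣ R := by
    intro d hd hqd
    rw [hER] at hd
    exact (Nat.Coprime.pow_right E ((Nat.Prime.coprime_iff_not_dvd hq).mpr hqd).symm).dvd_of_dvd_mul_left hd
  have hnorm : ∀ A B : ℕ, nm (⟨A, B⟩ : GI) = A ^ 2 + B ^ 2 := by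
    intro A B; have := nm_cast (⟨A, B⟩ : GI); simp at this; exact_mod_cast this
  have hnR : ∀ A B : ℕ, A ≡ 1 [MOD R] → B ≡ 0 [MOD R] → A ^ 2 + B ^ 2 ≡ 1 [MOD R] := by
    intro A B h1 h2
    exact (h1.pow 2).add (h2.pow 2)
  by_cases h2 : q = 2
  · subst h2
    have hR16 : R.Coprime 16 := by
      rw [show 16 = 2 ^ 4 from rfl]; exact (Nat.Coprime.pow_right 4 ((Nat.Prime.coprime_iff_not_dvd Nat.prime_two).mpr hR).symm)
    obtain ⟨A, B, hA, hB, hA', hB'⟩ := crt_alpha R 16 hR16 15 2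
    have hA4 : A % 16 = 15 := hA'
    have hB4 : B % 16 = 2 := hB'
    have hP : Prim (⟨A, B⟩ : GI) := by
      unfold Prim; simp; omega
    set N := A ^ 2 + B ^ 2 with hN
    have hN8 : N % 8 = 5 := by
      obtain ⟨x, hx⟩ : ∃ x, A = 16 * x + 15 := ⟨A / 16, by omega⟩
      obtain ⟨y, hy⟩ : ∃ y, B = 16 * y + 2 := ⟨B / 16, by omega⟩
      rw [hN, hx, hy]; ring_nf; omega
    have hNc := hcop N (hnR A B hA hB) (by rw [Nat.coprime_two_right, Nat.odd_iff]; omega)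
    refine ⟨⟨A, B⟩, hP, by rwa [hnorm], ?_⟩
    rw [hnorm, hjac N hNc]
    have hmodd : Odd m := by rw [← Nat.not_even_iff_odd, even_iff_two_dvd]; exact hqm
    have e1 : jacobiSym (2 : ℕ) N = -1 := by
      push_cast
      rw [jacobiSym.at_two (by rw [Nat.odd_iff]; omega), ZMod.χ₈_nat_mod_eight, hN8]; rfl
    have hmR : m ∣ R := hm48 m ⟨48 * b ^ 2 * 2, by rw [← hab]; ring⟩ hqm
    have e2 : jacobiSym m N = 1 := by
      rw [jacobiSym.quadratic_reciprocity_one_mod_four' hmodd (by omega)]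
      have h1 : N ≡ 1 [MOD m] := (hnR A B hA hB).of_dvd hmR
      rw [jacobiSym.mod_left' (a₂ := 1), jacobiSym.one_left]
      exact_mod_cast h1
    rw [e1, e2]; norm_num
  · obtain ⟨a, ha⟩ := exists_nonres q h2
    have hRq : R.Coprime q := ((Nat.Prime.coprime_iff_not_dvd hq).mpr hR).symm
    obtain ⟨A, B, hA, hB, hA', hB'⟩ := crt_alpha R q hRq a 1
    have hqodd : Odd q := hq.odd_of_ne_two h2
    have h16 : 16 ∣ R := by
      apply hm48 16 ⟨3 * k, by ring⟩
      intro h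
      rw [show 16 = 2 ^ 4 from rfl] at h
      exact h2 ((Nat.prime_dvd_prime_iff_eq hq Nat.prime_two).mp (hq.dvd_of_dvd_pow h))
    have hA4 : A % 16 = 1 := hA.of_dvd h16
    have hB4 : B % 16 = 0 := hB.of_dvd h16
    have hP : Prim (⟨A, B⟩ : GI) := by
      unfold Prim; simp; omega
    set N := A ^ 2 + B ^ 2 with hN
    have hN4 : N % 4 = 1 := by
      rw [hN, ← hnorm]; exact Prim_nm hP
    have hNq : N ≡ a ^ 2 + 1 [MOD q] := by
      have := (hA'.pow 2).add (hB'.pow 2); simpa using this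
    have e1 : jacobiSym q N = -1 := by
      rw [jacobiSym.quadratic_reciprocity_one_mod_four' hqodd hN4, ← jacobiSym.legendreSym.to_jacobiSym, ← ha]
      rw [jacobiSym.legendreSym.to_jacobiSym, jacobiSym.legendreSym.to_jacobiSym]
      apply jacobiSym.mod_left'
      exact_mod_cast hNq
    have hNcq : N.Coprime q := by
      by_contra h
      have : jacobiSym q N = 0 := by
        rw [jacobiSym.eq_zero_iff]
        refine ⟨by rintro h; rw [h] at hN4; simp at hN4, ?_⟩
        rw [Int.gcd_natCast_natCast]; intro h'; exact h (Nat.coprime_comm.mp h')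
      rw [this] at e1; norm_num at e1
    have hNc := hcop N (hnR A B hA hB) hNcq
    refine ⟨⟨A, B⟩, hP, by rwa [hnorm], ?_⟩
    rw [hnorm, hjac N hNc, e1]
    have h4m : 4 * m ∣ R := by
      apply hm48 (4 * m) ⟨12 * b ^ 2 * q, by rw [← hab]; ring⟩
      intro h
      rcases (Nat.Prime.dvd_mul hq).mp h with h | h
      · rw [show 4 = 2 ^ 2 from rfl] at h
        exact h2 ((Nat.prime_dvd_prime_iff_eq hq Nat.prime_two).mp (hq.dvd_of_dvd_pow h))
      · exact hqm h
    have e2 : jacobiSym m N = 1 := by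
      rw [jacobiSym.mod_right' m (by rw [Nat.odd_iff]; omega)]
      have h1 : N ≡ 1 [MOD 4 * m] := (hnR A B hA hB).of_dvd h4m
      rw [h1, ← jacobiSym.mod_right' m odd_one, jacobiSym.one_right]
    rw [e2]; norm_num

lemma exists_jac_neg_int (n : ℤ) (hn : n ≠ 0) (hns : ¬ IsSquare n) : 
    ∃ b : ℕ, b.Coprime 6 ∧ b.Coprime n.natAbs ∧ jacobiSym n b = -1 := by
  by_cases hsq : IsSquare n.natAbs
  · have hneg : n < 0 := by
      by_contra h
      push Not at h
      apply hns
      obtain ⟨r, hr⟩ := hsq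
      refine ⟨r, ?_⟩
      have : (n.natAbs : ℤ) = n := Int.natAbs_of_nonneg h
      rw [← this, hr]; push_cast; ring
    obtain ⟨r, hr⟩ := hsq
    have hr0 : 0 < r := by
      rcases Nat.eq_zero_or_pos r with h | h
      · rw [h] at hr; simp at hr; exact absurd hr hn
      · exact h
    have h12 : 1 ≤ r * r := Nat.mul_pos hr0 hr0
    refine ⟨12 * (r * r) - 1, ?_, ?_, ?_⟩
    · have : Nat.Coprime (12 * (r * r) - 1) (12 * (r * r)) := by
        rw [Nat.coprime_comm, Nat.coprime_self_sub_right (by omega)]; simp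
      exact this.coprime_dvd_right ⟨2 * (r * r), by ring⟩
    · have : Nat.Coprime (12 * (r * r) - 1) (12 * (r * r)) := by
        rw [Nat.coprime_comm, Nat.coprime_self_sub_right (by omega)]; simp
      rw [hr]
      exact this.coprime_dvd_right ⟨12, by ring⟩
    · have hn' : n = -((r : ℤ) ^ 2) := by
        have : (n.natAbs : ℤ) = -n := Int.ofNat_natAbs_of_nonpos hneg.le
        rw [hr] at this; push_cast at this; linarith
      have hodd : Odd (12 * (r * r) - 1) := by rw [Nat.odd_iff]; omega
      rw [hn', jacobiSym.neg _ hodd, jacobiSym.sq_one', ZMod.χ₄_nat_three_mod_four (by omega)]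
      · norm_num
      · rw [Int.gcd_natCast_natCast]
        have : Nat.Coprime (12 * (r * r) - 1) (12 * (r * r)) := by
          rw [Nat.coprime_comm, Nat.coprime_self_sub_right (by omega)]; simp
        exact (this.coprime_dvd_right ⟨12 * r, by ring⟩).symm
  · obtain ⟨α, hP, hc, hj⟩ := exists_jac_neg n.natAbs (by omega) hsq
    refine ⟨nm α, hc.coprime_dvd_right (Dvd.intro _ rfl), hc.coprime_dvd_right (Dvd.intro_left _ rfl), ?_⟩
    rcases Int.natAbs_eq n with h | h
    · rw [h]; exact hj
    · rw [h, jac_neg_nm _ hP]; exact hj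

/-- the quadratic character `b ↦ (n/b)` on `b` coprime to 6 -/
noncomputable def gr (n : ℤ) (b : ℕ) : ℝ := if b.Coprime 6 then (jacobiSym n b : ℝ) else 0

noncomputable def gq (n : ℤ) (b : ℕ) : ℂ := (gr n b : ℂ)

lemma gr_zero (n : ℤ) : gr n 0 = 0 := by unfold gr; rw [if_neg (by decide)]

lemma gr_one (n : ℤ) : gr n 1 = 1 := by unfold gr; rw [if_pos (by decide), jacobiSym.one_right]; simp

lemma gr_mul (n : ℤ) (a b : ℕ) : gr n (a * b) = gr n a * gr n b := by
  unfold gr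
  by_cases ha : a.Coprime 6
  · by_cases hb : b.Coprime 6
    · rw [if_pos ha, if_pos hb, if_pos (Nat.Coprime.mul_left ha hb), jacobiSym.mul_right']
      · push_cast; rfl
      · rintro rfl; revert ha; decide
      · rintro rfl; revert hb; decide
    · rw [if_neg hb, if_neg (fun h => hb (Nat.Coprime.coprime_mul_left h))]; simp
  · rw [if_neg ha, if_neg (fun h => ha (Nat.Coprime.coprime_mul_right h))]; simp

lemma gr_mul_left (n m : ℤ) (b : ℕ) : gr (n * m) b = gr n b * gr m b := by
  unfold gr
  split_ifs
  · rw [jacobiSym.mul_left]; push_cast; rfl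
  · simp

lemma gr_tri (n : ℤ) (b : ℕ) : gr n b = 0 ∨ gr n b = 1 ∨ gr n b = -1 := by
  unfold gr
  split_ifs
  · rcases jacobiSym.trichotomy n b with h | h | h <;> rw [h] <;> simp
  · left; rfl

lemma gr_abs (n : ℤ) (b : ℕ) : |gr n b| ≤ 1 := by
  rcases gr_tri n b with h | h | h <;> rw [h] <;> norm_num

lemma gq_norm (n : ℤ) (b : ℕ) : ‖gq n b‖ ≤ 1 := by
  unfold gq; rw [Complex.norm_real]; exact gr_abs n b

lemma gr_per (n : ℤ) (b : ℕ) : gr n (b + 12 * n.natAbs) = gr n b := by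
  unfold gr
  have hc : (b + 12 * n.natAbs).Coprime 6 ↔ b.Coprime 6 := by
    rw [show b + 12 * n.natAbs = b + (2 * n.natAbs) * 6 by ring, Nat.coprime_add_mul_right_left]
  simp only [hc]
  by_cases h : b.Coprime 6
  · have hodd : Odd b := by
      have : b.Coprime 2 := h.coprime_dvd_right (by norm_num)
      rwa [Nat.coprime_two_right] at this
    rw [if_pos h, if_pos h, jacobiSym.mod_right n hodd, jacobiSym.mod_right n (b := b + 12 * n.natAbs)]
    · rw [show b + 12 * n.natAbs = b + (4 * n.natAbs) * 3 by ring, Nat.add_mul_mod_self_left]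
    · rw [Nat.odd_iff] at *; omega
  · rw [if_neg h, if_neg h]

lemma gq_base (n : ℤ) : BaseF (gq n) where
  zero := by unfold gq; rw [gr_zero]; simp
  one := by unfold gq; rw [gr_one]; simp
  mult := by intro a b _; unfold gq; rw [gr_mul]; push_cast; rfl
  van := by intro b hb; unfold gq gr; rw [if_neg hb]; simp
  pow := by
    intro p j _
    exact (gq_norm n _).trans (one_le_pow₀ (by norm_num))
  cnt := by
    intro N
    calc _ ≤ ∑ b ∈ Icc 1 N, (1:ℝ) := sum_le_sum fun b _ => gq_norm n b
      _ ≤ 9 * N := by simp; linarith [Nat.cast_nonneg (α := ℝ) N]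

lemma gq_sum_zero (n : ℤ) (hn : n ≠ 0) (hns : ¬ IsSquare n) : ∑ r ∈ range (12 * n.natAbs), gq n r = 0 := by
  obtain ⟨b, hb6, hbn, hbj⟩ := exists_jac_neg_int n hn hns
  set M := 12 * n.natAbs with hM
  have hM0 : 0 < M := by omega
  have : NeZero M := ⟨hM0.ne'⟩
  have hbM : b.Coprime M := by
    have h2 : b.Coprime (6 * 2) := Nat.Coprime.mul_right hb6 (hb6.coprime_dvd_right (by norm_num))
    exact Nat.Coprime.mul_right h2 hbn
  have hper : ∀ c r : ℕ, gr n (r + M * c) = gr n r := by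
    intro c r
    induction c with
    | zero => simp
    | succ c ih => rw [show r + M * (c + 1) = (r + M * c) + M by ring, gr_per, ih]
  have hmod : ∀ c d : ℕ, (c : ZMod M) = d → gr n c = gr n d := by
    intro c d h
    rw [ZMod.natCast_eq_natCast_iff'] at h
    rw [← Nat.mod_add_div c M, ← Nat.mod_add_div d M, hper, hper, h]
  have hsum : ∑ r ∈ range M, gr n r = ∑ x : ZMod M, gr n x.val := by
    refine sum_bij' (fun r _ => (r : ZMod M)) (fun x _ => x.val) ?_ ?_ ?_ ?_ ?_
    · intros; simp
    · intro x _; rw [mem_range]; exact ZMod.val_lt x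
    · intro r hr; exact ZMod.val_cast_of_lt (mem_range.mp hr)
    · intro x _; exact ZMod.natCast_zmod_val x
    · intro r hr; rw [ZMod.val_cast_of_lt (mem_range.mp hr)]
  have hmul : ∑ x : ZMod M, gr n x.val = ∑ x : ZMod M, gr n b * gr n x.val := by
    let u := ZMod.unitOfCoprime b hbM
    rw [← Equiv.sum_comp (Units.mulLeft u)]
    apply sum_congr rfl
    intro x _
    rw [← gr_mul]
    apply hmod
    simp [u]
  have hb1 : gr n b = -1 := by unfold gr; rw [if_pos hb6, hbj]; simp
  rw [hb1, ← hsum, ← mul_sum] at hmul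
  have h0 : ∑ r ∈ range M, gr n r = 0 := by
    rw [← hsum] at hmul; linarith
  unfold gq
  rw [← Complex.ofReal_sum, h0]; simp

lemma gq_good (n : ℤ) (hn : n ≠ 0) (hns : ¬ IsSquare n) : GoodF (gq n) (12 * n.natAbs) where
  toBaseF := gq_base n
  hK := by
    have : (1:ℝ) ≤ n.natAbs := by exact_mod_cast Int.natAbs_pos.mpr hn
    linarith
  canc := by
    intro N
    rcases Nat.eq_zero_or_pos N with rfl | hN
    · simp
    have h := per_canc (12 * n.natAbs) (by have := Int.natAbs_pos.mpr hn; omega) (gq n) (gq_norm n) 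
      (fun a => by unfold gq; rw [gr_per]) (gq_sum_zero n hn hns) (N + 1)
    have e : ∑ n_1 ∈ range (N + 1), gq n n_1 = ∑ b ∈ Icc 1 N, gq n b := by
      rw [range_eq_Ico, sum_eq_sum_Ico_succ_bot (by omega), (gq_base n).zero, zero_add]; rfl
    rw [e] at h
    have h1 : (1:ℝ) ≤ Real.sqrt N := by
      rw [Real.one_le_sqrt]; exact_mod_cast hN
    have h2 : (0:ℝ) ≤ 12 * n.natAbs := by positivity
    push_cast at h
    nlinarith

lemma LL_le_cnt (f : ℕ → ℂ) (hc : ∀ N : ℕ, ∑ n ∈ Icc 1 N, ‖f n‖ ≤ 9 * N) (s : ℝ) (hs : 0 < s) (h1 : s ≤ 1) : ‖LL f s‖ ≤ 18 / s := by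
  rw [LL_eq f hc s hs, norm_mul]
  have hI : ‖∫ t in Set.Ioi (1 : ℝ), (∑ k ∈ Icc 1 ⌊t⌋₊, f k) * (t : ℂ) ^ (-(((1 + s : ℝ) : ℂ) + 1))‖ ≤ 
      ∫ t in Set.Ioi (1 : ℝ), 9 * t ^ (-1 - s) := by
    apply MeasureTheory.norm_integral_le_of_norm_le
    · exact (integrableOn_Ioi_rpow_of_lt (by linarith) one_pos).const_mul 9
    · rw [MeasureTheory.ae_restrict_iff' measurableSet_Ioi]
      refine Filter.Eventually.of_forall fun t ht => ?_
      have ht1 : (1:ℝ) < t := ht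
      have ht0 : (0:ℝ) < t := by linarith
      rw [norm_mul, Complex.norm_cpow_eq_rpow_re_of_pos ht0]
      have e : (-(((1 + s : ℝ) : ℂ) + 1)).re = -1 - s - 1 := by simp; ring
      rw [e]
      have h2 := sum_cnt f hc ⌊t⌋₊
      have h3 : (⌊t⌋₊ : ℝ) ≤ t := Nat.floor_le ht0.le
      have h4 : t ^ (-1 - s) = t * t ^ (-1 - s - 1) := by
        rw [Real.rpow_sub_one ht0.ne']; field_simp
      rw [h4, ← mul_assoc]
      apply mul_le_mul_of_nonneg_right (by linarith) (by positivity)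
  rw [MeasureTheory.integral_const_mul, integral_Ioi_rpow_of_lt (by linarith) one_pos] at hI
  have e2 : -(1:ℝ) ^ (-1 - s + 1) / (-1 - s + 1) = 1 / s := by
    rw [Real.one_rpow]; rw [show -1 - s + 1 = -s by ring]; rw [neg_div_neg_eq]
  rw [e2] at hI
  have h5 : ‖((1 + s : ℝ) : ℂ)‖ ≤ 2 := by
    rw [Complex.norm_real, Real.norm_of_nonneg (by linarith)]; linarith
  calc _ ≤ 2 * (9 * (1 / s)) := mul_le_mul h5 hI (norm_nonneg _) (by norm_num)
    _ = 18 / s := by ring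

lemma BaseF.LL_le {f : ℕ → ℂ} (hf : BaseF f) (s : ℝ) (hs : 0 < s) (h1 : s ≤ 1) : ‖LL f s‖ ≤ 18 / s := LL_le_cnt f hf.cnt s hs h1

lemma BaseF.PP_le {f : ℕ → ℂ} (hf : BaseF f) (s : ℝ) (hs : 0 < s) : PP f s ≤ Real.log ‖LL f s‖ + cP := by
  have := abs_le.mp (hf.log_bound s hs); linarith

lemma BaseF.le_PP {f : ℕ → ℂ} (hf : BaseF f) (s : ℝ) (hs : 0 < s) : Real.log ‖LL f s‖ - cP ≤ PP f s := by
  have := abs_le.mp (hf.log_bound s hs); linarith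

lemma BaseF.LL_pos {f : ℕ → ℂ} (hf : BaseF f) (s : ℝ) (hs : 0 < s) : 0 < ‖LL f s‖ := 
  norm_pos_iff.mpr (hf.log_eq s hs).1

lemma fk_base (k : ℕ) (hk : 0 < k) : BaseF (fk k) := (xi_GChar k hk).base

lemma xi_nontriv (k : ℕ) (hk : 0 < k) (hns : ¬ IsSquare k) : NonTriv (xi k) (48 * k) := by
  obtain ⟨α, hP, hc, hj⟩ := exists_jac_neg k hk hns
  have h2 : (nm α).Coprime 2 := hc.coprime_dvd_right ⟨3 * k, by ring⟩
  have h3 : (nm α).Coprime (6 * k) := hc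
  refine ⟨α, hP, ?_, ?_⟩
  · rw [show 48 * k = 2 ^ 3 * (6 * k) by ring]
    exact Nat.Coprime.mul_right (h2.pow_right 3) h3
  · intro h
    have h4 : ¬ 3 ∣ nm α := by
      have : (nm α).Coprime 3 := hc.coprime_dvd_right ⟨2 * k, by ring⟩
      exact (Nat.Prime.coprime_iff_not_dvd Nat.prime_three).mp this.symm
    have := xi_sq k hk hP h4
    rw [h, hj] at this; norm_num at this

lemma fk_good (k : ℕ) (hk : 0 < k) (hns : ¬ IsSquare k) : GoodF (fk k) (12 * (48 * k : ℕ)) := 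
  (xi_GChar k hk).good (xi_nontriv k hk hns)

lemma gr_neg_3 (n : ℤ) (p : ℕ) (h : p % 4 = 3) : gr (-n) p = - gr n p := by
  unfold gr
  split_ifs
  · rw [jacobiSym.neg _ (by rw [Nat.odd_iff]; omega), ZMod.χ₄_nat_three_mod_four h]; push_cast; ring
  · simp

lemma gr_neg_1 (n : ℤ) (p : ℕ) (h : p % 4 = 1) : gr (-n) p = gr n p := by
  unfold gr
  split_ifs
  · rw [jacobiSym.neg _ (by rw [Nat.odd_iff]; omega), ZMod.χ₄_nat_one_mod_four h]; push_cast; ring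
  · simp

lemma prime_cases (p : ℕ) (hp : p.Prime) : p = 2 ∨ p % 4 = 1 ∨ p % 4 = 3 := by
  rcases hp.eq_two_or_odd with h | h <;> omega

lemma gr_two (n : ℤ) : gr n 2 = 0 := by unfold gr; rw [if_neg (by decide)]

lemma cop6 (p : ℕ) (hp : p.Prime) (h : p % 4 = 1) : p.Coprime 6 := by
  rw [Nat.Prime.coprime_iff_not_dvd hp]
  intro hd
  have := Nat.le_of_dvd (by norm_num) hd
  have := hp.two_le
  interval_cases p <;> omega

lemma gr_jac (n : ℤ) (p : ℕ) (hp : p.Prime) (h : p % 4 = 1) : gr n p = (jacobiSym n p : ℝ) := by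
  unfold gr; rw [if_pos (cop6 p hp h)]

lemma fk_ne1 (k p : ℕ) (h : p % 4 ≠ 1) : fk k p = 0 := by
  unfold fk cf; rw [PS_empty h]; simp

lemma Ak_formula (k : ℕ) (hk : 0 < k) (p : ℕ) (hp : p.Prime) : 
    Ak k p = (fk k p).re + (gr k p + gr (-k) p) / 2 := by
  have : Fact p.Prime := ⟨hp⟩
  unfold Ak
  rcases prime_cases p hp with rfl | h | h
  · rw [gr_two, gr_two, fk_ne1 _ _ (by norm_num)]; simp
  · rw [if_pos h, nSol_formula k hk p h, gr_neg_1 _ _ h, gr_jac _ _ hp h]; push_cast; ring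
  · rw [if_neg (by omega), gr_neg_3 _ _ h, fk_ne1 _ _ (by omega)]; simp

lemma Ak_ge (k p : ℕ) : -1 ≤ Ak k p := by
  unfold Ak; split_ifs
  · have : (0:ℝ) ≤ nSol k 4 p := Nat.cast_nonneg _
    linarith
  · norm_num

lemma nSol_le4 (k : ℤ) (p : ℕ) (hp : p.Prime) : nSol k 4 p ≤ 4 := by
  have : Fact p.Prime := ⟨hp⟩
  rw [nSol_eq]
  have h := Polynomial.card_nthRoots (R := ZMod p) 4 (-(k : ZMod p))
  refine le_trans ?_ h
  refine le_trans (Finset.card_le_card (t := (Polynomial.nthRoots 4 (-(k : ZMod p))).toFinset) ?_) (Multiset.toFinset_card_le _)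
  intro x hx
  rw [mem_filter] at hx
  rw [Multiset.mem_toFinset, Polynomial.mem_nthRoots (by norm_num)]; exact hx.2

lemma Ak_le (k p : ℕ) (hp : p.Prime) : Ak k p ≤ 3 := by
  unfold Ak; split_ifs
  · have : (nSol k 4 p : ℝ) ≤ 4 := by exact_mod_cast nSol_le4 k p hp
    linarith
  · norm_num

lemma Ak_abs (k p : ℕ) (hp : p.Prime) : |Ak k p| ≤ 3 := by
  rw [abs_le]; constructor <;> linarith [Ak_ge k p, Ak_le k p hp]

lemma tfo (k : ℕ) (hk : 0 < k) (p : ℕ) (hp : p.Prime) : 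
    0 ≤ 3 * (gr 1 p + gr (-1) p) + 4 * (fk k p).re + (gr k p + gr (-k) p) := by
  have : Fact p.Prime := ⟨hp⟩
  rcases prime_cases p hp with rfl | h | h
  · rw [gr_two, gr_two, gr_two, gr_two, fk_ne1 _ _ (by norm_num)]; simp
  · have h1 := Ak_formula k hk p hp
    have h2 := Ak_ge k p
    rw [gr_neg_1 _ _ h] at *
    rw [gr_neg_1 _ _ h, gr_jac 1 _ hp h, jacobiSym.one_left]
    have h3 := (abs_le.mp (gr_abs k p)).2
    push_cast
    linarith
  · rw [gr_neg_3 _ _ h, gr_neg_3 _ _ h, fk_ne1 _ _ (by omega)]; simp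

lemma PP_gq (n : ℤ) (s : ℝ) : PP (gq n) s = ∑' p : Nat.Primes, gr n p * (p:ℝ) ^ (-(1 + s)) := by
  unfold PP gq; simp

lemma gq_summ (n : ℤ) (s : ℝ) (hs : 0 < s) : Summable fun p : Nat.Primes => gr n p * (p:ℝ) ^ (-(1 + s)) := by
  have := (gq_base n).PP_summ s hs
  simpa [gq] using this

lemma tfo_PP (k : ℕ) (hk : 0 < k) (s : ℝ) (hs : 0 < s) : 
    0 ≤ 3 * (PP (gq 1) s + PP (gq (-1)) s) + 4 * PP (fk k) s + (PP (gq k) s + PP (gq (-k)) s) := by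
  have h1 := gq_summ 1 s hs
  have h2 := gq_summ (-1) s hs
  have h3 := (fk_base k hk).PP_summ s hs
  have h4 := gq_summ k s hs
  have h5 := gq_summ (-k) s hs
  rw [PP_gq, PP_gq, PP_gq, PP_gq]
  unfold PP
  rw [← h1.tsum_add h2, ← tsum_mul_left, ← tsum_mul_left, ← h4.tsum_add h5, ← ((h1.add h2).mul_left 3).tsum_add (h3.mul_left 4),
    ← (((h1.add h2).mul_left 3).add (h3.mul_left 4)).tsum_add (h4.add h5)]
  apply tsum_nonneg
  intro p
  have := mul_nonneg (tfo k hk p p.2) (by positivity : (0:ℝ) ≤ (p:ℝ) ^ (-(1 + s)))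
  nlinarith [this]

lemma landau_PP (n m : ℤ) (s : ℝ) (hs : 0 < s) : 
    0 ≤ PP (gq 1) s + PP (gq n) s + PP (gq m) s + PP (gq (n * m)) s := by
  have h1 := gq_summ 1 s hs
  have h2 := gq_summ n s hs
  have h3 := gq_summ m s hs
  have h4 := gq_summ (n * m) s hs
  rw [PP_gq, PP_gq, PP_gq, PP_gq]
  rw [← h1.tsum_add h2, ← (h1.add h2).tsum_add h3, ← ((h1.add h2).add h3).tsum_add h4]
  apply tsum_nonneg
  intro p
  have h : 0 ≤ gr 1 p + gr n p + gr m p + gr (n * m) p := by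
    rw [gr_mul_left]
    by_cases hc : (p : ℕ).Coprime 6
    · have : gr 1 p = 1 := by unfold gr; rw [if_pos hc, jacobiSym.one_left]; simp
      rw [this]
      have ha := (abs_le.mp (gr_abs n p)).1
      have hb := (abs_le.mp (gr_abs m p)).1
      nlinarith
    · unfold gr; simp [hc]
  have := mul_nonneg h (by positivity : (0:ℝ) ≤ (p:ℝ) ^ (-(1 + s)))
  nlinarith [this]

/-- `Σ_p A_k(p) p^{-1-s}` -/
noncomputable def PA (k : ℕ) (s : ℝ) : ℝ := ∑' p : Nat.Primes, Ak k p * (p:ℝ) ^ (-(1 + s))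

lemma PA_summ (k : ℕ) (hk : 0 < k) (s : ℝ) (hs : 0 < s) : Summable fun p : Nat.Primes => Ak k p * (p:ℝ) ^ (-(1 + s)) := by
  have h3 := (fk_base k hk).PP_summ s hs
  have h4 := gq_summ k s hs
  have h5 := gq_summ (-k) s hs
  refine (h3.add ((h4.add h5).div_const 2)).congr ?_
  intro p
  rw [Ak_formula k hk p p.2]; ring

lemma PA_eq (k : ℕ) (hk : 0 < k) (s : ℝ) (hs : 0 < s) : PA k s = PP (fk k) s + (PP (gq k) s + PP (gq (-k)) s) / 2 := by
  have h3 := (fk_base k hk).PP_summ s hs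
  have h4 := gq_summ k s hs
  have h5 := gq_summ (-k) s hs
  rw [PP_gq, PP_gq]
  unfold PA PP
  rw [← h4.tsum_add h5, ← tsum_div_const, ← h3.tsum_add ((h4.add h5).div_const 2)]
  apply tsum_congr
  intro p
  rw [Ak_formula k hk p p.2]; ring

lemma GoodF.bd {f : ℕ → ℂ} {K : ℝ} (hf : GoodF f K) (y : ℝ) (hy : 1 < y) (hK : K ≤ y ^ 3) (s : ℝ) (hs : 0 < s) (h1 : s ≤ 1) : 
    ‖LL f s‖ ≤ 360 * Real.log y := by
  have h := (LL_bounds f K hf.hK hf.cnt hf.canc s s hs hs h1 h1).1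
  have hl : Real.log K ≤ 3 * Real.log y := by
    rw [show (3:ℝ) * Real.log y = Real.log (y ^ 3) by rw [Real.log_pow]; push_cast; ring]
    exact Real.log_le_log (by linarith [hf.hK]) hK
  linarith

lemma GoodF.lip {f : ℕ → ℂ} {K : ℝ} (hf : GoodF f K) (y : ℝ) (hy : 1 < y) (hK : K ≤ y ^ 3) (s s' : ℝ) (hs : 0 < s) (h1 : s ≤ 1) 
    (hs' : 0 < s') (h1' : s' ≤ 1) : 
    ‖LL f s - LL f s'‖ ≤ 9000 * |s - s'| * Real.log y ^ 2 := by
  have h := (LL_bounds f K hf.hK hf.cnt hf.canc s s' hs hs' h1 h1').2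
  have hl : Real.log K ≤ 3 * Real.log y := by
    rw [show (3:ℝ) * Real.log y = Real.log (y ^ 3) by rw [Real.log_pow]; push_cast; ring]
    exact Real.log_le_log (by linarith [hf.hK]) hK
  have hK0 : 0 ≤ Real.log K := Real.log_nonneg (by linarith [hf.hK])
  have h2 : Real.log K ^ 2 ≤ (3 * Real.log y) ^ 2 := pow_le_pow_left₀ hK0 hl 2
  calc _ ≤ _ := h
    _ ≤ 1000 * |s - s'| * (3 * Real.log y) ^ 2 := by gcongr
    _ = _ := by ring

lemma GoodF.lip_low {f : ℕ → ℂ} {K : ℝ} (hf : GoodF f K) (y : ℝ) (hy : 1 < y) (hK : K ≤ y ^ 3) (s s' c : ℝ) (hs : 0 < s) (hss : s ≤ s') 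
    (h1' : s' ≤ 1) (hc : 9000 * s' * Real.log y ^ 2 ≤ c) (hlow : 2 * c ≤ ‖LL f s'‖) : c ≤ ‖LL f s‖ := by
  have h := hf.lip y hy hK s' s (by linarith) h1' hs (by linarith)
  have h2 : |s' - s| ≤ s' := by rw [abs_of_nonneg (by linarith)]; linarith
  have h3 : 9000 * |s' - s| * Real.log y ^ 2 ≤ 9000 * s' * Real.log y ^ 2 := by gcongr
  have h4 := norm_sub_norm_le (LL f s') (LL f s)
  linarith

lemma evlog (C : ℝ) : ∀ᶠ y : ℝ in Filter.atTop, C ≤ Real.log y := Real.tendsto_log_atTop.eventually_ge_atTop C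

lemma neg_nonsq (n : ℤ) (hn : n < 0) : ¬ IsSquare n := by
  rintro ⟨r, hr⟩; nlinarith [mul_self_nonneg r]

lemma nat_nonsq (k : ℕ) (h : ¬ IsSquare k) : ¬ IsSquare (k : ℤ) := by
  rintro ⟨r, hr⟩
  apply h
  refine ⟨r.natAbs, ?_⟩
  zify; rw [hr]; exact (abs_mul_abs_self r).symm

lemma gq_PP_le (n : ℤ) (hn : n ≠ 0) (hns : ¬ IsSquare n) (y : ℝ) (hy : 12 ≤ y) (hny : (n.natAbs : ℝ) ≤ y ^ 2) (s : ℝ) (hs : 0 < s) (h1 : s ≤ 1) :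
    PP (gq n) s ≤ Real.log (Real.log y) + (Real.log 360 + cP) := by
  have hg := gq_good n hn hns
  have hb := hg.bd y (by linarith) (by nlinarith [sq_nonneg y]) s hs h1
  have h2 := hg.PP_le s hs
  have hp := hg.LL_pos s hs
  have hl : 0 < Real.log y := Real.log_pos (by linarith)
  have h3 := Real.log_le_log hp hb
  rw [Real.log_mul (by norm_num) hl.ne'] at h3
  linarith

lemma g1_PP_le (s : ℝ) (hs : 0 < s) (h1 : s ≤ 1) : PP (gq 1) s ≤ - Real.log s + (Real.log 18 + cP) := by
  have hb := (gq_base 1).LL_le s hs h1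
  have h2 := (gq_base 1).PP_le s hs
  have h3 := Real.log_le_log ((gq_base 1).LL_pos s hs) hb
  rw [Real.log_div (by norm_num) hs.ne'] at h3
  linarith

lemma gm1_PP_le (s : ℝ) (hs : 0 < s) (h1 : s ≤ 1) : PP (gq (-1)) s ≤ Real.log (Real.log 12) + (Real.log 360 + cP) := 
  gq_PP_le (-1) (by norm_num) (neg_nonsq _ (by norm_num)) 12 le_rfl (by norm_num) s hs h1

/-- lower bound for the quartic L-function -/
lemma f_lower : ∀ᶠ y : ℝ in Filter.atTop, ∀ k : ℕ, 0 < k → (k : ℝ) ≤ y → ¬ IsSquare k → ∀ s : ℝ, 0 < s → s ≤ (Real.log y ^ 16)⁻¹ → 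
    (Real.log y ^ 13)⁻¹ ≤ ‖LL (fk k) s‖ := by
  set C0 : ℝ := 3 * (Real.log 18 + cP) + 3 * (Real.log (Real.log 12) + (Real.log 360 + cP)) + 2 * (Real.log 360 + cP) + 4 * cP + 4 * Real.log 2 with hC0
  filter_upwards [Filter.eventually_ge_atTop 600, evlog 9000, (Real.tendsto_log_atTop.comp Real.tendsto_log_atTop).eventually_ge_atTop (C0 / 2)] with y hy hl hll
  intro k hk hky hns s hs hs1
  simp only [Function.comp] at hll
  set l := Real.log y with hldef
  have hl0 : 0 < l := by linarith
  have hf := fk_good k hk hns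
  set s1 := (l ^ 16)⁻¹ with hs1def
  have hs10 : 0 < s1 := by positivity
  have hs11 : s1 ≤ 1 := inv_le_one_of_one_le₀ (one_le_pow₀ (by linarith))
  have hk0 : (0:ℝ) < k := by exact_mod_cast hk
  refine hf.lip_low y (by linarith) ?_ s s1 _ hs hs1 hs11 ?_ ?_
  · push_cast; nlinarith [sq_nonneg y]
  · rw [hs1def, ← hldef]
    rw [show 9000 * (l ^ 16)⁻¹ * l ^ 2 = (9000 / l) * (l ^ 13)⁻¹ by field_simp]
    have : 9000 / l ≤ 1 := by rw [div_le_one hl0]; exact hl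
    nlinarith [show 0 < (l ^ 13)⁻¹ by positivity]
  · have ht := tfo_PP k hk s1 hs10
    have a1 := g1_PP_le s1 hs10 hs11
    have a2 := gm1_PP_le s1 hs10 hs11
    have hky2 : (k : ℝ) ≤ y ^ 2 := by nlinarith
    have a3 := gq_PP_le k (by exact_mod_cast hk.ne') (nat_nonsq k hns) y (by linarith) (by simpa using hky2) s1 hs10 hs11
    have a4 := gq_PP_le (-k) (by simp; omega) (neg_nonsq _ (by simpa using hk)) y (by linarith) (by simpa using hky2) s1 hs10 hs11
    have a5 := hf.PP_le s1 hs10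
    have e1 : Real.log s1 = - (16 * Real.log l) := by rw [hs1def, Real.log_inv, Real.log_pow]; push_cast; ring
    rw [e1] at a1
    rw [← hldef] at a3 a4
    have key : Real.log 2 - 13 * Real.log l ≤ Real.log ‖LL (fk k) s1‖ := by linarith
    rw [← Real.log_le_log_iff (by positivity) (hf.LL_pos s1 hs10), Real.log_mul (by norm_num) (by positivity), Real.log_inv, Real.log_pow]
    push_cast; linarith

/-- exceptional discriminants -/
def Exc (y : ℝ) (n : ℤ) : Prop := ‖LL (gq n) ((Real.log y ^ 8)⁻¹)‖ < (Real.log y ^ 5)⁻¹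

lemma exc_pair : ∀ᶠ y : ℝ in Filter.atTop, ∀ n m : ℤ, n ≠ 0 → m ≠ 0 → (n.natAbs : ℝ) ≤ y → (m.natAbs : ℝ) ≤ y → ¬ IsSquare n → ¬ IsSquare m → 
    Exc y n → Exc y m → IsSquare (n * m) := by
  set C0 : ℝ := (Real.log 18 + cP) + (Real.log 360 + cP) + 2 * cP with hC0
  filter_upwards [Filter.eventually_ge_atTop 600, evlog 9000, (Real.tendsto_log_atTop.comp Real.tendsto_log_atTop).eventually_gt_atTop C0] with y hy hl hll
  intro n m hn hm hny hmy hns hms h1 h2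
  simp only [Function.comp] at hll
  by_contra hsq
  unfold Exc at h1 h2
  set l := Real.log y with hldef
  have hl0 : 0 < l := by linarith
  set s1 := (l ^ 8)⁻¹ with hs1def
  have hs10 : 0 < s1 := by positivity
  have hs11 : s1 ≤ 1 := inv_le_one_of_one_le₀ (one_le_pow₀ (by linarith))
  have ht := landau_PP n m s1 hs10
  have a1 := g1_PP_le s1 hs10 hs11
  have a2 := gq_PP_le (n * m) (mul_ne_zero hn hm) hsq y (by linarith) (by
    rw [Int.natAbs_mul]; push_cast; rw [pow_two]
    exact mul_le_mul hny hmy (by positivity) (by linarith)) s1 hs10 hs11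
  have a3 := (gq_base n).PP_le s1 hs10
  have a4 := (gq_base m).PP_le s1 hs10
  have e1 : Real.log s1 = - (8 * Real.log l) := by rw [hs1def, Real.log_inv, Real.log_pow]; push_cast; ring
  have b1 := Real.log_le_log ((gq_base n).LL_pos s1 hs10) h1.le
  have b2 := Real.log_le_log ((gq_base m).LL_pos s1 hs10) h2.le
  rw [Real.log_inv, Real.log_pow] at b1 b2
  push_cast at b1 b2
  rw [e1] at a1
  linarith

lemma nonexc : ∀ᶠ y : ℝ in Filter.atTop, ∀ n : ℤ, n ≠ 0 → (n.natAbs : ℝ) ≤ y → ¬ IsSquare n → ¬ Exc y n → 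
    ∀ s : ℝ, 0 < s → s ≤ (Real.log y ^ 16)⁻¹ → (Real.log y ^ 6)⁻¹ ≤ ‖LL (gq n) s‖ := by
  filter_upwards [Filter.eventually_ge_atTop 600, evlog 18000] with y hy hl
  intro n hn hny hns hex s hs hs1
  unfold Exc at hex
  push Not at hex
  have hf := gq_good n hn hns
  set l := Real.log y with hldef
  have hl0 : 0 < l := by linarith
  set s1 := (l ^ 8)⁻¹ with hs1def
  have hs10 : 0 < s1 := by positivity
  have hs11 : s1 ≤ 1 := inv_le_one_of_one_le₀ (one_le_pow₀ (by linarith))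
  have hss : s ≤ s1 := hs1.trans (inv_anti₀ (by positivity) (pow_le_pow_right₀ (by linarith) (by norm_num)))
  have h5 : (l ^ 6)⁻¹ ≤ (l ^ 5)⁻¹ / 2 := by
    rw [show (l ^ 6)⁻¹ = (l ^ 5)⁻¹ * l⁻¹ by field_simp, div_eq_mul_inv]
    gcongr; linarith
  refine h5.trans ?_
  refine hf.lip_low y (by linarith) ?_ s s1 _ hs hss hs11 ?_ ?_
  · nlinarith [sq_nonneg y]
  · rw [hs1def, ← hldef]
    rw [show 9000 * (l ^ 8)⁻¹ * l ^ 2 = (18000 / l) * ((l ^ 5)⁻¹ / 2) by field_simp; norm_num]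
    have : 18000 / l ≤ 1 := by rw [div_le_one hl0]; exact hl
    nlinarith [show 0 < (l ^ 5)⁻¹ by positivity]
  · linarith

/-- Abel's theorem for Dirichlet series (finite form). -/
lemma abel_dir (a : ℕ → ℝ) (S : ℝ) (h : Filter.Tendsto (fun N => ∑ n ∈ range N, a (n+1)) Filter.atTop (nhds S)) 
    (F : ℝ → ℝ) (hF : ∀ s, 0 < s → Filter.Tendsto (fun N => ∑ n ∈ range N, a (n+1) * ((n+1:ℕ):ℝ) ^ (-s)) Filter.atTop (nhds (F s))) :
    Filter.Tendsto F (nhdsWithin 0 (Set.Ioi 0)) (nhds S) := by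
  set A : ℕ → ℝ := fun N => ∑ n ∈ range N, a (n+1) with hA
  have hw : ∀ (s : ℝ), 0 < s → ∀ n : ℕ, ((n+2:ℕ):ℝ)^(-s) ≤ ((n+1:ℕ):ℝ)^(-s) := by
    intro s hs n
    apply Real.rpow_le_rpow_of_nonpos (by positivity) (by push_cast; linarith) (by linarith)
  -- summation by parts
  have hsp : ∀ s : ℝ, ∀ N : ℕ, ∑ n ∈ range N, a (n+1) * ((n+1:ℕ):ℝ) ^ (-s) - S = 
      (A N - S) * ((N+1:ℕ):ℝ)^(-s) + ∑ n ∈ range N, (A (n+1) - S) * (((n+1:ℕ):ℝ)^(-s) - ((n+2:ℕ):ℝ)^(-s)) := by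
    intro s N
    induction N with
    | zero => simp [hA]
    | succ N ih =>
      rw [sum_range_succ, sum_range_succ]
      have e : A (N+1) = A N + a (N+1) := by simp only [hA]; rw [sum_range_succ]
      have : ∀ x : ℝ, ∑ n ∈ range N, a (n+1) * ((n+1:ℕ):ℝ) ^ (-s) + x - S = (∑ n ∈ range N, a (n+1) * ((n+1:ℕ):ℝ) ^ (-s) - S) + x := by intro x; ring
      rw [this, ih, e]
      ring
  have htel : ∀ s : ℝ, ∀ N : ℕ, ∑ n ∈ range N, (((n+1:ℕ):ℝ)^(-s) - ((n+2:ℕ):ℝ)^(-s)) = 1 - ((N+1:ℕ):ℝ)^(-s) := by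
    intro s N
    rw [Finset.sum_range_sub' (fun n => ((n+1:ℕ):ℝ)^(-s))]
    simp
  rw [Metric.tendsto_nhds]
  intro ε hε
  obtain ⟨N0, hN0⟩ := (Metric.tendsto_atTop.mp h) (ε/4) (by positivity)
  set D : ℝ := ∑ n ∈ range N0, |A (n+1) - S| with hD
  have hDn : 0 ≤ D := sum_nonneg fun _ _ => abs_nonneg _
  have hlim : Filter.Tendsto (fun s : ℝ => D * (1 - ((N0+1:ℕ):ℝ)^(-s))) (nhdsWithin 0 (Set.Ioi 0)) (nhds 0) := by
    have : ContinuousAt (fun s : ℝ => D * (1 - ((N0+1:ℕ):ℝ)^(-s))) 0 := by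
      have h0 : ((N0+1:ℕ):ℝ) ≠ 0 := by positivity
      have := (Real.continuousAt_const_rpow (a := ((N0+1:ℕ):ℝ)) (b := -(0:ℝ)) h0).comp (f := fun s : ℝ => -s) (continuous_neg.continuousAt)
      exact (continuousAt_const.sub this).const_mul D
    have := this.tendsto
    simp only [neg_zero, Real.rpow_zero, sub_self, mul_zero] at this
    exact this.mono_left nhdsWithin_le_nhds
  filter_upwards [hlim.eventually (gt_mem_nhds (show (0:ℝ) < ε/4 by positivity)), self_mem_nhdsWithin] with s hs1 hs
  have hs : 0 < s := hs
  rw [Real.dist_eq]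
  have hb : ∀ N ≥ N0, |∑ n ∈ range N, a (n+1) * ((n+1:ℕ):ℝ) ^ (-s) - S| ≤ 3 * (ε/4) := by
    intro N hN
    rw [hsp]
    have hle1 : ((N+1:ℕ):ℝ)^(-s) ≤ 1 := Real.rpow_le_one_of_one_le_of_nonpos (by push_cast; linarith [(Nat.cast_nonneg N : (0:ℝ) ≤ N)]) (by linarith)
    have hpos : 0 ≤ ((N+1:ℕ):ℝ)^(-s) := by positivity
    have h1 : |(A N - S) * ((N+1:ℕ):ℝ)^(-s)| ≤ ε/4 * ((N+1:ℕ):ℝ)^(-s) := by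
      rw [abs_mul, abs_of_nonneg hpos]
      have := hN0 N hN; rw [Real.dist_eq] at this
      gcongr
    have h2 : |∑ n ∈ range N, (A (n+1) - S) * (((n+1:ℕ):ℝ)^(-s) - ((n+2:ℕ):ℝ)^(-s))| ≤ ∑ n ∈ range N, ((if n < N0 then |A (n+1) - S| * (1 - ((N0+1:ℕ):ℝ)^(-s)) else 0) + ε/4 * (((n+1:ℕ):ℝ)^(-s) - ((n+2:ℕ):ℝ)^(-s))) := by
      refine (abs_sum_le_sum_abs _ _).trans (sum_le_sum fun n _ => ?_)
      have hd : 0 ≤ ((n+1:ℕ):ℝ)^(-s) - ((n+2:ℕ):ℝ)^(-s) := sub_nonneg.mpr (hw s hs n)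
      rw [abs_mul, abs_of_nonneg hd]
      split_ifs with hn
      · have : ((n+1:ℕ):ℝ)^(-s) - ((n+2:ℕ):ℝ)^(-s) ≤ 1 - ((N0+1:ℕ):ℝ)^(-s) := by
          have a1 : ((n+1:ℕ):ℝ)^(-s) ≤ 1 := Real.rpow_le_one_of_one_le_of_nonpos (by push_cast; linarith [(Nat.cast_nonneg n : (0:ℝ) ≤ n)]) (by linarith)
          have a2 : ((N0+1:ℕ):ℝ)^(-s) ≤ ((n+2:ℕ):ℝ)^(-s) := by
            apply Real.rpow_le_rpow_of_nonpos (by positivity) _ (by linarith)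
            exact_mod_cast (by omega)
          linarith
        have := mul_le_mul_of_nonneg_left this (abs_nonneg (A (n+1) - S))
        have : 0 ≤ ε/4 * (((n+1:ℕ):ℝ)^(-s) - ((n+2:ℕ):ℝ)^(-s)) := by positivity
        linarith
      · rw [zero_add]
        have := hN0 (n+1) (by omega); rw [Real.dist_eq] at this
        gcongr
    rw [sum_add_distrib, ← mul_sum, htel] at h2
    have h3 : ∑ n ∈ range N, (if n < N0 then |A (n+1) - S| * (1 - ((N0+1:ℕ):ℝ)^(-s)) else 0) = D * (1 - ((N0+1:ℕ):ℝ)^(-s)) := by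
      rw [← sum_filter, hD, sum_mul]
      apply sum_congr _ (fun _ _ => rfl)
      ext n; simp; omega
    rw [h3] at h2
    refine (abs_add_le _ _).trans ?_
    have : ε/4 * ((N+1:ℕ):ℝ)^(-s) ≤ ε/4 := by nlinarith
    nlinarith
  have := le_of_tendsto ((hF s hs).sub_const S).abs (Filter.eventually_atTop.mpr ⟨N0, hb⟩)
  linarith

lemma hd_eq {f g : ℝ → ℝ} {a b x : ℝ} (h : HasDerivAt f a x) (hf : ∀ z, g z = f z) (ha : b = a) : HasDerivAt g b x := by
  have : g = f := funext hf
  rw [this, ha]; exact h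

lemma nonneg_of_deriv (f f' : ℝ → ℝ) (h : ∀ x, 0 ≤ x → HasDerivAt f (f' x) x) (h' : ∀ x, 0 ≤ x → 0 ≤ f' x) (h0 : 0 ≤ f 0) (x : ℝ) (hx : 0 ≤ x) : 0 ≤ f x := by
  have : MonotoneOn f (Set.Ici 0) := by
    apply monotoneOn_of_deriv_nonneg (convex_Ici 0) (fun x hx => (h x hx).continuousAt.continuousWithinAt)
    · intro x hx
      rw [interior_Ici] at hx
      exact (h x (le_of_lt hx)).differentiableAt.differentiableWithinAt
    · intro x hx
      rw [interior_Ici] at hx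
      rw [(h x (le_of_lt hx)).deriv]
      exact h' x (le_of_lt hx)
  exact h0.trans (this (Set.mem_Ici.mpr le_rfl) hx hx)

lemma sinh_ineq (u : ℝ) (hu : 0 ≤ u) : u ^ 3 * Real.cosh u ≤ Real.sinh u ^ 3 := by
  have hc : ∀ u : ℝ, 0 < Real.cosh u := Real.cosh_pos
  have ht : ∀ u, HasDerivAt (fun u : ℝ => Real.sinh u / Real.cosh u) (1 / Real.cosh u ^ 2) u := by
    intro u
    have := (Real.hasDerivAt_sinh u).div (Real.hasDerivAt_cosh u) (hc u).ne'
    refine hd_eq this (fun _ => rfl) ?_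
    have := Real.cosh_sq u
    congr 1
    linear_combination -this
  have hi : ∀ u, HasDerivAt (fun u : ℝ => 1 / Real.cosh u ^ 2) (-2 * Real.sinh u / Real.cosh u ^ 3) u := by
    intro u
    have := (((Real.hasDerivAt_cosh u).pow 2).inv (pow_pos (hc u) 2).ne')
    refine hd_eq this (fun _ => by simp) ?_
    have := (hc u).ne'
    simp only [Pi.pow_apply]
    field_simp
    norm_num
    left; ring
  have hid : ∀ u : ℝ, HasDerivAt (fun u : ℝ => u) 1 u := hasDerivAt_id'
  have h3 : ∀ u : ℝ, 0 ≤ u → 0 ≤ Real.sinh u / Real.cosh u * (1 / Real.cosh u ^ 2) + 2 * (Real.sinh u * Real.cosh u) - 3 * u := by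
    apply nonneg_of_deriv (f' := fun u => ((1 / Real.cosh u ^ 2) * (1 / Real.cosh u ^ 2) + Real.sinh u / Real.cosh u * (-2 * Real.sinh u / Real.cosh u ^ 3)) + 2 * (Real.cosh u * Real.cosh u + Real.sinh u * Real.sinh u) - 3 * 1)
    · intro x _
      exact (((ht x).mul (hi x)).add (((Real.hasDerivAt_sinh x).mul (Real.hasDerivAt_cosh x)).const_mul 2)).sub ((hid x).const_mul 3)
    · intro x _
      have hs := Real.sinh_sq x
      have hcx := hc x
      have h1 : 1 ≤ Real.cosh x := Real.one_le_cosh x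
      have : ((1 / Real.cosh x ^ 2) * (1 / Real.cosh x ^ 2) + Real.sinh x / Real.cosh x * (-2 * Real.sinh x / Real.cosh x ^ 3)) + 2 * (Real.cosh x * Real.cosh x + Real.sinh x * Real.sinh x) - 3 * 1 = (Real.cosh x ^ 2 - 1)^2 * (4 * Real.cosh x ^ 2 + 3) / Real.cosh x ^ 4 := by
        field_simp
        ring_nf
        rw [hs]; ring
      rw [this]; positivity
    · simp
  have h2 : ∀ u : ℝ, 0 ≤ u → 0 ≤ (Real.sinh u / Real.cosh u) ^ 2 + 2 * Real.sinh u ^ 2 - 3 * u ^ 2 := by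
    apply nonneg_of_deriv (f' := fun u => 2 * (Real.sinh u / Real.cosh u * (1 / Real.cosh u ^ 2) + 2 * (Real.sinh u * Real.cosh u) - 3 * u))
    · intro x _
      have := (((ht x).pow 2).add (((Real.hasDerivAt_sinh x).pow 2).const_mul 2)).sub (((hid x).pow 2).const_mul 3)
      refine hd_eq this (fun _ => rfl) ?_
      simp; ring
    · intro x hx; have := h3 x hx; linarith
    · simp
  have h1 : ∀ u : ℝ, 0 ≤ u → 0 ≤ (Real.sinh u / Real.cosh u) * Real.sinh u ^ 2 - u ^ 3 := by
    apply nonneg_of_deriv (f' := fun u => (Real.sinh u / Real.cosh u) ^ 2 + 2 * Real.sinh u ^ 2 - 3 * u ^ 2)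
    · intro x _
      have := ((ht x).mul ((Real.hasDerivAt_sinh x).pow 2)).sub ((hid x).pow 3)
      refine hd_eq this (fun _ => rfl) ?_
      have := (hc x).ne'
      simp
      field_simp
    · exact h2
    · simp
  have := h1 u hu
  have hcu := hc u
  have e : (Real.sinh u / Real.cosh u) * Real.sinh u ^ 2 = Real.sinh u ^ 3 / Real.cosh u := by ring
  rw [e, sub_nonneg, le_div_iff₀ hcu] at this
  exact this

noncomputable def EE (t : ℝ) : ℝ := 1 / (Real.exp t - 1) - 1 / t

lemma EE_sinh (t : ℝ) (ht : 0 < t) : EE t = (Real.cosh (t/2) / Real.sinh (t/2) - 1) / 2 - 1 / t := by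
  unfold EE
  have hs : 0 < Real.sinh (t/2) := Real.sinh_pos_iff.mpr (by linarith)
  have he : 0 < Real.exp t - 1 := by have := Real.add_one_lt_exp ht.ne'; linarith
  congr 1
  have e1 : Real.exp t = (Real.cosh (t/2) + Real.sinh (t/2)) ^ 2 := by
    rw [Real.cosh_add_sinh, ← Real.exp_nat_mul]; congr 1; push_cast; ring
  have e2 := Real.cosh_sq (t/2)
  rw [div_eq_iff he.ne', e1]
  field_simp
  nlinarith

lemma EE_deriv (t : ℝ) (ht : 0 < t) : HasDerivAt EE (1 / t ^ 2 - 1 / (4 * Real.sinh (t/2) ^ 2)) t := by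
  have hs : 0 < Real.sinh (t/2) := Real.sinh_pos_iff.mpr (by linarith)
  have hh : HasDerivAt (fun t : ℝ => t / 2) (1/2) t := (hasDerivAt_id' t).div_const 2
  have h1 := ((((Real.hasDerivAt_cosh (t/2)).comp t hh).div ((Real.hasDerivAt_sinh (t/2)).comp t hh) (show (Real.sinh ∘ fun t => t/2) t ≠ 0 from hs.ne')).sub_const 1).div_const 2
  have h2 := (hasDerivAt_inv ht.ne')
  have h3 := h1.sub h2
  have h4 := h3.congr_of_eventuallyEq (f₁ := EE) ?_
  · refine hd_eq h4 (fun _ => rfl) ?_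
    have e2 := Real.cosh_sq (t/2)
    simp only [Function.comp]
    field_simp
    rw [e2]
    ring
  · filter_upwards [lt_mem_nhds ht] with x hx
    rw [EE_sinh x hx]; simp [Function.comp]

lemma EE_concave : ConcaveOn ℝ (Set.Ioi 0) EE := by
  apply AntitoneOn.concaveOn_of_deriv (convex_Ioi 0)
  · intro x hx; exact (EE_deriv x hx).continuousAt.continuousWithinAt
  · rw [interior_Ioi]; intro x hx; exact (EE_deriv x hx).differentiableAt.differentiableWithinAt
  · rw [interior_Ioi]
    have : AntitoneOn (fun t : ℝ => 1 / t ^ 2 - 1 / (4 * Real.sinh (t/2) ^ 2)) (Set.Ioi 0) := by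
      have hd : ∀ t : ℝ, 0 < t → HasDerivAt (fun t : ℝ => 1 / t ^ 2 - 1 / (4 * Real.sinh (t/2) ^ 2)) (- 2 / t ^ 3 + Real.cosh (t/2) / (4 * Real.sinh (t/2) ^ 3)) t := by
        intro t ht
        have hs : 0 < Real.sinh (t/2) := Real.sinh_pos_iff.mpr (by linarith)
        have hh : HasDerivAt (fun t : ℝ => t / 2) (1/2) t := (hasDerivAt_id' t).div_const 2
        have h1 := ((hasDerivAt_id' t).pow 2).inv (pow_pos ht 2).ne'
        have h2 := ((((Real.hasDerivAt_sinh (t/2)).comp t hh).pow 2).const_mul 4).inv (by simp only [Pi.pow_apply, Function.comp]; positivity)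
        have h3 := h1.sub h2
        refine hd_eq h3 (fun x => by simp [Function.comp]) ?_
        · simp only [Pi.pow_apply, Function.comp]
          field_simp
          ring
      apply antitoneOn_of_deriv_nonpos (convex_Ioi 0)
      · intro x hx; exact (hd x hx).continuousAt.continuousWithinAt
      · rw [interior_Ioi]; intro x hx; exact (hd x hx).differentiableAt.differentiableWithinAt
      · rw [interior_Ioi]; intro t ht
        have ht : 0 < t := ht
        have hs : 0 < Real.sinh (t/2) := Real.sinh_pos_iff.mpr (by linarith)
        rw [(hd t ht).deriv]
        have := sinh_ineq (t/2) (by linarith)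
        have h2 : Real.cosh (t/2) / (4 * Real.sinh (t/2) ^ 3) ≤ 2 / t ^ 3 := by
          rw [div_le_div_iff₀ (by positivity) (by positivity)]
          nlinarith
        have : -2 / t^3 = -(2/t^3) := by ring
        linarith
    exact this.congr (fun x hx => (EE_deriv x hx).deriv.symm)

lemma EE_mono : MonotoneOn EE (Set.Ioi 0) := by
  apply monotoneOn_of_deriv_nonneg (convex_Ioi 0)
  · intro x hx; exact (EE_deriv x hx).continuousAt.continuousWithinAt
  · rw [interior_Ioi]; intro x hx; exact (EE_deriv x hx).differentiableAt.differentiableWithinAt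
  · rw [interior_Ioi]; intro t ht
    have ht : 0 < t := ht
    rw [(EE_deriv t ht).deriv, sub_nonneg]
    have := Real.self_le_sinh_iff.mpr (show 0 ≤ t/2 by linarith)
    apply one_div_le_one_div_of_le (by positivity)
    nlinarith

lemma EE_tendsto : Filter.Tendsto EE Filter.atTop (nhds 0) := by
  have h1 : Filter.Tendsto (fun t : ℝ => 1 / (Real.exp t - 1)) Filter.atTop (nhds 0) := by
    simp only [one_div]
    apply Filter.Tendsto.inv_tendsto_atTop
    exact Filter.tendsto_atTop_add_const_right _ (-1) Real.tendsto_exp_atTop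
  have h2 : Filter.Tendsto (fun t : ℝ => 1 / t) Filter.atTop (nhds 0) := by
    simp only [one_div]; exact tendsto_inv_atTop_zero
  have h3 := h1.sub h2
  rw [sub_zero] at h3
  exact h3

lemma EE_diff (t : ℝ) (ht : 0 < t) : EE (2*t) - EE t ≤ t := by
  have hs : 0 < Real.sinh t := Real.sinh_pos_iff.mpr ht
  have h1 : EE (2*t) - EE t = 1/(2*t) - 1/(2*Real.sinh t) := by
    unfold EE
    have he : 0 < Real.exp t - 1 := by have := Real.add_one_lt_exp ht.ne'; linarith
    have he2 : 0 < Real.exp (2*t) - 1 := by have := Real.add_one_lt_exp (show 2*t ≠ 0 by positivity); linarith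
    have e2 : Real.exp (2*t) = Real.exp t ^ 2 := by rw [← Real.exp_nat_mul]; push_cast; rfl
    have e3 : Real.sinh t = (Real.exp t ^ 2 - 1) / (2 * Real.exp t) := by
      rw [Real.sinh_eq, Real.exp_neg]
      have := Real.exp_pos t
      field_simp
    rw [e2] at he2 ⊢
    rw [e3]
    have := Real.exp_pos t
    field_simp
    ring
  rw [h1]
  -- sinh t ≤ t + t^2 * sinh t
  have h2 : 0 ≤ t + t^2 * Real.sinh t - Real.sinh t := by
    by_cases h : 1 ≤ t
    · nlinarith [mul_le_mul_of_nonneg_right (one_le_pow₀ h (n := 2)) hs.le]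
    · push Not at h
      -- sinh t ≤ t cosh t
      have h3 : Real.sinh t ≤ t * Real.cosh t := by
        have := nonneg_of_deriv (fun t => t * Real.cosh t - Real.sinh t) (fun t => t * Real.sinh t) (fun x _ => by
          have := ((hasDerivAt_id' x).mul (Real.hasDerivAt_cosh x)).sub (Real.hasDerivAt_sinh x)
          exact hd_eq this (fun _ => by simp) (by ring)) (fun x hx => mul_nonneg hx (Real.sinh_nonneg_iff.mpr hx)) (by simp) t ht.le
        linarith
      -- cosh t - 1 ≤ t sinh t
      have h4 : Real.cosh t - 1 ≤ t * Real.sinh t := by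
        have := nonneg_of_deriv (fun t => t * Real.sinh t - Real.cosh t + 1) (fun t => t * Real.cosh t) (fun x _ => by
          have := (((hasDerivAt_id' x).mul (Real.hasDerivAt_sinh x)).sub (Real.hasDerivAt_cosh x)).add_const 1
          exact hd_eq this (fun _ => by simp) (by ring)) (fun x hx => mul_nonneg hx (Real.cosh_pos x).le) (by simp) t ht.le
        linarith
      nlinarith
  rw [div_sub_div _ _ (by positivity) (by positivity), div_le_iff₀ (by positivity)]
  nlinarith [mul_pos ht hs]

/-- Periodic mean-zero sequence against a concave increasing sequence. -/
lemma block_conc (χ : ℕ → ℝ) (M : ℕ) (hM : 0 < M) (hb : ∀ n, |χ n| ≤ 1) (hp : ∀ n, χ (n + M) = χ n) 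
    (h0 : ∑ r ∈ range M, χ r = 0) (e : ℕ → ℝ) (hm : ∀ n, e n ≤ e (n+1)) 
    (hc : ∀ n, e (n+2) - e (n+1) ≤ e (n+1) - e n) (J : ℕ) : 
    |∑ n ∈ range (J * M), χ n * e n - (∑ r ∈ range M, χ r * r) / M * (e (J*M) - e 0)| ≤ M * M * (e 1 - e 0) := by
  set D : ℕ → ℝ := fun n => e (n+1) - e n with hD
  have hanti : Antitone D := antitone_nat_of_succ_le (fun n => by simpa [hD] using hc n)
  have hD0 : ∀ n, 0 ≤ D n := fun n => sub_nonneg.mpr (hm n)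
  have hMr : (0:ℝ) < M := by exact_mod_cast hM
  -- increments
  have hinc : ∀ a r : ℕ, e (a + r) - e a = ∑ i ∈ range r, D (a+i) := by
    intro a r
    have := Finset.sum_range_sub (fun i => e (a+i)) r
    rw [add_zero] at this
    rw [← this]; rfl
  have hlow : ∀ a r : ℕ, r ≤ M → r * D (a + M) ≤ e (a+r) - e a := by
    intro a r hr
    rw [hinc]
    calc (r:ℝ) * D (a+M) = ∑ i ∈ range r, D (a+M) := by simp
      _ ≤ _ := sum_le_sum fun i hi => hanti (by have := mem_range.mp hi; omega)
  have hup : ∀ a r : ℕ, e (a+r) - e a ≤ r * D a := by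
    intro a r
    rw [hinc]
    calc _ ≤ ∑ i ∈ range r, D a := sum_le_sum fun i hi => hanti (by omega)
      _ = _ := by simp
  have hpj : ∀ j n, χ (j * M + n) = χ n := by
    intro j n
    induction j with
    | zero => simp
    | succ j ih => rw [show (j+1)*M+n = (j*M+n)+M by ring, hp, ih]
  have hblock : ∀ j : ℕ, |∑ r ∈ range M, χ r * e (j*M + r) - (∑ r ∈ range M, χ r * r) / M * (e ((j+1)*M) - e (j*M))| ≤ 
      M * M * (D (j*M) - D ((j+1)*M)) := by
    intro j
    have e1 : ∑ r ∈ range M, χ r * e (j*M + r) - (∑ r ∈ range M, χ r * r) / M * (e ((j+1)*M) - e (j*M)) = 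
        ∑ r ∈ range M, χ r * ((e (j*M + r) - e (j*M)) - r / M * (e ((j+1)*M) - e (j*M))) := by
      have : ∑ r ∈ range M, χ r * ((e (j*M + r) - e (j*M)) - r / M * (e ((j+1)*M) - e (j*M))) = 
        ∑ r ∈ range M, χ r * e (j*M + r) - (∑ r ∈ range M, χ r) * e (j*M) - (∑ r ∈ range M, χ r * r) / M * (e ((j+1)*M) - e (j*M)) := by
        rw [sum_mul, sum_div, sum_mul, ← sum_sub_distrib, ← sum_sub_distrib]
        apply sum_congr rfl; intro r _; ring
      rw [this, h0]; ring
    rw [e1]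
    have e2 : (j+1)*M = j*M+M := by ring
    calc _ ≤ ∑ r ∈ range M, |χ r * ((e (j*M + r) - e (j*M)) - r / M * (e ((j+1)*M) - e (j*M)))| := abs_sum_le_sum_abs _ _
      _ ≤ ∑ r ∈ range M, M * (D (j*M) - D ((j+1)*M)) := by
        apply sum_le_sum; intro r hr
        have hr := (mem_range.mp hr).le
        have hrr : (r:ℝ) ≤ M := by exact_mod_cast hr
        have hr0 : (0:ℝ) ≤ r := Nat.cast_nonneg r
        rw [abs_mul]
        have a1 := hlow (j*M) r hr
        have a2 := hup (j*M) r
        have a3 := hlow (j*M) M le_rfl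
        have a4 := hup (j*M) M
        rw [e2]
        have hq : 0 ≤ (r:ℝ)/M := by positivity
        have a3' := mul_le_mul_of_nonneg_left a3 hq
        have a4' := mul_le_mul_of_nonneg_left a4 hq
        have s1 : (r:ℝ)/M * (M * D (j*M+M)) = r * D (j*M+M) := by field_simp
        have s2 : (r:ℝ)/M * (M * D (j*M)) = r * D (j*M) := by field_simp
        rw [s1] at a3'; rw [s2] at a4'
        have hdd : 0 ≤ D (j*M) - D (j*M+M) := sub_nonneg.mpr (hanti (by omega))
        have key : |(e (j*M + r) - e (j*M)) - r / M * (e (j*M+M) - e (j*M))| ≤ r * (D (j*M) - D (j*M+M)) := by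
          rw [abs_le]; constructor <;> nlinarith
        calc _ ≤ 1 * (r * (D (j*M) - D (j*M+M))) := mul_le_mul (hb r) key (abs_nonneg _) zero_le_one
          _ ≤ _ := by rw [one_mul]; exact mul_le_mul_of_nonneg_right hrr hdd
      _ = _ := by simp; ring
  have hmain : ∀ J : ℕ, |∑ n ∈ range (J * M), χ n * e n - (∑ r ∈ range M, χ r * r) / M * (e (J*M) - e 0)| ≤ M * M * (D 0 - D (J*M)) := by
    intro J
    induction J with
    | zero => simp
    | succ J ih =>
      have : ∑ n ∈ range ((J+1) * M), χ n * e n = ∑ n ∈ range (J * M), χ n * e n + ∑ r ∈ range M, χ r * e (J*M + r) := by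
        rw [show (J+1)*M = J*M+M by ring, sum_range_add]
        congr 1
        exact sum_congr rfl fun r _ => by rw [hpj]
      rw [this]
      have hb := hblock J
      rw [abs_le] at ih hb ⊢
      constructor <;> nlinarith
  refine (hmain J).trans ?_
  have : D 0 = e 1 - e 0 := rfl
  rw [← this]
  apply mul_le_mul_of_nonneg_left _ (by positivity)
  linarith [hD0 (J*M)]

/-- upper estimate -/
lemma sum_h (χ : ℕ → ℝ) (M : ℕ) (hM : 0 < M) (hb : ∀ n, |χ n| ≤ 1) (hp : ∀ n, χ (n + M) = χ n) 
    (h0 : ∑ r ∈ range M, χ r = 0) (x : ℝ) (hx : 0 < x) (J : ℕ) : 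
    |∑ n ∈ range (J * M), χ n * (EE ((n+1:ℕ)/x) - EE (2 * ((n+1:ℕ)/x)))| ≤ 4 * M^2 / x + M * |EE ((J*M+1:ℕ)/x) - EE (2*((J*M+1:ℕ)/x))| := by
  have hMr : (1:ℝ) ≤ M := by exact_mod_cast hM
  have gen : ∀ c : ℝ, 0 < c → (∀ n : ℕ, EE (c * ((n+1:ℕ)/x)) ≤ EE (c * ((n+1+1:ℕ)/x))) ∧ 
      (∀ n : ℕ, EE (c * ((n+2+1:ℕ)/x)) - EE (c * ((n+1+1:ℕ)/x)) ≤ EE (c * ((n+1+1:ℕ)/x)) - EE (c * ((n+1:ℕ)/x))) := by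
    intro c hc
    have hpos : ∀ m : ℕ, 0 < m → 0 < c * ((m:ℝ)/x) := fun m hm => by
      have : (0:ℝ) < m := by exact_mod_cast hm
      positivity
    constructor
    · intro n
      apply EE_mono (hpos _ (by omega)) (hpos _ (by omega))
      apply mul_le_mul_of_nonneg_left _ hc.le
      apply div_le_div_of_nonneg_right _ hx.le
      exact_mod_cast (by omega)
    · intro n
      have := EE_concave.2 (show c * ((n+1:ℕ)/x) ∈ Set.Ioi 0 from hpos _ (by omega)) (show c * ((n+2+1:ℕ)/x) ∈ Set.Ioi 0 from hpos _ (by omega)) 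
        (show (0:ℝ) ≤ 1/2 by norm_num) (show (0:ℝ) ≤ 1/2 by norm_num) (by norm_num)
      simp only [smul_eq_mul] at this
      have e : 1/2 * (c * ((n+1:ℕ)/x)) + 1/2 * (c * ((n+2+1:ℕ)/x)) = c * ((n+1+1:ℕ)/x) := by push_cast; ring
      rw [e] at this
      linarith
  have g1 := gen 1 one_pos
  have g2 := gen 2 two_pos
  have b1 := block_conc χ M hM hb hp h0 (fun n => EE (1 * ((n+1:ℕ)/x))) g1.1 g1.2 J
  have b2 := block_conc χ M hM hb hp h0 (fun n => EE (2 * ((n+1:ℕ)/x))) g2.1 g2.2 J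
  simp only [one_mul] at b1
  set c1 := (∑ r ∈ range M, χ r * r) / M with hc1
  have hc1b : |c1| ≤ M := by
    rw [hc1, abs_div, abs_of_pos (show (0:ℝ) < M by linarith), div_le_iff₀ (by linarith)]
    calc _ ≤ ∑ r ∈ range M, |χ r * r| := abs_sum_le_sum_abs _ _
      _ ≤ ∑ r ∈ range M, (M:ℝ) := by
        apply sum_le_sum; intro r hr
        have hrr : (r:ℝ) ≤ M := by exact_mod_cast (mem_range.mp hr).le
        rw [abs_mul, abs_of_nonneg (Nat.cast_nonneg r : (0:ℝ) ≤ r)]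
        calc _ ≤ 1 * (r:ℝ) := mul_le_mul_of_nonneg_right (hb r) (Nat.cast_nonneg r)
          _ ≤ M := by linarith
      _ = _ := by simp
  have d1 := EE_diff (1/x) (by positivity)
  have d2 := EE_diff (2*(1/x)) (by positivity)
  have m1 : EE (1/x) ≤ EE (2*(1/x)) := by
    apply EE_mono (by simp [hx]) (by simp [hx])
    have : 0 < 1/x := by positivity
    linarith
  have split : ∑ n ∈ range (J * M), χ n * (EE ((n+1:ℕ)/x) - EE (2 * ((n+1:ℕ)/x))) = 
      (∑ n ∈ range (J * M), χ n * EE ((n+1:ℕ)/x)) - (∑ n ∈ range (J * M), χ n * EE (2 * ((n+1:ℕ)/x))) := by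
    rw [← sum_sub_distrib]; exact sum_congr rfl fun n _ => by ring
  rw [split]
  norm_num at b1 b2 d1 d2 m1 ⊢
  rw [show (2:ℝ)/x = (2 * x⁻¹) by ring] at b1 b2
  set X1 := ∑ n ∈ range (J * M), χ n * EE (((n:ℝ)+1)/x)
  set X2 := ∑ n ∈ range (J * M), χ n * EE (2 * (((n:ℝ)+1)/x))
  set e1 := EE (((J:ℝ)*M+1)/x)
  set e2 := EE (2*(((J:ℝ)*M+1)/x))
  have t1 : |c1 * (e1 - e2)| ≤ M * |e1 - e2| := by rw [abs_mul]; gcongr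
  have t2 : |c1 * (EE (x⁻¹) - EE (2 * x⁻¹))| ≤ M * x⁻¹ := by
    rw [abs_mul]
    apply mul_le_mul hc1b _ (abs_nonneg _) (by linarith)
    rw [abs_le]; constructor <;> linarith
  have t3 : (M:ℝ) * x⁻¹ ≤ M^2 * x⁻¹ := by
    apply mul_le_mul_of_nonneg_right _ (by positivity); nlinarith
  have t4 : (M:ℝ) * M * (EE (2 * x⁻¹) - EE x⁻¹) ≤ M * M * x⁻¹ := mul_le_mul_of_nonneg_left (by linarith) (by positivity)
  have t5 : (M:ℝ) * M * (EE (2 * (2 * x⁻¹)) - EE (2*x⁻¹)) ≤ M * M * (2*x⁻¹) := mul_le_mul_of_nonneg_left (by linarith) (by positivity)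
  have t6 : 4 * (M:ℝ)^2 / x = 4 * (M^2 * x⁻¹) := by ring
  rw [t6]
  have t7 : (M:ℝ) * M * x⁻¹ = M^2 * x⁻¹ := by ring
  have t8 : (M:ℝ) * M * (2*x⁻¹) = 2 * (M^2 * x⁻¹) := by ring
  rw [abs_le] at *
  constructor <;> linarith

structure RChar (χ : ℕ → ℝ) : Prop where
  zero : χ 0 = 0
  one : χ 1 = 1
  mul : ∀ a b, χ (a * b) = χ a * χ b
  tri : ∀ a, χ a = 0 ∨ χ a = 1 ∨ χ a = -1

noncomputable def rr (χ : ℕ → ℝ) (n : ℕ) : ℝ := ∑ d ∈ n.divisors, χ d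

lemma geo_tri (c : ℝ) (h : c = 0 ∨ c = 1 ∨ c = -1) (n : ℕ) : 0 ≤ ∑ i ∈ range (n+1), c ^ i ∧ 1 ≤ ∑ i ∈ range (2*n+1), c ^ i := by
  rcases h with h | h | h
  · subst h
    constructor
    · exact sum_nonneg fun i _ => by positivity
    · rw [sum_range_succ']; simp
  · subst h; simp; positivity
  · subst h
    have : ∀ n : ℕ, ∑ i ∈ range (2*n), (-1:ℝ)^i = 0 := by
      intro n
      induction n with
      | zero => simp
      | succ n ih => rw [show 2*(n+1) = 2*n+1+1 by ring, sum_range_succ, sum_range_succ, ih]; simp [pow_succ, pow_mul]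
    have h1 : ∀ n : ℕ, ∑ i ∈ range (2*n+1), (-1:ℝ)^i = 1 := by
      intro n; rw [sum_range_succ, this]; simp [pow_mul]
    constructor
    · rcases Nat.even_or_odd' n with ⟨m, hm | hm⟩
      · rw [hm, h1]; norm_num
      · rw [hm, show 2*m+1+1 = 2*(m+1) by ring, this]
    · rw [h1]

lemma rr_facts (χ : ℕ → ℝ) (h : RChar χ) (n : ℕ) (hn : 0 < n) : 0 ≤ rr χ n ∧ 1 ≤ rr χ (n^2) := by
  let A : ArithmeticFunction ℝ := ⟨χ, h.zero⟩
  have hA : A.IsMultiplicative := ⟨h.one, fun {m n} _ => h.mul m n⟩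
  have hZ : (A * (ArithmeticFunction.zeta : ArithmeticFunction ℝ)).IsMultiplicative := 
    hA.mul ArithmeticFunction.isMultiplicative_zeta.natCast
  have hr : ∀ n, rr χ n = (A * (ArithmeticFunction.zeta : ArithmeticFunction ℝ)) n := by
    intro n; rw [ArithmeticFunction.coe_mul_zeta_apply]; rfl
  have hmul : ∀ a b : ℕ, a.Coprime b → rr χ (a*b) = rr χ a * rr χ b := by
    intro a b hab; rw [hr, hr, hr]; exact hZ.2 hab
  have hpow : ∀ a i : ℕ, χ (a^i) = χ a ^ i := by
    intro a i
    induction i with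
    | zero => simp [h.one]
    | succ i ih => rw [pow_succ, pow_succ, h.mul, ih]
  have hpp : ∀ p a : ℕ, p.Prime → rr χ (p^a) = ∑ i ∈ range (a+1), χ p ^ i := by
    intro p a hp
    unfold rr
    rw [Nat.sum_divisors_prime_pow hp]
    exact sum_congr rfl fun i _ => hpow p i
  induction n using Nat.recOnPosPrimePosCoprime with
  | zero => omega
  | one => simp [rr, h.one]
  | prime_pow p a hp ha =>
    rw [← pow_mul, hpp _ _ hp, hpp _ _ hp, mul_comm a 2]
    exact geo_tri _ (h.tri p) a
  | coprime a b ha hb hab iha ihb =>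
    have ha' := iha (by omega)
    have hb' := ihb (by omega)
    rw [mul_pow, hmul a b hab, hmul _ _ (hab.pow 2 2)]
    exact ⟨mul_nonneg ha'.1 hb'.1, by nlinarith [ha'.2, hb'.2]⟩

lemma G_ident (χ : ℕ → ℝ) (h : RChar χ) (x : ℝ) (hx : 0 < x) : 
    ∃ G : ℝ, HasSum (fun d : ℕ+ => χ d * (1 / (Real.exp (d/x) - 1) - 1 / (Real.exp (2*(d/x)) - 1))) G ∧ 
      HasSum (fun n : ℕ+ => rr χ n * (Real.exp (-(n/x)) - Real.exp (-(2*(n/x))))) G := by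
  have hb : ∀ n, |χ n| ≤ 1 := by
    intro n; rcases h.tri n with e | e | e <;> rw [e] <;> simp
  set w : ℝ → ℝ := fun t => Real.exp (-t) - Real.exp (-(2*t)) with hw
  have hw0 : ∀ t, 0 ≤ t → 0 ≤ w t := by
    intro t ht; simp only [hw]; rw [sub_nonneg]; apply Real.exp_le_exp.mpr; linarith
  set q : ℝ := Real.exp (-(1/x)) with hq
  have hq1 : q < 1 := by rw [hq, Real.exp_lt_one_iff]; have : 0 < 1/x := by positivity
                         linarith
  have hq0 : 0 < q := Real.exp_pos _
  have hgeo : Summable fun n : ℕ+ => q ^ (n:ℕ) := (summable_geometric_of_lt_one hq0.le hq1).comp_injective PNat.coe_injective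
  have hexp : ∀ n : ℕ, Real.exp (-(n/x)) = q ^ n := by
    intro n; rw [hq, ← Real.exp_nat_mul]; congr 1; ring
  have hS : Summable fun z : ℕ+ × ℕ+ => χ z.1 * w (((z.1:ℕ) * (z.2:ℕ) : ℕ)/x) := by
    have h1 : Summable fun z : ℕ+ × ℕ+ => q⁻¹ * (q ^ (z.1:ℕ) * q ^ (z.2:ℕ)) := 
      (hgeo.mul_of_nonneg hgeo (fun _ => by positivity) (fun _ => by positivity)).mul_left _
    apply Summable.of_norm_bounded h1
    intro z
    rw [norm_mul, Real.norm_eq_abs, Real.norm_eq_abs, abs_of_nonneg (hw0 _ (by positivity))]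
    have a1 : w (((z.1:ℕ) * (z.2:ℕ) : ℕ)/x) ≤ q ^ ((z.1:ℕ) * (z.2:ℕ)) := by
      simp only [hw]; rw [hexp]; have := Real.exp_pos (-(2*((((z.1:ℕ) * (z.2:ℕ) : ℕ):ℝ)/x))); linarith
    have a2 : q ^ ((z.1:ℕ) * (z.2:ℕ)) ≤ q⁻¹ * (q ^ (z.1:ℕ) * q ^ (z.2:ℕ)) := by
      rw [inv_mul_eq_div, le_div_iff₀ hq0, ← pow_succ, ← pow_add]
      apply pow_le_pow_of_le_one hq0.le hq1.le
      have := z.1.pos; have := z.2.pos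
      nlinarith
    calc _ ≤ 1 * w _ := mul_le_mul_of_nonneg_right (hb _) (hw0 _ (by positivity))
      _ ≤ _ := by rw [one_mul]; exact a1.trans a2
  refine ⟨∑' z : ℕ+ × ℕ+, χ z.1 * w (((z.1:ℕ) * (z.2:ℕ) : ℕ)/x), ?_, ?_⟩
  · refine hS.hasSum.prod_fiberwise (fun d => ?_)
    apply HasSum.mul_left
    have hg : ∀ c : ℝ, 0 < c → HasSum (fun m : ℕ+ => Real.exp (-(c * (((d:ℕ) * (m:ℕ) : ℕ)/x)))) (1 / (Real.exp (c*(d/x)) - 1)) := by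
      intro c hc
      have hd : (0:ℝ) < d := by exact_mod_cast d.pos
      set t := c*((d:ℝ)/x) with ht
      have ht0 : 0 < t := by positivity
      have hr1 : Real.exp (-t) < 1 := by rw [Real.exp_lt_one_iff]; linarith
      have := hasSum_geometric_of_lt_one (Real.exp_pos (-t)).le hr1
      have h2 := this.mul_left (Real.exp (-t))
      have h3 := (Equiv.pnatEquivNat.hasSum_iff (f := fun n : ℕ => Real.exp (-t) * Real.exp (-t) ^ n)).mpr h2
      convert h3 using 1
      · funext m
        simp only [Function.comp, Equiv.pnatEquivNat_apply]
        rw [← pow_succ', ← Real.exp_nat_mul]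
        congr 1
        rw [PNat.natPred_add_one, ht]; push_cast; ring
      · rw [Real.exp_neg]
        have : 0 < Real.exp t - 1 := by have := Real.add_one_lt_exp ht0.ne'; linarith
        have h4 := Real.exp_pos t
        have : 1 - (Real.exp t)⁻¹ = (Real.exp t - 1) / Real.exp t := by field_simp
        rw [this]; field_simp
    have := (hg 1 one_pos).sub (hg 2 two_pos)
    simp only [one_mul] at this
    exact this
  · have h1 := (sigmaAntidiagonalEquivProd.hasSum_iff (f := fun z : ℕ+ × ℕ+ => χ z.1 * w (((z.1:ℕ) * (z.2:ℕ) : ℕ)/x))).mpr hS.hasSum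
    have h2 := h1.sigma (g := fun n : ℕ+ => rr χ n * w (n/x)) ?_
    · exact h2
    · intro n
      have := hasSum_fintype (fun c : Nat.divisorsAntidiagonal n => ((fun z : ℕ+ × ℕ+ => χ z.1 * w (((z.1:ℕ) * (z.2:ℕ) : ℕ)/x)) ∘ sigmaAntidiagonalEquivProd) ⟨n, c⟩)
      convert this using 1
      rw [rr, ← Nat.sum_divisorsAntidiagonal (fun d _ => χ d), sum_mul, ← Finset.sum_coe_sort]
      apply sum_congr rfl
      intro c _
      have hc := (Nat.mem_divisorsAntidiagonal.mp c.2).1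
      simp only [Function.comp, sigmaAntidiagonalEquivProd, Equiv.coe_fn_mk, divisorsAntidiagonalFactors, PNat.mk_coe]
      rw [hc]

lemma pnat_hs (f : ℕ → ℝ) (G : ℝ) (h : HasSum (fun d : ℕ+ => f d) G) : HasSum (fun n : ℕ => f (n+1)) G := 
  (Equiv.pnatEquivNat.symm.hasSum_iff).mpr h

set_option maxHeartbeats 1000000 in
lemma crude_L1 (χ : ℕ → ℝ) (h : RChar χ) (M : ℕ) (hM : 0 < M) (hp : ∀ n, χ (n + M) = χ n) 
    (h0 : ∑ r ∈ range M, χ r = 0) (L : ℝ) 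
    (hL : Filter.Tendsto (fun N => ∑ d ∈ range N, χ (d+1) / ((d+1:ℕ):ℝ)) Filter.atTop (nhds L)) : 
    1 / 300 * (M:ℝ) ^ (-(2/3) : ℝ) ≤ L := by
  have hb : ∀ n, |χ n| ≤ 1 := by
    intro n; rcases h.tri n with e | e | e <;> rw [e] <;> simp
  have hM1 : (1:ℝ) ≤ M := by exact_mod_cast hM
  set u : ℝ := (M:ℝ)^(2/3:ℝ) with hu
  have hu1 : 1 ≤ u := Real.one_le_rpow hM1 (by norm_num)
  have hu3 : u^3 = (M:ℝ)^2 := by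
    rw [hu, ← Real.rpow_natCast, ← Real.rpow_mul (by linarith), ← Real.rpow_natCast]; norm_num
  set P : ℕ := ⌈4 * u⌉₊ with hP
  have hP1 : 4 * u ≤ P := Nat.le_ceil _
  have hP2 : (P:ℝ) ≤ 5 * u := by have := Nat.ceil_lt_add_one (show 0 ≤ 4*u by linarith); linarith
  have hPpos : (0:ℝ) < P := by linarith
  set x : ℝ := (2 * P)^2 with hx
  have hxpos : 0 < x := by positivity
  obtain ⟨G, hG1, hG2⟩ := G_ident χ h x hxpos
  -- lower bound
  have hlow : (P:ℝ) / 15 ≤ G := by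
    have hG4 : HasSum (fun n : ℕ => rr χ (n+1) * (Real.exp (-((n+1:ℕ)/x)) - Real.exp (-(2*((n+1:ℕ)/x))))) G := 
      pnat_hs (fun n => rr χ n * (Real.exp (-((n:ℝ)/x)) - Real.exp (-(2*((n:ℝ)/x))))) G hG2
    have h1 : ∑ n ∈ (Icc P (2*P)).image (fun m => m^2-1), rr χ (n+1) * (Real.exp (-((n+1:ℕ)/x)) - Real.exp (-(2*((n+1:ℕ)/x)))) ≤ G := by
      apply sum_le_hasSum _ _ hG4
      intro n _
      apply mul_nonneg (rr_facts χ h (n+1) (by omega)).1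
      rw [sub_nonneg]; apply Real.exp_le_exp.mpr
      have : 0 ≤ ((n+1:ℕ):ℝ)/x := by positivity
      linarith
    refine le_trans ?_ h1
    have hPn : 0 < P := by exact_mod_cast hPpos
    rw [sum_image]
    · have : ∑ m ∈ Icc P (2*P), (1/15:ℝ) ≤ ∑ m ∈ Icc P (2*P), (rr χ (m^2-1+1) * (Real.exp (-((m^2-1+1:ℕ)/x)) - Real.exp (-(2*((m^2-1+1:ℕ)/x))))) := by
        apply sum_le_sum; intro m hm
        rw [mem_Icc] at hm
        have hm0 : 0 < m := by omega
        have hm2 : m^2-1+1 = m^2 := Nat.sub_add_cancel (by nlinarith)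
        rw [hm2]
        have hr := (rr_facts χ h m hm0).2
        have hml : (P:ℝ) ≤ m := by exact_mod_cast hm.1
        have hmu : (m:ℝ) ≤ 2*P := by exact_mod_cast hm.2
        set v : ℝ := ((m^2:ℕ):ℝ)/x with hv
        have hv1 : 1/4 ≤ v := by
          rw [hv, le_div_iff₀ hxpos, hx]; push_cast; nlinarith
        have hv2 : v ≤ 1 := by
          rw [hv, div_le_one hxpos, hx]; push_cast; nlinarith
        have e2 : Real.exp (-(2*v)) = Real.exp (-v) * Real.exp (-v) := by rw [← Real.exp_add]; congr 1; ring
        have e3 : 1/3 ≤ Real.exp (-v) := by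
          have : Real.exp (-1) ≤ Real.exp (-v) := Real.exp_le_exp.mpr (by linarith)
          have h3 : 1/3 ≤ Real.exp (-1) := by
            rw [Real.exp_neg, ← one_div]
            apply one_div_le_one_div_of_le (Real.exp_pos 1)
            have := Real.exp_one_lt_d9; linarith
          linarith
        have e4 : Real.exp (-v) ≤ 4/5 := by
          have : 5/4 ≤ Real.exp v := by have := Real.add_one_le_exp v; linarith
          rw [Real.exp_neg, ← one_div]
          rw [div_le_iff₀ (Real.exp_pos v)]; linarith
        have e5 : 1/15 ≤ Real.exp (-v) - Real.exp (-(2*v)) := by rw [e2]; nlinarith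
        nlinarith
      refine le_trans ?_ this
      rw [sum_const, Nat.card_Icc, nsmul_eq_mul]
      have : (P:ℝ) ≤ ((2*P+1-P:ℕ):ℝ) := by exact_mod_cast (by omega)
      linarith
    · intro a ha b hb hab
      simp only [coe_Icc, Set.mem_Icc] at ha hb
      have h2 : ∀ m : ℕ, 0 < m → m^2-1+1 = m^2 := fun m hm => Nat.sub_add_cancel (by nlinarith)
      have h3 : a^2-1 = b^2-1 := hab
      have : a^2 = b^2 := by rw [← h2 a (by omega), ← h2 b (by omega), h3]
      exact Nat.pow_left_injective (n := 2) (by norm_num) this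
  -- upper bound
  have hG3 : HasSum (fun d : ℕ => χ (d+1) * (1 / (Real.exp ((d+1:ℕ)/x) - 1) - 1 / (Real.exp (2*((d+1:ℕ)/x)) - 1))) G := by
    exact pnat_hs (fun d => χ d * (1 / (Real.exp ((d:ℝ)/x) - 1) - 1 / (Real.exp (2*((d:ℝ)/x)) - 1))) G hG1
  have hJ : Filter.Tendsto (fun J : ℕ => J * M) Filter.atTop Filter.atTop := Filter.tendsto_id.atTop_mul_const' hM
  have hlimG := hG3.tendsto_sum_nat.comp hJ
  have hlimL := (hL.comp hJ).const_mul (x/2)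
  have hlimE : Filter.Tendsto (fun J : ℕ => 4 * (M:ℝ)^2 / x + M * |EE ((J*M+1:ℕ)/x) - EE (2*((J*M+1:ℕ)/x))|) Filter.atTop (nhds (4 * (M:ℝ)^2 / x)) := by
    have t1 : Filter.Tendsto (fun J : ℕ => ((J*M+1:ℕ):ℝ)/x) Filter.atTop Filter.atTop := by
      apply Filter.Tendsto.atTop_div_const hxpos
      apply tendsto_natCast_atTop_atTop.comp
      exact (Filter.tendsto_add_atTop_nat 1).comp hJ
    have t2 := t1.const_mul_atTop (show (0:ℝ) < 2 by norm_num)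
    have t3 := (((EE_tendsto.comp t1).sub (EE_tendsto.comp t2)).abs.const_mul (M:ℝ)).const_add (4 * (M:ℝ)^2 / x)
    simpa [Function.comp] using t3
  have hup : G ≤ x/2 * L + 4 * (M:ℝ)^2 / x := by
    refine le_of_tendsto_of_tendsto' hlimG (hlimL.add hlimE) (fun J => ?_)
    have hz : ∑ r ∈ range M, χ (r+1) = 0 := by
      have := Finset.sum_range_succ' χ M
      rw [sum_range_succ, h0, zero_add] at this
      have hM0 := hp 0
      rw [zero_add] at hM0
      rw [hM0] at this
      linarith
    have := sum_h (fun n => χ (n+1)) M hM (fun n => hb _) (fun n => by rw [show n+M+1 = (n+1)+M by ring, hp]) hz x hxpos J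
    have := (abs_le.mp this).2
    simp only [Function.comp]
    have e : ∑ d ∈ range (J*M), χ (d+1) * (1 / (Real.exp ((d+1:ℕ)/x) - 1) - 1 / (Real.exp (2*((d+1:ℕ)/x)) - 1)) = 
      x/2 * ∑ d ∈ range (J*M), χ (d+1) / ((d+1:ℕ):ℝ) + ∑ n ∈ range (J * M), χ (n+1) * (EE ((n+1:ℕ)/x) - EE (2 * ((n+1:ℕ)/x))) := by
      rw [mul_sum, ← sum_add_distrib]
      apply sum_congr rfl; intro d _
      have hd : ((d+1:ℕ):ℝ) ≠ 0 := by positivity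
      unfold EE
      have : 1 / (2 * (((d+1:ℕ):ℝ)/x)) = x/2 / ((d+1:ℕ):ℝ) := by field_simp
      rw [this]
      have : 1 / ((((d+1:ℕ):ℝ)/x)) = x / ((d+1:ℕ):ℝ) := by field_simp
      rw [this]
      ring
    rw [e]
    linarith
  have hfin : (P:ℝ)/15 ≤ 2 * P^2 * L + M^2 / P^2 := by
    have e1 : x/2 = 2 * P^2 := by rw [hx]; ring
    have e2 : 4 * (M:ℝ)^2 / x = M^2/P^2 := by rw [hx]; field_simp; ring
    rw [e1, e2] at hup; linarith
  have hP3 : 64 * (M:ℝ)^2 ≤ P^3 := by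
    rw [← hu3]
    calc 64 * u^3 = (4*u)^3 := by ring
      _ ≤ _ := by gcongr
  have h5 : (M:ℝ)^2/P^2 ≤ P / 64 := by
    rw [div_le_div_iff₀ (by positivity) (by norm_num)]; nlinarith
  have h6 : 1/(60 * P) ≤ L := by
    rw [div_le_iff₀ (by positivity)]
    have : (P:ℝ)/30 ≤ 2 * P^2 * L := by linarith
    have : (P:ℝ) * (1/30) ≤ P * (2 * P * L) := by nlinarith
    have := le_of_mul_le_mul_left this hPpos
    linarith
  refine le_trans ?_ h6
  rw [Real.rpow_neg (by linarith), ← hu, ← one_div, ← one_div_mul_one_div]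
  rw [show (1:ℝ)/300 * (1/u) = 1/60 * (1/(5*u)) by field_simp; norm_num]
  gcongr

lemma gr_rchar (n : ℤ) : RChar (gr n) := ⟨gr_zero n, gr_one n, gr_mul n, gr_tri n⟩

/-- Crude lower bound for quadratic L-values near 1. -/
lemma crude_LL (n : ℤ) (hn : n ≠ 0) (hns : ¬ IsSquare n) : 
    ∀ᶠ s in nhdsWithin (0:ℝ) (Set.Ioi 0), 1 / 600 * ((12 * n.natAbs : ℕ):ℝ) ^ (-(2/3) : ℝ) ≤ ‖LL (gq n) s‖ := by
  set M : ℕ := 12 * n.natAbs with hM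
  have hM0 : 0 < M := by have := Int.natAbs_pos.mpr hn; omega
  have hz := gq_sum_zero n hn hns
  have hzr : ∑ r ∈ range M, gr n r = 0 := by
    have : ((∑ r ∈ range M, gr n r : ℝ) : ℂ) = 0 := by rw [← hz]; push_cast; rfl
    exact_mod_cast this
  have hbd : ∀ N, ‖∑ d ∈ range N, gr n (d+1)‖ ≤ (M:ℝ) := by
    intro N
    have := per_canc M hM0 (gq n) (gq_norm n) (fun a => by unfold gq; rw [gr_per]) hz (N+1)
    rw [sum_range_succ'] at this
    have e : gq n 0 = 0 := by unfold gq; rw [gr_zero]; simp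
    rw [e, add_zero] at this
    rw [← Complex.norm_real]
    push_cast
    exact this
  have hcau : ∃ L, Filter.Tendsto (fun N => ∑ d ∈ range N, gr n (d+1) / ((d+1:ℕ):ℝ)) Filter.atTop (nhds L) := by
    apply cauchySeq_tendsto_of_complete
    have := Antitone.cauchySeq_series_mul_of_tendsto_zero_of_bounded (f := fun d : ℕ => 1 / ((d+1:ℕ):ℝ)) (z := fun d => gr n (d+1)) (b := M) 
      (fun a b hab => one_div_le_one_div_of_le (by positivity) (by exact_mod_cast (by omega))) 
      (by have := tendsto_one_div_add_atTop_nhds_zero_nat (𝕜 := ℝ); simpa using this) hbd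
    convert this using 1
    funext N
    exact sum_congr rfl fun d _ => by rw [smul_eq_mul]; ring
  obtain ⟨L, hL⟩ := hcau
  have hlow := crude_L1 (gr n) (gr_rchar n) M hM0 (gr_per n) hzr L hL
  have hab := abel_dir (fun d => gr n d / (d:ℝ)) L hL (fun s => (LL (gq n) s).re) (by
    intro s hs
    have h1 := summ_of_cnt (gq n) (gq_base n).cnt s hs
    have h2 := h1.LSeriesHasSum
    have h3 := Complex.hasSum_re h2
    have h4 := h3.tendsto_sum_nat
    have h5 := h4.comp (Filter.tendsto_add_atTop_nat 1)
    refine h5.congr (fun N => ?_)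
    simp only [Function.comp]
    rw [sum_range_succ']
    simp only [LSeries.term_zero, Complex.zero_re, add_zero]
    apply sum_congr rfl; intro d _
    rw [LSeries.term_of_ne_zero (by omega)]
    have hd : (0:ℝ) < ((d+1:ℕ):ℝ) := by positivity
    have : (((d+1:ℕ):ℂ)) ^ (((1+s:ℝ)):ℂ) = (((((d+1:ℕ):ℝ)) ^ (1+s) : ℝ) : ℂ) := by
      rw [Complex.ofReal_cpow hd.le]; simp
    rw [this]
    unfold gq
    rw [← Complex.ofReal_div, Complex.ofReal_re, Real.rpow_add hd, Real.rpow_one, Real.rpow_neg hd.le]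
    field_simp)
  have hMp : (0:ℝ) < (M:ℝ) ^ (-(2/3) : ℝ) := by positivity
  filter_upwards [hab.eventually (lt_mem_nhds (show 1/600 * (M:ℝ) ^ (-(2/3) : ℝ) < L by linarith))] with s hs
  exact hs.le.trans ((le_abs_self _).trans (Complex.abs_re_le_norm _))

/-- squarefree-supported multiplicative function -/
noncomputable def gg (b : ℕ → ℝ) (q : ℕ) : ℝ := if Squarefree q then ∏ p ∈ q.primeFactors, b p else 0

/-- products of subsets -/
noncomputable def SQ (T : Finset ℕ) : Finset ℕ := T.powerset.image (fun S => ∏ p ∈ S, p)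

lemma sqf_prod (S : Finset ℕ) (hS : ∀ p ∈ S, p.Prime) : Squarefree (∏ p ∈ S, p) := 
  Finset.squarefree_prod_of_pairwise_isCoprime (fun a ha b hb hab => Nat.coprime_iff_isRelPrime.mp ((Nat.coprime_primes (hS a ha) (hS b hb)).mpr hab)) (fun p hp => (hS p hp).prime.squarefree)

lemma gg_prod (b : ℕ → ℝ) (S : Finset ℕ) (hS : ∀ p ∈ S, p.Prime) : gg b (∏ p ∈ S, p) = ∏ p ∈ S, b p := by
  unfold gg
  rw [if_pos (sqf_prod S hS), Nat.primeFactors_prod hS]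

lemma prod_inj (T : Finset ℕ) (hT : ∀ p ∈ T, p.Prime) : Set.InjOn (fun S : Finset ℕ => ∏ p ∈ S, p) (T.powerset : Set (Finset ℕ)) := by
  intro S hS S' hS' h
  simp only [coe_powerset, Set.mem_preimage, Set.mem_powerset_iff, coe_subset] at hS hS' h
  rw [← Nat.primeFactors_prod (fun p hp => hT p (hS hp)), h, Nat.primeFactors_prod (fun p hp => hT p (hS' hp))]

lemma sum_SQ (b : ℕ → ℝ) (T : Finset ℕ) (hT : ∀ p ∈ T, p.Prime) : ∑ q ∈ SQ T, gg b q = ∏ p ∈ T, (1 + b p) := by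
  unfold SQ
  rw [sum_image (prod_inj T hT), Finset.prod_one_add]
  exact sum_congr rfl (fun S hS => gg_prod b S (fun p hp => hT p (mem_powerset.mp hS hp)))

lemma mem_SQ (T : Finset ℕ) (hT : ∀ p ∈ T, p.Prime) (q : ℕ) : q ∈ SQ T ↔ Squarefree q ∧ q.primeFactors ⊆ T := by
  unfold SQ
  rw [mem_image]
  constructor
  · rintro ⟨S, hS, rfl⟩
    rw [mem_powerset] at hS
    refine ⟨sqf_prod S (fun p hp => hT p (hS hp)), ?_⟩
    rw [Nat.primeFactors_prod (fun p hp => hT p (hS hp))]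
    exact hS
  · rintro ⟨h1, h2⟩
    exact ⟨q.primeFactors, mem_powerset.mpr h2, Nat.prod_primeFactors_of_squarefree h1⟩

lemma gg_abs (b : ℕ → ℝ) (q : ℕ) : |gg b q| = gg (fun p => |b p|) q := by
  unfold gg
  split_ifs
  · rw [abs_prod]
  · simp

lemma gg_nonneg (b : ℕ → ℝ) (hb : ∀ p, 0 ≤ b p) (q : ℕ) : 0 ≤ gg b q := by
  unfold gg
  split_ifs
  · exact prod_nonneg (fun p _ => hb p)
  · exact le_rfl

lemma gg_nonneg' (b : ℕ → ℝ) (hb : ∀ p, p.Prime → 0 ≤ b p) (q : ℕ) : 0 ≤ gg b q := by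
  unfold gg
  split_ifs
  · exact prod_nonneg (fun p hp => hb p (Nat.prime_of_mem_primeFactors hp))
  · exact le_rfl

lemma gg_zero (b : ℕ → ℝ) : gg b 0 = 0 := by simp [gg]

lemma gg_one (b : ℕ → ℝ) : gg b 1 = 1 := by simp [gg]

lemma gg_mul (b : ℕ → ℝ) (m n : ℕ) (h : m.Coprime n) : gg b (m * n) = gg b m * gg b n := by
  unfold gg
  have e := Nat.squarefree_mul h
  by_cases h1 : Squarefree m <;> by_cases h2 : Squarefree n <;> simp [h1, h2, e]
  rw [h.primeFactors_mul, prod_union h.disjoint_primeFactors]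

lemma gg_prime (b : ℕ → ℝ) (p : ℕ) (hp : p.Prime) : gg b p = b p := by
  unfold gg; rw [if_pos hp.prime.squarefree, hp.primeFactors]; simp

lemma gg_summ (b : ℕ → ℝ) (h : Summable fun p : Nat.Primes => |b p|) : Summable fun q => |gg b q| := by
  set R := ∑' p : Nat.Primes, |b p|
  refine summable_of_sum_le (c := Real.exp R) (fun _ => abs_nonneg _) ?_
  intro u
  set T := u.biUnion Nat.primeFactors with hT
  have hTp : ∀ p ∈ T, p.Prime := by
    intro p hp
    rw [hT, mem_biUnion] at hp
    obtain ⟨q, _, hq⟩ := hp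
    exact Nat.prime_of_mem_primeFactors hq
  have h1 : ∑ q ∈ u, |gg b q| ≤ ∑ q ∈ SQ T, |gg b q| := by
    rw [← sum_filter_add_sum_filter_not u Squarefree]
    have : ∑ q ∈ u.filter (fun x => ¬ Squarefree x), |gg b q| = 0 := by
      apply sum_eq_zero
      intro q hq
      rw [mem_filter] at hq
      unfold gg; rw [if_neg hq.2, abs_zero]
    rw [this, add_zero]
    apply sum_le_sum_of_subset_of_nonneg
    · intro q hq
      rw [mem_filter] at hq
      rw [mem_SQ T hTp]
      exact ⟨hq.2, fun p hp => mem_biUnion.mpr ⟨q, hq.1, hp⟩⟩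
    · intros; positivity
  refine h1.trans ?_
  simp_rw [gg_abs]
  rw [sum_SQ _ T hTp]
  calc ∏ p ∈ T, (1 + |b p|) ≤ ∏ p ∈ T, Real.exp |b p| := 
        prod_le_prod (fun p _ => by positivity) (fun p _ => by linarith [Real.add_one_le_exp |b p|])
    _ = Real.exp (∑ p ∈ T, |b p|) := (Real.exp_sum _ _).symm
    _ ≤ _ := by
        apply Real.exp_le_exp.mpr
        have : ∑ p ∈ T, |b p| = ∑ p ∈ (T.subtype Nat.Prime : Finset Nat.Primes), |b p| := by
          have := Finset.sum_subtype_eq_sum_filter (s := T) (fun p => |b p|) (p := Nat.Prime)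
          rw [filter_true_of_mem hTp] at this
          exact this.symm
        rw [this]
        exact Summable.sum_le_tsum (f := fun p : Nat.Primes => |b p|) _ (fun _ _ => abs_nonneg _) h

lemma gg_pow (b : ℕ → ℝ) (p : ℕ) (hp : p.Prime) (e : ℕ) (he : 2 ≤ e) : gg b (p ^ e) = 0 := by
  unfold gg
  rw [if_neg]
  intro h
  have := (Nat.squarefree_pow_iff hp.one_lt.ne' (by omega)).mp h
  omega

lemma gg_hasProd (b : ℕ → ℝ) (h : Summable fun p : Nat.Primes => |b p|) : 
    HasProd (fun p : Nat.Primes => 1 + b p) (∑' q, gg b q) := by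
  have hs := gg_summ b h
  have h := EulerProduct.eulerProduct_hasProd (f := gg b) (gg_one b) (fun {m n} hmn => gg_mul b m n hmn) hs (gg_zero b)
  have e : (fun p : Nat.Primes => 1 + b p) = fun p : Nat.Primes => ∑' e : ℕ, gg b ((p:ℕ) ^ e) := by
    ext p
    rw [tsum_eq_sum (s := range 2)]
    · rw [sum_range_succ, sum_range_one, pow_zero, pow_one, gg_one, gg_prime _ _ p.2]
    · intro e he
      exact gg_pow b p p.2 e (by rw [mem_range] at he; omega)
  rw [e]
  exact h

/-- local factor -/
noncomputable def bk (k : ℕ) (s : ℝ) (p : ℕ) : ℝ := -(Ak k p / ((p:ℝ) - 1) * (p:ℝ) ^ (-s))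

/-- the full series -/
noncomputable def Fk (k : ℕ) (s : ℝ) : ℝ := ∑' q, gg (bk k s) q

/-- primes up to N -/
def TT (N : ℕ) : Finset ℕ := (range (N + 1)).filter Nat.Prime

lemma mem_TT (N p : ℕ) : p ∈ TT N ↔ p ≤ N ∧ p.Prime := by
  unfold TT; rw [mem_filter, mem_range, Nat.lt_succ_iff]

lemma Ak_zero (k p : ℕ) (h : p % 4 ≠ 1) : Ak k p = 0 := by unfold Ak; rw [if_neg h]

lemma p_ge5 (p : ℕ) (hp : p.Prime) (h : p % 4 = 1) : 5 ≤ p := by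
  have := hp.two_le; omega

lemma rpow_neg_le1 (p : ℕ) (hp : p.Prime) (s : ℝ) (hs : 0 ≤ s) : (p:ℝ) ^ (-s) ≤ 1 := 
  Real.rpow_le_one_of_one_le_of_nonpos (by exact_mod_cast hp.one_lt.le) (by linarith)

lemma x_split (p : ℕ) (hp : p.Prime) (s : ℝ) : (p:ℝ) ^ (-(1 + s)) = (p:ℝ) ^ (-s) / p := by
  have : (0:ℝ) < p := by exact_mod_cast hp.pos
  rw [show -(1+s) = -s - 1 by ring, Real.rpow_sub_one this.ne']

lemma bk_le_A (k : ℕ) (s : ℝ) (p : ℕ) (hp : p.Prime) : |bk k s p| ≤ 5 / 4 * |Ak k p * (p:ℝ) ^ (-(1 + s))| := by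
  unfold bk
  by_cases h : p % 4 = 1
  · have h5 : (5:ℝ) ≤ p := by exact_mod_cast p_ge5 p hp h
    rw [x_split p hp, abs_neg, abs_mul, abs_div, abs_mul, abs_div]
    rw [abs_of_pos (show (0:ℝ) < p - 1 by linarith), abs_of_pos (show (0:ℝ) < p by linarith)]
    have : |Ak k p| / ((p:ℝ) - 1) ≤ 5 / 4 * (|Ak k p| / p) := by
      rw [div_le_iff₀ (by linarith)]
      have e : 5 / 4 * (|Ak k p| / p) * ((p:ℝ) - 1) = |Ak k p| * (5 / 4 * ((p - 1) / p)) := by field_simp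
      rw [e]
      apply le_mul_of_one_le_right (abs_nonneg _)
      rw [← mul_div_assoc, le_div_iff₀ (by linarith)]; linarith
    calc _ ≤ 5 / 4 * (|Ak k p| / p) * |(p:ℝ) ^ (-s)| := mul_le_mul_of_nonneg_right this (abs_nonneg _)
      _ = _ := by ring
  · rw [Ak_zero k p h]; simp

lemma bk_abs (k : ℕ) (s : ℝ) (hs : 0 ≤ s) (p : ℕ) (hp : p.Prime) : |bk k s p| ≤ 15 / 4 / p := by
  refine (bk_le_A k s p hp).trans ?_
  have h0 : (0:ℝ) < p := by exact_mod_cast hp.pos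
  rw [x_split p hp, abs_mul, abs_div, abs_of_pos h0, abs_of_nonneg (Real.rpow_nonneg h0.le _)]
  have h1 := Ak_abs k p hp
  have h2 := rpow_neg_le1 p hp s hs
  have h3 := Real.rpow_nonneg h0.le (-s)
  have : |Ak k p| * ((p:ℝ) ^ (-s) / p) ≤ 3 * (1 / p) := by gcongr
  calc _ ≤ 5 / 4 * (3 * (1 / (p:ℝ))) := by gcongr
    _ = _ := by ring

lemma bk_zero (k : ℕ) (s : ℝ) (p : ℕ) (h : p % 4 ≠ 1) : bk k s p = 0 := by
  unfold bk; rw [Ak_zero k p h]; simp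

lemma bk_small (k : ℕ) (s : ℝ) (hs : 0 ≤ s) (p : ℕ) (hp : p.Prime) : |bk k s p| ≤ 3 / 4 := by
  by_cases h : p % 4 = 1
  · refine (bk_abs k s hs p hp).trans ?_
    have h5 : (5:ℝ) ≤ p := by exact_mod_cast p_ge5 p hp h
    rw [div_div, div_le_div_iff₀ (by positivity) (by positivity)]; linarith
  · rw [bk_zero k s p h]; norm_num

/-- error in the logarithm of the local factor -/
noncomputable def ek (k : ℕ) (s : ℝ) (p : ℕ) : ℝ := Real.log (1 + bk k s p) + Ak k p * (p:ℝ) ^ (-(1 + s))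

lemma ek_abs (k : ℕ) (s : ℝ) (hs : 0 ≤ s) (p : ℕ) (hp : p.Prime) : |ek k s p| ≤ 64 * ((p:ℝ) ^ 2)⁻¹ := by
  by_cases h : p % 4 = 1
  · have h5 : (5:ℝ) ≤ p := by exact_mod_cast p_ge5 p hp h
    set b := bk k s p with hb
    have hs1 := bk_small k s hs p hp
    have hs2 := bk_abs k s hs p hp
    rw [← hb] at hs1 hs2
    have h1 := Real.abs_log_sub_add_sum_range_le (x := -b) (by rw [abs_neg]; linarith) 1
    simp only [range_one, sum_singleton, abs_neg, sub_neg_eq_add] at h1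
    norm_num at h1
    have h2 : |b| ^ 2 / (1 - |b|) ≤ 4 * |b| ^ 2 := by
      rw [div_le_iff₀ (by linarith)]
      nlinarith [sq_nonneg |b|]
    have h3 : |b| ^ 2 ≤ (15 / 4 / p) ^ 2 := by gcongr
    have h4 : |b + Ak k p * (p:ℝ) ^ (-(1 + s))| ≤ 15 / 4 * ((p:ℝ) ^ 2)⁻¹ := by
      have e : b + Ak k p * (p:ℝ) ^ (-(1 + s)) = - (Ak k p * (p:ℝ) ^ (-s) * (1 / (p * (p - 1)))) := by
        rw [hb, x_split p hp]; unfold bk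
        have : (p:ℝ) - 1 ≠ 0 := by linarith
        have : (p:ℝ) ≠ 0 := by linarith
        field_simp; ring
      have hpp : (0:ℝ) < p * (p - 1) := by nlinarith
      rw [e, abs_neg, abs_mul, abs_mul, abs_of_nonneg (Real.rpow_nonneg (by linarith) _), abs_of_pos (show 0 < 1 / ((p:ℝ) * (p-1)) by positivity)]
      have : 1 / ((p:ℝ) * (p-1)) ≤ 5 / 4 * ((p:ℝ) ^ 2)⁻¹ := by
        rw [← div_eq_mul_inv, div_le_div_iff₀ hpp (by positivity)]
        nlinarith
      calc |Ak k p| * (p:ℝ) ^ (-s) * (1 / (p * (p - 1))) ≤ 3 * 1 * (5 / 4 * ((p:ℝ) ^ 2)⁻¹) := by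
            gcongr
            · exact Ak_abs k p hp
            · exact rpow_neg_le1 p hp s hs
        _ = _ := by ring
    have e : ek k s p = (-b + Real.log (1 + b)) + (b + Ak k p * (p:ℝ) ^ (-(1 + s))) := by unfold ek; rw [← hb]; ring
    rw [e]
    refine (abs_add_le _ _).trans ?_
    have h6 : (15 / 4 / (p:ℝ)) ^ 2 = 225 / 16 * ((p:ℝ) ^ 2)⁻¹ := by
      rw [div_pow, div_eq_mul_inv]; norm_num
    rw [h6] at h3
    have : 0 ≤ ((p:ℝ) ^ 2)⁻¹ := by positivity
    have h1' : |-b + Real.log (1 + b)| ≤ |b| ^ 2 / (1 - |b|) := by simpa using h1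
    linarith
  · unfold ek
    rw [bk_zero k s p h, Ak_zero k p h]
    simp

lemma ek_summ (k : ℕ) (s : ℝ) (hs : 0 ≤ s) : Summable fun p : Nat.Primes => ek k s p := by
  have h1 : Summable fun n : ℕ => 64 * ((n:ℝ) ^ 2)⁻¹ := (Real.summable_nat_pow_inv.mpr (by norm_num)).mul_left _
  exact Summable.of_norm_bounded (h1.comp_injective Subtype.val_injective) (fun p => ek_abs k s hs p p.2)

lemma bk_summ (k : ℕ) (hk : 0 < k) (s : ℝ) (hs : 0 < s) : Summable fun p : Nat.Primes => |bk k s p| := 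
  Summable.of_nonneg_of_le (fun _ => abs_nonneg _) (fun p => bk_le_A k s p p.2) ((PA_summ k hk s hs).abs.mul_left _)

lemma TT_prime (N : ℕ) : ∀ p ∈ TT N, p.Prime := fun p hp => ((mem_TT N p).mp hp).2

lemma tsum_primes (e : ℕ → ℝ) : ∑' p : Nat.Primes, e p = ∑' n : ℕ, if n.Prime then e n else 0 := by
  have := tsum_subtype {p : ℕ | p.Prime} e
  rw [show (∑' p : Nat.Primes, e p) = ∑' p : ({p : ℕ | p.Prime} : Set ℕ), e p from rfl, this]
  exact tsum_congr (fun n => by simp [Set.indicator])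

lemma tail_sq (N : ℕ) (e : ℕ → ℝ) (C : ℝ) (hC : 0 ≤ C) (he : ∀ p, p.Prime → |e p| ≤ C * ((p:ℝ) ^ 2)⁻¹) : 
    |∑' p : Nat.Primes, e p - ∑ p ∈ TT N, e p| ≤ C * (2 / (N + 1)) := by
  have h1 : Summable fun n : ℕ => C * ((n:ℝ) ^ 2)⁻¹ := (Real.summable_nat_pow_inv.mpr (by norm_num)).mul_left _
  set e' : ℕ → ℝ := fun n => if n.Prime then e n else 0 with he'
  have hb : ∀ n, |e' n| ≤ C * ((n:ℝ) ^ 2)⁻¹ := by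
    intro n
    simp only [he']
    split_ifs with h
    · exact he n h
    · rw [abs_zero]; positivity
  have hs : Summable e' := Summable.of_norm_bounded h1 hb
  have e2 : ∑ p ∈ TT N, e p = ∑ n ∈ range (N + 1), e' n := by
    unfold TT; rw [sum_filter]
  rw [tsum_primes, e2, ← hs.sum_add_tsum_nat_add (N + 1), add_sub_cancel_left]
  have hs2 : Summable fun n => e' (n + (N + 1)) := (summable_nat_add_iff (N + 1)).mpr hs
  refine le_of_tendsto hs2.hasSum.tendsto_sum_nat.abs (Filter.Eventually.of_forall ?_)
  intro M
  calc |∑ n ∈ range M, e' (n + (N + 1))| ≤ ∑ n ∈ range M, |e' (n + (N + 1))| := abs_sum_le_sum_abs _ _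
    _ ≤ ∑ n ∈ range M, C * (((n + (N + 1) : ℕ) : ℝ) ^ 2)⁻¹ := sum_le_sum (fun n _ => hb _)
    _ = ∑ n ∈ Ioo N (N + 1 + M), C * ((n:ℝ) ^ 2)⁻¹ := by
        rw [show Ioo N (N + 1 + M) = Ico (N + 1) (N + 1 + M) by ext; simp, sum_Ico_eq_sum_range]
        rw [Nat.add_sub_cancel_left]
        exact sum_congr rfl (fun n _ => by rw [add_comm n])
    _ ≤ _ := by
        rw [← mul_sum]
        exact mul_le_mul_of_nonneg_left (sum_Ioo_inv_sq_le N _) hC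

lemma one_bk_pos (k : ℕ) (s : ℝ) (hs : 0 ≤ s) (p : ℕ) (hp : p.Prime) : 0 < 1 + bk k s p := by
  have := bk_small k s hs p hp
  have := neg_abs_le (bk k s p)
  linarith

lemma Fk_split (k : ℕ) (hk : 0 < k) (s : ℝ) (hs : 0 < s) (N : ℕ) : ∃ θ : ℝ, |θ| ≤ 128 / (N + 1) ∧ 
    Fk k s = (∏ p ∈ TT N, (1 + bk k s p)) * Real.exp (-(PA k s - ∑ p ∈ TT N, Ak k p * (p:ℝ) ^ (-(1 + s))) + θ) := by
  refine ⟨∑' p : Nat.Primes, ek k s p - ∑ p ∈ TT N, ek k s p, ?_, ?_⟩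
  · refine (tail_sq N _ 64 (by norm_num) (ek_abs k s hs.le)).trans (le_of_eq (by ring))
  · have h1 := gg_hasProd (bk k s) (bk_summ k hk s hs)
    have h2 := ((ek_summ k s hs.le).hasSum.sub (PA_summ k hk s hs).hasSum).rexp
    have e : (Real.exp ∘ fun p : Nat.Primes => ek k s p - Ak k p * (p:ℝ) ^ (-(1 + s))) = fun p : Nat.Primes => 1 + bk k s p := by
      ext p
      simp only [Function.comp]
      unfold ek
      rw [add_sub_cancel_right, Real.exp_log (one_bk_pos k s hs.le p p.2)]
    rw [e] at h2
    have h3 := h1.unique h2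
    unfold Fk
    rw [h3]
    have h4 : ∏ p ∈ TT N, (1 + bk k s p) = Real.exp (∑ p ∈ TT N, (ek k s p - Ak k p * (p:ℝ) ^ (-(1 + s)))) := by
      rw [Real.exp_sum]
      refine prod_congr rfl (fun p hp => ?_)
      unfold ek
      rw [add_sub_cancel_right, Real.exp_log (one_bk_pos k s hs.le p (TT_prime N p hp))]
    rw [h4, ← Real.exp_add, sum_sub_distrib]
    congr 1
    unfold PA
    ring

lemma gg_bk0 (k q : ℕ) : gg (bk k 0) q = if Squarefree q ∧ (∀ p : ℕ, p.Prime → p ∣ q → p % 4 = 1) then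
            ((ArithmeticFunction.moebius q : ℝ) / (Nat.totient q : ℝ)) *
              ∏ p ∈ q.primeFactors, ((nSol (k : ℤ) 4 p : ℝ) - 1) else 0 := by
  unfold gg
  by_cases hq : Squarefree q
  · rw [if_pos hq]
    by_cases h4 : ∀ p : ℕ, p.Prime → p ∣ q → p % 4 = 1
    · rw [if_pos ⟨hq, h4⟩]
      have e1 : (ArithmeticFunction.moebius q : ℝ) = ∏ p ∈ q.primeFactors, (-1 : ℝ) := by
        rw [ArithmeticFunction.moebius_apply_of_squarefree hq, prod_const, ← (ArithmeticFunction.cardDistinctFactors_eq_cardFactors_iff_squarefree hq.ne_zero).mpr hq]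
        rw [ArithmeticFunction.cardDistinctFactors_apply]
        push_cast
        rfl
      have e2 : (Nat.totient q : ℝ) = ∏ p ∈ q.primeFactors, ((p:ℝ) - 1) := by
        have := Nat.totient_mul_prod_primeFactors q
        rw [Nat.prod_primeFactors_of_squarefree hq, mul_comm] at this
        have h2 := Nat.eq_of_mul_eq_mul_left (Nat.pos_of_ne_zero hq.ne_zero) this
        rw [h2, Nat.cast_prod]
        refine prod_congr rfl (fun p hp => ?_)
        rw [Nat.cast_pred (Nat.prime_of_mem_primeFactors hp).pos]
      rw [e1, e2, ← prod_div_distrib, ← prod_mul_distrib]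
      refine prod_congr rfl (fun p hp => ?_)
      unfold bk Ak
      rw [if_pos (h4 p (Nat.prime_of_mem_primeFactors hp) (Nat.dvd_of_mem_primeFactors hp))]
      simp; ring
    · rw [if_neg (fun h => h4 h.2)]
      push Not at h4
      obtain ⟨p, hp, hd, h⟩ := h4
      exact prod_eq_zero (Nat.mem_primeFactors.mpr ⟨hp, hd, hq.ne_zero⟩) (bk_zero k 0 p h)
  · rw [if_neg hq, if_neg (fun h => hq h.1)]

lemma gg_bk_s (k n : ℕ) (s : ℝ) : gg (bk k s) n = gg (bk k 0) n * (n:ℝ) ^ (-s) := by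
  unfold gg
  split_ifs with h
  · have : (n:ℝ) = ∏ p ∈ n.primeFactors, (p:ℝ) := by
      rw [← Nat.cast_prod, Nat.prod_primeFactors_of_squarefree h]
    conv_rhs => rw [this]
    rw [← Real.finsetProd_rpow _ _ (fun p _ => by positivity), ← prod_mul_distrib]
    refine prod_congr rfl (fun p hp => ?_)
    unfold bk; simp
  · simp

/-- the hypothesis on Psi at a single k -/
def HPsi (k : ℕ) (L Ψ : ℝ) : Prop := Filter.Tendsto
        (fun Q : ℕ => ∑ q ∈ Finset.range (Q + 1),
          (if Squarefree q ∧ (∀ p : ℕ, p.Prime → p ∣ q → p % 4 = 1) ∧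
              L < (q : ℝ) then
            ((ArithmeticFunction.moebius q : ℝ) / (Nat.totient q : ℝ)) *
              ∏ p ∈ q.primeFactors, ((nSol (k : ℤ) 4 p : ℝ) - 1)
          else 0))
        Filter.atTop (nhds Ψ)

lemma HPsi.lim {k : ℕ} {L Ψ : ℝ} (hk : 0 < k) (hL : 0 ≤ L) (h : HPsi k L Ψ) : 
    Filter.Tendsto (Fk k) (nhdsWithin 0 (Set.Ioi 0)) (nhds (Ψ + ∑ q ∈ range (⌊L⌋₊ + 1), gg (bk k 0) q)) := by
  have h1 : Filter.Tendsto (fun N : ℕ => ∑ n ∈ range N, gg (bk k 0) (n + 1)) Filter.atTop (nhds (Ψ + ∑ q ∈ range (⌊L⌋₊ + 1), gg (bk k 0) q)) := by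
    have h2 := h.add_const (∑ q ∈ range (⌊L⌋₊ + 1), gg (bk k 0) q)
    refine h2.congr' ?_
    filter_upwards [Filter.eventually_ge_atTop ⌊L⌋₊] with Q hQ
    have e0 : ∑ n ∈ range Q, gg (bk k 0) (n + 1) = ∑ n ∈ range (Q + 1), gg (bk k 0) n := by
      rw [sum_range_succ', gg_zero, add_zero]
    have e1 : ∑ q ∈ range (⌊L⌋₊ + 1), gg (bk k 0) q = ∑ q ∈ range (Q + 1), if (q:ℝ) ≤ L then gg (bk k 0) q else 0 := by
      rw [← sum_filter]
      refine sum_congr ?_ (fun _ _ => rfl)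
      ext q
      rw [mem_filter, mem_range, mem_range, ← Nat.le_floor_iff hL]
      omega
    rw [e0, e1, ← sum_add_distrib]
    refine sum_congr rfl (fun q _ => ?_)
    by_cases hq : (q:ℝ) ≤ L
    · rw [if_pos hq, if_neg (fun h => absurd h.2.2 (not_lt.mpr hq)), zero_add]
    · rw [if_neg hq, add_zero, gg_bk0]
      by_cases h' : Squarefree q ∧ (∀ p : ℕ, p.Prime → p ∣ q → p % 4 = 1)
      · rw [if_pos h', if_pos ⟨h'.1, h'.2, not_le.mp hq⟩]
      · rw [if_neg h', if_neg (fun h => h' ⟨h.1, h.2.1⟩)]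
  refine abel_dir _ _ h1 (Fk k) ?_
  intro s hs
  have h3 : Summable (gg (bk k s)) := (gg_summ _ (bk_summ k hk s hs)).of_abs
  have h4 := (Filter.tendsto_add_atTop_iff_nat 1).mpr h3.hasSum.tendsto_sum_nat
  refine h4.congr (fun N => ?_)
  rw [sum_range_succ', gg_zero, add_zero]
  exact sum_congr rfl (fun n _ => gg_bk_s k (n + 1) s)

lemma TT_zero : TT 0 = ∅ := by
  ext p; rw [mem_TT]; constructor
  · rintro ⟨h, hp⟩; exact absurd hp.pos (by omega)
  · intro h; simp at h

lemma Fk_nonneg (k : ℕ) (hk : 0 < k) (s : ℝ) (hs : 0 < s) : 0 ≤ Fk k s := by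
  obtain ⟨θ, _, h⟩ := Fk_split k hk s hs 0
  rw [h, TT_zero, prod_empty, one_mul]; positivity

lemma Fk_le (k : ℕ) (hk : 0 < k) (s : ℝ) (hs : 0 < s) (R : ℝ) (hR : -R ≤ PA k s) : Fk k s ≤ Real.exp (128 + R) := by
  obtain ⟨θ, h1, h⟩ := Fk_split k hk s hs 0
  rw [h, TT_zero, prod_empty, one_mul, sum_empty]
  apply Real.exp_le_exp.mpr
  have := le_abs_self θ
  norm_num at h1
  linarith

lemma pos_near : ∀ᶠ s in nhdsWithin (0:ℝ) (Set.Ioi 0), 0 < s := eventually_mem_nhdsWithin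

lemma F0_nonneg {k : ℕ} (hk : 0 < k) {F0 : ℝ} (h : Filter.Tendsto (Fk k) (nhdsWithin 0 (Set.Ioi 0)) (nhds F0)) : 0 ≤ F0 := by
  refine ge_of_tendsto h ?_
  filter_upwards [pos_near] with s hs using Fk_nonneg k hk s hs

lemma F0_le {k : ℕ} (hk : 0 < k) {F0 : ℝ} (h : Filter.Tendsto (Fk k) (nhdsWithin 0 (Set.Ioi 0)) (nhds F0)) (R : ℝ)
    (hR : ∀ᶠ s in nhdsWithin (0:ℝ) (Set.Ioi 0), -R ≤ PA k s) : F0 ≤ Real.exp (128 + R) := by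
  refine le_of_tendsto h ?_
  filter_upwards [pos_near, hR] with s hs hss using Fk_le k hk s hs R hss

/-- non-square and no exceptional behaviour -/
structure GoodK (y : ℝ) (k : ℕ) : Prop where
  pos : 0 < k
  le : (k:ℝ) ≤ y
  ns : ¬ IsSquare k
  e1 : ¬ Exc y k
  e2 : ¬ Exc y (-k)

lemma log_ge_of_inv {l x : ℝ} (n : ℕ) (hl : 0 < l) (h : (l ^ n)⁻¹ ≤ x) : -(n * Real.log l) ≤ Real.log x := by
  have := Real.log_le_log (by positivity) h
  rw [Real.log_inv, Real.log_pow] at this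
  exact this

lemma small_near (c : ℝ) (hc : 0 < c) : ∀ᶠ s in nhdsWithin (0:ℝ) (Set.Ioi 0), s ≤ c := by
  filter_upwards [Ioo_mem_nhdsGT hc] with s hs using hs.2.le

lemma good_PA : ∀ᶠ y : ℝ in Filter.atTop, ∀ k : ℕ, GoodK y k → ∀ s : ℝ, 0 < s → s ≤ (Real.log y ^ 16)⁻¹ → 
    -(19 * Real.log (Real.log y) + 2 * cP) ≤ PA k s := by
  filter_upwards [f_lower, nonexc, evlog 2] with y h1 h2 hl k hk s hs hs1
  have hk0 : (k:ℤ) ≠ 0 := by have := hk.pos; omega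
  have a1 := log_ge_of_inv 13 (by linarith) (h1 k hk.pos hk.le hk.ns s hs hs1)
  have a2 := log_ge_of_inv 6 (by linarith) (h2 k hk0 (by simpa using hk.le) (nat_nonsq k hk.ns) hk.e1 s hs hs1)
  have a3 := log_ge_of_inv 6 (by linarith) (h2 (-k) (by omega) (by simpa using hk.le) (neg_nonsq _ (by have := hk.pos; omega)) hk.e2 s hs hs1)
  have b1 := (fk_base k hk.pos).le_PP s hs
  have b2 := (gq_base k).le_PP s hs
  have b3 := (gq_base (-k)).le_PP s hs
  rw [PA_eq k hk.pos s hs]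
  push_cast at a1 a2 a3
  linarith

lemma good_F0 : ∀ᶠ y : ℝ in Filter.atTop, ∀ k : ℕ, GoodK y k → ∀ F0 : ℝ, Filter.Tendsto (Fk k) (nhdsWithin 0 (Set.Ioi 0)) (nhds F0) → 
    F0 ≤ Real.exp (128 + 2 * cP) * Real.log y ^ 19 := by
  filter_upwards [good_PA, evlog 2] with y h1 hl k hk F0 hF
  have := F0_le hk.pos hF _ (by 
    filter_upwards [pos_near, small_near ((Real.log y ^ 16)⁻¹) (by positivity)] with s hs hs1 using h1 k hk s hs hs1)
  refine this.trans (le_of_eq ?_)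
  rw [show 128 + (19 * Real.log (Real.log y) + 2 * cP) = (128 + 2 * cP) + (19:ℕ) * Real.log (Real.log y) by push_cast; ring, Real.exp_add, ← Real.log_pow, Real.exp_log (by positivity)]

lemma crude_log (n : ℤ) (hn : n ≠ 0) (hns : ¬ IsSquare n) : 
    ∀ᶠ s in nhdsWithin (0:ℝ) (Set.Ioi 0), -(Real.log 600 + 2 / 3 * Real.log ((12 * n.natAbs : ℕ):ℝ)) ≤ Real.log ‖LL (gq n) s‖ := by
  have hM : (0:ℝ) < ((12 * n.natAbs : ℕ):ℝ) := by
    have := Int.natAbs_pos.mpr hn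
    exact_mod_cast (by omega)
  filter_upwards [crude_LL n hn hns] with s hs
  have := Real.log_le_log (by positivity) hs
  rw [Real.log_mul (by norm_num) (by positivity), Real.log_rpow hM, one_div, Real.log_inv] at this
  linarith

lemma exc_F0_aux : ∀ᶠ y : ℝ in Filter.atTop, ∀ k : ℕ, 0 < k → (k:ℝ) ≤ y → ¬ IsSquare k → (Exc y k ∨ Exc y (-k)) → 
    ∀ F0 : ℝ, Filter.Tendsto (Fk k) (nhdsWithin 0 (Set.Ioi 0)) (nhds F0) → 
    F0 ^ 2 ≤ Real.exp (2 * (128 + 2 * cP + Real.log 600)) * Real.log y ^ 32 * (12 * y) ^ (2 / 3 : ℝ) := by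
  filter_upwards [f_lower, nonexc, exc_pair, evlog 2, Filter.eventually_ge_atTop 1] with y h1 h2 h3 hl hy k hk hky hns hex F0 hF
  have key : ∃ n m : ℤ, n ≠ 0 ∧ m ≠ 0 ∧ n.natAbs = k ∧ m.natAbs = k ∧ ¬ IsSquare n ∧ ¬ IsSquare m ∧ ¬ Exc y m ∧ 
      ∀ s, PP (gq k) s + PP (gq (-k)) s = PP (gq n) s + PP (gq m) s := by
    have hk0 : (k:ℤ) ≠ 0 := by omega
    have hk1 : -(k:ℤ) ≠ 0 := by omega
    have n1 := nat_nonsq k hns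
    have n2 := neg_nonsq (-k) (by omega)
    have hno : ¬ (Exc y k ∧ Exc y (-k)) := by
      rintro ⟨a, b⟩
      have := h3 k (-k) hk0 hk1 (by simpa using hky) (by simpa using hky) n1 n2 a b
      exact neg_nonsq _ (by nlinarith) this
    rcases hex with h | h
    · exact ⟨k, -k, hk0, hk1, by simp, by simp, n1, n2, fun h' => hno ⟨h, h'⟩, fun s => rfl⟩
    · exact ⟨-k, k, hk1, hk0, by simp, by simp, n2, n1, fun h' => hno ⟨h', h⟩, fun s => add_comm _ _⟩
  obtain ⟨n, m, hn, hm, en, em, sn, sm, hm', hPP⟩ := key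
  set l := Real.log y with hl'
  have hb := F0_le hk hF (16 * Real.log l + 1 / 2 * (Real.log 600 + 2 / 3 * Real.log ((12 * n.natAbs : ℕ):ℝ)) + 2 * cP) (by
    filter_upwards [pos_near, small_near ((l ^ 16)⁻¹) (by positivity), crude_log n hn sn] with s hs hs1 hc
    have a1 := log_ge_of_inv 13 (by linarith) (h1 k hk hky hns s hs hs1)
    have a2 := log_ge_of_inv 6 (by linarith) (h2 m hm (by rw [em]; exact hky) sm hm' s hs hs1)
    have b1 := (fk_base k hk).le_PP s hs
    have b2 := (gq_base n).le_PP s hs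
    have b3 := (gq_base m).le_PP s hs
    rw [PA_eq k hk s hs, hPP]
    push_cast at a1 a2
    push_cast at hc ⊢
    linarith)
  have hF0 := F0_nonneg hk hF
  have hlog : Real.log ((12 * n.natAbs : ℕ):ℝ) ≤ Real.log (12 * y) := by
    rw [en]
    apply Real.log_le_log
    · exact_mod_cast (by omega)
    · push_cast; linarith
  have h600 : 0 ≤ Real.log 600 := Real.log_nonneg (by norm_num)
  calc F0 ^ 2 ≤ (Real.exp (128 + (16 * Real.log l + 1 / 2 * (Real.log 600 + 2 / 3 * Real.log ((12 * n.natAbs : ℕ):ℝ)) + 2 * cP))) ^ 2 := by gcongr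
    _ = Real.exp (2 * (128 + (16 * Real.log l + 1 / 2 * (Real.log 600 + 2 / 3 * Real.log ((12 * n.natAbs : ℕ):ℝ)) + 2 * cP))) := by
        rw [sq, ← Real.exp_add]; ring_nf
    _ ≤ Real.exp (2 * (128 + 2 * cP + Real.log 600) + ((32:ℕ) * Real.log l + 2 / 3 * Real.log (12 * y))) := by
        apply Real.exp_le_exp.mpr
        push_cast at hlog ⊢
        linarith
    _ = _ := by
        rw [Real.exp_add, Real.exp_add, ← Real.log_pow, Real.exp_log (by positivity), Real.rpow_def_of_pos (by positivity)]
        rw [mul_comm (Real.log (12 * y)), mul_assoc]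

lemma sq_Ak (ℓ : ℕ) (hl : 0 < ℓ) (p : ℕ) (hp : p.Prime) : gr (2 * ℓ) p + gr (-(2 * ℓ)) p ≤ Ak (ℓ ^ 2) p := by
  have : Fact p.Prime := ⟨hp⟩
  rcases prime_cases p hp with rfl | h | h
  · rw [gr_two, gr_two, Ak_zero _ _ (by norm_num)]; simp
  · rw [gr_neg_1 _ _ h, gr_jac _ _ hp h]
    have hA := Ak_ge (ℓ ^ 2) p
    rcases jacobiSym.trichotomy (2 * ℓ) p with hj | hj | hj
    · -- p divides
      rw [hj]
      unfold Ak; rw [if_pos h]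
      have hz : ((2 * ℓ : ℤ) : ZMod p) = 0 := by
        rw [← jacobiSym.legendreSym.to_jacobiSym] at hj
        exact (legendreSym.eq_zero_iff p _).mp hj
      have h2 : (2 : ZMod p) ≠ 0 := by
        intro h2
        have : ((2:ℕ) : ZMod p) = 0 := by exact_mod_cast h2
        rw [ZMod.natCast_eq_zero_iff] at this
        have := Nat.le_of_dvd (by norm_num) this
        have := p_ge5 p hp h
        omega
      have hl0 : (ℓ : ZMod p) = 0 := by
        push_cast at hz
        exact (mul_eq_zero.mp hz).resolve_left h2
      have : 1 ≤ nSol ((ℓ ^ 2 : ℕ) : ℤ) 4 p := by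
        rw [nSol_eq, Nat.one_le_iff_ne_zero, Ne, card_eq_zero, ← Ne, ← nonempty_iff_ne_empty]
        refine ⟨0, ?_⟩
        rw [mem_filter]; refine ⟨mem_univ _, ?_⟩
        push_cast; rw [hl0]; ring
      have : (1:ℝ) ≤ nSol ((ℓ ^ 2 : ℕ) : ℤ) 4 p := by exact_mod_cast this
      push_cast at this ⊢
      linarith
    · rw [hj]
      unfold Ak; rw [if_pos h]
      obtain ⟨χ, hχ⟩ := exists_chi p h
      have h2 : (2 : ZMod p) ≠ 0 := by
        intro h2
        have : ((2:ℕ) : ZMod p) = 0 := by exact_mod_cast h2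
        rw [ZMod.natCast_eq_zero_iff] at this
        have := Nat.le_of_dvd (by norm_num) this
        have := p_ge5 p hp h
        omega
      have hz : ((2 * ℓ : ℤ) : ZMod p) ≠ 0 := by
        intro hz
        rw [← jacobiSym.legendreSym.to_jacobiSym, (legendreSym.eq_zero_iff p _).mpr hz] at hj
        omega
      have hsq : IsSquare ((2 * ℓ : ℤ) : ZMod p) := by
        rw [← jacobiSym.legendreSym.to_jacobiSym] at hj
        exact (legendreSym.eq_one_iff p hz).mp hj
      obtain ⟨t, ht⟩ := hsq
      obtain ⟨w, hw⟩ := (ZMod.exists_sq_eq_neg_one_iff (p := p)).mpr (by omega)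
      push_cast at ht hz
      have hroot : (((1 + w) * t / 2) : ZMod p) ^ 4 = - (ℓ:ZMod p) ^ 2 := by
        have e : (((1 + w) * t / 2) : ZMod p) ^ 2 = w * ℓ := by
          rw [div_pow, div_eq_iff (pow_ne_zero 2 h2)]
          have : ((1 + w) * t) ^ 2 = (1 + w) ^ 2 * (t * t) := by ring
          rw [this, ← ht]
          linear_combination (2 * (ℓ : ZMod p)) * (-hw)
        rw [show (4:ℕ) = 2 * 2 from rfl, pow_mul, e]
        linear_combination (-(ℓ:ZMod p)^2) * hw
      have hne : ((ℓ:ZMod p)) ≠ 0 := right_ne_zero_of_mul hz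
      have hc := card_pow4 h hχ (-(((ℓ ^ 2 : ℕ) : ℤ) : ZMod p))
      have h0 : (-(((ℓ ^ 2 : ℕ) : ℤ) : ZMod p)) ≠ 0 := by
        push_cast; exact neg_ne_zero.mpr (pow_ne_zero 2 hne)
      rw [if_neg h0] at hc
      have hpos : nSol ((ℓ ^ 2 : ℕ) : ℤ) 4 p ≠ 0 := by
        rw [nSol_eq, Ne, card_eq_zero, ← Ne, ← nonempty_iff_ne_empty]
        refine ⟨(1 + w) * t / 2, ?_⟩
        rw [mem_filter]; refine ⟨mem_univ _, ?_⟩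
        push_cast; exact hroot
      rw [← nSol_eq] at hc
      have : nSol ((ℓ ^ 2 : ℕ) : ℤ) 4 p = 4 := by
        split_ifs at hc
        · exact hc
        · exact absurd hc hpos
      rw [this]; norm_num
    · rw [hj]; push_cast; linarith
  · rw [gr_neg_3 _ _ h, Ak_zero _ _ (by omega)]; simp

lemma sq_PA (ℓ : ℕ) (hl : 0 < ℓ) (s : ℝ) (hs : 0 < s) : PP (gq (2 * ℓ)) s + PP (gq (-(2 * ℓ))) s ≤ PA (ℓ ^ 2) s := by
  rw [PP_gq, PP_gq, ← (gq_summ _ s hs).tsum_add (gq_summ _ s hs)]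
  unfold PA
  refine Summable.tsum_le_tsum ?_ ((gq_summ _ s hs).add (gq_summ _ s hs)) (PA_summ _ (by positivity) s hs)
  intro p
  rw [← add_mul]
  exact mul_le_mul_of_nonneg_right (sq_Ak ℓ hl p p.2) (by positivity)

lemma PP_sq_nonneg (n : ℤ) (h : IsSquare n) (s : ℝ) : 0 ≤ PP (gq n) s := by
  rw [PP_gq]
  refine tsum_nonneg (fun p => mul_nonneg ?_ (by positivity))
  obtain ⟨a, rfl⟩ := h
  rw [gr_mul_left]; exact mul_self_nonneg _

lemma sq_F0 (ℓ : ℕ) (hl : 0 < ℓ) (F0 : ℝ) (hF : Filter.Tendsto (Fk (ℓ ^ 2)) (nhdsWithin 0 (Set.Ioi 0)) (nhds F0)) : 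
    F0 ^ 2 ≤ Real.exp (2 * (128 + 2 * cP + 2 * Real.log 600)) * (24 * ℓ : ℝ) ^ (8 / 3 : ℝ) := by
  have h600 : 0 ≤ Real.log 600 := Real.log_nonneg (by norm_num)
  have hL : 0 ≤ Real.log (24 * ℓ) := Real.log_nonneg (by have : (1:ℝ) ≤ ℓ := by exact_mod_cast hl
                                                         linarith)
  have hcr : ∀ n : ℤ, n.natAbs = 2 * ℓ → ∀ᶠ s in nhdsWithin (0:ℝ) (Set.Ioi 0), -(Real.log 600 + 2 / 3 * Real.log (24 * ℓ) + cP) ≤ PP (gq n) s := by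
    intro n hn
    by_cases hs : IsSquare n
    · refine Filter.Eventually.of_forall (fun s => ?_)
      have := PP_sq_nonneg n hs s
      have := cP_nonneg
      linarith
    · filter_upwards [pos_near, crude_log n (by omega) hs] with s hs0 hc
      have := (gq_base n).le_PP s hs0
      rw [hn] at hc
      push_cast at hc
      rw [show (12 * (2 * ℓ) : ℝ) = 24 * ℓ by ring] at hc
      linarith
  have hb := F0_le (by positivity) hF (2 * (Real.log 600 + 2 / 3 * Real.log (24 * ℓ) + cP)) (by
    filter_upwards [pos_near, hcr (2 * ℓ) (by omega), hcr (-(2 * ℓ)) (by omega)] with s hs h1 h2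
    have := sq_PA ℓ hl s hs
    linarith)
  have hF0 := F0_nonneg (by positivity) hF
  have h24 : (0:ℝ) < 24 * ℓ := by positivity
  calc F0 ^ 2 ≤ (Real.exp (128 + 2 * (Real.log 600 + 2 / 3 * Real.log (24 * ℓ) + cP))) ^ 2 := by gcongr
    _ = Real.exp (2 * (128 + 2 * cP + 2 * Real.log 600) + Real.log (24 * ℓ) * (8 / 3)) := by
        rw [sq, ← Real.exp_add]; ring_nf
    _ = _ := by rw [Real.exp_add, Real.rpow_def_of_pos h24]

lemma kappa_fac (n p : ℕ) : (kappa n).factorization p = 2 * (n.factorization p / 2) := by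
  set f : ℕ →₀ ℕ := n.factorization.mapRange (fun v => 2 * (v / 2)) (by norm_num) with hf
  have hsub : f.support ⊆ n.primeFactors := by
    rw [← Nat.support_factorization]
    exact Finsupp.support_mapRange
  have e : kappa n = f.prod (fun a b => a ^ b) := by
    unfold kappa
    rw [Finsupp.prod_of_support_subset f hsub _ (fun _ _ => pow_zero _)]
    rfl
  rw [e, Nat.prod_pow_factorization_eq_self (fun q hq => Nat.prime_of_mem_primeFactors (hsub hq))]
  rfl

lemma kappa_pos (n : ℕ) : 0 < kappa n := by
  unfold kappa
  exact prod_pos (fun p hp => pow_pos (Nat.prime_of_mem_primeFactors hp).pos _)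

lemma kappa_le (n : ℕ) (hn : 0 < n) : kappa n ≤ n := by
  apply Nat.le_of_dvd hn
  rw [← Nat.factorization_le_iff_dvd (kappa_pos n).ne' hn.ne']
  intro p
  rw [kappa_fac]; omega

lemma kappa_isSq (n : ℕ) : ∃ d, kappa n = d ^ 2 := by
  refine ⟨∏ p ∈ n.primeFactors, p ^ (n.factorization p / 2), ?_⟩
  unfold kappa
  rw [← prod_pow]
  exact prod_congr rfl (fun p _ => by rw [← pow_mul, mul_comm])

lemma kappa_sq (n : ℕ) (hn : 0 < n) (h : IsSquare n) : kappa n = n := by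
  apply Nat.eq_of_factorization_eq (kappa_pos n).ne' hn.ne'
  intro p
  rw [kappa_fac]
  obtain ⟨a, rfl⟩ := h
  have : a ≠ 0 := by rintro rfl; simp at hn
  rw [Nat.factorization_mul this this]
  simp only [Finsupp.coe_add, Pi.add_apply]
  omega

lemma kappa_inj (a b : ℕ) (ha : 0 < a) (hb : 0 < b) (h : IsSquare (a * b)) (hk : kappa a = kappa b) : a = b := by
  apply Nat.eq_of_factorization_eq ha.ne' hb.ne'
  intro p
  have h1 := kappa_fac a p
  have h2 := kappa_fac b p
  rw [hk] at h1
  obtain ⟨c, hc⟩ := h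
  have hc0 : c ≠ 0 := by rintro rfl; have := Nat.mul_pos ha hb; omega
  have := congrArg (fun n => n.factorization p) hc
  simp only [Nat.factorization_mul ha.ne' hb.ne', Nat.factorization_mul hc0 hc0, Finsupp.coe_add, Pi.add_apply] at this
  omega

lemma class_count (S : Finset ℕ) (Z : ℝ) (h0 : ∀ k ∈ S, 0 < k) (hZ : ∀ k ∈ S, (kappa k : ℝ) ≤ Z) 
    (hp : ∀ a ∈ S, ∀ b ∈ S, IsSquare (a * b)) : (S.card : ℝ) ≤ Real.sqrt Z + 1 := by
  have h1 : S.card ≤ (range (⌊Real.sqrt Z⌋₊ + 1)).card := by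
    refine card_le_card_of_injOn (fun k => Nat.sqrt (kappa k)) ?_ ?_
    · intro k hk
      obtain ⟨d, hd⟩ := kappa_isSq k
      simp only [coe_range, Set.mem_Iio]
      rw [hd, Nat.sqrt_eq', Nat.lt_succ_iff]
      apply Nat.le_floor
      apply Real.le_sqrt_of_sq_le
      have := hZ k hk
      rw [hd] at this
      exact_mod_cast this
    · intro a ha b hb hab
      simp only at hab
      obtain ⟨d, hd⟩ := kappa_isSq a
      obtain ⟨d', hd'⟩ := kappa_isSq b
      rw [hd, hd', Nat.sqrt_eq', Nat.sqrt_eq'] at hab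
      exact kappa_inj a b (h0 a ha) (h0 b hb) (hp a ha b hb) (by rw [hd, hd', hab])
  rw [card_range] at h1
  calc (S.card : ℝ) ≤ ((⌊Real.sqrt Z⌋₊ + 1 : ℕ) : ℝ) := by exact_mod_cast h1
    _ ≤ _ := by push_cast; linarith [Nat.floor_le (Real.sqrt_nonneg Z)]

lemma isSq_trans (a b c : ℕ) (ha : 0 < a) (h1 : IsSquare (a * b)) (h2 : IsSquare (a * c)) : IsSquare (b * c) := by
  obtain ⟨x, hx⟩ := h1
  obtain ⟨y, hy⟩ := h2
  have h : a ^ 2 * (b * c) = (x * y) ^ 2 := by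
    calc a ^ 2 * (b * c) = (a * b) * (a * c) := by ring
      _ = _ := by rw [hx, hy]; ring
  have hd : a ∣ x * y := by
    rw [← Nat.pow_dvd_pow_iff (n := 2) (by norm_num), ← h]
    exact Dvd.intro _ rfl
  obtain ⟨e, he⟩ := hd
  refine ⟨e, ?_⟩
  rw [he, mul_pow] at h
  have := Nat.eq_of_mul_eq_mul_left (by positivity) h
  rw [this]; ring

lemma sq_count (k : ℕ) (hk : 0 < k) (S : Finset ℕ) (y : ℝ) (h0 : ∀ m ∈ S, 0 < m) (hy : ∀ m ∈ S, (m : ℝ) ≤ y) : 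
    ((S.filter (fun m => IsSquare (k * m))).card : ℝ) ≤ Real.sqrt y + 1 := by
  refine class_count _ y (fun m hm => h0 m (mem_filter.mp hm).1) ?_ ?_
  · intro m hm
    have hm' := (mem_filter.mp hm).1
    exact le_trans (by exact_mod_cast kappa_le m (h0 m hm')) (hy m hm')
  · intro a ha b hb
    exact isSq_trans k a b hk (mem_filter.mp ha).2 (mem_filter.mp hb).2

lemma PS_sum_le (N : ℕ) (s : ℝ) (hs : 0 < s) (h1 : s ≤ 1) : 
    ∑ n ∈ Icc 1 N, ((PS n).card : ℝ) * (n:ℝ) ^ (-(1 + s)) ≤ 18 / s := by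
  set f : ℕ → ℂ := fun n => ((PS n).card : ℂ) with hf
  have hc : ∀ N : ℕ, ∑ n ∈ Icc 1 N, ‖f n‖ ≤ 9 * N := by
    intro N
    simpa [hf] using cnt_aux N
  have hL := LL_le_cnt f hc s hs h1
  have hsum := summ_of_cnt f hc s hs
  set g : ℕ → ℝ := fun n => ((PS n).card : ℝ) * (n:ℝ) ^ (-(1 + s)) with hg
  have hFt : LSeries.term f ((1 + s : ℝ) : ℂ) = fun n => ((g n : ℝ) : ℂ) := by
    ext n
    rcases eq_or_ne n 0 with rfl | hn
    · simp [hg, PS_zero]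
    · rw [LSeries.term_of_ne_zero hn, hg]
      simp only
      rw [Complex.ofReal_mul, Complex.ofReal_cpow (by positivity), div_eq_mul_inv, ← Complex.cpow_neg]
      push_cast; rfl
  have hs2 : Summable g := by
    have : Summable fun n => ((g n : ℝ) : ℂ) := by rw [← hFt]; exact hsum
    exact Complex.summable_ofReal.mp this
  have e : LL f s = ((∑' n, g n : ℝ) : ℂ) := by
    unfold LL LSeries
    rw [hFt, Complex.ofReal_tsum]
  rw [e, Complex.norm_real] at hL
  calc ∑ n ∈ Icc 1 N, g n ≤ ∑' n, g n := hs2.sum_le_tsum _ (fun n _ => by positivity)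
    _ ≤ |∑' n, g n| := le_abs_self _
    _ ≤ _ := hL

lemma w_diff (X s : ℝ) (hX : 1 ≤ X) (hs : 0 ≤ s) (h1 : s ≤ 1) : 
    X ^ (-(1 + s)) - (X + 1) ^ (-(1 + s)) ≤ 2 / X ^ 2 := by
  have hX0 : 0 < X := by linarith
  have hb := one_add_mul_self_le_rpow_one_add (s := -(1 / (X + 1))) (by 
    have : 1 / (X + 1) ≤ 1 := by rw [div_le_one (by linarith)]; linarith
    linarith) (p := 1 + s) (by linarith)
  have e : 1 + -(1 / (X + 1)) = X / (X + 1) := by field_simp; ring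
  rw [e, Real.div_rpow hX0.le (by linarith)] at hb
  have hp : 0 < X ^ (1 + s) := by positivity
  have hp' : 0 < (X + 1) ^ (1 + s) := by positivity
  rw [Real.rpow_neg hX0.le, Real.rpow_neg (by linarith)]
  have hXX : X ≤ X ^ (1 + s) := by
    conv_lhs => rw [← Real.rpow_one X]
    exact Real.rpow_le_rpow_of_exponent_le hX (by linarith)
  have : (X ^ (1 + s))⁻¹ - ((X + 1) ^ (1 + s))⁻¹ = (X ^ (1 + s))⁻¹ * (1 - X ^ (1 + s) / (X + 1) ^ (1 + s)) := by
    field_simp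
  rw [this]
  calc (X ^ (1 + s))⁻¹ * (1 - X ^ (1 + s) / (X + 1) ^ (1 + s)) ≤ (X ^ (1 + s))⁻¹ * ((1 + s) * (1 / (X + 1))) := by
        apply mul_le_mul_of_nonneg_left _ (by positivity)
        linarith
    _ ≤ X⁻¹ * (2 * (1 / X)) := by
        gcongr
        · linarith
        · linarith
    _ = _ := by field_simp

lemma sqrt_diff (X : ℝ) (hX : 1 ≤ X) : Real.sqrt X * (2 / X ^ 2) ≤ 12 * (1 / Real.sqrt X - 1 / Real.sqrt (X + 1)) := by
  set a := Real.sqrt X with ha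
  set b := Real.sqrt (X + 1) with hb
  have ha0 : 0 < a := Real.sqrt_pos.mpr (by linarith)
  have ha2 : a ^ 2 = X := Real.sq_sqrt (by linarith)
  have hb2 : b ^ 2 = X + 1 := Real.sq_sqrt (by linarith)
  have ha1 : 1 ≤ a := by nlinarith
  have hab : a ≤ b := Real.sqrt_le_sqrt (by linarith)
  have hb0 : 0 < b := by linarith
  have hb3 : b ≤ 3 / 2 * a := by
    apply abs_le_of_sq_le_sq' _ (by positivity) |>.2
    nlinarith
  have e : 1 / a - 1 / b = 1 / (a * b * (a + b)) := by
    have : (b - a) * (a + b) = 1 := by nlinarith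
    field_simp
    linarith
  rw [e, ← ha2, ← mul_div_assoc, ← mul_div_assoc, div_le_div_iff₀ (by positivity) (by positivity)]
  have h1 : a * b * (a + b) ≤ a * (3 / 2 * a) * (a + 3 / 2 * a) := by gcongr
  calc a * 2 * (a * b * (a + b)) ≤ a * 2 * (a * (3 / 2 * a) * (a + 3 / 2 * a)) := by gcongr
    _ = 15 / 2 * a ^ 4 := by ring
    _ ≤ _ := by nlinarith [pow_pos ha0 4]

lemma GoodF.tail {f : ℕ → ℂ} {K : ℝ} (hf : GoodF f K) (s : ℝ) (hs : 0 ≤ s) (h1 : s ≤ 1) (W X : ℕ) (hW : 1 ≤ W) : 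
    ‖∑ n ∈ Ioc W X, f n * (((n:ℝ) ^ (-(1 + s)) : ℝ) : ℂ)‖ ≤ 13 * K / Real.sqrt W := by
  have hK := hf.hK
  have hW0 : (1:ℝ) ≤ W := by exact_mod_cast hW
  set a : ℕ → ℝ := fun n => (n:ℝ) ^ (-(1 + s)) with ha
  set S : ℕ → ℂ := fun N => ∑ n ∈ Icc 1 N, f n with hS
  have haX : ∀ n : ℕ, 1 ≤ n → Real.sqrt n * a n ≤ 1 / Real.sqrt n := by
    intro n hn
    have hn0 : (1:ℝ) ≤ n := by exact_mod_cast hn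
    have h2 : a n ≤ (n:ℝ)⁻¹ := by
      rw [← Real.rpow_neg_one]
      exact Real.rpow_le_rpow_of_exponent_le hn0 (by linarith)
    calc _ ≤ Real.sqrt n * (n:ℝ)⁻¹ := by gcongr
      _ = _ := by
        rw [← div_eq_mul_inv, Real.sqrt_div_self, one_div]
  have ha0 : ∀ n, 0 ≤ a n := fun n => by positivity
  have key : ∀ m : ℕ, ‖(∑ n ∈ Ioc W (W + m), f n * ((a n : ℝ) : ℂ)) - S (W + m) * ((a (W + m) : ℝ):ℂ)‖ ≤ 
      K * (13 / Real.sqrt W - 12 / Real.sqrt ((W + m : ℕ):ℝ)) := by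
    intro m
    induction m with
    | zero =>
      simp only [add_zero, Ioc_self, sum_empty, zero_sub, norm_neg, norm_mul, Complex.norm_real, Real.norm_eq_abs, abs_of_nonneg (ha0 W)]
      calc ‖S W‖ * a W ≤ (K * Real.sqrt W) * a W := by gcongr; exact hf.canc W
        _ = K * (Real.sqrt W * a W) := by ring
        _ ≤ K * (1 / Real.sqrt W) := by gcongr; exact haX W hW
        _ = _ := by ring
    | succ m ih =>
      set Y := W + m with hY
      have hY1 : 1 ≤ Y := by omega
      have hY0 : (1:ℝ) ≤ Y := by exact_mod_cast hY1
      have e1 : Ioc W (W + (m + 1)) = insert (Y + 1) (Ioc W Y) := by ext; simp; omega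
      have e2 : S (Y + 1) = S Y + f (Y + 1) := by
        simp only [hS]; rw [sum_Icc_succ_top (by omega)]
      rw [e1, sum_insert (by simp), show W + (m + 1) = Y + 1 by omega, e2]
      have e3 : f (Y + 1) * ((a (Y + 1) : ℝ):ℂ) + ∑ n ∈ Ioc W Y, f n * ((a n : ℝ):ℂ) - (S Y + f (Y + 1)) * ((a (Y + 1) : ℝ):ℂ) = 
          (∑ n ∈ Ioc W Y, f n * ((a n : ℝ):ℂ) - S Y * ((a Y : ℝ):ℂ)) + S Y * ((a Y - a (Y + 1) : ℝ) : ℂ) := by push_cast; ring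
      rw [e3]
      refine (norm_add_le _ _).trans ?_
      have hd : a Y - a (Y + 1) ≤ 2 / (Y:ℝ) ^ 2 := by
        have := w_diff Y s hY0 hs h1
        simp only [ha]; push_cast; exact this
      have hd0 : 0 ≤ a Y - a (Y + 1) := by
        simp only [ha]; push_cast
        rw [sub_nonneg]
        exact Real.rpow_le_rpow_of_nonpos (by linarith) (by linarith) (by linarith)
      have h3 : ‖S Y * ((a Y - a (Y + 1) : ℝ) : ℂ)‖ ≤ K * (12 * (1 / Real.sqrt Y - 1 / Real.sqrt ((Y:ℝ) + 1))) := by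
        rw [norm_mul, Complex.norm_real, Real.norm_of_nonneg hd0]
        calc _ ≤ (K * Real.sqrt Y) * (2 / (Y:ℝ) ^ 2) := by gcongr; exact hf.canc Y
          _ = K * (Real.sqrt Y * (2 / (Y:ℝ) ^ 2)) := by ring
          _ ≤ _ := mul_le_mul_of_nonneg_left (sqrt_diff Y hY0) (by linarith)
      have e4 : ((Y + 1 : ℕ):ℝ) = (Y:ℝ) + 1 := by push_cast; ring
      rw [e4]
      calc _ ≤ K * (13 / Real.sqrt W - 12 / Real.sqrt (Y:ℝ)) + K * (12 * (1 / Real.sqrt Y - 1 / Real.sqrt ((Y:ℝ) + 1))) := add_le_add ih h3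
        _ = _ := by ring
  rcases le_or_gt W X with h | h
  · obtain ⟨m, rfl⟩ := Nat.exists_eq_add_of_le h
    have h2 := key m
    have h3 : ‖S (W + m) * ((a (W + m) : ℝ):ℂ)‖ ≤ K * (1 / Real.sqrt ((W + m : ℕ):ℝ)) := by
      rw [norm_mul, Complex.norm_real, Real.norm_of_nonneg (ha0 _)]
      calc _ ≤ (K * Real.sqrt ((W + m : ℕ):ℝ)) * a (W + m) := by gcongr; exact hf.canc _
        _ = K * (Real.sqrt ((W + m : ℕ):ℝ) * a (W + m)) := by ring
        _ ≤ _ := by gcongr; exact haX _ (by omega)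
    have h4 := norm_le_norm_sub_add (∑ n ∈ Ioc W (W + m), f n * ((a n : ℝ) : ℂ)) (S (W + m) * ((a (W + m) : ℝ):ℂ))
    have h5 : 0 ≤ 1 / Real.sqrt ((W + m : ℕ):ℝ) := by positivity
    calc _ ≤ _ := h4
      _ ≤ _ := add_le_add h2 h3
      _ = 13 * K / Real.sqrt W - 11 * (K * (1 / Real.sqrt ((W + m : ℕ):ℝ))) := by ring
      _ ≤ _ := by
        have : 0 ≤ K * (1 / Real.sqrt ((W + m : ℕ):ℝ)) := by positivity
        linarith
  · rw [Ioc_eq_empty (by omega)]; simp; positivity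

/-- norm as a monoid hom -/
noncomputable def nmH : GI →* ℕ where
  toFun := nm
  map_one' := nm_one
  map_mul' := nm_mul

lemma nm_prod {ι : Type*} (s : Finset ι) (t : ι → GI) : nm (∏ i ∈ s, t i) = ∏ i ∈ s, nm (t i) := map_prod nmH t s

lemma Prim_prod {ι : Type*} (s : Finset ι) (t : ι → GI) (h : ∀ i ∈ s, Prim (t i)) : Prim (∏ i ∈ s, t i) := by
  induction s using Finset.induction_on with
  | empty => simpa using Prim_one
  | insert a s ha ih =>
    rw [prod_insert ha]
    exact Prim_mul (h a (mem_insert_self a s)) (ih (fun i hi => h i (mem_insert_of_mem hi)))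

lemma chi_prod {ι : Type*} (χ : GI → ℂ) (h1 : χ 1 = 1) (hm : ∀ α β, Prim α → Prim β → χ (α * β) = χ α * χ β)
    (s : Finset ι) (t : ι → GI) (h : ∀ i ∈ s, Prim (t i)) : χ (∏ i ∈ s, t i) = ∏ i ∈ s, χ (t i) := by
  induction s using Finset.induction_on with
  | empty => simpa using h1
  | insert a s ha ih =>
    rw [prod_insert ha, prod_insert ha, hm _ _ (h a (mem_insert_self a s)) (Prim_prod s t (fun i hi => h i (mem_insert_of_mem hi)))]
    rw [ih (fun i hi => h i (mem_insert_of_mem hi))]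

/-- the weight -/
noncomputable def wt (s : ℝ) (α : GI) : ℝ := (nm α : ℝ) ^ (-(1 + s))

lemma wt_nonneg (s : ℝ) (α : GI) : 0 ≤ wt s α := by unfold wt; positivity

lemma wt_prod {ι : Type*} (s : ℝ) (S : Finset ι) (t : ι → GI) : wt s (∏ i ∈ S, t i) = ∏ i ∈ S, wt s (t i) := by
  unfold wt
  rw [nm_prod, Nat.cast_prod, Real.finsetProd_rpow _ _ (fun i _ => by positivity)]

lemma fiber_card (Pset : Finset GI) (hPs : ∀ α ∈ Pset, Prim α ∧ (nm α).Prime) (j : ℕ) (β : GI) :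
    (((Fintype.piFinset (fun _ : Fin j => Pset)).filter (fun t => ∏ i, t i = β)).card) ≤ (2 * j) ^ j := by
  rcases ((Fintype.piFinset (fun _ : Fin j => Pset)).filter (fun t => ∏ i, t i = β)).eq_empty_or_nonempty with h | ⟨t0, h0⟩
  · rw [h]; simp
  rw [mem_filter, Fintype.mem_piFinset] at h0
  set U : Finset GI := univ.biUnion (fun i : Fin j => PS (nm (t0 i))) with hU
  have hUc : U.card ≤ 2 * j := by
    refine card_biUnion_le.trans ?_
    calc ∑ i : Fin j, (PS (nm (t0 i))).card ≤ ∑ i : Fin j, 2 := by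
          refine sum_le_sum (fun i _ => ?_)
          have := PS_pow_card (nm (t0 i)) (hPs _ (h0.1 i)).2 1
          simpa using this
      _ = _ := by simp; ring
  calc _ ≤ (Fintype.piFinset (fun _ : Fin j => U)).card := by
        apply card_le_card
        intro t ht
        rw [mem_filter, Fintype.mem_piFinset] at ht
        rw [Fintype.mem_piFinset]
        intro i
        have hp := hPs _ (ht.1 i)
        have hd : nm (t i) ∣ ∏ i', nm (t0 i') := by
          rw [← nm_prod, h0.2, ← ht.2, nm_prod]
          exact dvd_prod_of_mem _ (mem_univ i)
        obtain ⟨i', _, hi'⟩ := (Prime.dvd_finsetProd_iff hp.2.prime _).mp hd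
        have := (Nat.prime_dvd_prime_iff_eq hp.2 (hPs _ (h0.1 i')).2).mp hi'
        rw [hU, mem_biUnion]
        exact ⟨i', mem_univ _, (mem_PS _ _).mpr ⟨this, hp.1⟩⟩
    _ = U.card ^ j := by rw [Fintype.card_piFinset_const]
    _ ≤ _ := Nat.pow_le_pow_left hUc j

lemma exists_phase (w : ℂ) : ∃ c : ℂ, ‖c‖ ≤ 1 ∧ c * w = (‖w‖ : ℂ) := by
  by_cases h : w = 0
  · exact ⟨0, by simp, by simp [h]⟩
  · have hn : (‖w‖ : ℂ) ≠ 0 := by simpa using h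
    refine ⟨starRingEnd ℂ w / ‖w‖, ?_, ?_⟩
    · rw [norm_div, Complex.norm_conj, Complex.norm_real, norm_norm, div_self (by simpa using h)]
    · rw [div_mul_eq_mul_div, Complex.conj_mul', sq, mul_div_assoc, div_self hn, mul_one]

lemma LS (𝓚 : Finset ℕ) (χ : ℕ → GI → ℂ) (hone : ∀ k ∈ 𝓚, χ k 1 = 1) 
    (hmul : ∀ k ∈ 𝓚, ∀ α β, Prim α → Prim β → χ k (α * β) = χ k α * χ k β) 
    (Pset : Finset GI) (z X : ℕ) (hPs : ∀ α ∈ Pset, Prim α ∧ (nm α).Prime ∧ z < nm α ∧ nm α ≤ X) 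
    (s : ℝ) (hs : 0 < s) (hs1 : s ≤ 1) (j : ℕ) (hj : 1 ≤ j) (η : ℝ) (hη0 : 0 ≤ η) 
    (hη : ∀ k ∈ 𝓚, η ≤ ‖∑ α ∈ Pset, χ k α * ((wt s α : ℝ) : ℂ)‖) : 
    (η ^ j * 𝓚.card) ^ 2 ≤ (18 / s) ^ j * ((2 * j) ^ j * ∑ k ∈ 𝓚, ∑ m ∈ 𝓚, 
      ‖∑ n ∈ Ioc (z ^ j) (X ^ j), cf (fun α => χ k α * starRingEnd ℂ (χ m α)) n * (((n:ℝ) ^ (-(1 + s)) : ℝ) : ℂ)‖) := by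
  set Sk : ℕ → ℂ := fun k => ∑ α ∈ Pset, χ k α * ((wt s α : ℝ) : ℂ) with hSk
  set TPi := Fintype.piFinset (fun _ : Fin j => Pset) with hPi
  have hPp : ∀ t ∈ TPi, ∀ i, t i ∈ Pset := fun t ht i => Fintype.mem_piFinset.mp ht i
  have hpow : ∀ k ∈ 𝓚, Sk k ^ j = ∑ t ∈ TPi, χ k (∏ i, t i) * ((wt s (∏ i, t i) : ℝ) : ℂ) := by
    intro k hk
    rw [hSk]
    simp only
    rw [Finset.sum_pow']
    refine sum_congr rfl (fun t ht => ?_)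
    rw [prod_mul_distrib, chi_prod (χ k) (hone k hk) (hmul k hk) univ t (fun i _ => (hPs _ (hPp t ht i)).1), wt_prod]
    push_cast; rfl
  choose c hc1 hc2 using fun k => exists_phase (Sk k ^ j)
  set Y : GI → ℂ := fun β => ∑ k ∈ 𝓚, c k * χ k β with hY
  have h1 : η ^ j * 𝓚.card ≤ ∑ t ∈ TPi, wt s (∏ i, t i) * ‖Y (∏ i, t i)‖ := by
    have e1 : ((∑ k ∈ 𝓚, ‖Sk k ^ j‖ : ℝ) : ℂ) = ∑ t ∈ TPi, ((wt s (∏ i, t i) : ℝ) : ℂ) * Y (∏ i, t i) := by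
      push_cast
      simp_rw [hY, mul_sum]
      rw [sum_comm]
      refine sum_congr rfl (fun k hk => ?_)
      have := hc2 k
      rw [← this, hpow k hk, mul_sum]
      refine sum_congr rfl (fun t _ => by ring)
    have e2 : ∑ k ∈ 𝓚, ‖Sk k ^ j‖ ≤ ‖∑ t ∈ TPi, ((wt s (∏ i, t i) : ℝ) : ℂ) * Y (∏ i, t i)‖ := by
      rw [← e1, Complex.norm_real]; exact le_abs_self _
    calc η ^ j * 𝓚.card = ∑ k ∈ 𝓚, η ^ j := by simp; ring
      _ ≤ ∑ k ∈ 𝓚, ‖Sk k ^ j‖ := by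
          refine sum_le_sum (fun k hk => ?_)
          rw [norm_pow]
          exact pow_le_pow_left₀ hη0 (hη k hk) j
      _ ≤ _ := e2
      _ ≤ _ := by
          refine norm_sum_le_of_le _ (fun t _ => ?_)
          rw [norm_mul, Complex.norm_real, Real.norm_of_nonneg (wt_nonneg _ _)]
  have h2 : (∑ t ∈ TPi, wt s (∏ i, t i) * ‖Y (∏ i, t i)‖) ^ 2 ≤ 
      (∑ t ∈ TPi, wt s (∏ i, t i)) * ∑ t ∈ TPi, wt s (∏ i, t i) * ‖Y (∏ i, t i)‖ ^ 2 := by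
    apply Finset.sum_sq_le_sum_mul_sum_of_sq_le_mul
    · intro t _; exact wt_nonneg _ _
    · intro t _; exact mul_nonneg (wt_nonneg _ _) (by positivity)
    · intro t _; apply le_of_eq; ring
  have h3 : ∑ t ∈ TPi, wt s (∏ i, t i) ≤ (18 / s) ^ j := by
    have e : ∑ t ∈ TPi, wt s (∏ i, t i) = (∑ α ∈ Pset, wt s α) ^ j := by
      rw [Finset.sum_pow']
      exact sum_congr rfl (fun t _ => wt_prod _ _ _)
    rw [e]
    refine pow_le_pow_left₀ (sum_nonneg (fun α _ => wt_nonneg _ _)) ?_ j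
    refine le_trans ?_ (PS_sum_le X s hs hs1)
    calc ∑ α ∈ Pset, wt s α ≤ ∑ α ∈ (Icc 1 X).biUnion PS, wt s α := by
          apply sum_le_sum_of_subset_of_nonneg
          · intro α hα
            obtain ⟨a1, a2, a3, a4⟩ := hPs α hα
            rw [mem_biUnion]
            exact ⟨nm α, mem_Icc.mpr ⟨by omega, a4⟩, (mem_PS _ _).mpr ⟨rfl, a1⟩⟩
          · intro α _ _; exact wt_nonneg _ _
      _ ≤ ∑ n ∈ Icc 1 X, ∑ α ∈ PS n, wt s α := by
          rw [sum_biUnion]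
          intro a _ b _ hab
          rw [Function.onFun, disjoint_left]
          intro α h1 h2
          exact hab (by rw [← ((mem_PS _ _).mp h1).1, ((mem_PS _ _).mp h2).1])
      _ = _ := by
          refine sum_congr rfl (fun n _ => ?_)
          rw [sum_congr rfl (g := fun _ => (n:ℝ) ^ (-(1 + s))), sum_const, nsmul_eq_mul]
          intro α hα
          unfold wt; rw [((mem_PS _ _).mp hα).1]
  set ℬ := (Ioc (z ^ j) (X ^ j)).biUnion PS with hB
  have hmaps : ∀ t ∈ TPi, ∏ i, t i ∈ ℬ := by
    intro t ht
    rw [hB, mem_biUnion]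
    refine ⟨nm (∏ i, t i), ?_, (mem_PS _ _).mpr ⟨rfl, Prim_prod _ _ (fun i _ => (hPs _ (hPp t ht i)).1)⟩⟩
    rw [nm_prod, mem_Ioc]
    constructor
    · calc z ^ j < (z + 1) ^ j := Nat.pow_lt_pow_left (by omega) (by omega)
        _ = ∏ i : Fin j, (z + 1) := by simp
        _ ≤ _ := prod_le_prod' (fun i _ => (hPs _ (hPp t ht i)).2.2.1)
    · calc ∏ i : Fin j, nm (t i) ≤ ∏ i : Fin j, X := prod_le_prod' (fun i _ => (hPs _ (hPp t ht i)).2.2.2)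
        _ = _ := by simp
  have h4 : ∑ t ∈ TPi, wt s (∏ i, t i) * ‖Y (∏ i, t i)‖ ^ 2 ≤ (2 * j) ^ j * ∑ β ∈ ℬ, wt s β * ‖Y β‖ ^ 2 := by
    rw [← sum_fiberwise_of_maps_to hmaps, mul_sum]
    refine sum_le_sum (fun β _ => ?_)
    rw [sum_congr rfl (g := fun _ => wt s β * ‖Y β‖ ^ 2), sum_const, nsmul_eq_mul]
    · apply mul_le_mul_of_nonneg_right _ (mul_nonneg (wt_nonneg _ _) (by positivity))
      exact_mod_cast fiber_card Pset (fun α hα => ⟨(hPs α hα).1, (hPs α hα).2.1⟩) j β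
    · intro t ht
      rw [(mem_filter.mp ht).2]
  have h5 : ∑ β ∈ ℬ, wt s β * ‖Y β‖ ^ 2 ≤ ∑ k ∈ 𝓚, ∑ m ∈ 𝓚, 
      ‖∑ n ∈ Ioc (z ^ j) (X ^ j), cf (fun α => χ k α * starRingEnd ℂ (χ m α)) n * (((n:ℝ) ^ (-(1 + s)) : ℝ) : ℂ)‖ := by
    have hdis : (↑(Ioc (z ^ j) (X ^ j)) : Set ℕ).PairwiseDisjoint PS := by
      intro a _ b _ hab
      rw [Function.onFun, disjoint_left]
      intro α h1 h2
      exact hab (by rw [← ((mem_PS _ _).mp h1).1, ((mem_PS _ _).mp h2).1])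
    have e1 : ((∑ β ∈ ℬ, wt s β * ‖Y β‖ ^ 2 : ℝ) : ℂ) = ∑ k ∈ 𝓚, ∑ m ∈ 𝓚, c k * starRingEnd ℂ (c m) * 
        ∑ n ∈ Ioc (z ^ j) (X ^ j), cf (fun α => χ k α * starRingEnd ℂ (χ m α)) n * (((n:ℝ) ^ (-(1 + s)) : ℝ) : ℂ) := by
      have e2 : ∀ k m, ∑ n ∈ Ioc (z ^ j) (X ^ j), cf (fun α => χ k α * starRingEnd ℂ (χ m α)) n * (((n:ℝ) ^ (-(1 + s)) : ℝ) : ℂ) = 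
          ∑ β ∈ ℬ, χ k β * starRingEnd ℂ (χ m β) * ((wt s β : ℝ) : ℂ) := by
        intro k m
        rw [hB, sum_biUnion hdis]
        refine sum_congr rfl (fun n _ => ?_)
        unfold cf
        rw [sum_mul]
        refine sum_congr rfl (fun β hβ => ?_)
        unfold wt; rw [((mem_PS _ _).mp hβ).1]
      simp_rw [e2, mul_sum]
      rw [Complex.ofReal_sum, sum_congr rfl (fun k _ => sum_comm), sum_comm]
      refine sum_congr rfl (fun β _ => ?_)
      push_cast
      rw [← Complex.mul_conj', hY]
      simp only [map_sum, map_mul]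
      rw [sum_mul_sum, mul_sum]
      refine sum_congr rfl (fun k _ => ?_)
      rw [mul_sum]
      refine sum_congr rfl (fun m _ => by ring)
    have e3 : ∑ β ∈ ℬ, wt s β * ‖Y β‖ ^ 2 ≤ ‖((∑ β ∈ ℬ, wt s β * ‖Y β‖ ^ 2 : ℝ) : ℂ)‖ := by
      rw [Complex.norm_real]; exact le_abs_self _
    refine e3.trans ?_
    rw [e1]
    refine norm_sum_le_of_le _ (fun k _ => norm_sum_le_of_le _ (fun m _ => ?_))
    rw [norm_mul, norm_mul, Complex.norm_conj]
    have := mul_le_one₀ (hc1 k) (norm_nonneg _) (hc1 m)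
    exact mul_le_of_le_one_left (norm_nonneg _) this
  have hnn : 0 ≤ ∑ t ∈ TPi, wt s (∏ i, t i) * ‖Y (∏ i, t i)‖ ^ 2 := sum_nonneg (fun t _ => mul_nonneg (wt_nonneg _ _) (by positivity))
  calc (η ^ j * 𝓚.card) ^ 2 ≤ (∑ t ∈ TPi, wt s (∏ i, t i) * ‖Y (∏ i, t i)‖) ^ 2 := by gcongr
    _ ≤ _ := h2
    _ ≤ (18 / s) ^ j * ((2 * j) ^ j * ∑ β ∈ ℬ, wt s β * ‖Y β‖ ^ 2) := mul_le_mul h3 h4 hnn (by positivity)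
    _ ≤ _ := by gcongr

lemma cf_card_le {ξ : GI → ℂ} (h : ∀ α, ‖ξ α‖ ≤ 1) (n : ℕ) : ‖cf ξ n‖ ≤ (PS n).card := by
  unfold cf
  refine (norm_sum_le _ _).trans ?_
  calc _ ≤ ∑ α ∈ PS n, (1:ℝ) := sum_le_sum (fun α _ => h α)
    _ = _ := by simp

lemma LS_count (𝓚 : Finset ℕ) (χ : ℕ → GI → ℂ) (Mf : ℕ → ℕ) (Mb y : ℝ) (hy : 1 ≤ y)
    (hG : ∀ k ∈ 𝓚, GChar (χ k) (Mf k)) (hMf : ∀ k ∈ 𝓚, (Mf k : ℝ) ≤ Mb)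
    (hNT : ∀ k ∈ 𝓚, ∀ m ∈ 𝓚, ¬ IsSquare (k * m) → NonTriv (fun α => χ k α * starRingEnd ℂ (χ m α)) (Mf k * Mf m))
    (h0 : ∀ k ∈ 𝓚, 0 < k) (hk : ∀ k ∈ 𝓚, (k:ℝ) ≤ y)
    (Pset : Finset GI) (z X : ℕ) (hz : 1 ≤ z) (hPs : ∀ α ∈ Pset, Prim α ∧ (nm α).Prime ∧ z < nm α ∧ nm α ≤ X) 
    (s : ℝ) (hs : 0 < s) (hs1 : s ≤ 1) (j : ℕ) (hj : 1 ≤ j) (η : ℝ) (hη0 : 0 < η) 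
    (hη : ∀ k ∈ 𝓚, η ≤ ‖∑ α ∈ Pset, χ k α * ((wt s α : ℝ) : ℂ)‖) (D : ℝ) (hD : 18 / s * (2 * j) * (η⁻¹) ^ 2 ≤ D)
    (hz2 : D ^ j * (312 * Mb ^ 2) ≤ Real.sqrt ((z:ℝ) ^ j)) :
    (𝓚.card : ℝ) ≤ 2 * (D ^ j * (18 / s) * (Real.sqrt y + 1)) := by
  have hLS := LS 𝓚 χ (fun k hk => (hG k hk).one) (fun k hk => (hG k hk).mul) Pset z X hPs s hs hs1 j hj η hη0.le hη
  have hj0 : (1:ℝ) ≤ j := by exact_mod_cast hj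
  set W := Real.sqrt ((z:ℝ) ^ j) with hW
  have hz0 : (1:ℝ) ≤ z := by exact_mod_cast hz
  have hW0 : 0 < W := Real.sqrt_pos.mpr (by positivity)
  set N : ℝ := (𝓚.card : ℝ) with hN
  have hsum : ∑ k ∈ 𝓚, ∑ m ∈ 𝓚, 
      ‖∑ n ∈ Ioc (z ^ j) (X ^ j), cf (fun α => χ k α * starRingEnd ℂ (χ m α)) n * (((n:ℝ) ^ (-(1 + s)) : ℝ) : ℂ)‖ ≤ 
      N * (N * (156 * Mb ^ 2 / W) + (Real.sqrt y + 1) * (18 / s)) := by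
    rw [hN, ← nsmul_eq_mul, ← sum_const]
    refine sum_le_sum (fun k hkk => ?_)
    have hMb : 0 ≤ Mb := le_trans (by positivity) (hMf k hkk)
    calc _ ≤ ∑ m ∈ 𝓚, (156 * Mb ^ 2 / W + if IsSquare (k * m) then 18 / s else 0) := by
          refine sum_le_sum (fun m hm => ?_)
          split_ifs with hsq
          · have hb : ∀ α, ‖χ k α * starRingEnd ℂ (χ m α)‖ ≤ 1 := by
              intro α
              rw [norm_mul, Complex.norm_conj]
              exact mul_le_one₀ ((hG k hkk).bd α) (norm_nonneg _) ((hG m hm).bd α)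
            have : ‖∑ n ∈ Ioc (z ^ j) (X ^ j), cf (fun α => χ k α * starRingEnd ℂ (χ m α)) n * (((n:ℝ) ^ (-(1 + s)) : ℝ) : ℂ)‖ ≤ 18 / s := by
              refine (norm_sum_le _ _).trans (le_trans ?_ (PS_sum_le (X ^ j) s hs hs1))
              calc _ ≤ ∑ n ∈ Ioc (z ^ j) (X ^ j), ((PS n).card : ℝ) * (n:ℝ) ^ (-(1 + s)) := by
                    refine sum_le_sum (fun n _ => ?_)
                    rw [norm_mul, Complex.norm_real, Real.norm_of_nonneg (by positivity)]
                    gcongr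
                    exact cf_card_le hb n
                _ ≤ _ := by
                    apply sum_le_sum_of_subset_of_nonneg
                    · intro n hn; rw [mem_Ioc] at hn; rw [mem_Icc]; exact ⟨by omega, hn.2⟩
                    · intro n _ _; positivity
            have h2 : 0 ≤ 156 * Mb ^ 2 / W := by positivity
            linarith
          · have hg := ((hG k hkk).mulchar (hG m hm).conj).good (hNT k hkk m hm hsq)
            have := hg.tail s hs.le hs1 (z ^ j) (X ^ j) (Nat.one_le_pow _ _ hz)
            rw [add_zero]
            refine this.trans ?_
            push_cast
            rw [← hW]
            apply div_le_div_of_nonneg_right _ hW0.le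
            have := mul_le_mul (hMf k hkk) (hMf m hm) (by positivity) hMb
            nlinarith
      _ = N * (156 * Mb ^ 2 / W) + (𝓚.filter (fun m => IsSquare (k * m))).card * (18 / s) := by
          rw [sum_add_distrib, sum_const, ← sum_filter, sum_const, nsmul_eq_mul, nsmul_eq_mul]
      _ ≤ _ := by
          have := sq_count k (h0 k hkk) 𝓚 y h0 hk
          gcongr
  rcases eq_or_lt_of_le (show 0 ≤ N by positivity) with h | hNpos
  · rw [← h]
    have : 0 ≤ D := le_trans (by positivity) hD
    positivity
  have hMb : 0 ≤ Mb := by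
    have : 0 < 𝓚.card := by rw [hN] at hNpos; exact_mod_cast hNpos
    obtain ⟨k, hkk⟩ := card_pos.mp this
    exact le_trans (by positivity) (hMf k hkk)
  set Q := (18 / s) ^ j * (2 * (j:ℝ)) ^ j with hQ
  have hQ0 : 0 ≤ Q := by positivity
  have h1 : (η ^ j * N) ^ 2 ≤ Q * (N * (N * (156 * Mb ^ 2 / W) + (Real.sqrt y + 1) * (18 / s))) := by
    calc _ ≤ _ := hLS
      _ ≤ (18 / s) ^ j * ((2 * j) ^ j * (N * (N * (156 * Mb ^ 2 / W) + (Real.sqrt y + 1) * (18 / s)))) := by gcongr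
      _ = _ := by rw [hQ]; ring
  have hηj : 0 < η ^ j := by positivity
  have hQD : Q * (η⁻¹ ^ j) ^ 2 ≤ D ^ j := by
    calc Q * (η⁻¹ ^ j) ^ 2 = (18 / s * (2 * j) * (η⁻¹) ^ 2) ^ j := by rw [hQ, ← mul_pow, ← pow_mul, mul_comm j 2, pow_mul, ← mul_pow]
      _ ≤ D ^ j := pow_le_pow_left₀ (by positivity) hD j
  have h2 : N * N ≤ D ^ j * (N * (N * (156 * Mb ^ 2 / W) + (Real.sqrt y + 1) * (18 / s))) := by
    have e : N * N = (η⁻¹ ^ j) ^ 2 * (η ^ j * N) ^ 2 := by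
      rw [← mul_pow, ← mul_assoc, ← mul_pow, inv_mul_cancel₀ hη0.ne']; ring
    rw [e]
    calc _ ≤ (η⁻¹ ^ j) ^ 2 * (Q * (N * (N * (156 * Mb ^ 2 / W) + (Real.sqrt y + 1) * (18 / s)))) := by gcongr
      _ = (Q * (η⁻¹ ^ j) ^ 2) * (N * (N * (156 * Mb ^ 2 / W) + (Real.sqrt y + 1) * (18 / s))) := by ring
      _ ≤ _ := by gcongr
  have h3 : N ≤ D ^ j * (N * (156 * Mb ^ 2 / W) + (Real.sqrt y + 1) * (18 / s)) := by
    have := h2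
    rw [show D ^ j * (N * (N * (156 * Mb ^ 2 / W) + (Real.sqrt y + 1) * (18 / s))) = N * (D ^ j * (N * (156 * Mb ^ 2 / W) + (Real.sqrt y + 1) * (18 / s))) by ring] at this
    exact le_of_mul_le_mul_left this hNpos
  have h4 : D ^ j * (156 * Mb ^ 2 / W) ≤ 1 / 2 := by
    rw [← mul_div_assoc, div_le_iff₀ hW0]; linarith
  have h5 : D ^ j * (N * (156 * Mb ^ 2 / W)) ≤ N / 2 := by
    calc _ = N * (D ^ j * (156 * Mb ^ 2 / W)) := by ring
      _ ≤ N * (1 / 2) := by gcongr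
      _ = _ := by ring
  nlinarith

lemma nontriv_aux (k m : ℕ) (hk : 0 < k) (hm : 0 < m) (h : ¬ IsSquare (k * m)) : 
    ∃ α, Prim α ∧ (nm α).Coprime (6 * (k * m)) ∧ xi k α ^ 2 * starRingEnd ℂ (xi m α ^ 2) = -1 := by
  obtain ⟨α, hP, hc, hj⟩ := exists_jac_neg (k * m) (by positivity) h
  have h3 : ¬ 3 ∣ nm α := by
    have : (nm α).Coprime 3 := hc.coprime_dvd_right ⟨2 * (k * m), by ring⟩
    exact (Nat.Prime.coprime_iff_not_dvd Nat.prime_three).mp this.symm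
  refine ⟨α, hP, hc, ?_⟩
  rw [xi_sq k hk hP h3, xi_sq m hm hP h3]
  push_cast at hj
  rw [jacobiSym.mul_left] at hj
  simp only [map_intCast]
  exact_mod_cast hj

lemma cop_big {n k m : ℕ} (h : n.Coprime (6 * (k * m))) : n.Coprime (48 * k) := by
  have h2 : n.Coprime 2 := h.coprime_dvd_right ⟨3 * (k * m), by ring⟩
  rw [show 48 * k = 2 ^ 3 * (6 * k) by ring]
  exact Nat.Coprime.mul_right (h2.pow_right 3) (h.coprime_dvd_right ⟨m, by ring⟩)

lemma cop_big' {n k m : ℕ} (h : n.Coprime (6 * (k * m))) : n.Coprime (48 * m) := by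
  rw [mul_comm k m] at h; exact cop_big h

lemma nontriv1 (k m : ℕ) (hk : 0 < k) (hm : 0 < m) (h : ¬ IsSquare (k * m)) : 
    NonTriv (fun α => xi k α * starRingEnd ℂ (xi m α)) ((48 * k) * (48 * m)) := by
  obtain ⟨α, hP, hc, hj⟩ := nontriv_aux k m hk hm h
  refine ⟨α, hP, (cop_big hc).mul_right (cop_big' hc), fun h1 => ?_⟩
  rw [map_pow, ← mul_pow] at hj
  simp only at h1
  rw [h1] at hj; norm_num at hj

lemma nontriv2 (k m : ℕ) (hk : 0 < k) (hm : 0 < m) (h : ¬ IsSquare (k * m)) : 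
    NonTriv (fun α => (xi k α * xi k α) * starRingEnd ℂ (xi m α * xi m α)) (((48 * k) * (48 * k)) * ((48 * m) * (48 * m))) := by
  obtain ⟨α, hP, hc, hj⟩ := nontriv_aux k m hk hm h
  refine ⟨α, hP, ((cop_big hc).mul_right (cop_big hc)).mul_right ((cop_big' hc).mul_right (cop_big' hc)), fun h1 => ?_⟩
  simp only [← sq] at h1
  rw [h1] at hj; norm_num at hj

lemma PS_card_two (p : ℕ) (hp : p.Prime) (h : p % 4 = 1) : (PS p).card = 2 := by
  apply le_antisymm
  · simpa using PS_pow_card p hp 1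
  · have : Fact p.Prime := ⟨hp⟩
    obtain ⟨χ, hχ⟩ := exists_chi p h
    obtain ⟨π, h1, h2, -⟩ := xi_J 1 one_pos p h χ hχ
    have hm : π ∈ PS p := (mem_PS _ _).mpr ⟨h2, h1⟩
    have hm2 : star π ∈ PS p := by
      rw [mem_PS]
      constructor
      · rw [← h2]; unfold nm; simp [Zsqrtd.norm_conj]
      · unfold Prim at *
        simp only [Zsqrtd.im_star, Zsqrtd.re_star]
        omega
    have hne : π ≠ star π := by
      intro he
      have him : π.im = 0 := by
        have := congrArg Zsqrtd.im he
        simp only [Zsqrtd.im_star] at this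
        omega
      have : nm π = π.re.natAbs * π.re.natAbs := by
        unfold nm; rw [Zsqrtd.norm_def, him]; simp [Int.natAbs_mul]
      rw [h2] at this
      rw [this] at hp
      exact hp.prime.not_isSquare ⟨_, rfl⟩
    calc 2 = ({π, star π} : Finset GI).card := (card_pair hne).symm
      _ ≤ _ := card_le_card (by intro x hx; simp only [mem_insert, mem_singleton] at hx; rcases hx with rfl | rfl <;> assumption)

/-- primes between z and X -/
noncomputable def TZ (z X : ℕ) : Finset ℕ := (Ioc z X).filter Nat.Prime

noncomputable def PZ (z X : ℕ) : Finset GI := (TZ z X).biUnion PS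

lemma PZ_sum (z X : ℕ) (F : GI → ℂ) : ∑ α ∈ PZ z X, F α = ∑ p ∈ TZ z X, ∑ α ∈ PS p, F α := by
  unfold PZ
  rw [sum_biUnion]
  intro a _ b _ hab
  rw [Function.onFun, disjoint_left]
  intro α h1 h2
  exact hab (by rw [← ((mem_PS _ _).mp h1).1, ((mem_PS _ _).mp h2).1])

lemma PZ_mem (z X : ℕ) : ∀ α ∈ PZ z X, Prim α ∧ (nm α).Prime ∧ z < nm α ∧ nm α ≤ X := by
  intro α h
  unfold PZ TZ at h
  rw [mem_biUnion] at h
  obtain ⟨p, hp, hα⟩ := h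
  rw [mem_PS] at hα
  rw [mem_filter, mem_Ioc] at hp
  rw [hα.1]
  exact ⟨hα.2, hp.2, hp.1.1, hp.1.2⟩

lemma A_split (k : ℕ) (hk : 0 < k) (s : ℝ) (z X : ℕ) : 
    ∑ p ∈ TZ z X, Ak k p * (p:ℝ) ^ (-(1 + s)) = (∑ α ∈ PZ z X, xi k α * ((wt s α : ℝ) : ℂ)).re + 
      (∑ α ∈ PZ z X, (xi k α * xi k α) * ((wt s α : ℝ) : ℂ)).re / 2 := by
  rw [PZ_sum, PZ_sum, Complex.re_sum, Complex.re_sum, sum_div, ← sum_add_distrib]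
  refine sum_congr rfl (fun p hp => ?_)
  have hpp : p.Prime := (mem_filter.mp hp).2
  have hw : ∀ α ∈ PS p, wt s α = (p:ℝ) ^ (-(1 + s)) := by
    intro α hα; unfold wt; rw [((mem_PS _ _).mp hα).1]
  have e1 : ∑ α ∈ PS p, xi k α * ((wt s α : ℝ) : ℂ) = (∑ α ∈ PS p, xi k α) * (((p:ℝ) ^ (-(1 + s)) : ℝ) : ℂ) := by
    rw [sum_mul]; exact sum_congr rfl (fun α hα => by rw [hw α hα])
  have e2 : ∑ α ∈ PS p, (xi k α * xi k α) * ((wt s α : ℝ) : ℂ) = (∑ α ∈ PS p, xi k α * xi k α) * (((p:ℝ) ^ (-(1 + s)) : ℝ) : ℂ) := by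
    rw [sum_mul]; exact sum_congr rfl (fun α hα => by rw [hw α hα])
  rw [e1, e2, Complex.re_mul_ofReal, Complex.re_mul_ofReal]
  by_cases h4 : p % 4 = 1
  · have : Fact p.Prime := ⟨hpp⟩
    have hs2 : ∑ α ∈ PS p, xi k α * xi k α = 2 * ((jacobiSym k p : ℤ) : ℂ) := by
      rw [sum_congr rfl (g := fun _ => ((jacobiSym k p : ℤ) : ℂ)), sum_const, PS_card_two p hpp h4]
      · simp
      · intro α hα
        obtain ⟨h1, h2⟩ := (mem_PS _ _).mp hα
        have h3 : ¬ 3 ∣ nm α := by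
          rw [h1]; intro hd
          have := (Nat.prime_dvd_prime_iff_eq Nat.prime_three hpp).mp hd
          omega
        have := xi_sq k hk h2 h3
        rw [h1] at this
        rw [← this, sq]
    have hA : Ak k p = (fk k p).re + jacobiSym k p := by
      unfold Ak; rw [if_pos h4]; exact nSol_formula k hk p h4
    rw [hs2, hA]
    have : (2 * ((jacobiSym k p : ℤ) : ℂ)).re = 2 * (jacobiSym k p : ℝ) := by simp
    rw [this]
    unfold fk cf
    ring
  · rw [Ak_zero k p h4, PS_empty h4]; simp

lemma tail_lim (k : ℕ) (hk : 0 < k) (s : ℝ) (hs : 0 < s) (z : ℕ) : 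
    Filter.Tendsto (fun X : ℕ => ∑ p ∈ TZ z X, Ak k p * (p:ℝ) ^ (-(1 + s))) Filter.atTop 
      (nhds (PA k s - ∑ p ∈ TT z, Ak k p * (p:ℝ) ^ (-(1 + s)))) := by
  have h := PA_summ k hk s hs
  set e : ℕ → ℝ := fun p => Ak k p * (p:ℝ) ^ (-(1 + s)) with he
  have h1 : PA k s = ∑' n : ℕ, if n.Prime then e n else 0 := tsum_primes e
  have h2 : Summable (fun n : ℕ => if n.Prime then e n else 0) := by
    have : (fun n : ℕ => if n.Prime then e n else 0) = Set.indicator {n : ℕ | n.Prime} e := by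
      ext n; simp [Set.indicator]
    rw [this]
    exact (summable_subtype_iff_indicator (s := {n : ℕ | n.Prime})).mp h
  have h3 := (h2.hasSum.tendsto_sum_nat).comp (Filter.tendsto_add_atTop_nat 1)
  rw [← h1] at h3
  have h4 := h3.sub_const (∑ p ∈ TT z, e p)
  refine h4.congr' ?_
  filter_upwards [Filter.eventually_ge_atTop z] with X hX
  simp only [Function.comp]
  rw [← sum_filter, sub_eq_iff_eq_add]
  rw [← sum_union]
  · apply sum_congr _ (fun _ _ => rfl)
    ext p
    simp only [mem_filter, mem_range, mem_union, TZ, mem_Ioc, mem_TT]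
    constructor
    · rintro ⟨a, b⟩
      by_cases c : p ≤ z
      · right; tauto
      · left; exact ⟨⟨by omega, by omega⟩, b⟩
    · rintro (⟨a, b⟩ | a)
      · exact ⟨by omega, b⟩
      · exact ⟨by omega, by tauto⟩
  · rw [disjoint_left]
    intro p h1 h2
    simp only [TZ, mem_filter, mem_Ioc, mem_TT] at h1 h2
    omega

lemma evpow (C : ℝ) (n : ℕ) (c : ℝ) (hc : 0 < c) : ∀ᶠ y : ℝ in Filter.atTop, C * Real.log y ^ n ≤ y ^ c := by
  have h := isLittleO_log_rpow_rpow_atTop (n : ℝ) hc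
  have h2 := h.bound (show 0 < (|C| + 1)⁻¹ by positivity)
  filter_upwards [h2, evlog 1, Filter.eventually_ge_atTop 1] with y hy hl hy1
  rw [Real.rpow_natCast, Real.norm_of_nonneg (by positivity), Real.norm_of_nonneg (by positivity)] at hy
  have hp : 0 ≤ Real.log y ^ n := by positivity
  have hy2 : 0 ≤ y ^ c := by positivity
  have h3 : (|C| + 1) * Real.log y ^ n ≤ y ^ c := by
    calc _ ≤ (|C| + 1) * ((|C| + 1)⁻¹ * y ^ c) := by gcongr
      _ = _ := by field_simp
  have := le_abs_self C
  nlinarith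

lemma evll (C : ℝ) : ∀ᶠ y : ℝ in Filter.atTop, C * Real.log (Real.log y) ≤ Real.log y := by
  have h := Real.isLittleO_log_id_atTop.bound (show 0 < (|C| + 1)⁻¹ by positivity)
  have h2 := Real.tendsto_log_atTop.eventually h
  filter_upwards [h2, evlog 1] with y hy hl
  have hll : 0 ≤ Real.log (Real.log y) := Real.log_nonneg hl
  rw [Real.norm_of_nonneg hll, id, Real.norm_of_nonneg (by linarith)] at hy
  have h3 : (|C| + 1) * Real.log (Real.log y) ≤ Real.log y := by
    calc _ ≤ (|C| + 1) * ((|C| + 1)⁻¹ * Real.log y) := by gcongr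
      _ = _ := by field_simp
  have := le_abs_self C
  nlinarith

lemma floor_z (l : ℝ) (hl : 2 ≤ l) (c : ℕ) (hc : 1 ≤ c) : l ^ (c - 1) ≤ (⌊l ^ c⌋₊ : ℝ) := by
  obtain ⟨d, rfl⟩ := Nat.exists_eq_add_of_le' hc
  have h := Nat.lt_floor_add_one (l ^ (d + 1))
  simp only [Nat.add_sub_cancel]
  have h1 : 1 ≤ l ^ d := one_le_pow₀ (by linarith)
  have : l ^ (d + 1) = l ^ d * l := pow_succ _ _
  nlinarith

lemma params (A A1 c1 : ℕ) (h : 200 * (A + 2 * A1 + 2) + 1 ≤ c1) : ∀ᶠ y : ℝ in Filter.atTop, 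
    ∃ j : ℕ, 1 ≤ j ∧ 18 / (Real.log y ^ A)⁻¹ * (2 * j) * (((Real.log y ^ A1)⁻¹)⁻¹) ^ 2 ≤ Real.log y ^ (A + 2 * A1 + 2) ∧ 
      (Real.log y ^ (A + 2 * A1 + 2)) ^ j * (312 * ((48 * y) ^ 2) ^ 2) ≤ Real.sqrt ((⌊Real.log y ^ c1⌋₊ : ℝ) ^ j) ∧ 
      2 * ((Real.log y ^ (A + 2 * A1 + 2)) ^ j * (18 / (Real.log y ^ A)⁻¹) * (Real.sqrt y + 1)) ≤ y ^ ((3:ℝ)/4) := by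
  set D0 := A + 2 * A1 + 2 with hD0
  filter_upwards [evll (10 * D0), evlog 100, evpow (72) A (1/20) (by norm_num), Filter.eventually_ge_atTop 1, evpow (312 * 48 ^ 4) 0 1 (by norm_num)] with y h1 hl h2 hy h3
  set l := Real.log y with hlog
  set ll := Real.log l with hll
  have hD : (2:ℝ) ≤ D0 := by exact_mod_cast (by omega : 2 ≤ D0)
  have hll1 : 1 ≤ ll := by
    rw [hll, Real.le_log_iff_exp_le (by linarith)]
    linarith [Real.exp_one_lt_d9]
  set x := l / (5 * D0 * ll) with hx
  have hden : 0 < 5 * D0 * ll := by positivity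
  have hx2 : 2 ≤ x := by rw [hx, le_div_iff₀ hden]; linarith
  have hxe : 5 * D0 * ll * x = l := by rw [hx]; field_simp
  have hxl : x ≤ l := by
    rw [hx]; apply div_le_self (by linarith); nlinarith
  set j := ⌊x⌋₊ with hj
  have hj1 : (j:ℝ) ≤ x := Nat.floor_le (by linarith)
  have hj2 : x / 2 ≤ j := by have := Nat.lt_floor_add_one x; rw [← hj] at this; linarith
  have hy0 : 0 < y := lt_of_lt_of_le one_pos hy
  have hyl : y = Real.exp l := (Real.exp_log hy0).symm
  have hle : l = Real.exp ll := (Real.exp_log (by linarith)).symm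
  have hDj : (l ^ D0) ^ j ≤ Real.exp (l / 5) := by
    rw [← pow_mul, hle, ← Real.exp_nat_mul, Real.exp_le_exp, ← hle]
    push_cast
    have : (D0:ℝ) * ll * j ≤ D0 * ll * x := by gcongr
    nlinarith
  refine ⟨j, ?_, ?_, ?_, ?_⟩
  · exact Nat.le_floor (by push_cast; linarith)
  · rw [inv_inv, div_inv_eq_mul, hD0, pow_add, pow_add, pow_mul']
    have e : 18 * l ^ A * (2 * j) * (l ^ A1) ^ 2 = l ^ A * (l ^ A1) ^ 2 * (36 * j) := by ring
    rw [e]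
    gcongr
    nlinarith
  · have hz := floor_z l (by linarith) c1 (by omega)
    have hz2 : Real.exp (20 * l) ≤ (⌊l ^ c1⌋₊ : ℝ) ^ j := by
      calc Real.exp (20 * l) ≤ (l ^ (200 * D0)) ^ j := by
            rw [← pow_mul]
            nth_rw 2 [hle]
            rw [← Real.exp_nat_mul, Real.exp_le_exp]
            push_cast
            have : 200 * (D0:ℝ) * ll * (x / 2) ≤ 200 * D0 * ll * j := by gcongr
            nlinarith
        _ ≤ (l ^ (c1 - 1)) ^ j := by
            gcongr
            · linarith
            · omega
        _ ≤ _ := by gcongr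
    apply Real.le_sqrt_of_sq_le
    refine le_trans ?_ hz2
    rw [show 20 * l = (2:ℕ) * (10 * l) by push_cast; ring, Real.exp_nat_mul]
    gcongr
    have hC : 312 * 48 ^ 4 ≤ Real.exp l := by rw [← hyl]; simpa using h3
    calc _ ≤ Real.exp (l / 5) * (312 * ((48 * y) ^ 2) ^ 2) := by gcongr
      _ = Real.exp (l / 5) * ((312 * 48 ^ 4) * Real.exp ((4:ℕ) * l)) := by rw [Real.exp_nat_mul, ← hyl]; ring
      _ ≤ Real.exp (l / 5) * (Real.exp l * Real.exp ((4:ℕ) * l)) := by gcongr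
      _ ≤ _ := by
        rw [← Real.exp_add, ← Real.exp_add, Real.exp_le_exp]; push_cast; linarith
  · rw [div_inv_eq_mul]
    have hsq : Real.sqrt y = Real.exp (l / 2) := by rw [hyl, Real.exp_half]
    have hrp : ∀ c : ℝ, y ^ c = Real.exp (l * c) := fun c => by rw [Real.rpow_def_of_pos hy0]
    rw [hsq, hrp]
    rw [hrp] at h2
    have h5 : 1 ≤ Real.exp (l / 2) := Real.one_le_exp (by linarith)
    calc _ ≤ 2 * (Real.exp (l / 5) * (18 * l ^ A) * (Real.exp (l / 2) + Real.exp (l / 2))) := by gcongr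
      _ = (72 * l ^ A) * (Real.exp (l / 5) * Real.exp (l / 2)) := by ring
      _ ≤ Real.exp (l * (1 / 20)) * (Real.exp (l / 5) * Real.exp (l / 2)) := by gcongr
      _ = _ := by rw [← Real.exp_add, ← Real.exp_add]; ring_nf

lemma E_count (A A1 c1 : ℕ) (h : 200 * (A + 2 * A1 + 2) + 1 ≤ c1) : ∀ᶠ y : ℝ in Filter.atTop, 
    ∀ S : Finset ℕ, (∀ k ∈ S, 0 < k ∧ (k:ℝ) ≤ y) → 
      (∀ k ∈ S, 2 * (Real.log y ^ A1)⁻¹ < |PA k (Real.log y ^ A)⁻¹ - ∑ p ∈ TT ⌊Real.log y ^ c1⌋₊, Ak k p * (p:ℝ) ^ (-(1 + (Real.log y ^ A)⁻¹))|) → 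
      (S.card : ℝ) ≤ 2 * y ^ ((3:ℝ)/4) := by
  filter_upwards [params A A1 c1 h, evlog 2, Filter.eventually_ge_atTop 1] with y ⟨j, hj, hp1, hp2, hp3⟩ hl hy S hS hE
  set l := Real.log y with hlog
  set s := (l ^ A)⁻¹ with hs
  set η := (l ^ A1)⁻¹ with hη
  set z := ⌊l ^ c1⌋₊ with hz
  have hs0 : 0 < s := by positivity
  have hs1 : s ≤ 1 := inv_le_one_of_one_le₀ (one_le_pow₀ (by linarith))
  have hη0 : 0 < η := by positivity
  have hz1 : 1 ≤ z := Nat.le_floor (by push_cast; exact one_le_pow₀ (by linarith))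
  have hev : ∀ᶠ X : ℕ in Filter.atTop, ∀ k ∈ S, 2 * η < |∑ p ∈ TZ z X, Ak k p * (p:ℝ) ^ (-(1 + s))| := by
    rw [Finset.eventually_all]
    intro k hk
    have := (tail_lim k (hS k hk).1 s hs0 z).abs
    exact this.eventually (lt_mem_nhds (hE k hk))
  obtain ⟨X, hX⟩ := hev.exists
  set S1 := S.filter (fun k => η ≤ ‖∑ α ∈ PZ z X, xi k α * ((wt s α : ℝ) : ℂ)‖) with hS1
  set S2 := S.filter (fun k => η ≤ ‖∑ α ∈ PZ z X, (xi k α * xi k α) * ((wt s α : ℝ) : ℂ)‖) with hS2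
  have hsub : S ⊆ S1 ∪ S2 := by
    intro k hk
    rw [mem_union, hS1, hS2, mem_filter, mem_filter]
    by_contra hcon
    push Not at hcon
    have a1 := hcon.1 hk
    have a2 := hcon.2 hk
    have a3 := hX k hk
    rw [A_split k (hS k hk).1] at a3
    have b1 := Complex.abs_re_le_norm (∑ α ∈ PZ z X, xi k α * ((wt s α : ℝ) : ℂ))
    have b2 := Complex.abs_re_le_norm (∑ α ∈ PZ z X, (xi k α * xi k α) * ((wt s α : ℝ) : ℂ))
    have b3 := abs_add_le (∑ α ∈ PZ z X, xi k α * ((wt s α : ℝ) : ℂ)).re ((∑ α ∈ PZ z X, (xi k α * xi k α) * ((wt s α : ℝ) : ℂ)).re / 2)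
    rw [abs_div, abs_two] at b3
    have b4 := abs_nonneg (∑ α ∈ PZ z X, (xi k α * xi k α) * ((wt s α : ℝ) : ℂ)).re
    linarith
  have hb : ∀ k ∈ S, (48 * k : ℝ) ≤ 48 * y := fun k hk => by have := (hS k hk).2; linarith
  have c1' : (S1.card : ℝ) ≤ y ^ ((3:ℝ)/4) := by
    refine le_trans (LS_count S1 xi (fun k => 48 * k) ((48 * y) ^ 2) y hy ?_ ?_ ?_ ?_ ?_ (PZ z X) z X hz1 (PZ_mem z X) s hs0 hs1 j hj η hη0 ?_ _ hp1 hp2) hp3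
    · intro k hk; exact xi_GChar k (hS k (mem_filter.mp hk).1).1
    · intro k hk
      have := hb k (mem_filter.mp hk).1
      push_cast
      nlinarith
    · intro k hk m hm hns
      exact nontriv1 k m (hS k (mem_filter.mp hk).1).1 (hS m (mem_filter.mp hm).1).1 hns
    · intro k hk; exact (hS k (mem_filter.mp hk).1).1
    · intro k hk; exact (hS k (mem_filter.mp hk).1).2
    · intro k hk; exact (mem_filter.mp hk).2
  have c2' : (S2.card : ℝ) ≤ y ^ ((3:ℝ)/4) := by
    refine le_trans (LS_count S2 (fun k α => xi k α * xi k α) (fun k => (48 * k) * (48 * k)) ((48 * y) ^ 2) y hy ?_ ?_ ?_ ?_ ?_ (PZ z X) z X hz1 (PZ_mem z X) s hs0 hs1 j hj η hη0 ?_ _ hp1 hp2) hp3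
    · intro k hk; exact (xi_GChar k (hS k (mem_filter.mp hk).1).1).mulchar (xi_GChar k (hS k (mem_filter.mp hk).1).1)
    · intro k hk
      have := hb k (mem_filter.mp hk).1
      push_cast
      rw [← sq]
      gcongr
    · intro k hk m hm hns
      exact nontriv2 k m (hS k (mem_filter.mp hk).1).1 (hS m (mem_filter.mp hm).1).1 hns
    · intro k hk; exact (hS k (mem_filter.mp hk).1).1
    · intro k hk; exact (hS k (mem_filter.mp hk).1).2
    · intro k hk; exact (mem_filter.mp hk).2
  have : (S.card : ℝ) ≤ S1.card + S2.card := by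
    exact_mod_cast (card_le_card hsub).trans (card_union_le _ _)
  linarith

lemma TT_inv (z : ℕ) : ∑ p ∈ TT z, (1:ℝ) / p ≤ 1 + Real.log z := by
  refine le_trans ?_ (harmonic_le_one_add_log z)
  rw [harmonic_eq_sum_Icc]
  push_cast
  simp only [one_div]
  apply sum_le_sum_of_subset_of_nonneg
  · intro p hp
    rw [mem_TT] at hp
    exact mem_Icc.mpr ⟨hp.2.one_lt.le, hp.1⟩
  · intro i _ _; positivity

lemma log_diff_le (a b c : ℝ) (hc : 0 < c) (ha : c⁻¹ ≤ a) (hb : c⁻¹ ≤ b) : |Real.log a - Real.log b| ≤ |a - b| * c := by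
  have key : ∀ a b : ℝ, c⁻¹ ≤ a → c⁻¹ ≤ b → Real.log a - Real.log b ≤ |a - b| * c := by
    intro a b ha hb
    have hc' : 0 < c⁻¹ := by positivity
    have ha0 : 0 < a := by linarith
    have hb0 : 0 < b := by linarith
    rw [← Real.log_div ha0.ne' hb0.ne']
    have h1 := Real.log_le_sub_one_of_pos (div_pos ha0 hb0)
    have h2 : a / b - 1 = (a - b) * b⁻¹ := by field_simp
    rw [h2] at h1
    refine h1.trans ?_
    have h3 : b⁻¹ ≤ c := by rw [inv_le_comm₀ hb0 hc]; exact hb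
    calc _ ≤ |a - b| * b⁻¹ := by gcongr; exact le_abs_self _
      _ ≤ _ := by gcongr
  rw [abs_le]
  constructor
  · have := key b a hb ha
    rw [abs_sub_comm] at this
    linarith
  · exact key a b ha hb

lemma PP_lip {f : ℕ → ℂ} {K : ℝ} (hf : GoodF f K) (y : ℝ) (hy : 1 < y) (hK : K ≤ y ^ 3) (n : ℕ) (hn : n ≤ 13) (hl : 1 ≤ Real.log y) (s s' : ℝ) (hs : 0 < s)
    (hss : s ≤ s') (h1 : s' ≤ 1) (ha : (Real.log y ^ n)⁻¹ ≤ ‖LL f s‖) (hb : (Real.log y ^ n)⁻¹ ≤ ‖LL f s'‖) : 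
    |PP f s - PP f s'| ≤ s' * (9000 * Real.log y ^ 15 + cP) := by
  have hs' : 0 < s' := by linarith
  have a1 := hf.lip y hy hK s s' hs (by linarith) hs' h1
  have a2 := hf.toBaseF.log_lip s s' hs hs'
  have a3 := log_diff_le _ _ (Real.log y ^ n) (by positivity) ha hb
  have a4 := abs_norm_sub_norm_le (LL f s) (LL f s')
  have hd : |s - s'| ≤ s' := by rw [abs_le]; constructor <;> linarith
  have hp : Real.log y ^ n ≤ Real.log y ^ 13 := pow_le_pow_right₀ hl hn
  have a5 : |Real.log ‖LL f s‖ - Real.log ‖LL f s'‖| ≤ s' * (9000 * Real.log y ^ 15) := by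
    calc _ ≤ _ := a3
      _ ≤ (9000 * |s - s'| * Real.log y ^ 2) * Real.log y ^ 13 := by
          gcongr
          exact a4.trans a1
      _ ≤ (9000 * s' * Real.log y ^ 2) * Real.log y ^ 13 := by gcongr
      _ = _ := by ring
  have a6 : |s - s'| * cP ≤ s' * cP := mul_le_mul_of_nonneg_right hd cP_nonneg
  have e : PP f s - PP f s' = (Real.log ‖LL f s‖ - Real.log ‖LL f s'‖) - (Real.log ‖LL f s‖ - PP f s - (Real.log ‖LL f s'‖ - PP f s')) := by ring
  rw [e]
  refine (abs_sub _ _).trans ?_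
  linarith

lemma good_tail (A1 c1 : ℕ) : ∀ᶠ y : ℝ in Filter.atTop, ∀ k : ℕ, GoodK y k → 
    |PA k (Real.log y ^ (A1 + 18))⁻¹ - ∑ p ∈ TT ⌊Real.log y ^ c1⌋₊, Ak k p * (p:ℝ) ^ (-(1 + (Real.log y ^ (A1 + 18))⁻¹))| ≤ 2 * (Real.log y ^ A1)⁻¹ → 
    ∀ s : ℝ, 0 < s → s ≤ (Real.log y ^ (A1 + 18))⁻¹ → 
    |PA k s - ∑ p ∈ TT ⌊Real.log y ^ c1⌋₊, Ak k p * (p:ℝ) ^ (-(1 + s))| ≤ 3 * (Real.log y ^ A1)⁻¹ := by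
  filter_upwards [f_lower, nonexc, evlog (18000 + 2 * cP + 3), Filter.eventually_ge_atTop 600, evll (c1 + 1)] with y h1 h2 hl hy hll k hk htail s hs hss
  set l := Real.log y with hlog
  set s0 := (l ^ (A1 + 18))⁻¹ with hs0
  set z := ⌊l ^ c1⌋₊ with hz
  have hcP := cP_nonneg
  have hl1 : 1 ≤ l := by linarith
  have hs00 : 0 < s0 := by positivity
  have hs01 : s0 ≤ (l ^ 16)⁻¹ := inv_anti₀ (by positivity) (pow_le_pow_right₀ hl1 (by omega))
  have hs02 : s0 ≤ 1 := inv_le_one_of_one_le₀ (one_le_pow₀ hl1)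
  have hk0 : (k:ℤ) ≠ 0 := by have := hk.pos; omega
  have hkle := hk.le
  have hy3 : 600 * y ≤ y ^ 3 := by
    have : 600 * y ≤ y * y := mul_le_mul_of_nonneg_right hy (by linarith)
    have : y * y ≤ y ^ 3 := by nlinarith [mul_nonneg (by linarith : 0 ≤ y) (by linarith : 0 ≤ y)]
    linarith
  have hK1 : (12 * ((48 * k : ℕ) : ℝ)) ≤ y ^ 3 := by push_cast; linarith
  have hK2 : (12 * (((k:ℤ).natAbs : ℕ) : ℝ)) ≤ y ^ 3 := by simp; linarith
  have hK3 : (12 * (((-(k:ℤ)).natAbs : ℕ) : ℝ)) ≤ y ^ 3 := by simp; linarith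
  have n1 := nat_nonsq k hk.ns
  have n2 := neg_nonsq (-(k:ℤ)) (by have := hk.pos; omega)
  have g1 := h1 k hk.pos hk.le hk.ns
  have g2 := h2 k hk0 (by simpa using hk.le) n1 hk.e1
  have g3 := h2 (-k) (by omega) (by simpa using hk.le) n2 hk.e2
  have p1 := PP_lip (fk_good k hk.pos hk.ns) y (by linarith) hK1 13 le_rfl hl1 s s0 hs hss hs02 (g1 s hs (hss.trans hs01)) (g1 s0 hs00 hs01)
  have p2 := PP_lip (gq_good k hk0 n1) y (by linarith) hK2 6 (by norm_num) hl1 s s0 hs hss hs02 (g2 s hs (hss.trans hs01)) (g2 s0 hs00 hs01)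
  have p3 := PP_lip (gq_good (-k) (by omega) n2) y (by linarith) hK3 6 (by norm_num) hl1 s s0 hs hss hs02 (g3 s hs (hss.trans hs01)) (g3 s0 hs00 hs01)
  have q1 : |PA k s - PA k s0| ≤ 2 * (s0 * (9000 * l ^ 15 + cP)) := by
    rw [PA_eq k hk.pos s hs, PA_eq k hk.pos s0 hs00]
    rw [abs_le] at p1 p2 p3 ⊢
    constructor <;> linarith [p1.1, p1.2, p2.1, p2.2, p3.1, p3.2]
  have hz1 : 1 ≤ z := Nat.le_floor (by push_cast; exact one_le_pow₀ hl1)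
  have hlz : 1 + Real.log z ≤ l := by
    have : Real.log z ≤ c1 * Real.log l := by
      rw [← Real.log_pow]
      apply Real.log_le_log (by exact_mod_cast hz1) (Nat.floor_le (by positivity))
    have h3 : 1 ≤ Real.log l := by
      rw [Real.le_log_iff_exp_le (by linarith)]
      linarith [Real.exp_one_lt_d9]
    linarith
  have hlz0 : 0 ≤ Real.log z := Real.log_nonneg (by exact_mod_cast hz1)
  have q2 : |∑ p ∈ TT z, Ak k p * (p:ℝ) ^ (-(1 + s)) - ∑ p ∈ TT z, Ak k p * (p:ℝ) ^ (-(1 + s0))| ≤ s0 * (3 * l ^ 2) := by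
    rw [← sum_sub_distrib]
    refine (abs_sum_le_sum_abs _ _).trans ?_
    calc _ ≤ ∑ p ∈ TT z, 3 * (s0 * Real.log z) * (1 / (p:ℝ)) := by
          refine sum_le_sum (fun p hp => ?_)
          rw [mem_TT] at hp
          rw [← mul_sub, abs_mul]
          have b1 := prime_x_lip p hp.2.two_le s s0 hs.le hs00.le
          have b2 := Ak_abs k p hp.2
          have b3 : |s - s0| ≤ s0 := by rw [abs_le]; constructor <;> linarith
          have hp1 : (1:ℝ) ≤ p := by exact_mod_cast hp.2.one_lt.le
          have b4 : Real.log p ≤ Real.log z := Real.log_le_log (by linarith) (by exact_mod_cast hp.1)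
          have b5 : 0 ≤ Real.log p := Real.log_nonneg hp1
          calc _ ≤ 3 * (|s - s0| * (Real.log p / p)) := by gcongr
            _ ≤ 3 * (s0 * (Real.log z / p)) := by gcongr
            _ = _ := by ring
      _ = 3 * (s0 * Real.log z) * ∑ p ∈ TT z, 1 / (p:ℝ) := by rw [mul_sum]
      _ ≤ 3 * (s0 * l) * l := by
          gcongr
          · linarith
          · exact (TT_inv z).trans hlz
      _ = _ := by ring
  have q3 : 2 * (s0 * (9000 * l ^ 15 + cP)) + s0 * (3 * l ^ 2) ≤ (l ^ A1)⁻¹ := by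
    have e1 : 1 ≤ l ^ 17 := one_le_pow₀ hl1
    have e2 : l ^ 2 ≤ l ^ 17 := pow_le_pow_right₀ hl1 (by norm_num)
    have e3 : l ^ 15 ≤ l ^ 17 := pow_le_pow_right₀ hl1 (by norm_num)
    calc _ = s0 * (18000 * l ^ 15 + 2 * cP * 1 + 3 * l ^ 2) := by ring
      _ ≤ s0 * (18000 * l ^ 17 + 2 * cP * l ^ 17 + 3 * l ^ 17) := by gcongr
      _ = s0 * ((18000 + 2 * cP + 3) * l ^ 17) := by ring
      _ ≤ s0 * (l * l ^ 17) := by gcongr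
      _ = _ := by rw [hs0, pow_add]; field_simp
  rw [abs_le] at htail q1 q2 ⊢
  constructor <;> linarith [htail.1, htail.2, q1.1, q1.2, q2.1, q2.2]

lemma good_approx (A1 c1 : ℕ) (h : A1 + 1 ≤ c1) : ∀ᶠ y : ℝ in Filter.atTop, ∀ k : ℕ, GoodK y k → 
    |PA k (Real.log y ^ (A1 + 18))⁻¹ - ∑ p ∈ TT ⌊Real.log y ^ c1⌋₊, Ak k p * (p:ℝ) ^ (-(1 + (Real.log y ^ (A1 + 18))⁻¹))| ≤ 2 * (Real.log y ^ A1)⁻¹ → 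
    ∀ F0 : ℝ, Filter.Tendsto (Fk k) (nhdsWithin 0 (Set.Ioi 0)) (nhds F0) → 1 ≤ A1 → 
    |∏ p ∈ TT ⌊Real.log y ^ c1⌋₊, (1 + bk k 0 p) - F0| ≤ F0 * (8 * (Real.log y ^ A1)⁻¹) := by
  filter_upwards [good_tail A1 c1, evlog 128] with y h1 hl k hk htail F0 hF hA1
  set l := Real.log y with hlog
  set z := ⌊l ^ c1⌋₊ with hz
  have hl1 : 1 ≤ l := by linarith
  have hP : Filter.Tendsto (fun s => ∏ p ∈ TT z, (1 + bk k s p)) (nhdsWithin 0 (Set.Ioi 0)) (nhds (∏ p ∈ TT z, (1 + bk k 0 p))) := by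
    apply Filter.Tendsto.mono_left _ nhdsWithin_le_nhds
    apply tendsto_finsetProd
    intro p hp
    apply Filter.Tendsto.const_add
    unfold bk
    apply Filter.Tendsto.neg
    apply Filter.Tendsto.const_mul
    have hp0 : (0:ℝ) < p := by exact_mod_cast (TT_prime z p hp).pos
    have : Continuous (fun s : ℝ => (p:ℝ) ^ (-s)) := by
      apply Continuous.rpow continuous_const continuous_neg
      intro x; left; exact hp0.ne'
    exact this.tendsto 0
  refine le_of_tendsto_of_tendsto (hP.sub hF).abs (hF.mul_const (8 * (l ^ A1)⁻¹)) ?_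
  filter_upwards [pos_near, small_near ((l ^ (A1 + 18))⁻¹) (by positivity)] with s hs hss
  obtain ⟨θ, hθ, he⟩ := Fk_split k hk.pos s hs z
  have ht := h1 k hk htail s hs hss
  set t := PA k s - ∑ p ∈ TT z, Ak k p * (p:ℝ) ^ (-(1 + s)) with htdef
  have hFn := Fk_nonneg k hk.pos s hs
  have hz2 : 128 / ((z:ℝ) + 1) ≤ (l ^ A1)⁻¹ := by
    have b := Nat.lt_floor_add_one (l ^ c1)
    have b2 : l ^ (A1 + 1) ≤ l ^ c1 := pow_le_pow_right₀ hl1 h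
    rw [inv_eq_one_div, div_le_div_iff₀ (by positivity) (by positivity)]
    have b3 : 128 * l ^ A1 ≤ l ^ (A1 + 1) := by rw [pow_succ]; nlinarith [pow_pos (by linarith : 0 < l) A1]
    rw [← hz] at b
    linarith
  have hx : |t - θ| ≤ 4 * (l ^ A1)⁻¹ := by
    refine (abs_sub _ _).trans ?_
    linarith
  have hx1 : 4 * (l ^ A1)⁻¹ ≤ 1 := by
    have : l ^ 1 ≤ l ^ A1 := pow_le_pow_right₀ hl1 hA1
    rw [← div_eq_mul_inv, div_le_one (by positivity)]
    linarith
  have h3 := Real.abs_exp_sub_one_le (hx.trans hx1)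
  have e : ∏ p ∈ TT z, (1 + bk k s p) - Fk k s = Fk k s * (Real.exp (t - θ) - 1) := by
    have : Fk k s * Real.exp (t - θ) = ∏ p ∈ TT z, (1 + bk k s p) := by
      rw [he, mul_assoc, ← Real.exp_add]
      simp
    linarith
  rw [e, abs_mul, abs_of_nonneg hFn]
  apply mul_le_mul_of_nonneg_left _ hFn
  linarith

lemma nSol_per (k M p : ℕ) (h : p ∣ M) : nSol ((k + M : ℕ) : ℤ) 4 p = nSol (k : ℤ) 4 p := by
  unfold nSol
  congr 1
  apply filter_congr
  intro n _
  obtain ⟨c, rfl⟩ := h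
  push_cast
  rw [← add_assoc, Int.add_mul_emod_self_left]

lemma Ak_per (k M p : ℕ) (h : p ∣ M) : Ak (k + M) p = Ak k p := by
  unfold Ak; rw [nSol_per k M p h]

lemma Ak_mod (k p : ℕ) : Ak (k % p) p = Ak k p := by
  conv_rhs => rw [← Nat.mod_add_div k p]
  rw [Ak_per _ _ _ ⟨_, rfl⟩]

lemma Ak_sum (p : ℕ) (hp : 0 < p) : ∑ u ∈ range p, Ak u p = 0 := by
  unfold Ak
  by_cases h4 : p % 4 = 1
  · simp only [if_pos h4]
    rw [sum_sub_distrib, sum_const, card_range, sub_eq_zero]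
    have : ∑ u ∈ range p, nSol (u : ℤ) 4 p = p := by
      unfold nSol
      simp only [card_filter]
      rw [sum_comm]
      conv_rhs => rw [← card_range p, card_eq_sum_ones]
      refine sum_congr rfl (fun n _ => ?_)
      rw [← card_filter, card_eq_one]
      refine ⟨(p - n ^ 4 % p) % p, ?_⟩
      ext u
      rw [mem_filter, mem_singleton, mem_range]
      have hr : n ^ 4 % p < p := Nat.mod_lt _ hp
      have e : (((n:ℤ) ^ 4 + u) % p = 0) ↔ p ∣ n ^ 4 % p + u := by
        rw [← Int.dvd_iff_emod_eq_zero]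
        have : ((n:ℤ) ^ 4 + u) = ((n ^ 4 + u : ℕ) : ℤ) := by push_cast; ring
        rw [this, Int.natCast_dvd_natCast, Nat.dvd_iff_mod_eq_zero, Nat.dvd_iff_mod_eq_zero, Nat.mod_add_mod]
      rw [e]
      set r := n ^ 4 % p with hrdef
      constructor
      · rintro ⟨hu, c, hc⟩
        rcases Nat.eq_zero_or_pos r with h0 | h0
        · rw [h0, Nat.sub_zero, Nat.mod_self]
          rw [h0, zero_add] at hc
          rcases Nat.eq_zero_or_pos c with h1 | h1
          · rw [hc, h1]; simp
          · nlinarith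
        · rw [Nat.mod_eq_of_lt (by omega)]
          have : c = 1 := by
            have : c < 2 := by
              by_contra hcon
              have : p * 2 ≤ p * c := Nat.mul_le_mul_left p (by omega)
              omega
            have : c ≠ 0 := by rintro rfl; omega
            omega
          subst this
          omega
      · intro hu
        rcases Nat.eq_zero_or_pos r with h0 | h0
        · rw [h0, Nat.sub_zero, Nat.mod_self] at hu
          rw [h0, hu]; simp [hp]
        · rw [Nat.mod_eq_of_lt (by omega)] at hu
          exact ⟨by omega, 1, by omega⟩
    rw [← Nat.cast_sum, this]; simp
  · simp [h4]

lemma Ak_sum_aff (p M r : ℕ) (hp : 0 < p) (hc : M.Coprime p) : ∑ t ∈ range p, Ak (r + M * t) p = 0 := by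
  rw [← Ak_sum p hp]
  have hinj : Set.InjOn (fun t => (r + M * t) % p) (range p) := by
    intro a ha b hb hab
    simp only [coe_range, Set.mem_Iio] at ha hb
    have h1 : r + M * a ≡ r + M * b [MOD p] := hab
    have h2 : M * a ≡ M * b [MOD p] := Nat.ModEq.add_left_cancel' r h1
    have h3 : a ≡ b [MOD p] := Nat.ModEq.cancel_left_of_coprime (by rw [Nat.gcd_comm]; exact hc) h2
    exact h3.eq_of_lt_of_lt ha hb
  have him : (range p).image (fun t => (r + M * t) % p) = range p := by
    apply eq_of_subset_of_card_le
    · intro x hx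
      obtain ⟨t, _, rfl⟩ := mem_image.mp hx
      exact mem_range.mpr (Nat.mod_lt _ hp)
    · rw [card_image_of_injOn hinj]
  conv_rhs => rw [← him]
  rw [sum_image hinj]
  exact sum_congr rfl (fun t _ => (Ak_mod _ _).symm)

lemma sum_range_mul' (h : ℕ → ℝ) (M p : ℕ) : ∑ k ∈ range (M * p), h k = ∑ t ∈ range p, ∑ r ∈ range M, h (r + M * t) := by
  induction p with
  | zero => simp
  | succ p ih =>
    rw [mul_add, mul_one, sum_range_add, ih, sum_range_succ]
    congr 1
    exact sum_congr rfl (fun r _ => by rw [add_comm])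

lemma gg_per (k M q : ℕ) (h : q ∣ M) : gg (bk (k + M) 0) q = gg (bk k 0) q := by
  unfold gg
  split_ifs
  · refine prod_congr rfl (fun p hp => ?_)
    unfold bk
    rw [Ak_per k M p ((Nat.dvd_of_mem_primeFactors hp).trans h)]
  · rfl

lemma gg_le_one (k q : ℕ) : |gg (bk k 0) q| ≤ 1 := by
  rw [gg_abs]
  unfold gg
  split_ifs
  · apply prod_le_one
    · intro p _; exact abs_nonneg _
    · intro p hp
      have := bk_small k 0 le_rfl p (Nat.prime_of_mem_primeFactors hp)
      linarith
  · exact zero_le_one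

lemma full_aux (q q' : ℕ) (hq : Squarefree q) (hq' : Squarefree q') (p : ℕ) (hp : p.Prime) (hpq : p ∣ q) (hpq' : ¬ p ∣ q') : 
    ∑ k ∈ range (q * q'), gg (bk k 0) q * gg (bk k 0) q' = 0 := by
  obtain ⟨m, rfl⟩ := hpq
  have hpm : p.Coprime m := Nat.coprime_of_squarefree_mul hq
  set M := m * q' with hM
  have hc : M.Coprime p := by
    rw [hM]
    exact Nat.Coprime.mul_left hpm.symm ((Nat.Prime.coprime_iff_not_dvd hp).mpr hpq').symm
  rw [show p * m * q' = M * p by rw [hM]; ring, sum_range_mul', sum_comm]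
  apply sum_eq_zero
  intro r _
  have e : ∀ t, gg (bk (r + M * t) 0) (p * m) * gg (bk (r + M * t) 0) q' = 
      Ak (r + M * t) p * (-(1 / ((p:ℝ) - 1)) * (gg (bk r 0) m * gg (bk r 0) q')) := by
    intro t
    rw [gg_mul _ _ _ hpm, gg_per r (M * t) m ⟨q' * t, by rw [hM]; ring⟩, gg_per r (M * t) q' ⟨m * t, by rw [hM]; ring⟩, gg_prime _ _ hp]
    unfold bk
    simp
    ring
  rw [sum_congr rfl (fun t _ => e t), ← sum_mul, Ak_sum_aff p M r hp.pos hc, zero_mul]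

lemma full_zero (q q' : ℕ) (hq : Squarefree q) (hq' : Squarefree q') (hne : q ≠ q') : 
    ∑ k ∈ range (q * q'), gg (bk k 0) q * gg (bk k 0) q' = 0 := by
  by_cases h : ∃ p, p.Prime ∧ p ∣ q ∧ ¬ p ∣ q'
  · obtain ⟨p, hp, h1, h2⟩ := h
    exact full_aux q q' hq hq' p hp h1 h2
  · by_cases h' : ∃ p, p.Prime ∧ p ∣ q' ∧ ¬ p ∣ q
    · obtain ⟨p, hp, h1, h2⟩ := h'
      have := full_aux q' q hq' hq p hp h1 h2
      rw [mul_comm q q']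
      exact (sum_congr rfl (fun k _ => mul_comm _ _)).trans this
    · exfalso
      push Not at h h'
      apply hne
      rw [← Nat.prod_primeFactors_of_squarefree hq, ← Nat.prod_primeFactors_of_squarefree hq']
      apply prod_congr _ (fun _ _ => rfl)
      ext p
      simp only [Nat.mem_primeFactors]
      constructor
      · rintro ⟨a, b, c⟩; exact ⟨a, h p a b, hq'.ne_zero⟩
      · rintro ⟨a, b, c⟩; exact ⟨a, h' p a b, hq.ne_zero⟩

lemma offdiag (q q' N : ℕ) (hq : Squarefree q) (hq' : Squarefree q') (hne : q ≠ q') : 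
    |∑ k ∈ range N, gg (bk k 0) q * gg (bk k 0) q'| ≤ q * q' := by
  have := per_canc (q * q') (Nat.mul_pos (Nat.pos_of_ne_zero hq.ne_zero) (Nat.pos_of_ne_zero hq'.ne_zero)) 
    (fun k => ((gg (bk k 0) q * gg (bk k 0) q' : ℝ) : ℂ)) ?_ ?_ ?_ N
  · rw [← Complex.ofReal_sum, Complex.norm_real] at this
    push_cast at this
    exact this
  · intro k
    rw [Complex.norm_real, Real.norm_eq_abs, abs_mul]
    exact mul_le_one₀ (gg_le_one k q) (abs_nonneg _) (gg_le_one k q')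
  · intro k
    beta_reduce
    rw [gg_per k _ q ⟨q', rfl⟩, gg_per k _ q' ⟨q, by ring⟩]
  · rw [← Complex.ofReal_sum, full_zero q q' hq hq' hne]; simp

lemma gg_mono (a b : ℕ → ℝ) (q : ℕ) (h0 : ∀ p, p.Prime → 0 ≤ a p) (h : ∀ p, p.Prime → a p ≤ b p) : gg a q ≤ gg b q := by
  unfold gg
  split_ifs
  · exact prod_le_prod (fun p hp => h0 p (Nat.prime_of_mem_primeFactors hp)) (fun p hp => h p (Nat.prime_of_mem_primeFactors hp))
  · exact le_rfl

lemma gg_rpow (a : ℕ → ℝ) (q : ℕ) (t : ℝ) : gg a q * (q:ℝ) ^ t = gg (fun p => a p * (p:ℝ) ^ t) q := by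
  unfold gg
  split_ifs with h
  · have : (q:ℝ) = ∏ p ∈ q.primeFactors, (p:ℝ) := by
      rw [← Nat.cast_prod, Nat.prod_primeFactors_of_squarefree h]
    conv_lhs => rw [this]
    rw [← Real.finsetProd_rpow _ _ (fun p _ => by positivity), ← prod_mul_distrib]
  · simp

/-- Rankin bound -/
lemma rankin (a : ℕ → ℝ) (h0 : ∀ p, p.Prime → 0 ≤ a p) (z : ℕ) (W t : ℝ) (hW : 0 < W) (ht : 0 ≤ t) : 
    ∑ q ∈ (SQ (TT z)).filter (fun q : ℕ => W ≤ (q:ℝ)), gg a q ≤ W ^ (-t) * Real.exp (∑ p ∈ TT z, a p * (p:ℝ) ^ t) := by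
  have hb : ∀ p, p.Prime → 0 ≤ a p * (p:ℝ) ^ t := fun p hp => mul_nonneg (h0 p hp) (by positivity)
  calc _ ≤ ∑ q ∈ (SQ (TT z)).filter (fun q : ℕ => W ≤ (q:ℝ)), W ^ (-t) * gg (fun p => a p * (p:ℝ) ^ t) q := by
        refine sum_le_sum (fun q hq => ?_)
        have hq2 := (mem_filter.mp hq).2
        rw [← gg_rpow]
        have hg := gg_nonneg' a h0 q
        have h1 : 1 ≤ W ^ (-t) * (q:ℝ) ^ t := by
          rw [Real.rpow_neg hW.le]
          have : W ^ t ≤ (q:ℝ) ^ t := Real.rpow_le_rpow hW.le hq2 ht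
          have hp : 0 < W ^ t := by positivity
          calc 1 = (W ^ t)⁻¹ * W ^ t := by field_simp
            _ ≤ _ := by gcongr
        calc gg a q = gg a q * 1 := by ring
          _ ≤ gg a q * (W ^ (-t) * (q:ℝ) ^ t) := by gcongr
          _ = _ := by ring
    _ = W ^ (-t) * ∑ q ∈ (SQ (TT z)).filter (fun q : ℕ => W ≤ (q:ℝ)), gg (fun p => a p * (p:ℝ) ^ t) q := by rw [mul_sum]
    _ ≤ W ^ (-t) * ∑ q ∈ SQ (TT z), gg (fun p => a p * (p:ℝ) ^ t) q := by
        gcongr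
        · exact fun i _ _ => gg_nonneg' _ hb i
        · exact filter_subset _ _
    _ = W ^ (-t) * ∏ p ∈ TT z, (1 + a p * (p:ℝ) ^ t) := by rw [sum_SQ _ _ (TT_prime z)]
    _ ≤ _ := by
        rw [Real.exp_sum]
        gcongr with p hp
        · intro p hp
          have := hb p (TT_prime z p hp)
          linarith
        · have := Real.add_one_le_exp (a p * (p:ℝ) ^ t)
          linarith

/-- the constant in the diagonal bound -/
noncomputable def cD : ℝ := Real.exp (225 / 16 * ∑' n : ℕ, (n:ℝ) ^ (-(3/2) : ℝ))

lemma cD_pos : 0 < cD := Real.exp_pos _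

lemma diag_rankin (z : ℕ) (W : ℝ) (hW : 0 < W) : 
    ∑ q ∈ (SQ (TT z)).filter (fun q : ℕ => W ≤ (q:ℝ)), gg (fun p => (15 / 4 / (p:ℝ)) ^ 2) q ≤ W ^ (-(1/2):ℝ) * cD := by
  refine (rankin _ (fun p _ => by positivity) z W (1/2) hW (by norm_num)).trans ?_
  unfold cD
  gcongr
  have hsum : Summable (fun n : ℕ => (n:ℝ) ^ (-(3/2) : ℝ)) := Real.summable_nat_rpow.mpr (by norm_num)
  calc _ = 225 / 16 * ∑ p ∈ TT z, (p:ℝ) ^ (-(3/2) : ℝ) := by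
        rw [mul_sum]
        refine sum_congr rfl (fun p hp => ?_)
        have hp0 : (0:ℝ) < p := by exact_mod_cast (TT_prime z p hp).pos
        have : (p:ℝ) ^ (-(3/2) : ℝ) = (p:ℝ) ^ (-(2:ℕ) : ℝ) * (p:ℝ) ^ (1/2 : ℝ) := by
          rw [← Real.rpow_add hp0]; norm_num
        rw [this, Real.rpow_neg hp0.le, Real.rpow_natCast]
        field_simp
        norm_num
    _ ≤ _ := by
        gcongr
        exact hsum.sum_le_tsum _ (fun n _ => by positivity)

lemma partA (z w N : ℕ) (W : ℝ) (hW : 0 < W) : 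
    ∑ k ∈ range N, (∑ q ∈ (SQ (TT z)).filter (fun q : ℕ => W ≤ (q:ℝ) ∧ q ≤ w), gg (bk k 0) q) ^ 2 ≤ 
      N * (W ^ (-(1/2):ℝ) * cD) + (w:ℝ) ^ 4 := by
  set Q := (SQ (TT z)).filter (fun q : ℕ => W ≤ (q:ℝ) ∧ q ≤ w) with hQ
  have hsf : ∀ q ∈ Q, Squarefree q := fun q hq => ((mem_SQ _ (TT_prime z) q).mp (mem_filter.mp hq).1).1
  have hcard : Q.card ≤ w := by
    calc Q.card ≤ (Icc 1 w).card := by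
          apply card_le_card
          intro q hq
          rw [mem_Icc]
          exact ⟨Nat.pos_of_ne_zero (hsf q hq).ne_zero, (mem_filter.mp hq).2.2⟩
      _ = w := by simp
  have hdiag : ∀ q, ∑ k ∈ range N, gg (bk k 0) q * gg (bk k 0) q ≤ N * gg (fun p => (15 / 4 / (p:ℝ)) ^ 2) q := by
    intro q
    calc _ ≤ ∑ k ∈ range N, gg (fun p => (15 / 4 / (p:ℝ)) ^ 2) q := by
          refine sum_le_sum (fun k _ => ?_)
          have : gg (bk k 0) q * gg (bk k 0) q = gg (fun p => |bk k 0 p| ^ 2) q := by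
            unfold gg
            split_ifs
            · rw [← prod_mul_distrib]; exact prod_congr rfl (fun p _ => by simp only [sq_abs]; ring)
            · simp
          rw [this]
          apply gg_mono
          · intro p _; positivity
          · intro p hp
            have := bk_abs k 0 le_rfl p hp
            gcongr
      _ = _ := by simp
  calc _ = ∑ q ∈ Q, ∑ q' ∈ Q, ∑ k ∈ range N, gg (bk k 0) q * gg (bk k 0) q' := by
        simp_rw [sq, sum_mul_sum]
        rw [sum_comm]
        exact sum_congr rfl (fun q _ => sum_comm)
    _ ≤ ∑ q ∈ Q, ∑ q' ∈ Q, ((if q = q' then N * gg (fun p => (15 / 4 / (p:ℝ)) ^ 2) q else 0) + (w:ℝ) ^ 2) := by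
        refine sum_le_sum (fun q hq => sum_le_sum (fun q' hq' => ?_))
        split_ifs with h
        · subst h
          have := hdiag q
          have : (0:ℝ) ≤ (w:ℝ) ^ 2 := by positivity
          linarith
        · rw [zero_add, sq]
          refine (le_abs_self _).trans ((offdiag q q' N (hsf q hq) (hsf q' hq') h).trans ?_)
          gcongr
          · exact (mem_filter.mp hq).2.2
          · exact (mem_filter.mp hq').2.2
    _ = N * ∑ q ∈ Q, gg (fun p => (15 / 4 / (p:ℝ)) ^ 2) q + Q.card * (Q.card * (w:ℝ) ^ 2) := by
        simp_rw [sum_add_distrib, sum_const, nsmul_eq_mul]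
        rw [mul_sum]
        congr 1
        exact sum_congr rfl (fun q hq => by rw [sum_ite_eq, if_pos hq])
    _ ≤ N * (W ^ (-(1/2):ℝ) * cD) + w * (w * (w:ℝ) ^ 2) := by
        gcongr
        refine le_trans ?_ (diag_rankin z W hW)
        apply sum_le_sum_of_subset_of_nonneg
        · intro q hq; rw [hQ, mem_filter] at hq; rw [mem_filter]; tauto
        · intro q _ _; exact gg_nonneg _ (fun p => by positivity) q
    _ = _ := by ring

lemma head_eq (b : ℕ → ℝ) (z : ℕ) : ∑ q ∈ range (z + 1), gg b q = ∑ q ∈ (SQ (TT z)).filter (fun q => q ≤ z), gg b q := by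
  symm
  apply sum_subset
  · intro q hq
    rw [mem_range]
    have := (mem_filter.mp hq).2
    omega
  · intro q hq hn
    by_contra h
    apply hn
    have hs : Squarefree q := by
      by_contra hs
      exact h (by unfold gg; rw [if_neg hs])
    rw [mem_range] at hq
    rw [mem_filter, mem_SQ _ (TT_prime z)]
    refine ⟨⟨hs, fun p hp => ?_⟩, by omega⟩
    rw [mem_TT]
    have h1 := Nat.le_of_mem_primeFactors hp
    exact ⟨by omega, Nat.prime_of_mem_primeFactors hp⟩

/-- middle range of moduli -/
noncomputable def QA (z w : ℕ) : Finset ℕ := (SQ (TT z)).filter (fun q : ℕ => ((z + 1 : ℕ) : ℝ) ≤ (q:ℝ) ∧ q ≤ w)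
/-- large moduli -/
noncomputable def QB (z w : ℕ) : Finset ℕ := (SQ (TT z)).filter (fun q : ℕ => z < q ∧ w < q)

lemma psi_split (b : ℕ → ℝ) (z w : ℕ) : ∏ p ∈ TT z, (1 + b p) = ∑ q ∈ range (z + 1), gg b q + ∑ q ∈ QA z w, gg b q + ∑ q ∈ QB z w, gg b q := by
  rw [head_eq, ← sum_SQ b _ (TT_prime z), ← sum_filter_add_sum_filter_not (SQ (TT z)) (fun q => q ≤ z), add_assoc]
  congr 1
  rw [← sum_filter_add_sum_filter_not _ (fun q => q ≤ w), filter_filter, filter_filter]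
  unfold QA QB
  congr 1
  · apply sum_congr _ (fun _ _ => rfl)
    apply filter_congr
    intro q _
    rw [Nat.cast_le, not_le, Nat.succ_le_iff]
  · apply sum_congr _ (fun _ _ => rfl)
    apply filter_congr
    intro q _
    rw [not_le, not_le]

lemma partB (c1 B : ℕ) (hc : 1 ≤ c1) : ∀ᶠ y : ℝ in Filter.atTop, ∀ k : ℕ, 
    |∑ q ∈ QB ⌊Real.log y ^ c1⌋₊ ⌊y ^ ((1:ℝ)/16)⌋₊, gg (bk k 0) q| ≤ (Real.log y ^ B)⁻¹ := by
  set D : ℝ := 64 * c1 * (15 / 4 * (1 + 4 * c1) + 4 * B) with hD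
  filter_upwards [evlog 1, evlog (D ^ 2), Filter.eventually_ge_atTop 1] with y hl hlD hy k
  set l := Real.log y with hldef
  set z := ⌊l ^ c1⌋₊ with hz
  set w := ⌊y ^ ((1:ℝ)/16)⌋₊ with hw
  have hc0 : (1:ℝ) ≤ c1 := by exact_mod_cast hc
  have hD0 : 0 ≤ D := by positivity
  have hl0 : 0 < l := by linarith
  set t : ℝ := 1 / (4 * c1) with ht
  have ht0 : 0 ≤ t := by positivity
  set r := l ^ ((1:ℝ)/4) with hr
  have hr1 : 1 ≤ r := Real.one_le_rpow hl (by norm_num)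
  have hr4 : r ^ 4 = l := by
    rw [hr, ← Real.rpow_natCast, ← Real.rpow_mul hl0.le]; norm_num
  have hDr : D ≤ r ^ 2 := by
    refine (pow_le_pow_iff_left₀ hD0 (by positivity) two_ne_zero).mp ?_
    rw [← pow_mul, hr4]; exact hlD
  have hlogl : Real.log l ≤ 4 * r := by
    have := Real.log_le_rpow_div hl0.le (show (0:ℝ) < 1/4 by norm_num)
    rw [← hr] at this
    linarith
  have hW : (y ^ ((1:ℝ)/16)) < ((w + 1 : ℕ) : ℝ) := by
    push_cast; exact Nat.lt_floor_add_one _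
  have hy0 : (0:ℝ) < y := by linarith
  have hyp : 0 < y ^ ((1:ℝ)/16) := by positivity
  have hz1 : 1 ≤ z := by
    rw [hz]; apply Nat.le_floor; push_cast; exact one_le_pow₀ hl
  have hzl : (z:ℝ) ≤ l ^ c1 := Nat.floor_le (by positivity)
  have step1 : |∑ q ∈ QB z w, gg (bk k 0) q| ≤ ∑ q ∈ (SQ (TT z)).filter (fun q : ℕ => y ^ ((1:ℝ)/16) ≤ (q:ℝ)), gg (fun p => 15 / 4 / (p:ℝ)) q := by
    refine (abs_sum_le_sum_abs _ _).trans ?_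
    calc _ ≤ ∑ q ∈ QB z w, gg (fun p => 15 / 4 / (p:ℝ)) q := by
          refine sum_le_sum (fun q _ => ?_)
          rw [gg_abs]
          exact gg_mono _ _ _ (fun p _ => abs_nonneg _) (fun p hp => bk_abs k 0 le_rfl p hp)
      _ ≤ _ := by
          apply sum_le_sum_of_subset_of_nonneg
          · intro q hq
            unfold QB at hq
            rw [mem_filter] at hq ⊢
            refine ⟨hq.1, hW.le.trans ?_⟩
            exact_mod_cast hq.2.2
          · intro q _ _; exact gg_nonneg _ (fun p => by positivity) q
  have step2 := rankin (fun p => 15 / 4 / (p:ℝ)) (fun p _ => by positivity) z _ t hyp ht0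
  have step3 : ∑ p ∈ TT z, 15 / 4 / (p:ℝ) * (p:ℝ) ^ t ≤ 15 / 4 * (1 + 4 * c1) * r ^ 2 := by
    calc _ ≤ ∑ p ∈ TT z, 15 / 4 * r * (1 / (p:ℝ)) := by
          refine sum_le_sum (fun p hp => ?_)
          have hpz : (p:ℝ) ≤ l ^ c1 := le_trans (by exact_mod_cast ((mem_TT z p).mp hp).1) hzl
          have : (p:ℝ) ^ t ≤ r := by
            calc (p:ℝ) ^ t ≤ (l ^ c1) ^ t := Real.rpow_le_rpow (by positivity) hpz ht0
              _ = r := by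
                rw [← Real.rpow_natCast, ← Real.rpow_mul hl0.le, hr]
                congr 1
                rw [ht]; field_simp
          calc _ ≤ 15 / 4 / (p:ℝ) * r := by gcongr
            _ = _ := by ring
      _ = 15 / 4 * r * ∑ p ∈ TT z, (1 / (p:ℝ)) := by rw [mul_sum]
      _ ≤ 15 / 4 * r * (1 + c1 * (4 * r)) := by
          gcongr
          refine (TT_inv z).trans ?_
          gcongr
          calc Real.log z ≤ Real.log (l ^ c1) := Real.log_le_log (by exact_mod_cast hz1) hzl
            _ = c1 * Real.log l := Real.log_pow _ _
            _ ≤ _ := by gcongr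
      _ ≤ 15 / 4 * r * (r + c1 * (4 * r)) := by gcongr
      _ = _ := by ring
  have step4 : (y ^ ((1:ℝ)/16)) ^ (-t) = Real.exp (-(r ^ 4 / (64 * c1))) := by
    rw [← Real.rpow_mul hy0.le, Real.rpow_def_of_pos hy0, ← hldef, hr4]
    congr 1
    rw [ht]; field_simp; norm_num
  have step5 : (l ^ B)⁻¹ = Real.exp (-(B * Real.log l)) := by
    rw [Real.exp_neg, ← Real.log_pow, Real.exp_log (by positivity)]
  rw [step5]
  rw [step4, ← Real.exp_add] at step2
  refine step1.trans (step2.trans (Real.exp_le_exp.mpr ?_))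
  have h6 : D * r ^ 2 ≤ r ^ 2 * r ^ 2 := by gcongr
  have h7 : (15 / 4 * (1 + 4 * c1) + 4 * B) * r ^ 2 ≤ r ^ 4 / (64 * c1) := by
    rw [le_div_iff₀ (by positivity)]
    calc _ = D * r ^ 2 := by rw [hD]; ring
      _ ≤ _ := h6
      _ = _ := by ring
  have h8 : B * Real.log l ≤ 4 * B * r ^ 2 := by
    calc B * Real.log l ≤ B * (4 * r) := by gcongr
      _ = 4 * B * r := by ring
      _ ≤ 4 * B * r ^ 2 := by
          gcongr
          nlinarith
  have h9 : (15 / 4 * (1 + 4 * c1) + 4 * B) * r ^ 2 = 15 / 4 * (1 + 4 * (c1:ℝ)) * r ^ 2 + 4 * B * r ^ 2 := by ring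
  linarith

/-- crude bound on the square of Ψ -/
lemma psi_sq (k z : ℕ) (L Ψ F0 : ℝ) (hL : (z:ℝ) + 1 ≤ L) (h : F0 = Ψ + ∑ q ∈ range (z + 1), gg (bk k 0) q) : 
    Ψ ^ 2 ≤ 2 * F0 ^ 2 + 2 * L ^ 2 := by
  have h1 : |∑ q ∈ range (z + 1), gg (bk k 0) q| ≤ L := by
    refine (abs_sum_le_sum_abs _ _).trans (le_trans ?_ hL)
    calc _ ≤ ∑ q ∈ range (z + 1), (1:ℝ) := sum_le_sum (fun q _ => gg_le_one k q)
      _ = _ := by simp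
  set S := ∑ q ∈ range (z + 1), gg (bk k 0) q
  have h2 : S ^ 2 ≤ L ^ 2 := sq_le_sq' (by linarith [neg_abs_le S]) ((le_abs_self S).trans h1)
  have : Ψ = F0 - S := by linarith
  rw [this]
  nlinarith [sq_nonneg (F0 + S)]

lemma bad_sum (D : ℝ) (m Bn : ℕ) (hD : 0 ≤ D) : ∀ᶠ y : ℝ in Filter.atTop, ∀ S : Finset ℕ, ∀ Ψ : ℕ → ℝ, ∀ α β : ℝ, α + β = 11 / 12 → 
    (S.card : ℝ) ≤ 2 * y ^ α → (∀ k ∈ S, Ψ k ^ 2 ≤ D * Real.log y ^ m * y ^ β) → 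
    ∑ k ∈ S, Ψ k ^ 2 ≤ y * (Real.log y ^ Bn)⁻¹ := by
  filter_upwards [evpow (2 * D) (m + Bn) (1 / 12) (by norm_num), evlog 1, Filter.eventually_ge_atTop 1] with y h hl hy S Ψ α β hab hc hS
  have hy0 : 0 < y := by linarith
  have hl0 : 0 < Real.log y := by linarith
  calc _ ≤ ∑ k ∈ S, D * Real.log y ^ m * y ^ β := sum_le_sum hS
    _ = S.card * (D * Real.log y ^ m * y ^ β) := by rw [sum_const, nsmul_eq_mul]
    _ ≤ 2 * y ^ α * (D * Real.log y ^ m * y ^ β) := by gcongr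
    _ = (2 * D * Real.log y ^ (m + Bn)) * (y ^ α * y ^ β) * (Real.log y ^ Bn)⁻¹ := by
        rw [pow_add]; field_simp
    _ ≤ y ^ ((1:ℝ) / 12) * (y ^ α * y ^ β) * (Real.log y ^ Bn)⁻¹ := by gcongr
    _ = _ := by
        rw [← Real.rpow_add hy0, hab, ← Real.rpow_add hy0]; norm_num

/-- the limit hypothesis for `Fk` -/
def HF (k : ℕ) (F0 : ℝ) : Prop := Filter.Tendsto (Fk k) (nhdsWithin 0 (Set.Ioi 0)) (nhds F0)

/-- exceptional integers of the class -/
lemma exc_card : ∀ᶠ y : ℝ in Filter.atTop, ∀ S : Finset ℕ, ∀ e : ℤ, (e = 1 ∨ e = -1) → (∀ k ∈ S, 0 < k ∧ (k:ℝ) ≤ y ∧ (kappa k : ℝ) ≤ y ^ ((1:ℝ)/2) ∧ ¬ IsSquare k) → 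
    (∀ k ∈ S, Exc y (e * k)) → (S.card : ℝ) ≤ 2 * y ^ ((1:ℝ)/4) := by
  filter_upwards [exc_pair, Filter.eventually_ge_atTop 1] with y h hy S e he hS hE
  have hy0 : 0 ≤ y := by linarith
  have hns : ∀ k ∈ S, ¬ IsSquare (e * (k:ℤ)) := by
    intro k hk
    obtain ⟨h1, h2, h3, h4⟩ := hS k hk
    rcases he with rfl | rfl
    · rw [one_mul]; exact nat_nonsq k h4
    · apply neg_nonsq; omega
  have hna : ∀ k : ℕ, (e * (k:ℤ)).natAbs = k := by
    intro k; rcases he with rfl | rfl <;> simp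
  have hee : e * e = 1 := by rcases he with rfl | rfl <;> norm_num
  have he0 : e ≠ 0 := by rcases he with rfl | rfl <;> norm_num
  have := class_count S (y ^ ((1:ℝ)/2)) (fun k hk => (hS k hk).1) (fun k hk => (hS k hk).2.2.1) ?_
  · rw [Real.sqrt_eq_rpow, ← Real.rpow_mul hy0] at this
    have h1 : 1 ≤ y ^ ((1:ℝ)/4) := Real.one_le_rpow hy (by norm_num)
    norm_num at this h1 ⊢
    linarith
  · intro a ha b hb
    have ha' := hS a ha
    have hb' := hS b hb
    have := h (e * a) (e * b) (mul_ne_zero he0 (by have := ha'.1; omega)) (mul_ne_zero he0 (by have := hb'.1; omega))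
      (by rw [hna]; exact ha'.2.1) (by rw [hna]; exact hb'.2.1) (hns a ha) (hns b hb) (hE a ha) (hE b hb)
    rw [show e * (a:ℤ) * (e * b) = e * e * (a * b) by ring, hee, one_mul] at this
    by_contra hc
    exact nat_nonsq _ hc (by push_cast; exact this)

lemma sq_card (y : ℝ) (hy : 1 ≤ y) (S : Finset ℕ) (hS : ∀ k ∈ S, 0 < k ∧ (kappa k : ℝ) ≤ y ^ ((1:ℝ)/2) ∧ IsSquare k) : 
    (S.card : ℝ) ≤ 2 * y ^ ((1:ℝ)/4) := by
  have hy0 : 0 ≤ y := by linarith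
  have := class_count S (y ^ ((1:ℝ)/2)) (fun k hk => (hS k hk).1) (fun k hk => (hS k hk).2.1) 
    (fun a ha b hb => (hS a ha).2.2.mul (hS b hb).2.2)
  rw [Real.sqrt_eq_rpow, ← Real.rpow_mul hy0] at this
  have h1 : 1 ≤ y ^ ((1:ℝ)/4) := Real.one_le_rpow hy (by norm_num)
  norm_num at this h1 ⊢
  linarith

/-- constant for the bad integers -/
noncomputable def K1 : ℝ := Real.exp (2 * (128 + 2 * cP + Real.log 600)) * 12 ^ (2 / 3 : ℝ) + Real.exp (2 * (128 + 2 * cP + 2 * Real.log 600)) * 24 ^ (8 / 3 : ℝ)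

lemma K1_pos : 0 < K1 := by unfold K1; positivity

lemma sq_bd (y : ℝ) (hy : 1 ≤ y) (hl : 1 ≤ Real.log y) (k : ℕ) (hk : 0 < k) (hkap : (kappa k : ℝ) ≤ y ^ ((1:ℝ)/2)) (hs : IsSquare k) (F0 : ℝ) (hF : HF k F0) : 
    F0 ^ 2 ≤ K1 * Real.log y ^ 32 * y ^ (2 / 3 : ℝ) := by
  rw [kappa_sq k hk hs] at hkap
  have hy0 : 0 < y := by linarith
  obtain ⟨ℓ, rfl⟩ := hs
  have hl0 : 0 < ℓ := Nat.pos_of_mul_pos_left hk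
  rw [← sq] at hF
  have h1 := sq_F0 ℓ hl0 F0 hF
  have h2 : (ℓ:ℝ) ≤ y ^ ((1:ℝ)/4) := by
    refine (pow_le_pow_iff_left₀ (by positivity) (by positivity) two_ne_zero).mp ?_
    rw [← Real.rpow_natCast (y ^ ((1:ℝ)/4)), ← Real.rpow_mul hy0.le]
    norm_num
    norm_num at hkap
    rw [sq]; exact hkap
  have h3 : (24 * ℓ : ℝ) ^ (8 / 3 : ℝ) ≤ 24 ^ (8 / 3 : ℝ) * y ^ (2 / 3 : ℝ) := by
    calc (24 * ℓ : ℝ) ^ (8 / 3 : ℝ) ≤ (24 * y ^ ((1:ℝ)/4)) ^ (8 / 3 : ℝ) := by gcongr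
      _ = _ := by
        rw [Real.mul_rpow (by norm_num) (by positivity), ← Real.rpow_mul hy0.le]; norm_num
  have h4 : (1:ℝ) ≤ Real.log y ^ 32 := one_le_pow₀ hl
  calc F0 ^ 2 ≤ _ := h1
    _ ≤ Real.exp (2 * (128 + 2 * cP + 2 * Real.log 600)) * (24 ^ (8 / 3 : ℝ) * y ^ (2 / 3 : ℝ)) := by gcongr
    _ = Real.exp (2 * (128 + 2 * cP + 2 * Real.log 600)) * 24 ^ (8 / 3 : ℝ) * 1 * y ^ (2 / 3 : ℝ) := by ring
    _ ≤ K1 * Real.log y ^ 32 * y ^ (2 / 3 : ℝ) := by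
        gcongr
        · exact K1_pos.le
        · unfold K1
          have : 0 < Real.exp (2 * (128 + 2 * cP + Real.log 600)) * 12 ^ (2 / 3 : ℝ) := by positivity
          linarith

lemma exc_bd : ∀ᶠ y : ℝ in Filter.atTop, ∀ k : ℕ, 0 < k → (k:ℝ) ≤ y → ¬ IsSquare k → (Exc y k ∨ Exc y (-k)) → 
    ∀ F0 : ℝ, HF k F0 → F0 ^ 2 ≤ K1 * Real.log y ^ 32 * y ^ (2 / 3 : ℝ) := by
  filter_upwards [exc_F0_aux, Filter.eventually_ge_atTop 1, evlog 1] with y h hy hl k hk hky hns hE F0 hF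
  have hy0 : 0 < y := by linarith
  calc F0 ^ 2 ≤ _ := h k hk hky hns hE F0 hF
    _ = Real.exp (2 * (128 + 2 * cP + Real.log 600)) * 12 ^ (2 / 3 : ℝ) * Real.log y ^ 32 * y ^ (2 / 3 : ℝ) := by
        rw [Real.mul_rpow (by norm_num) hy0.le]; ring
    _ ≤ _ := by
        gcongr
        unfold K1
        have : 0 < Real.exp (2 * (128 + 2 * cP + 2 * Real.log 600)) * 24 ^ (8 / 3 : ℝ) := by positivity
        linarith

/-- constant for the good integers -/
noncomputable def K2 : ℝ := Real.exp (128 + 2 * cP)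

/-- the approximation hypothesis fails -/
def BadE (A1 c1 : ℕ) (y : ℝ) (k : ℕ) : Prop := 2 * (Real.log y ^ A1)⁻¹ < |PA k (Real.log y ^ (A1 + 18))⁻¹ - ∑ p ∈ TT ⌊Real.log y ^ c1⌋₊, Ak k p * (p:ℝ) ^ (-(1 + (Real.log y ^ (A1 + 18))⁻¹))|

set_option maxHeartbeats 2000000 in
/-- the good sum -/
lemma good_sum (Bn c1 : ℕ) (hc : Bn + 21 ≤ c1) (hc2 : 2 * Bn ≤ c1) : ∀ᶠ y : ℝ in Filter.atTop, ∀ S : Finset ℕ, ∀ Ψ : ℕ → ℝ, 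
    (∀ k ∈ S, GoodK y k ∧ ¬ BadE (Bn + 20) c1 y k ∧ HPsi k (Real.log y ^ c1) (Ψ k)) → 
    ∑ k ∈ S, Ψ k ^ 2 ≤ (192 * K2 ^ 2 + 6 + 6 * cD) * (y * (Real.log y ^ Bn)⁻¹) := by
  filter_upwards [good_approx (Bn + 20) c1 (by omega), good_F0, partB c1 Bn (by omega), evpow 1 Bn (3/4) (by norm_num), evlog 1, Filter.eventually_ge_atTop 1] with y h1 h2 h3 h4 hl hy S Ψ hS
  set l := Real.log y with hldef
  set z := ⌊l ^ c1⌋₊ with hz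
  set w := ⌊y ^ ((1:ℝ)/16)⌋₊ with hw
  have hl0 : 0 < l := by linarith
  have hy0 : 0 < y := by linarith
  have hlB : 0 < (l ^ Bn)⁻¹ := by positivity
  have hlB1 : (l ^ Bn)⁻¹ ≤ 1 := inv_le_one_of_one_le₀ (one_le_pow₀ hl)
  have hsub : S ⊆ range (⌊y⌋₊ + 1) := by
    intro k hk
    rw [mem_range, Nat.lt_succ_iff]
    exact Nat.le_floor (hS k hk).1.le
  have hN : ((⌊y⌋₊ + 1 : ℕ) : ℝ) ≤ 2 * y := by
    push_cast; have := Nat.floor_le hy0.le; linarith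
  have hcard : (S.card : ℝ) ≤ y := by
    have hsub' : S ⊆ Icc 1 ⌊y⌋₊ := by
      intro k hk
      rw [mem_Icc]
      exact ⟨(hS k hk).1.pos, Nat.le_floor (hS k hk).1.le⟩
    have h5 := card_le_card hsub'
    rw [Nat.card_Icc, Nat.add_sub_cancel] at h5
    exact le_trans (by exact_mod_cast h5) (Nat.floor_le hy0.le)
  have hpt : ∀ k ∈ S, Ψ k ^ 2 ≤ (192 * K2 ^ 2 + 3) * (l ^ Bn)⁻¹ + 3 * (∑ q ∈ QA z w, gg (bk k 0) q) ^ 2 := by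
    intro k hk
    obtain ⟨hg, hb, hP⟩ := hS k hk
    have hF := hP.lim hg.pos (by positivity)
    have hpr := psi_split (bk k 0) z w
    set F0 := Ψ k + ∑ q ∈ range (z + 1), gg (bk k 0) q with hF0
    have ha := h1 k hg (not_lt.mp hb) F0 hF (by omega)
    have hF2 := h2 k hg F0 hF
    have hF3 := F0_nonneg hg.pos hF
    have hB := h3 k
    set a := ∏ p ∈ TT z, (1 + bk k 0 p) - F0 with hadef
    set bb := ∑ q ∈ QB z w, gg (bk k 0) q with hbb
    set aa := ∑ q ∈ QA z w, gg (bk k 0) q with haa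
    have e : Ψ k = -a + aa + bb := by linarith
    have ha2 : |a| ≤ 8 * K2 * (l ^ Bn)⁻¹ := by
      calc |a| ≤ _ := ha
        _ ≤ (K2 * l ^ 19) * (8 * (l ^ (Bn + 20))⁻¹) := by gcongr; exact hF2
        _ = 8 * K2 * (l ^ Bn)⁻¹ * l⁻¹ := by
            rw [pow_add, show l ^ 20 = l ^ 19 * l by ring]; field_simp
        _ ≤ 8 * K2 * (l ^ Bn)⁻¹ * 1 := by
            have : 0 ≤ K2 := (Real.exp_pos _).le
            gcongr
            exact inv_le_one_of_one_le₀ hl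
        _ = _ := by ring
    have hx : ((l ^ Bn)⁻¹) ^ 2 ≤ (l ^ Bn)⁻¹ := by nlinarith
    have ha3 : a ^ 2 ≤ 64 * K2 ^ 2 * (l ^ Bn)⁻¹ := by
      calc a ^ 2 = |a| ^ 2 := (sq_abs a).symm
        _ ≤ (8 * K2 * (l ^ Bn)⁻¹) ^ 2 := by gcongr
        _ = 64 * K2 ^ 2 * ((l ^ Bn)⁻¹) ^ 2 := by ring
        _ ≤ _ := by gcongr
    have hb3 : bb ^ 2 ≤ (l ^ Bn)⁻¹ := by
      calc bb ^ 2 = |bb| ^ 2 := (sq_abs bb).symm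
        _ ≤ ((l ^ Bn)⁻¹) ^ 2 := by gcongr
        _ ≤ _ := hx
    have e2 : Ψ k ^ 2 ≤ 3 * (a ^ 2 + aa ^ 2 + bb ^ 2) := by
      rw [e]
      nlinarith [sq_nonneg (a + aa), sq_nonneg (a + bb), sq_nonneg (aa - bb)]
    have e3 : (192 * K2 ^ 2 + 3) * (l ^ Bn)⁻¹ = 3 * (64 * K2 ^ 2 * (l ^ Bn)⁻¹) + 3 * (l ^ Bn)⁻¹ := by ring
    linarith
  have hA := partA z w (⌊y⌋₊ + 1) ((z + 1 : ℕ) : ℝ) (by positivity)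
  have hA1 : ((z + 1 : ℕ) : ℝ) ^ (-(1/2):ℝ) ≤ (l ^ Bn)⁻¹ := by
    have hzz : l ^ (2 * Bn) ≤ ((z + 1 : ℕ) : ℝ) := by
      push_cast
      exact (pow_le_pow_right₀ hl hc2).trans (Nat.lt_floor_add_one _).le
    calc ((z + 1 : ℕ) : ℝ) ^ (-(1/2):ℝ) ≤ (l ^ (2 * Bn)) ^ (-(1/2):ℝ) := 
          Real.rpow_le_rpow_of_nonpos (by positivity) hzz (by norm_num)
      _ = (l ^ Bn)⁻¹ := by
          rw [← Real.rpow_natCast, ← Real.rpow_mul hl0.le, ← Real.rpow_natCast, ← Real.rpow_neg hl0.le]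
          congr 1; push_cast; ring
  have hA2 : (w:ℝ) ^ 4 ≤ y * (l ^ Bn)⁻¹ := by
    calc (w:ℝ) ^ 4 ≤ (y ^ ((1:ℝ)/16)) ^ 4 := by gcongr; exact Nat.floor_le (by positivity)
      _ = y ^ ((1:ℝ)/4) * l ^ Bn * (l ^ Bn)⁻¹ := by
          rw [mul_assoc, mul_inv_cancel₀ (by positivity), mul_one, ← Real.rpow_natCast, ← Real.rpow_mul hy0.le]; norm_num
      _ ≤ y ^ ((1:ℝ)/4) * y ^ ((3:ℝ)/4) * (l ^ Bn)⁻¹ := by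
          gcongr; linarith
      _ = _ := by rw [← Real.rpow_add hy0]; norm_num
  have hcD := cD_pos
  calc ∑ k ∈ S, Ψ k ^ 2 ≤ ∑ k ∈ S, ((192 * K2 ^ 2 + 3) * (l ^ Bn)⁻¹ + 3 * (∑ q ∈ QA z w, gg (bk k 0) q) ^ 2) := sum_le_sum hpt
    _ = S.card * ((192 * K2 ^ 2 + 3) * (l ^ Bn)⁻¹) + 3 * ∑ k ∈ S, (∑ q ∈ QA z w, gg (bk k 0) q) ^ 2 := by
        rw [sum_add_distrib, sum_const, nsmul_eq_mul, mul_sum]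
    _ ≤ y * ((192 * K2 ^ 2 + 3) * (l ^ Bn)⁻¹) + 3 * ∑ k ∈ range (⌊y⌋₊ + 1), (∑ q ∈ QA z w, gg (bk k 0) q) ^ 2 := by
        have := sum_le_sum_of_subset_of_nonneg hsub (f := fun k => (∑ q ∈ QA z w, gg (bk k 0) q) ^ 2) (fun i _ _ => sq_nonneg _)
        gcongr
    _ ≤ y * ((192 * K2 ^ 2 + 3) * (l ^ Bn)⁻¹) + 3 * (2 * y * ((l ^ Bn)⁻¹ * cD) + y * (l ^ Bn)⁻¹) := by
        gcongr
        refine hA.trans ?_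
        gcongr
    _ = _ := by ring

set_option maxHeartbeats 1000000 in
lemma main_ev (Bn c1 : ℕ) (hc : 200 * ((Bn + 20 + 18) + 2 * (Bn + 20) + 2) + 1 ≤ c1) : ∀ᶠ y : ℝ in Filter.atTop, ∀ Ψ : ℕ → ℝ, 
    (∀ k : ℕ, HPsi k (Real.log y ^ c1) (Ψ k)) → 
    ∑ k ∈ (Icc 1 ⌊y⌋₊).filter (fun k => (kappa k : ℝ) ≤ y ^ ((1:ℝ)/2)), Ψ k ^ 2 ≤ (192 * K2 ^ 2 + 10 + 6 * cD) * (y * (Real.log y ^ Bn)⁻¹) := by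
  have hK1 := K1_pos
  have hK2 : 0 < K2 := Real.exp_pos _
  filter_upwards [good_sum Bn c1 (by omega) (by omega), bad_sum (2 * K1 + 8) (2 * c1) Bn (by positivity), bad_sum (2 * K2 ^ 2 + 8) (2 * c1) Bn (by positivity), 
    exc_card, exc_bd, good_F0, E_count (Bn + 20 + 18) (Bn + 20) c1 hc, evlog 1, Filter.eventually_ge_atTop 1] with y hgood hbad hbad2 hec heb hgF hE hl hy Ψ hΨ
  set l := Real.log y with hldef
  have hl0 : 0 < l := by linarith
  have hy0 : 0 < y := by linarith
  set S := (Icc 1 ⌊y⌋₊).filter (fun k => (kappa k : ℝ) ≤ y ^ ((1:ℝ)/2)) with hS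
  have hSm : ∀ k ∈ S, 0 < k ∧ (k:ℝ) ≤ y ∧ (kappa k : ℝ) ≤ y ^ ((1:ℝ)/2) := by
    intro k hk
    rw [hS, mem_filter, mem_Icc] at hk
    refine ⟨hk.1.1, ?_, hk.2⟩
    exact le_trans (by exact_mod_cast hk.1.2) (Nat.floor_le hy0.le)
  have hlc : 1 ≤ l ^ c1 := one_le_pow₀ hl
  have hz : (⌊l ^ c1⌋₊ : ℝ) + 1 ≤ 2 * l ^ c1 := by
    have := Nat.floor_le (show 0 ≤ l ^ c1 by positivity)
    linarith
  have hF : ∀ k ∈ S, ∃ F0, HF k F0 ∧ Ψ k ^ 2 ≤ 2 * F0 ^ 2 + 8 * l ^ (2 * c1) := by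
    intro k hk
    refine ⟨_, (hΨ k).lim (hSm k hk).1 (by positivity), ?_⟩
    refine (psi_sq k ⌊l ^ c1⌋₊ (2 * l ^ c1) (Ψ k) _ hz rfl).trans (le_of_eq ?_)
    ring
  have hbd1 : ∀ F0 P : ℝ, F0 ^ 2 ≤ K1 * l ^ 32 * y ^ (2 / 3 : ℝ) → P ≤ 2 * F0 ^ 2 + 8 * l ^ (2 * c1) → P ≤ (2 * K1 + 8) * l ^ (2 * c1) * y ^ (2 / 3 : ℝ) := by
    intro F0 P h1 h2
    have hy1 : 1 ≤ y ^ (2 / 3 : ℝ) := Real.one_le_rpow hy (by norm_num)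
    have h3 : l ^ 32 ≤ l ^ (2 * c1) := pow_le_pow_right₀ hl (by omega)
    calc P ≤ 2 * F0 ^ 2 + 8 * l ^ (2 * c1) * 1 := by linarith
      _ ≤ 2 * (K1 * l ^ (2 * c1) * y ^ (2 / 3 : ℝ)) + 8 * l ^ (2 * c1) * y ^ (2 / 3 : ℝ) := by
          gcongr
          refine h1.trans ?_
          gcongr
      _ = _ := by ring
  -- the squares
  have s1 : ∑ k ∈ S.filter (fun k => IsSquare k), Ψ k ^ 2 ≤ y * (l ^ Bn)⁻¹ := by
    refine hbad _ Ψ (1/4) (2/3) (by norm_num) (sq_card y hy _ ?_) ?_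
    · intro k hk
      rw [mem_filter] at hk
      exact ⟨(hSm k hk.1).1, (hSm k hk.1).2.2, hk.2⟩
    · intro k hk
      rw [mem_filter] at hk
      obtain ⟨F0, h1, h2⟩ := hF k hk.1
      exact hbd1 F0 _ (sq_bd y hy hl k (hSm k hk.1).1 (hSm k hk.1).2.2 hk.2 F0 h1) h2
  set S' := S.filter (fun k => ¬ IsSquare k) with hS'
  have hS'm : ∀ k ∈ S', k ∈ S ∧ ¬ IsSquare k := fun k hk => by rwa [hS', mem_filter] at hk
  have s2 : ∑ k ∈ S'.filter (fun k : ℕ => Exc y ((1:ℤ) * (k:ℤ))), Ψ k ^ 2 ≤ y * (l ^ Bn)⁻¹ := by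
    refine hbad _ Ψ (1/4) (2/3) (by norm_num) (hec _ 1 (Or.inl rfl) ?_ ?_) ?_
    · intro k hk
      have hk' := hS'm k (mem_filter.mp hk).1
      obtain ⟨a, b, c⟩ := hSm k hk'.1
      exact ⟨a, b, c, hk'.2⟩
    · intro k hk; exact (mem_filter.mp hk).2
    · intro k hk
      have hk' := hS'm k (mem_filter.mp hk).1
      have hk2 := (mem_filter.mp hk).2
      rw [one_mul] at hk2
      obtain ⟨F0, h1, h2⟩ := hF k hk'.1
      exact hbd1 F0 _ (heb k (hSm k hk'.1).1 (hSm k hk'.1).2.1 hk'.2 (Or.inl hk2) F0 h1) h2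
  set S2 := S'.filter (fun k : ℕ => ¬ Exc y ((1:ℤ) * (k:ℤ))) with hS2
  have hS2m : ∀ k ∈ S2, k ∈ S' ∧ ¬ Exc y ((1:ℤ) * (k:ℤ)) := fun k hk => by rwa [hS2, mem_filter] at hk
  have s3 : ∑ k ∈ S2.filter (fun k : ℕ => Exc y ((-1:ℤ) * (k:ℤ))), Ψ k ^ 2 ≤ y * (l ^ Bn)⁻¹ := by
    refine hbad _ Ψ (1/4) (2/3) (by norm_num) (hec _ (-1) (Or.inr rfl) ?_ ?_) ?_
    · intro k hk
      have hk' := hS'm k (hS2m k (mem_filter.mp hk).1).1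
      obtain ⟨a, b, c⟩ := hSm k hk'.1
      exact ⟨a, b, c, hk'.2⟩
    · intro k hk; exact (mem_filter.mp hk).2
    · intro k hk
      have hk' := hS'm k (hS2m k (mem_filter.mp hk).1).1
      have hk2 := (mem_filter.mp hk).2
      rw [neg_one_mul] at hk2
      obtain ⟨F0, h1, h2⟩ := hF k hk'.1
      exact hbd1 F0 _ (heb k (hSm k hk'.1).1 (hSm k hk'.1).2.1 hk'.2 (Or.inr hk2) F0 h1) h2
  set S3 := S2.filter (fun k : ℕ => ¬ Exc y ((-1:ℤ) * (k:ℤ))) with hS3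
  have hS3g : ∀ k ∈ S3, k ∈ S ∧ GoodK y k := by
    intro k hk
    rw [hS3, mem_filter] at hk
    have h2 := hS2m k hk.1
    have h1 := hS'm k h2.1
    have e1 := h2.2
    have e2 := hk.2
    rw [one_mul] at e1
    rw [neg_one_mul] at e2
    exact ⟨h1.1, (hSm k h1.1).1, (hSm k h1.1).2.1, h1.2, e1, e2⟩
  have s4 : ∑ k ∈ S3.filter (fun k => BadE (Bn + 20) c1 y k), Ψ k ^ 2 ≤ y * (l ^ Bn)⁻¹ := by
    refine hbad2 _ Ψ (3/4) (1/6) (by norm_num) (hE _ ?_ ?_) ?_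
    · intro k hk
      have := hS3g k (mem_filter.mp hk).1
      exact ⟨this.2.pos, this.2.le⟩
    · intro k hk; exact (mem_filter.mp hk).2
    · intro k hk
      have hg := hS3g k (mem_filter.mp hk).1
      obtain ⟨F0, h1, h2⟩ := hF k hg.1
      have hF1 := hgF k hg.2 F0 h1
      have hF0 := F0_nonneg hg.2.pos h1
      have hy1 : 1 ≤ y ^ (1 / 6 : ℝ) := Real.one_le_rpow hy (by norm_num)
      have h3 : l ^ 38 ≤ l ^ (2 * c1) := pow_le_pow_right₀ hl (by omega)
      have h4 : F0 ^ 2 ≤ K2 ^ 2 * l ^ (2 * c1) := by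
        calc F0 ^ 2 ≤ (K2 * l ^ 19) ^ 2 := by gcongr; exact hF1
          _ = K2 ^ 2 * l ^ 38 := by ring
          _ ≤ _ := by gcongr
      calc Ψ k ^ 2 ≤ 2 * F0 ^ 2 + 8 * l ^ (2 * c1) := h2
        _ ≤ 2 * (K2 ^ 2 * l ^ (2 * c1)) + 8 * l ^ (2 * c1) := by gcongr
        _ = (2 * K2 ^ 2 + 8) * l ^ (2 * c1) * 1 := by ring
        _ ≤ _ := by gcongr
  have s5 : ∑ k ∈ S3.filter (fun k => ¬ BadE (Bn + 20) c1 y k), Ψ k ^ 2 ≤ (192 * K2 ^ 2 + 6 + 6 * cD) * (y * (l ^ Bn)⁻¹) := by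
    apply hgood
    intro k hk
    rw [mem_filter] at hk
    exact ⟨(hS3g k hk.1).2, hk.2, hΨ k⟩
  have e1 := sum_filter_add_sum_filter_not S (fun k => IsSquare k) (fun k => Ψ k ^ 2)
  have e2 := sum_filter_add_sum_filter_not S' (fun k : ℕ => Exc y ((1:ℤ) * (k:ℤ))) (fun k => Ψ k ^ 2)
  have e3 := sum_filter_add_sum_filter_not S2 (fun k : ℕ => Exc y ((-1:ℤ) * (k:ℤ))) (fun k => Ψ k ^ 2)
  have e4 := sum_filter_add_sum_filter_not S3 (fun k => BadE (Bn + 20) c1 y k) (fun k => Ψ k ^ 2)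
  rw [← hS'] at e1
  rw [← hS2] at e2
  rw [← hS3] at e3
  have e5 : (192 * K2 ^ 2 + 10 + 6 * cD) * (y * (l ^ Bn)⁻¹) = (192 * K2 ^ 2 + 6 + 6 * cD) * (y * (l ^ Bn)⁻¹) + 4 * (y * (l ^ Bn)⁻¹) := by ring
  linarith

lemma F_bdd (k : ℕ) : ∃ M : ℝ, 0 ≤ M ∧ ∀ F0, HF k F0 → |F0| ≤ M := by
  by_cases h : ∃ F1, HF k F1
  · obtain ⟨F1, h1⟩ := h
    exact ⟨|F1|, abs_nonneg _, fun F0 h0 => by rw [tendsto_nhds_unique h0 h1]⟩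
  · push Not at h
    exact ⟨0, le_rfl, fun F0 h0 => absurd h0 (h F0)⟩

lemma small_y (Y0 : ℝ) (c1 : ℕ) : ∃ D : ℝ, 0 ≤ D ∧ ∀ y : ℝ, 3 ≤ y → y ≤ Y0 → ∀ Ψ : ℕ → ℝ, (∀ k : ℕ, HPsi k (Real.log y ^ c1) (Ψ k)) → 
    ∑ k ∈ Icc 1 ⌊y⌋₊, Ψ k ^ 2 ≤ D := by
  choose M hM0 hM using F_bdd
  refine ⟨∑ k ∈ Icc 1 ⌊Y0⌋₊, (2 * M k ^ 2 + 2 * (Real.log Y0 ^ c1 + 1) ^ 2), sum_nonneg (fun k _ => by positivity), ?_⟩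
  intro y hy hyY Ψ hΨ
  have hl0 : 0 ≤ Real.log y := Real.log_nonneg (by linarith)
  have hlY : Real.log y ≤ Real.log Y0 := Real.log_le_log (by linarith) hyY
  calc _ ≤ ∑ k ∈ Icc 1 ⌊y⌋₊, (2 * M k ^ 2 + 2 * (Real.log Y0 ^ c1 + 1) ^ 2) := by
        refine sum_le_sum (fun k hk => ?_)
        have hk0 : 0 < k := (mem_Icc.mp hk).1
        have hF := (hΨ k).lim hk0 (by positivity)
        have hz : (⌊Real.log y ^ c1⌋₊ : ℝ) + 1 ≤ Real.log Y0 ^ c1 + 1 := by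
          have := Nat.floor_le (show 0 ≤ Real.log y ^ c1 by positivity)
          have : Real.log y ^ c1 ≤ Real.log Y0 ^ c1 := by gcongr
          linarith
        have h1 := psi_sq k _ _ (Ψ k) _ hz rfl
        refine h1.trans ?_
        have h2 := hM k _ hF
        rw [← sq_abs (Ψ k + _)]
        gcongr
    _ ≤ _ := by
        apply sum_le_sum_of_subset_of_nonneg
        · apply Icc_subset_Icc le_rfl
          exact Nat.floor_le_floor hyY
        · intro k _ _; positivity

theorem stmt12 (ε' B : ℝ) (hε' : 0 < ε') (hB : 0 < B) :
    ∃ c₁ > (0:ℝ), ∃ C > 0, ∀ y : ℝ, 3 ≤ y → ∀ Ψ : ℕ → ℝ,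
      (∀ k : ℕ, Filter.Tendsto
        (fun Q : ℕ => ∑ q ∈ Finset.range (Q + 1),
          (if Squarefree q ∧ (∀ p : ℕ, p.Prime → p ∣ q → p % 4 = 1) ∧
              Real.log y ^ c₁ < (q : ℝ) then
            ((ArithmeticFunction.moebius q : ℝ) / (Nat.totient q : ℝ)) *
              ∏ p ∈ q.primeFactors, ((nSol (k : ℤ) 4 p : ℝ) - 1)
          else 0))
        Filter.atTop (nhds (Ψ k))) →
      ∑ k ∈ (Finset.Icc 1 ⌊y⌋₊).filter (fun k => (kappa k : ℝ) ≤ y ^ ((1 : ℝ) / 2 - ε')),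
          |Ψ k| ^ 2
        ≤ C * (y * Real.log y ^ (-B)) := by
  set Bn := ⌈B⌉₊ with hBn
  set c1 : ℕ := 200 * ((Bn + 20 + 18) + 2 * (Bn + 20) + 2) + 1 with hc1
  obtain ⟨Y1, hY1⟩ := Filter.eventually_atTop.mp (main_ev Bn c1 le_rfl)
  set Y0 := max Y1 3 with hY0
  obtain ⟨D, hD0, hD⟩ := small_y Y0 c1
  have hcD := cD_pos
  have hY3 : 3 ≤ Y0 := le_max_right _ _
  have hlog1 : ∀ y : ℝ, 3 ≤ y → 1 ≤ Real.log y := by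
    intro y hy
    rw [Real.le_log_iff_exp_le (by linarith)]
    linarith [Real.exp_one_lt_d9]
  have hlY := hlog1 Y0 hY3
  set d : ℝ := 3 * Real.log Y0 ^ (-B) with hd
  have hd0 : 0 < d := by positivity
  refine ⟨(c1 : ℝ), by positivity, (192 * K2 ^ 2 + 10 + 6 * cD) + D / d, by positivity, ?_⟩
  intro y hy Ψ hΨ
  have hl := hlog1 y hy
  have hl0 : 0 < Real.log y := by linarith
  have hP : ∀ k : ℕ, HPsi k (Real.log y ^ c1) (Ψ k) := by
    intro k
    have := hΨ k
    rw [Real.rpow_natCast] at this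
    exact this
  simp only [sq_abs]
  have hpos : 0 ≤ y * Real.log y ^ (-B) := by positivity
  have hDd : 0 ≤ D / d := by positivity
  rcases le_total y Y0 with h | h
  · have h1 := hD y hy h Ψ hP
    have h2 : d ≤ y * Real.log y ^ (-B) := by
      rw [hd]
      have : Real.log Y0 ^ (-B) ≤ Real.log y ^ (-B) := 
        Real.rpow_le_rpow_of_nonpos hl0 (Real.log_le_log (by linarith) h) (by linarith)
      gcongr
    calc _ ≤ ∑ k ∈ Icc 1 ⌊y⌋₊, Ψ k ^ 2 := 
          sum_le_sum_of_subset_of_nonneg (filter_subset _ _) (fun k _ _ => sq_nonneg _)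
      _ ≤ D := h1
      _ = 0 + D / d * d := by field_simp; ring
      _ ≤ (192 * K2 ^ 2 + 10 + 6 * cD) * (y * Real.log y ^ (-B)) + D / d * (y * Real.log y ^ (-B)) := by
          apply add_le_add
          · positivity
          · gcongr
      _ = _ := by ring
  · have h1 := hY1 y ((le_max_left _ _).trans h) Ψ hP
    have h2 : (Real.log y ^ Bn)⁻¹ ≤ Real.log y ^ (-B) := by
      rw [← Real.rpow_natCast, ← Real.rpow_neg hl0.le]
      apply Real.rpow_le_rpow_of_exponent_le hl
      have := Nat.le_ceil B
      rw [← hBn] at this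
      linarith
    calc _ ≤ ∑ k ∈ (Icc 1 ⌊y⌋₊).filter (fun k => (kappa k : ℝ) ≤ y ^ ((1:ℝ)/2)), Ψ k ^ 2 := by
          apply sum_le_sum_of_subset_of_nonneg
          · intro k hk
            rw [mem_filter] at hk ⊢
            exact ⟨hk.1, hk.2.trans (Real.rpow_le_rpow_of_exponent_le (by linarith) (by linarith))⟩
          · intro k _ _; exact sq_nonneg _
      _ ≤ _ := h1
      _ ≤ (192 * K2 ^ 2 + 10 + 6 * cD) * (y * Real.log y ^ (-B)) := by
          gcongr
      _ ≤ _ := by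
          have := mul_nonneg hDd hpos
          rw [add_mul]; linarith
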